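/- There is an absolute constant L > 0 such that for every pair of coprime positive integers a and q with q ≥ 2 and every integer n ≥ 1, there are at least n primes congruent to a modulo q, and the n-th such prime p (in increasing order) satisfies p ≤ q^L · n · log(2n). -/

import Mathlib

set_option linter.unusedSectionVars false

namespace Linnik

open Finset ArithmeticFunction

/-- Mertens' first theorem, at integers. -/
lemma sum_vonMangoldt_div_bounds {N : ℕ} (hN : 1 ≤ N) :
    Real.log N - 1 ≤ ∑ n ∈ Ioc 0 N, Λ n / n ∧
      ∑ n ∈ Ioc 0 N, Λ n / n ≤ Real.log N + (Real.log 4 + 4) := by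
  have hN0 : (0 : ℝ) < N := by exact_mod_cast hN
  have hfac : Real.log (N.factorial) = ∑ n ∈ Ioc 0 N, Λ n * ((N / n : ℕ) : ℝ) := by
    have h := sum_Ioc_mul_zeta_eq_sum (R := ℝ) Λ N
    rw [vonMangoldt_mul_zeta] at h
    rw [← h, ← Finset.prod_Ico_id_eq_factorial, Nat.cast_prod, Real.log_prod]
    · rfl
    · intro i hi
      have := (Finset.mem_Ico.1 hi).1
      positivity
  have hup : Real.log (N.factorial) ≤ N * Real.log N := by
    rw [← Real.log_pow]
    apply Real.log_le_log (by positivity)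
    exact_mod_cast Nat.factorial_le_pow N
  have hlow : N * Real.log N - N ≤ Real.log (N.factorial) := by
    have h := Stirling.le_log_factorial_stirling (n := N) (by omega)
    have h1 : 0 ≤ Real.log N := Real.log_nonneg (by exact_mod_cast hN)
    have h2 : 0 ≤ Real.log (2 * Real.pi) := Real.log_nonneg (by nlinarith [Real.pi_gt_three])
    linarith
  have hψ : ∑ n ∈ Ioc 0 N, Λ n ≤ (Real.log 4 + 4) * N := by
    have h := Chebyshev.psi_le_const_mul_self (x := N) (by positivity)
    simpa [Chebyshev.psi] using h
  have hmul : (∑ n ∈ Ioc 0 N, Λ n / n) * N = ∑ n ∈ Ioc 0 N, Λ n * ((N : ℝ) / n) := by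
    rw [Finset.sum_mul]
    refine Finset.sum_congr rfl fun n _ => by ring
  constructor
  · have : Real.log (N.factorial) ≤ (∑ n ∈ Ioc 0 N, Λ n / n) * N := by
      rw [hmul, hfac]
      refine Finset.sum_le_sum fun n _ => mul_le_mul_of_nonneg_left Nat.cast_div_le
        vonMangoldt_nonneg
    nlinarith
  · have : (∑ n ∈ Ioc 0 N, Λ n / n) * N ≤ Real.log (N.factorial) + ∑ n ∈ Ioc 0 N, Λ n := by
      rw [hmul, hfac, ← Finset.sum_add_distrib]
      refine Finset.sum_le_sum fun n hn => ?_
      have hn0 : 0 < n := (Finset.mem_Ioc.1 hn).1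
      have h1 : (N : ℝ) / n ≤ (N / n : ℕ) + 1 := by
        rw [← Nat.floor_div_eq_div (K := ℝ)]
        exact (Nat.lt_floor_add_one _).le
      have := mul_le_mul_of_nonneg_left h1 (vonMangoldt_nonneg (n := n))
      linarith
    have h3 : (∑ n ∈ Ioc 0 N, Λ n / n) * N ≤ (Real.log N + (Real.log 4 + 4)) * N := by
      linarith
    exact le_of_mul_le_mul_right h3 hN0

/-- The constant in the Chebyshev bound for a dyadic (in the log scale) range. -/
lemma sum_inv_primes_le {w v : ℝ} (hw : 2 ≤ w) (hv : 0 < v) (s : Finset ℕ)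
    (hs : ∀ p ∈ s, p.Prime ∧ (p : ℝ) ≤ w ∧ v ≤ Real.log p) :
    ∑ p ∈ s, (1 : ℝ) / p ≤ (Real.log w + 6) / v := by
  rw [le_div_iff₀ hv]
  have h1 : (∑ p ∈ s, (1 : ℝ) / p) * v ≤ ∑ n ∈ Ioc 0 ⌊w⌋₊, Λ n / n := by
    rw [Finset.sum_mul]
    calc ∑ p ∈ s, (1 : ℝ) / p * v ≤ ∑ p ∈ s, Λ p / p := by
          refine Finset.sum_le_sum fun p hp => ?_
          obtain ⟨h1, h2, h3⟩ := hs p hp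
          rw [vonMangoldt_apply_prime h1, div_mul_eq_mul_div, one_mul]
          gcongr
      _ ≤ _ := by
          refine Finset.sum_le_sum_of_subset_of_nonneg ?_ ?_
          · intro p hp
            obtain ⟨h1, h2, h3⟩ := hs p hp
            exact Finset.mem_Ioc.2 ⟨h1.pos, Nat.le_floor h2⟩
          · intro n _ _
            exact div_nonneg vonMangoldt_nonneg (by positivity)
  have h2 := (sum_vonMangoldt_div_bounds (N := ⌊w⌋₊) (Nat.le_floor (by simpa using by linarith))).2
  have h3 : Real.log ⌊w⌋₊ ≤ Real.log w := by
    apply Real.log_le_log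
    · exact_mod_cast Nat.floor_pos.2 (by linarith)
    · exact Nat.floor_le (by linarith)
  have h4 : Real.log 4 ≤ 2 := by
    have : (4 : ℝ) = 2 ^ 2 := by norm_num
    rw [this, Real.log_pow]
    have := Real.log_two_lt_d9
    norm_num; linarith
  linarith

end Linnik

namespace Linnik

open Finset

/-- Elementary symmetric sum of the weights `x` over the index set `B`. -/
def esymmSum (x : ℕ → ℝ) (B : Finset ℕ) (k : ℕ) : ℝ :=
  ∑ D ∈ B.powersetCard k, ∏ p ∈ D, x p

/-- Truncated inclusion–exclusion sum. -/
def truncSum (x : ℕ → ℝ) (B : Finset ℕ) (m : ℕ) : ℝ :=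
  ∑ k ∈ range (m + 1), (-1) ^ k * esymmSum x B k

lemma esymmSum_zero (x : ℕ → ℝ) (B : Finset ℕ) : esymmSum x B 0 = 1 := by
  simp [esymmSum]

lemma esymmSum_empty_succ (x : ℕ → ℝ) (k : ℕ) : esymmSum x ∅ (k + 1) = 0 := by
  rw [esymmSum, powersetCard_eq_empty.2 (by simp), sum_empty]

lemma esymmSum_insert (x : ℕ → ℝ) {B : Finset ℕ} {p : ℕ} (hp : p ∉ B) (k : ℕ) :
    esymmSum x (insert p B) (k + 1) = esymmSum x B (k + 1) + x p * esymmSum x B k := by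
  unfold esymmSum
  rw [powersetCard_succ_insert hp, sum_union, sum_image, mul_sum]
  · congr 1
    refine sum_congr rfl fun D hD => ?_
    rw [prod_insert fun h => hp ((mem_powersetCard.1 hD).1 h)]
  · intro D hD D' hD' h
    have h1 : p ∉ D := fun h => hp ((mem_powersetCard.1 hD).1 h)
    have h2 : p ∉ D' := fun h => hp ((mem_powersetCard.1 hD').1 h)
    rw [← erase_insert h1, ← erase_insert h2]
    exact congrArg (fun s => s.erase p) h
  · rw [disjoint_left]
    intro D hD hD'
    obtain ⟨E, _, rfl⟩ := mem_image.1 hD'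
    exact hp ((mem_powersetCard.1 hD).1 (mem_insert_self p E))

lemma esymmSum_nonneg {x : ℕ → ℝ} {B : Finset ℕ} (hx : ∀ p ∈ B, 0 ≤ x p) (k : ℕ) :
    0 ≤ esymmSum x B k :=
  sum_nonneg fun _ hD => prod_nonneg fun p hp => hx p ((mem_powersetCard.1 hD).1 hp)

lemma truncSum_insert (x : ℕ → ℝ) {B : Finset ℕ} {p : ℕ} (hp : p ∉ B) (m : ℕ) :
    truncSum x (insert p B) (m + 1) = truncSum x B (m + 1) - x p * truncSum x B m := by
  unfold truncSum
  rw [sum_range_succ' _ (m + 1), sum_range_succ' _ (m + 1)]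
  simp only [esymmSum_insert x hp, esymmSum_zero, mul_add, sum_add_distrib, mul_sum]
  have : ∑ k ∈ range (m + 1), (-1 : ℝ) ^ (k + 1) * (x p * esymmSum x B k)
      = - ∑ k ∈ range (m + 1), x p * ((-1) ^ k * esymmSum x B k) := by
    rw [← sum_neg_distrib]
    refine sum_congr rfl fun k _ => by ring
  rw [this]
  ring

lemma bonferroni {x : ℕ → ℝ} (B : Finset ℕ) (hx : ∀ p ∈ B, 0 ≤ x p ∧ x p ≤ 1) (m : ℕ) :
    0 ≤ (-1) ^ m * (truncSum x B m - ∏ p ∈ B, (1 - x p)) ∧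
      (-1) ^ m * (truncSum x B m - ∏ p ∈ B, (1 - x p)) ≤ esymmSum x B (m + 1) := by
  induction B using Finset.induction_on generalizing m with
  | empty =>
    have h : truncSum x ∅ m = 1 := by
      unfold truncSum
      rw [sum_range_succ', esymmSum_zero]
      simp [esymmSum_empty_succ]
    simp [h, esymmSum_empty_succ]
  | insert p B hp ih =>
    have hxB : ∀ p ∈ B, 0 ≤ x p ∧ x p ≤ 1 := fun p' h => hx p' (mem_insert_of_mem h)
    have hxp := hx p (mem_insert_self p B)
    have hV0 : 0 ≤ ∏ p ∈ B, (1 - x p) := prod_nonneg fun p h => by linarith [(hxB p h).2]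
    have hV1 : ∏ p ∈ B, (1 - x p) ≤ 1 :=
      prod_le_one (fun p h => by linarith [(hxB p h).2]) fun p h => by linarith [(hxB p h).1]
    rw [esymmSum_insert x hp, prod_insert hp]
    cases m with
    | zero =>
      have h0 : ∀ B, truncSum x B 0 = 1 := fun B => by simp [truncSum, esymmSum_zero]
      have h := ih hxB 0
      simp only [h0, pow_zero, one_mul, esymmSum_zero] at h ⊢
      constructor <;> nlinarith
    | succ m =>
      rw [truncSum_insert x hp]
      have h1 := ih hxB (m + 1)
      have h2 := ih hxB m
      have e : (-1 : ℝ) ^ (m + 1) * (truncSum x B (m + 1) - x p * truncSum x B m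
          - (1 - x p) * ∏ p ∈ B, (1 - x p)) =
          (-1) ^ (m + 1) * (truncSum x B (m + 1) - ∏ p ∈ B, (1 - x p)) +
          x p * ((-1) ^ m * (truncSum x B m - ∏ p ∈ B, (1 - x p))) := by ring
      rw [e]
      constructor
      · have := mul_nonneg hxp.1 h2.1
        linarith [h1.1]
      · have := mul_le_mul_of_nonneg_left h2.2 hxp.1
        linarith [h1.2]

lemma pow_succ_add_le {S g : ℝ} (hS : 0 ≤ S) (hg : 0 ≤ g) (k : ℕ) :
    S ^ (k + 1) + (k + 1) * g * S ^ k ≤ (S + g) ^ (k + 1) := by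
  induction k with
  | zero => simp
  | succ k ih =>
    have h := mul_le_mul_of_nonneg_right ih (add_nonneg hS hg)
    have h2 : 0 ≤ (k + 1) * g * S ^ k * g := by positivity
    push_cast
    calc _ ≤ (S ^ (k + 1) + (k + 1) * g * S ^ k) * (S + g) := by ring_nf at h2 ⊢; linarith
      _ ≤ _ := by rw [pow_succ (S + g) (k + 1)]; exact h

lemma factorial_mul_esymmSum_le {x : ℕ → ℝ} (B : Finset ℕ) (hx : ∀ p ∈ B, 0 ≤ x p) (k : ℕ) :
    k.factorial * esymmSum x B k ≤ (∑ p ∈ B, x p) ^ k := by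
  induction B using Finset.induction_on generalizing k with
  | empty =>
    cases k with
    | zero => simp [esymmSum_zero]
    | succ k => simp [esymmSum_empty_succ]
  | insert p B hp ih =>
    have hxB : ∀ p ∈ B, 0 ≤ x p := fun p' h => hx p' (mem_insert_of_mem h)
    have hxp := hx p (mem_insert_self p B)
    cases k with
    | zero => simp [esymmSum_zero]
    | succ k =>
      rw [esymmSum_insert x hp, sum_insert hp]
      have h1 := ih hxB (k + 1)
      have h2 := mul_le_mul_of_nonneg_left (ih hxB k) (by positivity : 0 ≤ (k + 1 : ℝ) * x p)
      have h3 := pow_succ_add_le (sum_nonneg hxB) hxp k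
      rw [Nat.factorial_succ] at h1 ⊢
      push_cast at h1 ⊢
      calc _ = ((k : ℝ) + 1) * k.factorial * esymmSum x B (k + 1)
              + (k + 1) * x p * (k.factorial * esymmSum x B k) := by ring
        _ ≤ (∑ p ∈ B, x p) ^ (k + 1) + (k + 1) * x p * (∑ p ∈ B, x p) ^ k := add_le_add h1 h2
        _ ≤ _ := by rw [add_comm (x p)]; exact h3

/-- A combination of block-supported coefficients. -/
def blockSum (w : Finset ℕ → ℝ) (x : ℕ → ℝ) (B : Finset ℕ) : ℝ :=
  ∑ D ∈ B.powerset, w D * ∏ p ∈ D, x p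

/-- Coefficients of the truncated inclusion–exclusion sum. -/
def truncCoeff (m : ℕ) (D : Finset ℕ) : ℝ := if D.card ≤ m then (-1) ^ D.card else 0

/-- Coefficients of the elementary symmetric sum. -/
def esymmCoeff (m : ℕ) (D : Finset ℕ) : ℝ := if D.card = m then 1 else 0

lemma blockSum_esymmCoeff (x : ℕ → ℝ) (B : Finset ℕ) (m : ℕ) :
    blockSum (esymmCoeff m) x B = esymmSum x B m := by
  unfold blockSum esymmSum esymmCoeff
  rw [powersetCard_eq_filter, sum_filter]
  refine sum_congr rfl fun D _ => by split_ifs <;> simp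

lemma blockSum_truncCoeff (x : ℕ → ℝ) (B : Finset ℕ) (m : ℕ) :
    blockSum (truncCoeff m) x B = truncSum x B m := by
  have h : ∀ D : Finset ℕ, truncCoeff m D = ∑ k ∈ range (m + 1), (-1) ^ k * esymmCoeff k D := by
    intro D
    unfold truncCoeff esymmCoeff
    simp
  unfold truncSum
  simp_rw [← blockSum_esymmCoeff, blockSum, h, sum_mul, mul_sum]
  rw [sum_comm]
  refine sum_congr rfl fun k _ => sum_congr rfl fun D _ => by ring

lemma prod_sum_powerset {J : Finset ℕ} {B : ℕ → Finset ℕ}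
    (hB : ∀ i ∈ J, ∀ j ∈ J, i ≠ j → Disjoint (B i) (B j)) (f : ℕ → Finset ℕ → ℝ) :
    ∏ j ∈ J, ∑ D ∈ (B j).powerset, f j D =
      ∑ D ∈ (J.biUnion B).powerset, ∏ j ∈ J, f j (D ∩ B j) := by
  induction J using Finset.induction_on with
  | empty => simp
  | insert i J hi ih =>
    have hB' : ∀ j ∈ J, Disjoint (B i) (B j) := fun j hj =>
      hB i (mem_insert_self _ _) j (mem_insert_of_mem hj) fun h => hi (h ▸ hj)
    have hdis : Disjoint (B i) (J.biUnion B) := (disjoint_biUnion_right _ _ _).2 hB'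
    rw [prod_insert hi, ih fun a ha b hb => hB a (mem_insert_of_mem ha) b (mem_insert_of_mem hb),
      sum_mul_sum, ← sum_product', biUnion_insert]
    refine sum_nbij' (fun D => D.1 ∪ D.2) (fun D => (D ∩ B i, D ∩ J.biUnion B)) ?_ ?_ ?_ ?_ ?_
    · intro D hD
      rw [mem_product, mem_powerset, mem_powerset] at hD
      exact mem_powerset.2 (union_subset_union hD.1 hD.2)
    · intro D _
      rw [mem_product, mem_powerset, mem_powerset]
      exact ⟨inter_subset_right, inter_subset_right⟩
    · rintro ⟨D, E⟩ hD
      rw [mem_product, mem_powerset, mem_powerset] at hD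
      have h1 : E ∩ B i = ∅ := disjoint_iff_inter_eq_empty.1 (hdis.symm.mono_left hD.2)
      have h2 : D ∩ J.biUnion B = ∅ := disjoint_iff_inter_eq_empty.1 (hdis.mono_left hD.1)
      simp only [union_inter_distrib_right, h1, h2, inter_eq_left.2 hD.1, inter_eq_left.2 hD.2,
        union_empty, empty_union]
    · intro D hD
      simp only [← inter_union_distrib_left]
      exact inter_eq_left.2 (mem_powerset.1 hD)
    · rintro ⟨D, E⟩ hD
      rw [mem_product, mem_powerset, mem_powerset] at hD
      rw [prod_insert hi]
      have h1 : E ∩ B i = ∅ := disjoint_iff_inter_eq_empty.1 (hdis.symm.mono_left hD.2)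
      simp only [union_inter_distrib_right, h1, inter_eq_left.2 hD.1, union_empty]
      congr 1
      refine prod_congr rfl fun j hj => ?_
      have h3 : D ∩ B j = ∅ := disjoint_iff_inter_eq_empty.1 ((hB' j hj).mono_left hD.1)
      rw [h3, empty_union]

/-- Hooley's almost-disjoint inequality. -/
lemma hooley_lower (J : Finset ℕ) {x y : ℕ → ℝ} (h : ∀ j ∈ J, 0 ≤ x j ∧ x j ≤ y j) :
    ∏ j ∈ J, y j - ∑ l ∈ J, (y l - x l) * ∏ j ∈ J.erase l, y j ≤ ∏ j ∈ J, x j := by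
  induction J using Finset.induction_on with
  | empty => simp
  | insert i J hi ih =>
    have hJ : ∀ j ∈ J, 0 ≤ x j ∧ x j ≤ y j := fun j hj => h j (mem_insert_of_mem hj)
    have hi' := h i (mem_insert_self _ _)
    have ih' := ih hJ
    rw [prod_insert hi, prod_insert hi, sum_insert hi, erase_insert hi]
    have e : ∑ l ∈ J, (y l - x l) * ∏ j ∈ (insert i J).erase l, y j
        = y i * ∑ l ∈ J, (y l - x l) * ∏ j ∈ J.erase l, y j := by
      rw [mul_sum]
      refine sum_congr rfl fun l hl => ?_
      have hli : i ≠ l := fun h => hi (h ▸ hl)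
      rw [erase_insert_of_ne hli, prod_insert fun hm => hi (mem_of_mem_erase hm)]
      ring
    rw [e]
    have hS : 0 ≤ ∑ l ∈ J, (y l - x l) * ∏ j ∈ J.erase l, y j :=
      sum_nonneg fun l hl => mul_nonneg (by linarith [(hJ l hl).2]) <|
        prod_nonneg fun j hj => by
          have := hJ j (mem_of_mem_erase hj); linarith
    nlinarith

/-- Primality-free evaluation of block sieve weights against a sequence. -/
lemma block_weights_eval {J : Finset ℕ} {B : ℕ → Finset ℕ}
    (hB : ∀ i ∈ J, ∀ j ∈ J, i ≠ j → Disjoint (B i) (B j))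
    (hprime : ∀ j ∈ J, ∀ p ∈ B j, p.Prime)
    (w : ℕ → Finset ℕ → ℝ) (hw : ∀ j D, |w j D| ≤ 1) (m : ℕ → ℕ)
    (hwm : ∀ j D, w j D ≠ 0 → D.card ≤ m j)
    {N : ℕ} (hN : ∀ D ⊆ J.biUnion B, (∀ j ∈ J, (D ∩ B j).card ≤ m j) → ∏ p ∈ D, p ≤ N)
    (Ω : Finset ℕ) (a g : ℕ → ℝ) {X R : ℝ} (hR : 0 ≤ R)
    (hA : ∀ D ⊆ J.biUnion B, |∑ n ∈ Ω with ∀ p ∈ D, p ∣ n, a n - X * ∏ p ∈ D, g p| ≤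
      R * (∏ p ∈ D, p : ℕ) ^ 2) :
    |∑ n ∈ Ω, a n * ∏ j ∈ J, blockSum (w j) (fun p => if p ∣ n then 1 else 0) (B j)
      - X * ∏ j ∈ J, blockSum (w j) g (B j)| ≤ R * (N : ℝ) ^ 3 := by
  have hexp : ∀ x : ℕ → ℝ, ∏ j ∈ J, blockSum (w j) x (B j) =
      ∑ D ∈ (J.biUnion B).powerset, (∏ j ∈ J, w j (D ∩ B j)) * ∏ p ∈ D, x p := by
    intro x
    unfold blockSum
    rw [prod_sum_powerset hB]
    refine sum_congr rfl fun D hD => ?_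
    rw [prod_mul_distrib]
    congr 1
    rw [← prod_biUnion]
    · refine prod_congr ?_ fun _ _ => rfl
      rw [← inter_biUnion]
      exact inter_eq_left.2 (mem_powerset.1 hD)
    · intro i hi j hj hij
      exact (hB i hi j hj hij).mono inter_subset_right inter_subset_right
  have hind : ∀ (D : Finset ℕ) (n : ℕ), ∏ p ∈ D, (if p ∣ n then (1 : ℝ) else 0) =
      if ∀ p ∈ D, p ∣ n then 1 else 0 := fun D n => by
    rw [prod_ite_zero]; simp
  simp_rw [hexp, hind, mul_sum]
  rw [sum_comm, ← sum_sub_distrib]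
  have hterm : ∀ D ∈ (J.biUnion B).powerset,
      |∑ n ∈ Ω, a n * ((∏ j ∈ J, w j (D ∩ B j)) * if ∀ p ∈ D, p ∣ n then 1 else 0)
        - X * ((∏ j ∈ J, w j (D ∩ B j)) * ∏ p ∈ D, g p)| ≤
      if (∀ j ∈ J, (D ∩ B j).card ≤ m j) then R * (∏ p ∈ D, p : ℕ) ^ 2 else 0 := by
    intro D hD
    have e : ∑ n ∈ Ω, a n * ((∏ j ∈ J, w j (D ∩ B j)) * if ∀ p ∈ D, p ∣ n then 1 else 0)
        - X * ((∏ j ∈ J, w j (D ∩ B j)) * ∏ p ∈ D, g p) = (∏ j ∈ J, w j (D ∩ B j)) *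
        (∑ n ∈ Ω with ∀ p ∈ D, p ∣ n, a n - X * ∏ p ∈ D, g p) := by
      rw [sum_filter, mul_sub, mul_sum]
      congr 1
      · refine sum_congr rfl fun n _ => by split_ifs <;> ring
      · ring
    rw [e, abs_mul]
    have hw1 : |∏ j ∈ J, w j (D ∩ B j)| ≤ 1 := by
      rw [abs_prod]
      exact prod_le_one (fun _ _ => abs_nonneg _) fun j _ => hw j _
    split_ifs with hc
    · calc _ ≤ 1 * _ := mul_le_mul_of_nonneg_right hw1 (abs_nonneg _)
        _ ≤ _ := by rw [one_mul]; exact hA D (mem_powerset.1 hD)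
    · push Not at hc
      obtain ⟨j, hj, hjc⟩ := hc
      have : w j (D ∩ B j) = 0 := by
        by_contra h0
        exact absurd (hwm j _ h0) (by omega)
      rw [prod_eq_zero hj this]
      simp
  refine (abs_sum_le_sum_abs _ _).trans ((sum_le_sum hterm).trans ?_)
  rw [← sum_filter, ← mul_sum]
  refine mul_le_mul_of_nonneg_left ?_ hR
  set S := {D ∈ (J.biUnion B).powerset | ∀ j ∈ J, (D ∩ B j).card ≤ m j} with hS
  have hinj : Set.InjOn (fun D : Finset ℕ => ∏ p ∈ D, p) S := by
    have hpf : ∀ D ∈ S, (∏ p ∈ D, p).primeFactors = D := by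
      intro D hD
      refine Nat.primeFactors_prod fun p hp => ?_
      obtain ⟨j, hj, hpj⟩ := mem_biUnion.1 (mem_powerset.1 (mem_filter.1 hD).1 hp)
      exact hprime j hj p hpj
    intro D hD E hE h
    rw [← hpf D hD, ← hpf E hE]
    exact congrArg _ h
  calc ∑ D ∈ S, ((∏ p ∈ D, p : ℕ) : ℝ) ^ 2 = ∑ d ∈ S.image (fun D => ∏ p ∈ D, p), (d : ℝ) ^ 2 := by
        rw [sum_image hinj]
    _ ≤ ∑ d ∈ Ioc 0 N, (d : ℝ) ^ 2 := by
        refine sum_le_sum_of_subset_of_nonneg ?_ fun _ _ _ => by positivity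
        intro d hd
        obtain ⟨D, hD, rfl⟩ := mem_image.1 hd
        obtain ⟨h1, h2⟩ := mem_filter.1 hD
        refine mem_Ioc.2 ⟨prod_pos fun p hp => ?_, hN D (mem_powerset.1 h1) h2⟩
        obtain ⟨j, hj, hpj⟩ := mem_biUnion.1 (mem_powerset.1 h1 hp)
        exact (hprime j hj p hpj).pos
    _ ≤ ∑ d ∈ Ioc 0 N, (N : ℝ) ^ 2 := by
        refine sum_le_sum fun d hd => ?_
        have : (d : ℝ) ≤ N := by exact_mod_cast (mem_Ioc.1 hd).2
        gcongr
    _ = (N : ℝ) ^ 3 := by simp; ring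

end Linnik

namespace Linnik

open Finset

lemma exp_neg_four_mul_le {g : ℝ} (h0 : 0 ≤ g) (h1 : g ≤ 3 / 4) : Real.exp (-4 * g) ≤ 1 - g := by
  have h2 : 1 + 2 * g ≤ Real.exp (2 * g) := by linarith [Real.add_one_le_exp (2 * g)]
  have h3 : (1 + 2 * g) ^ 2 ≤ Real.exp (4 * g) := by
    have : Real.exp (4 * g) = Real.exp (2 * g) ^ 2 := by rw [← Real.exp_nat_mul]; ring_nf
    rw [this]
    gcongr
  have h4 : 1 ≤ (1 + 2 * g) ^ 2 * (1 - g) := by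
    have h5 : 0 ≤ g * (3 / 4 - g) := mul_nonneg h0 (by linarith)
    have h6 : 0 ≤ g * (3 / 4 - g) * g := mul_nonneg h5 h0
    nlinarith
  have h5 : 1 ≤ Real.exp (4 * g) * (1 - g) :=
    h4.trans (mul_le_mul_of_nonneg_right h3 (by linarith))
  rw [show -4 * g = -(4 * g) by ring, Real.exp_neg, inv_le_iff_one_le_mul₀ (Real.exp_pos _)]
  linarith

lemma prod_one_sub_ge {g : ℕ → ℝ} {P : Finset ℕ} (hg : ∀ p ∈ P, 0 ≤ g p ∧ g p ≤ 3 / 4) {Λ : ℝ}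
    (h : ∑ p ∈ P, g p ≤ Λ) : Real.exp (-4 * Λ) ≤ ∏ p ∈ P, (1 - g p) := by
  calc Real.exp (-4 * Λ) ≤ Real.exp (∑ p ∈ P, -4 * g p) := by
        rw [Real.exp_le_exp, ← mul_sum]; linarith
    _ = ∏ p ∈ P, Real.exp (-4 * g p) := Real.exp_sum _ _
    _ ≤ _ := prod_le_prod (fun _ _ => (Real.exp_pos _).le) fun p hp =>
        exp_neg_four_mul_le (hg p hp).1 (hg p hp).2

/-- Conditions on a set of sifting primes and its density function. -/
def SieveDensity (z : ℝ) (P : Finset ℕ) (g : ℕ → ℝ) : Prop :=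
  ∀ p ∈ P, p.Prime ∧ (p : ℝ) ≤ z ∧ 0 ≤ g p ∧ g p ≤ 3 / 4 ∧ g p ≤ 2 / p

lemma SieveDensity.mono {z : ℝ} {P Q : Finset ℕ} {g : ℕ → ℝ} (h : SieveDensity z P g)
    (hQ : Q ⊆ P) : SieveDensity z Q g := fun p hp => h p (hQ hp)

lemma SieveDensity.sum_le {z : ℝ} {P : Finset ℕ} {g : ℕ → ℝ} (h : SieveDensity z P g) (i : ℕ)
    (hP : ∀ p ∈ P, Real.log z < Real.log p * 2 ^ i) : ∑ p ∈ P, g p ≤ 20 * 2 ^ i := by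
  rcases P.eq_empty_or_nonempty with rfl | ⟨p, hp⟩
  · simp
  have hz : 2 ≤ z := by
    have h2 : (2 : ℝ) ≤ p := by exact_mod_cast (h p hp).1.two_le
    linarith [(h p hp).2.1]
  have hl : 0.69 < Real.log z :=
    lt_of_lt_of_le (by linarith [Real.log_two_gt_d9]) (Real.log_le_log (by norm_num) hz)
  have h1 := sum_inv_primes_le (v := Real.log z / 2 ^ i) hz (by positivity) P fun p hp =>
    ⟨(h p hp).1, (h p hp).2.1, by rw [div_le_iff₀ (by positivity)]; exact (hP p hp).le⟩
  calc ∑ p ∈ P, g p ≤ ∑ p ∈ P, 2 * ((1 : ℝ) / p) := sum_le_sum fun p hp => by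
        have := (h p hp).2.2.2.2
        rwa [mul_one_div]
    _ = 2 * ∑ p ∈ P, (1 : ℝ) / p := by rw [mul_sum]
    _ ≤ 2 * ((Real.log z + 6) / (Real.log z / 2 ^ i)) := by linarith
    _ = 2 * (1 + 6 / Real.log z) * 2 ^ i := by field_simp
    _ ≤ 20 * 2 ^ i := by
        have : 6 / Real.log z ≤ 9 := by rw [div_le_iff₀ (by linarith)]; linarith
        have h2 : (0 : ℝ) < 2 ^ i := by positivity
        nlinarith

/-- The primes of `P` whose logarithm lies in `(log z / 2 ^ (j + 1), log z / 2 ^ j]`. -/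
noncomputable def sieveBlock (z : ℝ) (P : Finset ℕ) (j : ℕ) : Finset ℕ :=
  {p ∈ P | Real.log p * 2 ^ j ≤ Real.log z ∧ Real.log z < Real.log p * 2 ^ (j + 1)}

lemma sieveBlock_disjoint (z : ℝ) {P : Finset ℕ} (hP : ∀ p ∈ P, 0 ≤ Real.log p) {i j : ℕ}
    (hij : i < j) : Disjoint (sieveBlock z P i) (sieveBlock z P j) := by
  rw [disjoint_left]
  intro p hi hj
  simp only [sieveBlock, mem_filter] at hi hj
  have : (2 : ℝ) ^ (i + 1) ≤ 2 ^ j := pow_le_pow_right₀ (by norm_num) hij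
  have := mul_le_mul_of_nonneg_left this (hP p hi.1)
  linarith

lemma biUnion_sieveBlock {z : ℝ} {P : Finset ℕ} {g : ℕ → ℝ} (h : SieveDensity z P g) :
    (range (⌊2 * z⌋₊ + 1)).biUnion (sieveBlock z P) = P := by
  ext p
  simp only [mem_biUnion, mem_range, sieveBlock, mem_filter]
  refine ⟨fun ⟨_, _, hp, _⟩ => hp, fun hp => ?_⟩
  have h2 : (2 : ℝ) ≤ p := by exact_mod_cast (h p hp).1.two_le
  have hz := (h p hp).2.1
  have hlp : 0.69 < Real.log p :=
    lt_of_lt_of_le (by linarith [Real.log_two_gt_d9]) (Real.log_le_log (by norm_num) h2)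
  have hlz : Real.log p ≤ Real.log z := Real.log_le_log (by linarith) hz
  obtain ⟨j, hj1, hj2⟩ := exists_nat_pow_near (x := Real.log z / Real.log p) (y := 2)
    (by rw [one_le_div (by linarith)]; exact hlz) (by norm_num)
  rw [le_div_iff₀ (by linarith)] at hj1
  rw [div_lt_iff₀ (by linarith)] at hj2
  refine ⟨j, ?_, hp, by linarith, by linarith⟩
  have h3 : (j : ℝ) ≤ 2 ^ j := by exact_mod_cast (Nat.lt_two_pow_self).le
  have h4 : Real.log z ≤ z - 1 := Real.log_le_sub_one_of_pos (by linarith)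
  have h5 : (j : ℝ) ≤ 2 * z := by nlinarith [pow_pos (show (0 : ℝ) < 2 by norm_num) j]
  exact Nat.lt_succ_of_le (Nat.le_floor h5)

lemma block_level_sum_le (K J : ℕ) :
    ∑ j ∈ range J, (2 * (K + j) + 1 : ℝ) / 2 ^ j ≤ 4 * K + 6 := by
  have h : ∑ j ∈ range J, (2 * (K + j) + 1 : ℝ) / 2 ^ j
      = 4 * K + 6 - (4 * K + 4 * J + 6) / 2 ^ J := by
    induction J with
    | zero => simp
    | succ J ih => rw [sum_range_succ, ih]; push_cast; field_simp; ring
  rw [h]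
  have : (0 : ℝ) ≤ (4 * K + 4 * J + 6) / 2 ^ J := by positivity
  linarith

lemma block_level {z : ℝ} {P : Finset ℕ} {g : ℕ → ℝ} (hz : 1 ≤ z) (h : SieveDensity z P g)
    (K J : ℕ) {D : Finset ℕ} (hD : D ⊆ (range J).biUnion (sieveBlock z P))
    (hc : ∀ j ∈ range J, (D ∩ sieveBlock z P j).card ≤ 2 * (K + j) + 1) :
    ∏ p ∈ D, p ≤ ⌊z ^ (4 * K + 6)⌋₊ := by
  apply Nat.le_floor
  have hP : ∀ p ∈ P, 0 < p := fun p hp => (h p hp).1.pos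
  have hPl : ∀ p ∈ P, 0 ≤ Real.log p := fun p hp => Real.log_natCast_nonneg p
  have hDP : ∀ p ∈ D, p ∈ P := fun p hp => by
    obtain ⟨j, _, hj⟩ := mem_biUnion.1 (hD hp)
    exact (mem_filter.1 hj).1
  have hlz : 0 ≤ Real.log z := Real.log_nonneg hz
  rw [← Real.log_le_log_iff, Nat.cast_prod, Real.log_prod, Real.log_pow]
  · have hDe : D = (range J).biUnion fun j => D ∩ sieveBlock z P j := by
      rw [← inter_biUnion]
      exact (inter_eq_left.2 hD).symm
    rw [hDe, sum_biUnion]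
    · calc ∑ j ∈ range J, ∑ p ∈ D ∩ sieveBlock z P j, Real.log p
          ≤ ∑ j ∈ range J, (2 * (K + j) + 1 : ℝ) / 2 ^ j * Real.log z := by
            refine sum_le_sum fun j hj => ?_
            calc ∑ p ∈ D ∩ sieveBlock z P j, Real.log p
                ≤ ∑ p ∈ D ∩ sieveBlock z P j, Real.log z / 2 ^ j := sum_le_sum fun p hp => by
                  rw [le_div_iff₀ (by positivity)]
                  exact (mem_filter.1 (mem_inter.1 hp).2).2.1
              _ = (D ∩ sieveBlock z P j).card * (Real.log z / 2 ^ j) := by simp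
              _ ≤ (2 * (K + j) + 1 : ℝ) * (Real.log z / 2 ^ j) := by
                  refine mul_le_mul_of_nonneg_right ?_ (by positivity)
                  exact_mod_cast hc j hj
              _ = _ := by ring
        _ = (∑ j ∈ range J, (2 * (K + j) + 1 : ℝ) / 2 ^ j) * Real.log z := by rw [sum_mul]
        _ ≤ _ := by
            push_cast
            exact mul_le_mul_of_nonneg_right (block_level_sum_le K J) hlz
    · intro i _ j _ hij
      rcases lt_or_gt_of_ne hij with h1 | h1
      · exact (sieveBlock_disjoint z hPl h1).mono inter_subset_right inter_subset_right
      · exact (sieveBlock_disjoint z hPl h1).symm.mono inter_subset_right inter_subset_right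
  · intro p hp
    have := hP p (hDP p hp)
    positivity
  · exact_mod_cast prod_pos fun p hp => hP p (hDP p hp)
  · positivity

/-- The constant governing the relative size of the block truncation errors. -/
noncomputable def blockConst : ℝ := Real.exp (160 + 40 * Real.exp 2)

lemma block_error_le {z : ℝ} {P : Finset ℕ} {g : ℕ → ℝ} (h : SieveDensity z P g) (K j : ℕ) :
    esymmSum g (sieveBlock z P j) (2 * (K + j) + 1) / ∏ p ∈ sieveBlock z P j, (1 - g p) ≤
      blockConst * Real.exp (-K) * (1 / 2) ^ j := by
  set m := 2 * (K + j) + 1 with hm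
  have hB : SieveDensity z (sieveBlock z P j) g := h.mono (filter_subset _ _)
  have hB0 : ∀ p ∈ sieveBlock z P j, 0 ≤ g p := fun p hp => (hB p hp).2.2.1
  have hsum : ∑ p ∈ sieveBlock z P j, g p ≤ 40 := by
    rcases (sieveBlock z P j).eq_empty_or_nonempty with he | ⟨p, hp⟩
    · simp [he]
    have hlz : Real.log z / 2 ^ j = Real.log (Real.exp (Real.log z / 2 ^ j)) :=
      (Real.log_exp _).symm
    have hB' : SieveDensity (Real.exp (Real.log z / 2 ^ j)) (sieveBlock z P j) g := by
      intro p hp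
      refine ⟨(hB p hp).1, ?_, (hB p hp).2.2⟩
      rw [← Real.log_le_iff_le_exp (by exact_mod_cast (hB p hp).1.pos),
        le_div_iff₀ (by positivity)]
      exact (mem_filter.1 hp).2.1
    have := hB'.sum_le 1 fun p hp => by
      rw [← hlz, div_lt_iff₀ (by positivity)]
      have := (mem_filter.1 hp).2.2
      rw [pow_succ] at this
      linarith
    linarith
  have hV := prod_one_sub_ge (fun p hp => ⟨(hB p hp).2.2.1, (hB p hp).2.2.2.1⟩) hsum
  have hE : esymmSum g (sieveBlock z P j) m ≤ Real.exp (40 * Real.exp 2) * Real.exp (-2 * m) := by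
    have h1 := factorial_mul_esymmSum_le (sieveBlock z P j) hB0 m
    have h2 : (∑ p ∈ sieveBlock z P j, g p) ^ m ≤ 40 ^ m :=
      pow_le_pow_left₀ (sum_nonneg hB0) hsum m
    have h3 := Real.pow_div_factorial_le_exp (40 * Real.exp 2) (by positivity) m
    have hf : (0 : ℝ) < m.factorial := by positivity
    rw [div_le_iff₀ hf, mul_pow, ← Real.exp_nat_mul] at h3
    have h4 : (m.factorial : ℝ) * esymmSum g (sieveBlock z P j) m ≤
        m.factorial * (Real.exp (40 * Real.exp 2) * Real.exp (-2 * m)) := by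
      calc _ ≤ (40 : ℝ) ^ m := h1.trans h2
        _ = 40 ^ m * Real.exp (m * 2) * Real.exp (-2 * m) := by
            rw [mul_assoc, ← Real.exp_add]; ring_nf; simp
        _ ≤ _ := by
            have := mul_le_mul_of_nonneg_right h3 (Real.exp_pos (-2 * m)).le
            linarith
    exact le_of_mul_le_mul_left h4 hf
  have hE2 : Real.exp (-2 * (m : ℝ)) ≤ Real.exp (-K) * (1 / 2) ^ j := by
    have h1 : Real.exp (-1 : ℝ) ≤ 1 / 2 := by
      rw [Real.exp_neg, one_div]
      exact inv_anti₀ (by norm_num) (by linarith [Real.add_one_le_exp (1 : ℝ)])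
    calc Real.exp (-2 * (m : ℝ)) ≤ Real.exp (-K + j * (-1)) := by
          rw [Real.exp_le_exp, hm]; push_cast
          have : (0 : ℝ) ≤ K := by positivity
          have : (0 : ℝ) ≤ j := by positivity
          linarith
      _ = Real.exp (-K) * Real.exp (-1) ^ j := by rw [Real.exp_add, Real.exp_nat_mul]
      _ ≤ _ := by gcongr
  rw [div_le_iff₀ (lt_of_lt_of_le (Real.exp_pos _) hV)]
  calc _ ≤ Real.exp (40 * Real.exp 2) * Real.exp (-2 * m) := hE
    _ ≤ Real.exp (40 * Real.exp 2) * (Real.exp (-K) * (1 / 2) ^ j) := by gcongr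
    _ = blockConst * Real.exp (-K) * (1 / 2) ^ j * Real.exp (-4 * 40) := by
        have : blockConst = Real.exp (40 * Real.exp 2) * Real.exp 160 := by
          rw [blockConst, ← Real.exp_add]; ring_nf
        rw [this]
        have h2 : Real.exp 160 * Real.exp (-4 * 40) = 1 := by rw [← Real.exp_add]; norm_num
        linear_combination -(Real.exp (40 * Real.exp 2) * (Real.exp (-K) * (1 / 2) ^ j)) * h2
    _ ≤ _ := by
        refine mul_le_mul_of_nonneg_left hV ?_
        unfold blockConst
        positivity

lemma sum_block_error_le {z : ℝ} {P : Finset ℕ} {g : ℕ → ℝ} (h : SieveDensity z P g) (K J : ℕ) :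
    ∑ j ∈ range J, esymmSum g (sieveBlock z P j) (2 * (K + j) + 1) /
      ∏ p ∈ sieveBlock z P j, (1 - g p) ≤ 2 * blockConst * Real.exp (-K) := by
  calc _ ≤ ∑ j ∈ range J, blockConst * Real.exp (-K) * (1 / 2) ^ j :=
        sum_le_sum fun j _ => block_error_le h K j
    _ = blockConst * Real.exp (-K) * ∑ j ∈ range J, (1 / 2 : ℝ) ^ j := by rw [mul_sum]
    _ ≤ blockConst * Real.exp (-K) * 2 := by
        refine mul_le_mul_of_nonneg_left ?_ (by unfold blockConst; positivity)
        exact sum_geometric_two_le J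
    _ = _ := by ring

/-- Fundamental lemma of the sieve (Brun–Hooley form). -/
theorem fundamental_lemma {z : ℝ} {P : Finset ℕ} {g : ℕ → ℝ} (hz : 1 ≤ z)
    (h : SieveDensity z P g) {Ω : Finset ℕ} {a : ℕ → ℝ} (ha : ∀ n ∈ Ω, 0 ≤ a n) {X R : ℝ}
    (hX : 0 ≤ X) (hR : 0 ≤ R)
    (hA : ∀ D ⊆ P, |∑ n ∈ Ω with ∀ p ∈ D, p ∣ n, a n - X * ∏ p ∈ D, g p| ≤
      R * (∏ p ∈ D, p : ℕ) ^ 2) (K : ℕ) :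
    |∑ n ∈ Ω with ∀ p ∈ P, ¬ p ∣ n, a n - X * ∏ p ∈ P, (1 - g p)| ≤
      2 * blockConst * Real.exp (2 * blockConst) * Real.exp (-K) * (X * ∏ p ∈ P, (1 - g p)) +
      4 * R * z ^ (12 * K + 19) := by
  set J := ⌊2 * z⌋₊ + 1 with hJ
  set B := sieveBlock z P with hBdef
  set N := ⌊z ^ (4 * K + 6)⌋₊ with hN
  have hU : (range J).biUnion B = P := biUnion_sieveBlock h
  have hPl : ∀ p ∈ P, 0 ≤ Real.log p := fun p hp => Real.log_natCast_nonneg p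
  have hdis : ∀ i ∈ range J, ∀ j ∈ range J, i ≠ j → Disjoint (B i) (B j) := by
    intro i _ j _ hij
    rcases lt_or_gt_of_ne hij with h1 | h1
    · exact sieveBlock_disjoint z hPl h1
    · exact (sieveBlock_disjoint z hPl h1).symm
  have hBP : ∀ j, B j ⊆ P := fun j => filter_subset _ _
  have hprime : ∀ j ∈ range J, ∀ p ∈ B j, p.Prime := fun j _ p hp => (h p (hBP j hp)).1
  set V : ℕ → ℝ := fun j => ∏ p ∈ B j, (1 - g p) with hV
  set Y : ℕ → ℝ := fun j => truncSum g (B j) (2 * (K + j)) with hY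
  set E : ℕ → ℝ := fun j => esymmSum g (B j) (2 * (K + j) + 1) with hE
  set iv : ℕ → ℕ → ℝ := fun n p => if p ∣ n then 1 else 0 with hiv
  set x : ℕ → ℕ → ℝ := fun n j => ∏ p ∈ B j, (1 - iv n p) with hx
  set y : ℕ → ℕ → ℝ := fun n j => truncSum (iv n) (B j) (2 * (K + j)) with hy
  set e : ℕ → ℕ → ℝ := fun n j => esymmSum (iv n) (B j) (2 * (K + j) + 1) with he
  have hVpos : ∀ j, 0 < V j := fun j => prod_pos fun p hp => by
    have := (h p (hBP j hp)).2.2.2.1; linarith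
  have hVprod : ∏ j ∈ range J, V j = ∏ p ∈ P, (1 - g p) := by
    rw [← hU, prod_biUnion]
    exact fun i hi j hj hij => hdis i hi j hj hij
  have hbon : ∀ (u : ℕ → ℝ) (j : ℕ), (∀ p ∈ B j, 0 ≤ u p ∧ u p ≤ 1) →
      ∏ p ∈ B j, (1 - u p) ≤ truncSum u (B j) (2 * (K + j)) ∧
      truncSum u (B j) (2 * (K + j)) - ∏ p ∈ B j, (1 - u p) ≤
        esymmSum u (B j) (2 * (K + j) + 1) := by
    intro u j hu
    have hb := bonferroni (B j) hu (2 * (K + j))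
    rw [pow_mul, neg_one_sq, one_pow, one_mul] at hb
    exact ⟨by linarith [hb.1], hb.2⟩
  have hg01 : ∀ j, ∀ p ∈ B j, 0 ≤ g p ∧ g p ≤ 1 := fun j p hp => by
    have := h p (hBP j hp); exact ⟨this.2.2.1, by linarith [this.2.2.2.1]⟩
  have hVY : ∀ j, V j ≤ Y j ∧ Y j - V j ≤ E j := fun j => hbon g j (hg01 j)
  have hiv01 : ∀ n p, 0 ≤ iv n p ∧ iv n p ≤ 1 := fun n p => by
    simp only [hiv]; split_ifs <;> norm_num
  have hxy : ∀ n j, x n j ≤ y n j ∧ y n j - x n j ≤ e n j :=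
    fun n j => hbon (iv n) j fun p _ => hiv01 n p
  have hx0 : ∀ n j, 0 ≤ x n j := fun n j => prod_nonneg fun p _ => by linarith [(hiv01 n p).2]
  have hy0 : ∀ n j, 0 ≤ y n j := fun n j => (hx0 n j).trans (hxy n j).1
  have hE0 : ∀ j, 0 ≤ E j := fun j => esymmSum_nonneg (fun p hp => (hg01 j p hp).1) _
  have hxprod : ∀ n, ∏ j ∈ range J, x n j = if ∀ p ∈ P, ¬ p ∣ n then 1 else 0 := by
    intro n
    have h1 : ∏ j ∈ range J, x n j = ∏ p ∈ P, (1 - iv n p) := by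
      rw [← hU, prod_biUnion]
      exact fun i hi j hj hij => hdis i hi j hj hij
    rw [h1]
    have h2 : ∀ p, 1 - iv n p = if ¬ p ∣ n then 1 else 0 := fun p => by
      simp only [hiv]; split_ifs <;> simp_all
    simp_rw [h2]
    rw [prod_ite_zero]; simp
  have hS : ∑ n ∈ Ω with ∀ p ∈ P, ¬ p ∣ n, a n = ∑ n ∈ Ω, a n * ∏ j ∈ range J, x n j := by
    rw [sum_filter]
    refine sum_congr rfl fun n _ => ?_
    rw [hxprod]; split_ifs <;> simp
  have hA' : ∀ D ⊆ (range J).biUnion B, |∑ n ∈ Ω with ∀ p ∈ D, p ∣ n, a n - X * ∏ p ∈ D, g p| ≤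
      R * (∏ p ∈ D, p : ℕ) ^ 2 := by rw [hU]; exact hA
  have hlev : ∀ D ⊆ (range J).biUnion B, (∀ j ∈ range J, (D ∩ B j).card ≤ 2 * (K + j) + 1) →
      ∏ p ∈ D, p ≤ N := fun D hD hc => block_level hz h K J hD hc
  have htc : ∀ m D, |truncCoeff m D| ≤ 1 := fun m D => by
    unfold truncCoeff; split_ifs <;> simp
  have hec : ∀ m D, |esymmCoeff m D| ≤ 1 := fun m D => by
    unfold esymmCoeff; split_ifs <;> simp
  -- the two evaluations
  have hmain := block_weights_eval hdis hprime (fun j => truncCoeff (2 * (K + j)))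
    (fun j D => htc _ _) (fun j => 2 * (K + j) + 1)
    (fun j D hD => by unfold truncCoeff at hD; split_ifs at hD <;> [omega; simp at hD])
    hlev Ω a g hR hA'
  have hcor : ∀ l ∈ range J, |∑ n ∈ Ω, a n * (e n l * ∏ j ∈ (range J).erase l, y n j) -
      X * (E l * ∏ j ∈ (range J).erase l, Y j)| ≤ R * (N : ℝ) ^ 3 := by
    intro l hl
    have hev := block_weights_eval hdis hprime
      (fun j => if j = l then esymmCoeff (2 * (K + j) + 1) else truncCoeff (2 * (K + j)))
      (fun j D => by split_ifs; exacts [hec _ _, htc _ _])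
      (fun j => 2 * (K + j) + 1)
      (fun j D hD => by
        split_ifs at hD
        · unfold esymmCoeff at hD; split_ifs at hD <;> [omega; simp at hD]
        · unfold truncCoeff at hD; split_ifs at hD <;> [omega; simp at hD])
      hlev Ω a g hR hA'
    have hprod : ∀ u : ℕ → ℝ, ∏ j ∈ range J, blockSum (if j = l then
        esymmCoeff (2 * (K + j) + 1) else truncCoeff (2 * (K + j))) u (B j) =
        esymmSum u (B l) (2 * (K + l) + 1) *
          ∏ j ∈ (range J).erase l, truncSum u (B j) (2 * (K + j)) := by
      intro u
      rw [← mul_prod_erase _ _ hl, if_pos rfl, blockSum_esymmCoeff]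
      congr 1
      refine prod_congr rfl fun j hj => ?_
      rw [if_neg (ne_of_mem_erase hj), blockSum_truncCoeff]
    simp only [hprod] at hev
    exact hev
  simp only [blockSum_truncCoeff] at hmain
  change |∑ n ∈ Ω, a n * ∏ j ∈ range J, y n j - X * ∏ j ∈ range J, Y j| ≤ _ at hmain
  -- size of the main terms
  set W := ∏ p ∈ P, (1 - g p) with hW
  have hWpos : 0 < W := by rw [← hVprod]; exact prod_pos fun j _ => hVpos j
  set η := ∑ j ∈ range J, E j / V j with hη
  have hη0 : 0 ≤ η := sum_nonneg fun j _ => div_nonneg (hE0 j) (hVpos j).le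
  have hη1 : η ≤ 2 * blockConst * Real.exp (-K) := sum_block_error_le h K J
  have hη2 : η ≤ 2 * blockConst := by
    refine hη1.trans ?_
    have : Real.exp (-(K : ℝ)) ≤ 1 := Real.exp_le_one_iff.2 (by simp)
    have h0 : 0 ≤ 2 * blockConst := by unfold blockConst; positivity
    nlinarith
  have hYW : ∏ j ∈ range J, Y j ≤ W * Real.exp η := by
    rw [hη, Real.exp_sum, ← hVprod, ← prod_mul_distrib]
    refine prod_le_prod (fun j _ => (hVpos j).le.trans (hVY j).1) fun j _ => ?_
    have h1 : E j / V j + 1 ≤ Real.exp (E j / V j) := Real.add_one_le_exp _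
    have h2 : V j * (E j / V j + 1) = E j + V j := by have := (hVpos j).ne'; field_simp
    have := mul_le_mul_of_nonneg_left h1 (hVpos j).le
    linarith [(hVY j).2]
  have hWY : W ≤ ∏ j ∈ range J, Y j := by
    rw [← hVprod]; exact prod_le_prod (fun j _ => (hVpos j).le) fun j _ => (hVY j).1
  have hEY : ∑ l ∈ range J, E l * ∏ j ∈ (range J).erase l, Y j ≤ η * (W * Real.exp η) := by
    calc _ ≤ ∑ l ∈ range J, E l / V l * ∏ j ∈ range J, Y j := by
          refine sum_le_sum fun l hl => ?_
          rw [← mul_prod_erase _ _ hl, div_mul_eq_mul_div, le_div_iff₀ (hVpos l), mul_assoc]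
          refine mul_le_mul_of_nonneg_left ?_ (hE0 l)
          rw [mul_comm]
          refine mul_le_mul_of_nonneg_right (hVY l).1 (prod_nonneg fun j _ => ?_)
          exact (hVpos j).le.trans (hVY j).1
      _ = η * ∏ j ∈ range J, Y j := by rw [hη, sum_mul]
      _ ≤ _ := mul_le_mul_of_nonneg_left hYW hη0
  have hexp1 : Real.exp η - 1 ≤ η * Real.exp η := by
    have h1 : -η + 1 ≤ Real.exp (-η) := Real.add_one_le_exp _
    have h2 := mul_le_mul_of_nonneg_right h1 (Real.exp_pos η).le
    rw [← Real.exp_add, neg_add_cancel, Real.exp_zero] at h2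
    linarith
  have hηC : η * Real.exp η ≤ 2 * blockConst * Real.exp (2 * blockConst) * Real.exp (-K) := by
    calc η * Real.exp η ≤ (2 * blockConst * Real.exp (-K)) * Real.exp (2 * blockConst) := by
          have : 0 ≤ 2 * blockConst * Real.exp (-K) := hη0.trans hη1
          gcongr
      _ = _ := by ring
  have hN3 : ((J : ℝ) + 1) * (R * (N : ℝ) ^ 3) ≤ 4 * R * z ^ (12 * K + 19) := by
    have h1 : (J : ℝ) + 1 ≤ 4 * z := by
      have := Nat.floor_le (show 0 ≤ 2 * z by linarith)
      rw [hJ]; push_cast; linarith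
    have h2 : (N : ℝ) ≤ z ^ (4 * K + 6) := Nat.floor_le (by positivity)
    calc ((J : ℝ) + 1) * (R * (N : ℝ) ^ 3) ≤ (4 * z) * (R * (z ^ (4 * K + 6)) ^ 3) := by gcongr
      _ = 4 * R * z ^ (12 * K + 19) := by ring
  have hRN : 0 ≤ R * (N : ℝ) ^ 3 := by positivity
  have hXW : 0 ≤ X * W := mul_nonneg hX hWpos.le
  have hXWη := mul_le_mul_of_nonneg_left hηC hXW
  rw [hS, abs_le]
  constructor
  · have h1 : ∑ n ∈ Ω, a n * ∏ j ∈ range J, y n j -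
        ∑ l ∈ range J, ∑ n ∈ Ω, a n * (e n l * ∏ j ∈ (range J).erase l, y n j) ≤
        ∑ n ∈ Ω, a n * ∏ j ∈ range J, x n j := by
      rw [sum_comm, ← sum_sub_distrib]
      refine sum_le_sum fun n hn => ?_
      rw [← mul_sum, ← mul_sub]
      refine mul_le_mul_of_nonneg_left ?_ (ha n hn)
      refine le_trans ?_ (hooley_lower (range J) fun j _ => ⟨hx0 n j, (hxy n j).1⟩)
      gcongr with l hl
      · exact prod_nonneg fun j _ => hy0 n j
      · exact (hxy n l).2
    have h2 : ∑ l ∈ range J, ∑ n ∈ Ω, a n * (e n l * ∏ j ∈ (range J).erase l, y n j) ≤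
        X * (η * (W * Real.exp η)) + J * (R * (N : ℝ) ^ 3) := by
      calc _ ≤ ∑ l ∈ range J, (X * (E l * ∏ j ∈ (range J).erase l, Y j) + R * (N : ℝ) ^ 3) :=
            sum_le_sum fun l hl => by linarith [(abs_le.1 (hcor l hl)).2]
        _ = X * ∑ l ∈ range J, (E l * ∏ j ∈ (range J).erase l, Y j) + J * (R * (N : ℝ) ^ 3) := by
            rw [sum_add_distrib, mul_sum]; simp
        _ ≤ _ := by gcongr
    have h3 := (abs_le.1 hmain).1
    have h4 := mul_le_mul_of_nonneg_left hWY hX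
    linarith
  · have h1 : ∑ n ∈ Ω, a n * ∏ j ∈ range J, x n j ≤ ∑ n ∈ Ω, a n * ∏ j ∈ range J, y n j :=
      sum_le_sum fun n hn => mul_le_mul_of_nonneg_left
        (prod_le_prod (fun j _ => hx0 n j) fun j _ => (hxy n j).1) (ha n hn)
    have h3 := (abs_le.1 hmain).2
    have h4 := mul_le_mul_of_nonneg_left hYW hX
    have h5 := mul_le_mul_of_nonneg_left hexp1 hXW
    have h6 : 0 ≤ (J : ℝ) * (R * (N : ℝ) ^ 3) := by positivity
    linarith

end Linnik

namespace Linnik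

open Finset

/-- Implied constant of the fundamental lemma. -/
noncomputable def flConst : ℝ := 2 * blockConst * Real.exp (2 * blockConst)

/-- Implied constant of the upper bound sieve. -/
noncomputable def upperConst : ℝ := (1 + flConst) * Real.exp 10240

lemma flConst_pos : 0 < flConst := by unfold flConst blockConst; positivity

lemma upperConst_pos : 0 < upperConst := by have := flConst_pos; unfold upperConst; positivity

/-- Upper bound sieve with small level of distribution. -/
theorem sieve_upper {z : ℝ} {P : Finset ℕ} {g : ℕ → ℝ} (hz : 1 ≤ z) (h : SieveDensity z P g)
    {Ω : Finset ℕ} {a : ℕ → ℝ} (ha : ∀ n ∈ Ω, 0 ≤ a n) {X R : ℝ} (hX : 0 ≤ X) (hR : 0 ≤ R)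
    (hA : ∀ D ⊆ P, |∑ n ∈ Ω with ∀ p ∈ D, p ∣ n, a n - X * ∏ p ∈ D, g p| ≤
      R * ((∏ p ∈ D, p : ℕ) : ℝ) ^ 2) :
    ∑ n ∈ Ω with ∀ p ∈ P, ¬ p ∣ n, a n ≤
      upperConst * (X * ∏ p ∈ P, (1 - g p)) + 4 * R * z ^ (1 / 4 : ℝ) := by
  have hz0 : 0 < z := by linarith
  set z' : ℝ := z ^ (1 / 128 : ℝ) with hz'
  have hz'1 : 1 ≤ z' := Real.one_le_rpow hz (by norm_num)
  have hlog : Real.log z' = Real.log z / 128 := by rw [hz', Real.log_rpow hz0]; ring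
  set P' := P.filter fun p : ℕ => Real.log p * 2 ^ 7 ≤ Real.log z with hP'
  have hsub : P' ⊆ P := filter_subset _ _
  have h' : SieveDensity z' P' g := by
    intro p hp
    obtain ⟨hpP, hpl⟩ := mem_filter.1 hp
    obtain ⟨h1, -, h3⟩ := h p hpP
    refine ⟨h1, ?_, h3⟩
    have hp0 : (0 : ℝ) < p := by exact_mod_cast h1.pos
    rw [← Real.log_le_log_iff hp0 (by linarith), hlog]
    linarith
  have key := fundamental_lemma hz'1 h' ha hX hR (fun D hD => hA D (hD.trans hsub)) 0
  have hcompl : Real.exp (-10240) ≤ ∏ p ∈ P \ P', (1 - g p) := by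
    have hs := (h.mono (sdiff_subset (s := P) (t := P'))).sum_le 7 (by
      intro p hp
      obtain ⟨h1, h2⟩ := mem_sdiff.1 hp
      simp only [hP', mem_filter, h1, true_and, not_le] at h2
      exact h2)
    have := prod_one_sub_ge (P := P \ P') (fun p hp =>
      ⟨(h p (sdiff_subset hp)).2.2.1, (h p (sdiff_subset hp)).2.2.2.1⟩) hs
    norm_num at this ⊢
    exact this
  have hVnn : 0 ≤ ∏ p ∈ P', (1 - g p) :=
    prod_nonneg fun p hp => by linarith [(h p (hsub hp)).2.2.2.1]
  have hV : ∏ p ∈ P', (1 - g p) ≤ Real.exp 10240 * ∏ p ∈ P, (1 - g p) := by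
    rw [← prod_sdiff hsub, ← mul_assoc]
    refine le_mul_of_one_le_left hVnn ?_
    calc (1 : ℝ) = Real.exp 10240 * Real.exp (-10240) := by rw [← Real.exp_add]; simp
      _ ≤ _ := by gcongr
  have hmono : ∑ n ∈ Ω with ∀ p ∈ P, ¬ p ∣ n, a n ≤ ∑ n ∈ Ω with ∀ p ∈ P', ¬ p ∣ n, a n := by
    refine sum_le_sum_of_subset_of_nonneg (fun n hn => ?_) fun n hn _ => ha n (mem_filter.1 hn).1
    obtain ⟨h1, h2⟩ := mem_filter.1 hn
    exact mem_filter.2 ⟨h1, fun p hp => h2 p (hsub hp)⟩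
  have hzz : z' ^ (12 * 0 + 19) ≤ z ^ (1 / 4 : ℝ) := by
    rw [hz', ← Real.rpow_natCast, ← Real.rpow_mul hz0.le]
    exact Real.rpow_le_rpow_of_exponent_le hz (by norm_num)
  have h1 := (abs_le.1 key).2
  simp only [Nat.cast_zero, neg_zero, Real.exp_zero, mul_one] at h1
  have hfl := flConst_pos
  have h2 : 4 * R * z' ^ (12 * 0 + 19) ≤ 4 * R * z ^ (1 / 4 : ℝ) := by gcongr
  have h3 : (1 + flConst) * (X * ∏ p ∈ P', (1 - g p)) ≤
      upperConst * (X * ∏ p ∈ P, (1 - g p)) := by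
    have := mul_le_mul_of_nonneg_left hV (show 0 ≤ (1 + flConst) * X by positivity)
    unfold upperConst
    linarith
  have h4 : 2 * blockConst * Real.exp (2 * blockConst) = flConst := rfl
  rw [h4] at h1
  generalize ∏ p ∈ P', (1 - g p) = V' at *
  generalize ∏ p ∈ P, (1 - g p) = V at *
  refine hmono.trans ((sub_le_iff_le_add.1 h1).trans ?_)
  have h5 : (1 + flConst) * (X * V') = X * V' + flConst * (X * V') := by ring
  linarith

end Linnik

namespace Linnik

open Finset

/-- A positive integer without prime factors up to `Z`. -/
def Rough (Z n : ℕ) : Prop := n ≠ 0 ∧ ∀ p ∈ (Z + 1).primesBelow, ¬ p ∣ n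

instance (Z : ℕ) : DecidablePred (Rough Z) := fun n => by unfold Rough; infer_instance

lemma rough_one (Z : ℕ) : Rough Z 1 :=
  ⟨one_ne_zero, fun p hp h => (Nat.prime_of_mem_primesBelow hp).one_lt.ne' (Nat.dvd_one.1 h)⟩

lemma rough_mul {Z m n : ℕ} : Rough Z (m * n) ↔ Rough Z m ∧ Rough Z n := by
  constructor
  · rintro ⟨h0, h⟩
    exact ⟨⟨left_ne_zero_of_mul h0, fun p hp hd => h p hp (hd.mul_right _)⟩,
      ⟨right_ne_zero_of_mul h0, fun p hp hd => h p hp (hd.mul_left _)⟩⟩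
  · rintro ⟨⟨h0, h⟩, ⟨h0', h'⟩⟩
    refine ⟨mul_ne_zero h0 h0', fun p hp hd => ?_⟩
    rcases (Nat.prime_of_mem_primesBelow hp).dvd_mul.1 hd with h1 | h1
    · exact h p hp h1
    · exact h' p hp h1

lemma mem_primesBelow_succ {Z p : ℕ} : p ∈ (Z + 1).primesBelow ↔ p ≤ Z ∧ p.Prime := by
  rw [Nat.mem_primesBelow, Nat.lt_succ_iff]

lemma Rough.coprime {Z n q : ℕ} (h : Rough Z n) (hq0 : q ≠ 0) (hq : q ≤ Z) : n.Coprime q := by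
  refine Nat.coprime_of_dvd fun p hp h1 h2 => h.2 p ?_ h1
  exact mem_primesBelow_succ.2 ⟨(Nat.le_of_dvd (Nat.pos_of_ne_zero hq0) h2).trans hq, hp⟩

lemma Rough.lt_of_ne_one {Z n : ℕ} (h : Rough Z n) (h1 : n ≠ 1) : Z < n := by
  by_contra! hn
  have hp := Nat.minFac_prime h1
  exact h.2 _ (mem_primesBelow_succ.2
    ⟨(Nat.minFac_le (Nat.pos_of_ne_zero h.1)).trans hn, hp⟩) (Nat.minFac_dvd n)

lemma rough_of_prime {Z p : ℕ} (hp : p.Prime) (h : Z < p) : Rough Z p := by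
  refine ⟨hp.ne_zero, fun r hr hd => ?_⟩
  obtain ⟨h1, h2⟩ := mem_primesBelow_succ.1 hr
  have := (Nat.prime_dvd_prime_iff_eq h2 hp).1 hd
  omega

/-- The density of the `Z`-rough numbers. -/
noncomputable def roughDensity (Z : ℕ) : ℝ := ∏ p ∈ (Z + 1).primesBelow, (1 - 1 / (p : ℝ))

lemma one_sub_inv_prime_pos {p : ℕ} (hp : p.Prime) : (0 : ℝ) < 1 - 1 / p := by
  have : (1 : ℝ) < p := by exact_mod_cast hp.one_lt
  have h2 : (1 : ℝ) / p < 1 := by rw [div_lt_one (by linarith)]; exact this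
  linarith

lemma roughDensity_pos (Z : ℕ) : 0 < roughDensity Z :=
  prod_pos fun _ hp => one_sub_inv_prime_pos (Nat.prime_of_mem_primesBelow hp)

lemma roughDensity_mul_log_le (Z : ℕ) : roughDensity Z * Real.log Z ≤ 1 := by
  let f : ℕ →* ℝ :=
    { toFun := fun n => ((n : ℝ))⁻¹
      map_one' := by simp
      map_mul' := fun a b => by push_cast; rw [mul_inv] }
  have hf : ∀ {p : ℕ}, p.Prime → ‖f p‖ < 1 := fun {p} hp => by
    have : (1 : ℝ) < p := by exact_mod_cast hp.one_lt
    change ‖((p : ℝ))⁻¹‖ < 1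
    rw [Real.norm_of_nonneg (by positivity)]
    exact inv_lt_one_of_one_lt₀ this
  have h := (EulerProduct.summable_and_hasSum_smoothNumbers_prod_primesBelow_geometric hf
    (Z + 1)).2
  have h1 : Real.log Z ≤ ∏ p ∈ (Z + 1).primesBelow, (1 - f p)⁻¹ := by
    rcases Nat.eq_zero_or_pos Z with rfl | hZ
    · simp only [CharP.cast_eq_zero, Real.log_zero]
      exact prod_nonneg fun p hp => by
        have := one_sub_inv_prime_pos (Nat.prime_of_mem_primesBelow hp)
        rw [one_div] at this
        exact inv_nonneg.2 this.le
    have hH : Real.log Z ≤ ∑ n ∈ Icc 1 Z, ((n : ℝ))⁻¹ := by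
      have h2 := log_add_one_le_harmonic Z
      rw [harmonic_eq_sum_Icc] at h2
      push_cast at h2
      refine le_trans (Real.log_le_log (by exact_mod_cast hZ) (by linarith)) h2
    refine hH.trans ?_
    have hmem : ∀ n ∈ Icc 1 Z, n ∈ (Z + 1).smoothNumbers := fun n hn => by
      obtain ⟨h2, h3⟩ := mem_Icc.1 hn
      exact Nat.mem_smoothNumbers_of_lt (by omega) (by omega)
    have h4 := h.summable.sum_le_tsum ((Icc 1 Z).subtype (· ∈ (Z + 1).smoothNumbers))
      (fun i _ => show (0 : ℝ) ≤ ((i : ℕ) : ℝ)⁻¹ by positivity)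
    have h5 := h.tsum_eq
    change ∑' i : {x // x ∈ (Z + 1).smoothNumbers}, ((i : ℕ) : ℝ)⁻¹ = _ at h5
    rw [h5] at h4
    refine le_trans (le_of_eq ?_) h4
    rw [← sum_subtype_of_mem (fun n : ℕ => ((n : ℝ))⁻¹) hmem]
  have h2 : roughDensity Z * ∏ p ∈ (Z + 1).primesBelow, (1 - f p)⁻¹ = 1 := by
    unfold roughDensity
    rw [← prod_mul_distrib]
    refine prod_eq_one fun p hp => ?_
    have := one_sub_inv_prime_pos (Nat.prime_of_mem_primesBelow hp)
    change (1 - 1 / (p : ℝ)) * (1 - ((p : ℝ))⁻¹)⁻¹ = 1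
    rw [one_div] at this ⊢
    exact mul_inv_cancel₀ this.ne'
  have := mul_le_mul_of_nonneg_left h1 (roughDensity_pos Z).le
  linarith

lemma abs_card_modEq_sub_le (r v : ℕ) (hr : 0 < r) {x : ℝ} (hx : 0 ≤ x) :
    |(#{n ∈ Ioc 0 ⌊x⌋₊ | n ≡ v [MOD r]} : ℝ) - x / r| ≤ 2 := by
  have h := Nat.Ioc_filter_modEq_card 0 ⌊x⌋₊ hr v
  set b := ⌊x⌋₊
  set c := #{n ∈ Ioc 0 b | n ≡ v [MOD r]}
  have hr' : (0 : ℚ) < r := by exact_mod_cast hr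
  have hr1 : (1 : ℚ) ≤ r := by exact_mod_cast hr
  have hdiff : (((b : ℚ) - v) / r) - (((0 : ℕ) : ℚ) - v) / r = b / r := by push_cast; ring
  have h0 : (0 : ℚ) ≤ b / r := by positivity
  have f1 := Int.floor_le (((b : ℚ) - v) / r)
  have f2 := Int.lt_floor_add_one (((b : ℚ) - v) / r)
  have f3 := Int.floor_le ((((0 : ℕ) : ℚ) - v) / r)
  have f4 := Int.lt_floor_add_one ((((0 : ℕ) : ℚ) - v) / r)
  have hmono : ⌊(((0 : ℕ) : ℚ) - v) / r⌋ ≤ ⌊((b : ℚ) - v) / r⌋ :=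
    Int.floor_mono (by linarith)
  rw [max_eq_left (by linarith)] at h
  have hc : (c : ℚ) = ⌊((b : ℚ) - v) / r⌋ - ⌊(((0 : ℕ) : ℚ) - v) / r⌋ := by exact_mod_cast h
  have hq : |(c : ℚ) - b / r| ≤ 1 := by rw [abs_le]; constructor <;> linarith
  have hq' : |(c : ℝ) - b / r| ≤ 1 := by
    have : ((|(c : ℚ) - b / r| : ℚ) : ℝ) ≤ ((1 : ℚ) : ℝ) := by exact_mod_cast hq
    push_cast at this
    exact this
  have hrr : (1 : ℝ) ≤ r := by exact_mod_cast hr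
  have hb1 := Nat.floor_le hx
  have hb2 := Nat.lt_floor_add_one x
  have h5 : |(b : ℝ) / r - x / r| ≤ 1 := by
    rw [← sub_div, abs_div, abs_of_pos (by linarith : (0 : ℝ) < r), div_le_one (by linarith),
      abs_le]
    constructor <;> linarith
  calc |(c : ℝ) - x / r| ≤ |(c : ℝ) - b / r| + |(b : ℝ) / r - x / r| := abs_sub_le _ _ _
    _ ≤ 2 := by linarith

lemma prod_dvd_iff {D : Finset ℕ} (hD : ∀ p ∈ D, p.Prime) (n : ℕ) :
    ∏ p ∈ D, p ∣ n ↔ ∀ p ∈ D, p ∣ n :=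
  ⟨fun h p hp => (dvd_prod_of_mem _ hp).trans h,
    fun h => prod_primes_dvd n (fun p hp => (hD p hp).prime) h⟩

lemma abs_card_class_dvd_sub_le {q : ℕ} [NeZero q] (b : ZMod q) {D : Finset ℕ}
    (hD : ∀ p ∈ D, p.Prime ∧ ¬ p ∣ q) {x : ℝ} (hx : 0 ≤ x) :
    |(#{n ∈ {n ∈ Ioc 0 ⌊x⌋₊ | ((n : ℕ) : ZMod q) = b} | ∀ p ∈ D, p ∣ n} : ℝ)
      - x / q * ∏ p ∈ D, (1 / (p : ℝ))| ≤ 2 := by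
  have hco : q.Coprime (∏ p ∈ D, p) := Nat.Coprime.prod_right fun p hp =>
    ((Nat.Prime.coprime_iff_not_dvd (hD p hp).1).2 (hD p hp).2).symm
  obtain ⟨k, hk1, hk2⟩ := Nat.chineseRemainder hco b.val 0
  have hpos : 0 < ∏ p ∈ D, p := prod_pos fun p hp => (hD p hp).1.pos
  have h := abs_card_modEq_sub_le (q * ∏ p ∈ D, p) k
    (Nat.mul_pos (Nat.pos_of_ne_zero (NeZero.ne q)) hpos) hx
  have e1 : {n ∈ {n ∈ Ioc 0 ⌊x⌋₊ | ((n : ℕ) : ZMod q) = b} | ∀ p ∈ D, p ∣ n} =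
      {n ∈ Ioc 0 ⌊x⌋₊ | n ≡ k [MOD q * ∏ p ∈ D, p]} := by
    rw [filter_filter]
    refine filter_congr fun n _ => ?_
    rw [← Nat.modEq_and_modEq_iff_modEq_mul hco, ← prod_dvd_iff fun p hp => (hD p hp).1]
    refine and_congr ?_ ?_
    · rw [← ZMod.natCast_eq_natCast_iff, (ZMod.natCast_eq_natCast_iff _ _ _).2 hk1,
        ZMod.natCast_zmod_val]
    · rw [← Nat.modEq_zero_iff_dvd]
      exact ⟨fun h => h.trans hk2.symm, fun h => h.trans hk2⟩
  have e2 : x / q * ∏ p ∈ D, (1 / (p : ℝ)) = x / ((q * ∏ p ∈ D, p : ℕ) : ℝ) := by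
    push_cast
    rw [prod_div_distrib, prod_const_one, div_mul_div_comm, mul_one]
  rw [e1, e2]
  exact h

/-- Number of `Z`-rough integers up to `x` in a residue class. -/
noncomputable def roughCount (Z : ℕ) {q : ℕ} (b : ZMod q) (x : ℝ) : ℕ :=
  #{n ∈ Ioc 0 ⌊x⌋₊ | Rough Z n ∧ ((n : ℕ) : ZMod q) = b}

/-- The primes up to `Z` not dividing `q`. -/
def siftPrimes (Z q : ℕ) : Finset ℕ := (Z + 1).primesBelow.filter fun p => ¬ p ∣ q

lemma roughDensity_div_totient {q Z : ℕ} (hq : q ≠ 0) (hqZ : q ≤ Z) :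
    1 / (q : ℝ) * ∏ p ∈ siftPrimes Z q, (1 - 1 / (p : ℝ)) =
      roughDensity Z / q.totient := by
  have h1 : (q.totient : ℝ) = q * ∏ p ∈ q.primeFactors, (1 - 1 / (p : ℝ)) := by
    have := Nat.totient_eq_mul_prod_factors q
    have h2 : ((q.totient : ℚ) : ℝ) = ((q * ∏ p ∈ q.primeFactors, (1 - (p : ℚ)⁻¹) : ℚ) : ℝ) := by
      rw [this]
    push_cast at h2
    simpa only [one_div] using h2
  have h2 : q.primeFactors = {p ∈ (Z + 1).primesBelow | p ∣ q} := by
    ext p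
    simp only [Nat.mem_primeFactors, mem_filter, mem_primesBelow_succ]
    constructor
    · rintro ⟨hp, hd, -⟩
      exact ⟨⟨(Nat.le_of_dvd (Nat.pos_of_ne_zero hq) hd).trans hqZ, hp⟩, hd⟩
    · rintro ⟨⟨-, hp⟩, hd⟩
      exact ⟨hp, hd, hq⟩
  have h3 : roughDensity Z = (∏ p ∈ (Z + 1).primesBelow with p ∣ q, (1 - 1 / (p : ℝ))) *
      ∏ p ∈ siftPrimes Z q, (1 - 1 / (p : ℝ)) :=
    (prod_filter_mul_prod_filter_not _ _ _).symm
  have hpos : (0 : ℝ) < ∏ p ∈ (Z + 1).primesBelow with p ∣ q, (1 - 1 / (p : ℝ)) :=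
    prod_pos fun p hp => one_sub_inv_prime_pos (mem_primesBelow_succ.1 (mem_filter.1 hp).1).2
  have hq' : (q : ℝ) ≠ 0 := by exact_mod_cast hq
  rw [h1, h2, h3]
  field_simp

lemma sieveDensity_inv (Z q : ℕ) :
    SieveDensity Z (siftPrimes Z q) fun p => 1 / (p : ℝ) := by
  intro p hp
  obtain ⟨h1, h2⟩ := mem_primesBelow_succ.1 (mem_filter.1 hp).1
  have h3 : (2 : ℝ) ≤ p := by exact_mod_cast h2.two_le
  have h4 : (1 : ℝ) / p ≤ 1 / 2 := one_div_le_one_div_of_le (by norm_num) h3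
  refine ⟨h2, by exact_mod_cast h1, by positivity, by linarith, ?_⟩
  exact div_le_div_of_nonneg_right (by norm_num) (by positivity)

lemma roughCount_eq_sum {Z q : ℕ} [NeZero q] {b : ZMod q} (hb : IsUnit b) (x : ℝ) :
    (roughCount Z b x : ℝ) = ∑ n ∈ {n ∈ Ioc 0 ⌊x⌋₊ | ((n : ℕ) : ZMod q) = b} with
      ∀ p ∈ siftPrimes Z q, ¬ p ∣ n, (1 : ℝ) := by
  rw [sum_const, nsmul_eq_mul, mul_one, roughCount, filter_filter]
  congr 2
  refine filter_congr fun n hn => ?_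
  have hn0 := (mem_Ioc.1 hn).1
  constructor
  · rintro ⟨h1, h2⟩
    exact ⟨h2, fun p hp => h1.2 p (mem_filter.1 hp).1⟩
  · rintro ⟨h1, h2⟩
    refine ⟨⟨hn0.ne', fun p hp hd => ?_⟩, h1⟩
    by_cases hpq : p ∣ q
    · rw [← h1, ZMod.isUnit_iff_coprime] at hb
      have := Nat.dvd_gcd hd hpq
      rw [hb] at this
      exact (mem_primesBelow_succ.1 hp).2.one_lt.ne' (Nat.dvd_one.1 this)
    · exact h2 p (mem_filter.2 ⟨hp, hpq⟩) hd

lemma level_of_class {Z q : ℕ} [NeZero q] (b : ZMod q) {x : ℝ} (hx : 0 ≤ x) :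
    ∀ D ⊆ siftPrimes Z q,
      |∑ n ∈ {n ∈ Ioc 0 ⌊x⌋₊ | ((n : ℕ) : ZMod q) = b} with ∀ p ∈ D, p ∣ n, (1 : ℝ)
        - x / q * ∏ p ∈ D, (1 / (p : ℝ))| ≤ 2 * ((∏ p ∈ D, p : ℕ) : ℝ) ^ 2 := by
  intro D hD
  have hD' : ∀ p ∈ D, p.Prime ∧ ¬ p ∣ q := fun p hp =>
    ⟨(mem_primesBelow_succ.1 (mem_filter.1 (hD hp)).1).2, (mem_filter.1 (hD hp)).2⟩
  have h := abs_card_class_dvd_sub_le b hD' hx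
  rw [sum_const, nsmul_eq_mul, mul_one]
  refine h.trans ?_
  have h1 : (1 : ℝ) ≤ ((∏ p ∈ D, p : ℕ) : ℝ) := by
    exact_mod_cast prod_pos fun p hp => (hD' p hp).1.pos
  nlinarith

lemma sieve_main_eq {Z q : ℕ} (hq : q ≠ 0) (hqZ : q ≤ Z) (x : ℝ) :
    x / q * ∏ p ∈ siftPrimes Z q, (1 - 1 / (p : ℝ)) =
      x * (roughDensity Z / q.totient) := by
  rw [← roughDensity_div_totient hq hqZ]; ring

lemma roughCount_le {Z q : ℕ} [NeZero q] (hZ : 1 ≤ Z) (hqZ : q ≤ Z) {b : ZMod q} (hb : IsUnit b)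
    {x : ℝ} (hx : 0 ≤ x) : (roughCount Z b x : ℝ) ≤
      upperConst * (x * (roughDensity Z / q.totient)) + 8 * (Z : ℝ) ^ (1 / 4 : ℝ) := by
  have h := sieve_upper (by exact_mod_cast hZ) (sieveDensity_inv Z q)
    (Ω := {n ∈ Ioc 0 ⌊x⌋₊ | ((n : ℕ) : ZMod q) = b}) (a := fun _ => 1)
    (fun _ _ => zero_le_one) (by positivity) (by norm_num) (level_of_class b hx)
  rw [sieve_main_eq (NeZero.ne q) hqZ, ← roughCount_eq_sum hb] at h
  linarith

lemma abs_roughCount_sub_le {Z q : ℕ} [NeZero q] (hZ : 1 ≤ Z) (hqZ : q ≤ Z) {b : ZMod q}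
    (hb : IsUnit b) {x : ℝ} (hx : 0 ≤ x) (K : ℕ) :
    |(roughCount Z b x : ℝ) - x * (roughDensity Z / q.totient)| ≤
      flConst * Real.exp (-K) * (x * (roughDensity Z / q.totient)) +
        8 * (Z : ℝ) ^ (12 * K + 19) := by
  have h := fundamental_lemma (by exact_mod_cast hZ) (sieveDensity_inv Z q)
    (Ω := {n ∈ Ioc 0 ⌊x⌋₊ | ((n : ℕ) : ZMod q) = b}) (a := fun _ => 1)
    (fun _ _ => zero_le_one) (by positivity) (by norm_num) (level_of_class b hx) K
  rw [sieve_main_eq (NeZero.ne q) hqZ, ← roughCount_eq_sum hb] at h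
  refine h.trans (le_of_eq ?_)
  unfold flConst
  ring

end Linnik

namespace Linnik

open Finset ArithmeticFunction

lemma log_le_two_sqrt {x : ℝ} (hx : 0 < x) : Real.log x ≤ 2 * √x := by
  have h := Real.log_le_sub_one_of_pos (Real.sqrt_pos.2 hx)
  rw [Real.log_sqrt hx.le] at h
  linarith

lemma primeCounting_le_roughCount (Z : ℕ) :
    (Nat.primeCounting (Z ^ 2) : ℝ) ≤ roughCount Z (1 : ZMod 1) ((Z : ℝ) ^ 2) + Z := by
  have hfl : ⌊(Z : ℝ) ^ 2⌋₊ = Z ^ 2 := by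
    rw [← Nat.cast_pow, Nat.floor_natCast]
  have h1 : (Z ^ 2 + 1).primesBelow ⊆
      {n ∈ Ioc 0 ⌊(Z : ℝ) ^ 2⌋₊ | Rough Z n ∧ ((n : ℕ) : ZMod 1) = 1} ∪ Icc 1 Z := by
    intro p hp
    obtain ⟨h2, h3⟩ := mem_primesBelow_succ.1 hp
    rw [mem_union, mem_filter, hfl, mem_Ioc, mem_Icc]
    rcases le_or_gt p Z with h | h
    · exact Or.inr ⟨h3.one_le, h⟩
    · exact Or.inl ⟨⟨h3.pos, h2⟩, rough_of_prime h3 h, Subsingleton.elim _ _⟩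
  have h2 := (card_le_card h1).trans (card_union_le _ _)
  rw [Nat.primesBelow_card_eq_primeCounting', Nat.card_Icc, Nat.add_sub_cancel] at h2
  change Nat.primeCounting (Z ^ 2) ≤ roughCount Z (1 : ZMod 1) ((Z : ℝ) ^ 2) + Z at h2
  exact_mod_cast h2

lemma one_le_roughDensity_mul_log {Z : ℕ} (hZ : 2 ^ 16 ≤ Z) :
    1 ≤ 4 * upperConst * (roughDensity Z * Real.log Z) := by
  have hZr : (2 : ℝ) ^ 16 ≤ Z := by exact_mod_cast hZ
  have hZ1 : (1 : ℝ) ≤ Z := by linarith [show (1 : ℝ) ≤ 2 ^ 16 by norm_num]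
  have h1 := roughCount_le (q := 1) (by omega : 1 ≤ Z) (by omega) (b := 1) isUnit_one
    (x := (Z : ℝ) ^ 2) (by positivity)
  simp only [Nat.totient_one, Nat.cast_one, div_one] at h1
  have h2 := primeCounting_le_roughCount Z
  have h3 := Chebyshev.pi_ge (Z ^ 2)
  push_cast at h3
  rw [Real.log_pow] at h3
  push_cast at h3
  have hs : (256 : ℝ) ≤ √Z := Real.le_sqrt_of_sq_le (by linarith [show (256 : ℝ) ^ 2 = 2 ^ 16 by norm_num])
  have hss : √(Z : ℝ) * √Z = Z := Real.mul_self_sqrt (by linarith)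
  have hlog : Real.log Z ≤ Z / 128 := (log_le_two_sqrt (by linarith)).trans (by nlinarith)
  have hlogpos : 0 < Real.log Z := Real.log_pos (by linarith [show (1 : ℝ) < 2 ^ 16 by norm_num])
  have hlog2 : Real.log ((Z : ℝ) ^ 2 + 1) ≤ Z := by
    calc Real.log ((Z : ℝ) ^ 2 + 1) ≤ Real.log ((Z : ℝ) ^ 3) := by
          apply Real.log_le_log (by positivity)
          nlinarith [sq_nonneg (Z : ℝ)]
      _ = 3 * Real.log Z := by rw [Real.log_pow]; norm_num
      _ ≤ Z := by linarith
  have hw : 8 * (Z : ℝ) ^ (1 / 4 : ℝ) ≤ Z := by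
    have : (Z : ℝ) ^ (1 / 4 : ℝ) ≤ √Z := by
      rw [Real.sqrt_eq_rpow]
      exact Real.rpow_le_rpow_of_exponent_le hZ1 (by norm_num)
    nlinarith
  rw [div_le_iff₀ (by positivity)] at h3
  have hl2 := Real.log_two_gt_d9
  have h4 : (Nat.primeCounting (Z ^ 2) : ℝ) ≤
      upperConst * ((Z : ℝ) ^ 2 * roughDensity Z) + 2 * Z := by linarith
  have h5 := mul_le_mul_of_nonneg_right h4 (show 0 ≤ 2 * Real.log Z by positivity)
  have h6 : Real.log Z * Z ≤ Z ^ 2 / 128 := by nlinarith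
  have h7 : (Z : ℝ) ^ 2 / 2 ≤ upperConst * ((Z : ℝ) ^ 2 * roughDensity Z) * (2 * Real.log Z) := by
    nlinarith
  have h8 : (Z : ℝ) ^ 2 * 1 ≤ Z ^ 2 * (4 * upperConst * (roughDensity Z * Real.log Z)) := by
    linarith
  exact le_of_mul_le_mul_left h8 (by positivity)

/-- Number of `Z`-rough integers in `(1, x]` in a residue class. -/
noncomputable def roughCount' (Z : ℕ) {q : ℕ} (b : ZMod q) (x : ℝ) : ℕ :=
  #{n ∈ Ioc 1 ⌊x⌋₊ | Rough Z n ∧ ((n : ℕ) : ZMod q) = b}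

lemma roughCount'_bounds (Z : ℕ) {q : ℕ} (b : ZMod q) (x : ℝ) :
    roughCount' Z b x ≤ roughCount Z b x ∧ roughCount Z b x ≤ roughCount' Z b x + 1 := by
  constructor
  · refine card_le_card (filter_subset_filter _ (Ioc_subset_Ioc_left zero_le_one))
  · have : {n ∈ Ioc 0 ⌊x⌋₊ | Rough Z n ∧ ((n : ℕ) : ZMod q) = b} ⊆
        insert 1 {n ∈ Ioc 1 ⌊x⌋₊ | Rough Z n ∧ ((n : ℕ) : ZMod q) = b} := by
      intro n hn
      simp only [mem_filter, mem_Ioc, mem_insert] at hn ⊢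
      by_cases h : n = 1
      · exact Or.inl h
      · exact Or.inr ⟨⟨by omega, hn.1.2⟩, hn.2⟩
    exact (card_le_card this).trans (card_insert_le _ _)

lemma roughCount'_eq_zero {Z q : ℕ} (b : ZMod q) {x : ℝ} (hx : x < Z) :
    roughCount' Z b x = 0 := by
  rw [roughCount', card_eq_zero, filter_eq_empty_iff]
  rintro n hn ⟨h1, -⟩
  rw [mem_Ioc] at hn
  have h2 := h1.lt_of_ne_one (by omega)
  have h3 : (n : ℝ) ≤ x := (Nat.le_floor_iff' (by omega)).1 hn.2
  have h4 : (n : ℝ) < Z := h3.trans_lt hx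
  have h5 : n < Z := by exact_mod_cast h4
  omega

/-- Implied constant for counts of rough numbers. -/
noncomputable def countConst : ℝ := 21 * (1 + 160 * upperConst + flConst)

lemma exp_three_le : Real.exp 3 ≤ 21 := by
  have h := Real.exp_one_lt_d9
  have : Real.exp 3 = Real.exp 1 ^ 3 := by rw [← Real.exp_nat_mul]; norm_num
  rw [this]
  calc Real.exp 1 ^ 3 ≤ 2.7182818286 ^ 3 := by gcongr
    _ ≤ 21 := by norm_num

theorem abs_roughCount'_sub_le {Z q : ℕ} [NeZero q] (hZ : 2 ^ 16 ≤ Z) (hqZ : q ^ 4 ≤ Z)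
    {b : ZMod q} (hb : IsUnit b) {x : ℝ} (hx : 1 ≤ x) :
    |(roughCount' Z b x : ℝ) - x * (roughDensity Z / q.totient)| ≤
      countConst * (x * (roughDensity Z / q.totient)) *
        Real.exp (-(Real.log x / (24 * Real.log Z))) := by
  have hq1 : 1 ≤ q := Nat.pos_of_ne_zero (NeZero.ne q)
  have hqZ' : q ≤ Z := (Nat.le_self_pow (by norm_num) q).trans hqZ
  have hZr : (2 : ℝ) ^ 16 ≤ Z := by exact_mod_cast hZ
  have hZ1 : (1 : ℝ) < Z := by linarith [show (1 : ℝ) < 2 ^ 16 by norm_num]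
  have hZ0 : (0 : ℝ) < Z := by linarith
  have hl : 0 < Real.log Z := Real.log_pos hZ1
  have hl1 : 1 ≤ Real.log Z := by
    rw [Real.le_log_iff_exp_le hZ0]
    linarith [Real.exp_one_lt_d9, show (3 : ℝ) < 2 ^ 16 by norm_num]
  have hlx : 0 ≤ Real.log x := Real.log_nonneg hx
  have hU := upperConst_pos
  have hF := flConst_pos
  set ε := roughDensity Z / q.totient with hε
  have hφ : (0 : ℝ) < q.totient := by exact_mod_cast Nat.totient_pos.2 hq1
  have hφq : (q.totient : ℝ) ≤ q := by exact_mod_cast Nat.totient_le q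
  have hε0 : 0 < ε := div_pos (roughDensity_pos Z) hφ
  set w : ℝ := (Z : ℝ) ^ (1 / 4 : ℝ) with hw
  have hw1 : 1 ≤ w := Real.one_le_rpow hZ1.le (by norm_num)
  have hw4 : w ^ 4 = Z := by
    rw [hw, ← Real.rpow_natCast, ← Real.rpow_mul hZ0.le]; norm_num
  have hqw : (q : ℝ) ≤ w := by
    have : (q : ℝ) ^ 4 ≤ w ^ 4 := by rw [hw4]; exact_mod_cast hqZ
    exact le_of_pow_le_pow_left₀ (by norm_num) (by linarith) this
  have hlw : Real.log Z ≤ 4 * w := by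
    rw [← hw4, Real.log_pow]
    have := Real.log_le_sub_one_of_pos (show 0 < w by linarith)
    push_cast
    linarith
  have hstar : 1 ≤ 16 * upperConst * ε * w ^ 2 := by
    have h1 := one_le_roughDensity_mul_log hZ
    have h2 : roughDensity Z = ε * q.totient := by rw [hε]; field_simp
    rw [h2] at h1
    calc (1 : ℝ) ≤ 4 * upperConst * (ε * q.totient * Real.log Z) := h1
      _ ≤ 4 * upperConst * (ε * w * (4 * w)) := by gcongr; linarith
      _ = _ := by ring
  have hxε : 0 < x * ε := by positivity
  obtain ⟨hc1, hc2⟩ := roughCount'_bounds Z b x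
  have hc1' : (roughCount' Z b x : ℝ) ≤ roughCount Z b x := by exact_mod_cast hc1
  have hc2' : (roughCount Z b x : ℝ) ≤ roughCount' Z b x + 1 := by exact_mod_cast hc2
  set E := Real.exp (-(Real.log x / (24 * Real.log Z))) with hE
  have hE0 : 0 < E := Real.exp_pos _
  have hElow : ∀ k : ℕ, x < (Z : ℝ) ^ (24 * k + 62) → Real.exp (-k) ≤ 21 * E := by
    intro k hk
    have h1 : Real.log x ≤ (24 * k + 62 : ℕ) * Real.log Z := by
      rw [← Real.log_pow]
      exact Real.log_le_log (by linarith) hk.le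
    push_cast at h1
    have h2 : Real.log x / (24 * Real.log Z) ≤ k + 3 := by
      rw [div_le_iff₀ (by positivity)]
      nlinarith
    calc Real.exp (-k) ≤ Real.exp (3 + -(Real.log x / (24 * Real.log Z))) := by
          rw [Real.exp_le_exp]; linarith
      _ = Real.exp 3 * E := by rw [Real.exp_add]
      _ ≤ 21 * E := by gcongr; exact exp_three_le
  have hfin : ∀ B : ℝ, 0 ≤ B → B ≤ 1 + 160 * upperConst + flConst → ∀ k : ℕ,
      x < (Z : ℝ) ^ (24 * k + 62) → B * (x * ε) * Real.exp (-k) ≤ countConst * (x * ε) * E := by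
    intro B hB0 hB k hk
    calc B * (x * ε) * Real.exp (-k) ≤ (1 + 160 * upperConst + flConst) * (x * ε) * (21 * E) := by
          have := hElow k hk
          gcongr
      _ = _ := by unfold countConst; ring
  rcases lt_or_ge x ((Z : ℝ) ^ 38) with h38 | h38
  · have h62 : x < (Z : ℝ) ^ (24 * 0 + 62) :=
      h38.trans_le (pow_le_pow_right₀ hZ1.le (by norm_num))
    refine le_trans ?_ (hfin (1 + 160 * upperConst) (by positivity) (by linarith) 0 h62)
    simp only [Nat.cast_zero, neg_zero, Real.exp_zero, mul_one]
    rcases lt_or_ge x Z with hxZ | hxZ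
    · rw [roughCount'_eq_zero b hxZ]
      simp only [Nat.cast_zero, zero_sub, abs_neg, abs_of_pos hxε]
      nlinarith
    · have h1 := roughCount_le (by omega : 1 ≤ Z) hqZ' hb (x := x) (by linarith)
      have h2 : 8 * w ≤ 128 * upperConst * (x * ε) := by
        calc 8 * w = 8 * w * 1 := by ring
          _ ≤ 8 * w * (16 * upperConst * ε * w ^ 2) := by gcongr
          _ = 128 * upperConst * ε * w ^ 3 := by ring
          _ ≤ 128 * upperConst * ε * w ^ 4 := by gcongr; norm_num [hw1]
          _ ≤ 128 * upperConst * ε * x := by rw [hw4]; gcongr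
          _ = _ := by ring
      have h3 : (0 : ℝ) ≤ roughCount' Z b x := by positivity
      have h4 : 0 < upperConst * (x * ε) := by positivity
      rw [abs_le]
      constructor <;> nlinarith
  · obtain ⟨K, hK1, hK2⟩ : ∃ K : ℕ, (Z : ℝ) ^ (24 * K + 38) ≤ x ∧ x < (Z : ℝ) ^ (24 * K + 62) := by
      have hy : 1 ≤ x / (Z : ℝ) ^ 38 := by rwa [one_le_div (by positivity)]
      have hz : 1 < (Z : ℝ) ^ 24 := one_lt_pow₀ hZ1 (by norm_num)
      obtain ⟨K, h1, h2⟩ := exists_nat_pow_near hy hz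
      refine ⟨K, ?_, ?_⟩
      · rw [le_div_iff₀ (by positivity)] at h1
        rw [pow_add, pow_mul]; exact h1
      · rw [div_lt_iff₀ (by positivity)] at h2
        refine h2.trans_le (le_of_eq ?_)
        rw [← pow_mul, ← pow_add]; congr 1
    refine le_trans ?_ (hfin (160 * upperConst + flConst) (by positivity) (by linarith) K hK2)
    have h1 := abs_roughCount_sub_le (by omega : 1 ≤ Z) hqZ' hb (x := x) (by linarith) K
    rw [← hε] at h1
    have hZK : (1 : ℝ) ≤ (Z : ℝ) ^ (12 * K + 19) := one_le_pow₀ hZ1.le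
    have h2 : 9 * (Z : ℝ) ^ (12 * K + 19) ≤ 144 * upperConst * (x * ε) * Real.exp (-K) := by
      have hw2 : w ^ 2 ≤ Z := by rw [← hw4]; exact pow_le_pow_right₀ hw1 (by norm_num)
      have hZe : (Z : ℝ) ^ K * Real.exp (-K) ≥ 1 := by
        rw [Real.exp_neg, ge_iff_le, ← div_eq_mul_inv, one_le_div (Real.exp_pos _),
          ← Real.le_log_iff_exp_le (by positivity), Real.log_pow]
        nlinarith [show (0 : ℝ) ≤ K by positivity]
      calc 9 * (Z : ℝ) ^ (12 * K + 19) = 9 * (Z : ℝ) ^ (12 * K + 19) * 1 := by ring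
        _ ≤ 9 * (Z : ℝ) ^ (12 * K + 19) * (16 * upperConst * ε * w ^ 2) := by gcongr
        _ ≤ 9 * (Z : ℝ) ^ (12 * K + 19) * (16 * upperConst * ε * Z) := by gcongr
        _ = 144 * upperConst * ε * (Z : ℝ) ^ (12 * K + 20) * 1 := by ring
        _ ≤ 144 * upperConst * ε * (Z : ℝ) ^ (12 * K + 20) * ((Z : ℝ) ^ K * Real.exp (-K)) := by
            gcongr
        _ = 144 * upperConst * ε * (Z : ℝ) ^ (13 * K + 20) * Real.exp (-K) := by ring
        _ ≤ 144 * upperConst * ε * (Z : ℝ) ^ (24 * K + 38) * Real.exp (-K) := by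
            gcongr
            · exact hZ1.le
            · omega
            · omega
        _ ≤ 144 * upperConst * ε * x * Real.exp (-K) := by gcongr
        _ = _ := by ring
    have h3 : 0 < upperConst * (x * ε) * Real.exp (-K) := by positivity
    rw [abs_le] at h1 ⊢
    constructor <;> linarith [h1.1, h1.2]

/-- Mertens' theorem for rough prime powers. -/
theorem abs_sum_rough_vonMangoldt_div_sub_le {Z : ℕ} (hZ : 2 ^ 16 ≤ Z) {t : ℝ} (ht : 0 ≤ t) :
    |∑ n ∈ Ioc 0 ⌊Real.exp t⌋₊ with Rough Z n, Λ n / n - t| ≤ 20 * Real.log Z := by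
  set N := ⌊Real.exp t⌋₊ with hN
  have hN1 : 1 ≤ N := Nat.le_floor (by simpa using Real.one_le_exp ht)
  have hNr : (1 : ℝ) ≤ N := by exact_mod_cast hN1
  have hl1 : 1 ≤ Real.log Z := by
    have hZr : (2 : ℝ) ^ 16 ≤ Z := by exact_mod_cast hZ
    rw [Real.le_log_iff_exp_le (by linarith [show (0 : ℝ) < 2 ^ 16 by norm_num])]
    linarith [Real.exp_one_lt_d9, show (3 : ℝ) < 2 ^ 16 by norm_num]
  have hlog4 : Real.log 4 < 1.4 := by
    have : Real.log 4 = 2 * Real.log 2 := by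
      rw [show (4 : ℝ) = 2 ^ 2 by norm_num, Real.log_pow]; norm_num
    rw [this]; linarith [Real.log_two_lt_d9]
  have hlogN1 : Real.log N ≤ t := by
    rw [← Real.log_exp t]
    exact Real.log_le_log (by linarith) (Nat.floor_le (Real.exp_pos t).le)
  have hlogN2 : t ≤ Real.log N + 1 := by
    have h1 : Real.exp t ≤ N + 1 := (Nat.lt_floor_add_one _).le
    have h2 : t ≤ Real.log (2 * N) := by
      rw [Real.le_log_iff_exp_le (by positivity)]; linarith
    rw [Real.log_mul (by norm_num) (by positivity)] at h2
    linarith [Real.log_two_lt_d9]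
  obtain ⟨hm1, hm2⟩ := sum_vonMangoldt_div_bounds hN1
  have hsplit := sum_filter_add_sum_filter_not (Ioc 0 N) (Rough Z) fun n => Λ n / (n : ℝ)
  have hnn : 0 ≤ ∑ n ∈ Ioc 0 N with ¬ Rough Z n, Λ n / (n : ℝ) :=
    sum_nonneg fun n _ => div_nonneg vonMangoldt_nonneg (by positivity)
  have hbad : ∑ n ∈ Ioc 0 N with ¬ Rough Z n, Λ n / (n : ℝ) ≤ 2 * (Real.log Z + 6) := by
    calc ∑ n ∈ Ioc 0 N with ¬ Rough Z n, Λ n / (n : ℝ)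
        = ∑ n ∈ Ioc 0 N with ¬ Rough Z n ∧ IsPrimePow n, Λ n / (n : ℝ) := by
          rw [← filter_filter]
          refine (sum_filter_of_ne ?_).symm
          intro n _ hn
          by_contra h
          exact hn (by rw [vonMangoldt_eq_zero_iff.2 h, zero_div])
      _ ≤ ∑ n ∈ ((Z + 1).primesBelow ×ˢ Icc 1 N).image (fun pk => pk.1 ^ pk.2), Λ n / (n : ℝ) := by
          refine sum_le_sum_of_subset_of_nonneg (fun n hn => ?_) fun n _ _ =>
            div_nonneg vonMangoldt_nonneg (by positivity)
          obtain ⟨h1, h2, h3⟩ := mem_filter.1 hn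
          obtain ⟨p, k, hp, hk, rfl⟩ := (isPrimePow_nat_iff _).1 h3
          have h4 := mem_Ioc.1 h1
          refine mem_image.2 ⟨(p, k), mem_product.2 ⟨?_, ?_⟩, rfl⟩
          · rw [mem_primesBelow_succ]
            refine ⟨?_, hp⟩
            by_contra! hpZ
            refine h2 ⟨h4.1.ne', fun r hr hd => ?_⟩
            exact (rough_of_prime hp hpZ).2 r hr
              ((mem_primesBelow_succ.1 hr).2.dvd_of_dvd_pow hd)
          · exact mem_Icc.2 ⟨hk, (Nat.lt_pow_self hp.one_lt).le.trans h4.2⟩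
      _ ≤ ∑ pk ∈ (Z + 1).primesBelow ×ˢ Icc 1 N, Λ (pk.1 ^ pk.2) / ((pk.1 ^ pk.2 : ℕ) : ℝ) :=
          sum_image_le_of_nonneg fun n _ => div_nonneg vonMangoldt_nonneg (by positivity)
      _ = ∑ p ∈ (Z + 1).primesBelow, ∑ k ∈ Icc 1 N, Λ (p ^ k) / ((p ^ k : ℕ) : ℝ) :=
          sum_product _ _ _
      _ ≤ ∑ p ∈ (Z + 1).primesBelow, 2 * (Λ p / p) := by
          refine sum_le_sum fun p hp => ?_
          have hp' := (mem_primesBelow_succ.1 hp).2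
          have hp2 : (2 : ℝ) ≤ p := by exact_mod_cast hp'.two_le
          have h1 : ∀ M : ℕ, ∑ k ∈ Icc 1 M, Λ (p ^ k) / ((p ^ k : ℕ) : ℝ) ≤
              2 * (Λ p / p) * (1 - 1 / 2 ^ M) := by
            intro M
            induction M with
            | zero => simp
            | succ M ih =>
              rw [sum_Icc_succ_top (by omega)]
              have hΛ : 0 ≤ Λ p := vonMangoldt_nonneg
              have h2 : Λ (p ^ (M + 1)) / ((p ^ (M + 1) : ℕ) : ℝ) ≤ Λ p / p * (1 / 2 ^ M) := by
                rw [vonMangoldt_apply_pow (by omega), div_mul_div_comm, mul_one]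
                push_cast
                rw [pow_succ, mul_comm ((p : ℝ) ^ M)]
                gcongr
              have h3 : 2 * (Λ p / p) * (1 - 1 / 2 ^ (M + 1)) =
                  2 * (Λ p / p) * (1 - 1 / 2 ^ M) + Λ p / p * (1 / 2 ^ M) := by
                rw [pow_succ]; field_simp; ring
              linarith
          refine (h1 N).trans ?_
          have h2 : 0 ≤ 2 * (Λ p / (p : ℝ)) :=
            mul_nonneg (by norm_num) (div_nonneg vonMangoldt_nonneg (by positivity))
          have h3 : (0 : ℝ) ≤ 1 / 2 ^ N := by positivity
          nlinarith
      _ = 2 * ∑ p ∈ (Z + 1).primesBelow, Λ p / p := by rw [mul_sum]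
      _ ≤ 2 * ∑ p ∈ Ioc 0 Z, Λ p / (p : ℝ) := by
          refine mul_le_mul_of_nonneg_left (sum_le_sum_of_subset_of_nonneg (fun p hp => ?_)
            fun n _ _ => div_nonneg vonMangoldt_nonneg (Nat.cast_nonneg n)) (by norm_num)
          obtain ⟨h1, h2⟩ := mem_primesBelow_succ.1 hp
          exact mem_Ioc.2 ⟨h2.pos, h1⟩
      _ ≤ 2 * (Real.log Z + 6) := by
          have := (sum_vonMangoldt_div_bounds (show 1 ≤ Z by omega)).2
          linarith
  rw [abs_le]
  constructor <;> linarith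

end Linnik

namespace Linnik

open Finset MeasureTheory intervalIntegral

/-- Summatory function on a logarithmic scale. -/
noncomputable def logSum {E : Type*} [AddCommMonoid E] (c : ℕ → E) (t : ℝ) : E :=
  ∑ n ∈ Ioc 0 ⌊Real.exp t⌋₊, c n

lemma mem_Ioc_floor_exp {n : ℕ} {t : ℝ} :
    n ∈ Ioc 0 ⌊Real.exp t⌋₊ ↔ 0 < n ∧ Real.log n ≤ t := by
  rw [mem_Ioc]
  refine and_congr_right fun hn => ?_
  rw [Nat.le_floor_iff' hn.ne', ← Real.log_le_iff_le_exp (by exact_mod_cast hn)]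

lemma logSum_of_neg {E : Type*} [AddCommMonoid E] (c : ℕ → E) {t : ℝ} (ht : t < 0) :
    logSum c t = 0 := by
  refine sum_eq_zero fun n hn => ?_
  have := mem_Ioc_floor_exp.1 hn
  have h1 : 0 ≤ Real.log n := Real.log_natCast_nonneg n
  linarith

lemma logSum_eq_sum_ite {E : Type*} [AddCommMonoid E] (c : ℕ → E) {t T : ℝ} (h : t ≤ T) :
    logSum c t = ∑ n ∈ Ioc 0 ⌊Real.exp T⌋₊, if Real.log n ≤ t then c n else 0 := by
  rw [← sum_filter]
  refine sum_congr ?_ fun _ _ => rfl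
  ext n
  rw [mem_filter, mem_Ioc_floor_exp, mem_Ioc_floor_exp]
  constructor
  · rintro ⟨h1, h2⟩; exact ⟨⟨h1, h2.trans h⟩, h2⟩
  · rintro ⟨⟨h1, -⟩, h2⟩; exact ⟨h1, h2⟩

lemma logSum_sub_eq {E : Type*} [AddCommGroup E] (c : ℕ → E) {s t : ℝ} (h : s ≤ t) :
    logSum c t - logSum c s = ∑ n ∈ Ioc 0 ⌊Real.exp t⌋₊ with s < Real.log (n : ℕ), c n := by
  rw [logSum_eq_sum_ite c h, logSum, ← sum_sub_distrib, sum_filter]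
  refine sum_congr rfl fun n _ => ?_
  by_cases h1 : Real.log n ≤ s
  · simp [h1, not_lt.2 h1]
  · simp [h1, not_le.1 h1]

lemma logSum_mono {c : ℕ → ℝ} (hc : ∀ n, 0 ≤ c n) : Monotone (logSum c) := fun _ _ h =>
  sum_le_sum_of_subset_of_nonneg
    (Ioc_subset_Ioc_right (Nat.floor_mono (Real.exp_le_exp.2 h))) fun n _ _ => hc n

lemma logSum_nonneg {c : ℕ → ℝ} (hc : ∀ n, 0 ≤ c n) (t : ℝ) : 0 ≤ logSum c t :=
  sum_nonneg fun n _ => hc n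

lemma norm_logSum_le {E : Type*} [NormedAddCommGroup E] (c : ℕ → E) {t T : ℝ} (h : t ≤ T) :
    ‖logSum c t‖ ≤ logSum (fun n => ‖c n‖) T :=
  (norm_sum_le _ _).trans (logSum_mono (fun n => norm_nonneg (c n)) h)

lemma stronglyMeasurable_logSum {E : Type*} [NormedAddCommGroup E] (c : ℕ → E) :
    StronglyMeasurable (logSum c) := by
  have h : StronglyMeasurable (fun N : ℕ => ∑ n ∈ Ioc 0 N, c n) := StronglyMeasurable.of_discrete
  exact h.comp_measurable (Nat.measurable_floor.comp Real.measurable_exp)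

lemma intervalIntegrable_of_bound {E : Type*} [NormedAddCommGroup E] {f : ℝ → E}
    (hf : StronglyMeasurable f) {a b M : ℝ} (h : ∀ s ∈ Set.uIoc a b, ‖f s‖ ≤ M) :
    IntervalIntegrable f volume a b := by
  rw [intervalIntegrable_iff]
  refine Measure.integrableOn_of_bounded (M := M) (by simp [Set.uIoc]) hf.aestronglyMeasurable ?_
  exact (ae_restrict_iff' measurableSet_uIoc).2 (Filter.Eventually.of_forall h)

lemma intervalIntegrable_logSum {E : Type*} [NormedAddCommGroup E] (c : ℕ → E) (a b : ℝ) :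
    IntervalIntegrable (logSum c) volume a b :=
  intervalIntegrable_of_bound (stronglyMeasurable_logSum c) (M := logSum (fun n => ‖c n‖) (max a b))
    fun _ hs => norm_logSum_le c hs.2

lemma logSum_comp_sub_measurable {E : Type*} [NormedAddCommGroup E] (c : ℕ → E) (T : ℝ) :
    StronglyMeasurable fun s => logSum c (T - s) :=
  (stronglyMeasurable_logSum c).comp_measurable (measurable_const.sub measurable_id)

/-- Partial summation on a logarithmic scale. -/
lemma logSum_mul_eq {c : ℕ → ℝ} {f f' : ℝ → ℝ} (hf : ∀ s, HasDerivAt f (f' s) s)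
    (hf' : Continuous f') {t : ℝ} (ht : 0 ≤ t) :
    logSum (fun n => c n * f (Real.log n)) t =
      logSum c t * f t - ∫ s in (0 : ℝ)..t, logSum c s * f' s := by
  have h1 : ∫ s in (0 : ℝ)..t, logSum c s * f' s =
      ∑ n ∈ Ioc 0 ⌊Real.exp t⌋₊, c n * (f t - f (Real.log n)) := by
    have e1 : ∫ s in (0 : ℝ)..t, logSum c s * f' s =
        ∫ s in (0 : ℝ)..t, ∑ n ∈ Ioc 0 ⌊Real.exp t⌋₊,
          c n * (Set.Ici (Real.log n)).indicator f' s := by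
      refine integral_congr fun s hs => ?_
      rw [Set.uIcc_of_le ht] at hs
      rw [logSum_eq_sum_ite c hs.2, sum_mul]
      refine sum_congr rfl fun n _ => ?_
      by_cases h : Real.log n ≤ s <;> simp [Set.indicator, h]
    have hintegrable : ∀ (r a b : ℝ), IntervalIntegrable ((Set.Ici r).indicator f') volume a b := by
      intro r a b
      rw [intervalIntegrable_iff]
      exact ((hf'.intervalIntegrable a b).def').indicator measurableSet_Ici
    rw [e1, intervalIntegral.integral_finsetSum]
    · refine sum_congr rfl fun n hn => ?_
      obtain ⟨hn0, hnt⟩ := mem_Ioc_floor_exp.1 hn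
      have hl0 : 0 ≤ Real.log n := Real.log_natCast_nonneg n
      rw [intervalIntegral.integral_const_mul,
        ← integral_add_adjacent_intervals (hintegrable _ 0 (Real.log n)) (hintegrable _ (Real.log n) t)]
      have z1 : ∫ s in (0 : ℝ)..Real.log n, (Set.Ici (Real.log n)).indicator f' s = 0 := by
        rw [integral_of_le hl0, integral_Ioc_eq_integral_Ioo]
        refine setIntegral_eq_zero_of_forall_eq_zero fun s hs => ?_
        rw [Set.indicator_of_notMem]
        simpa using hs.2
      have z2 : ∫ s in (Real.log n)..t, (Set.Ici (Real.log n)).indicator f' s =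
          f t - f (Real.log n) := by
        rw [← integral_eq_sub_of_hasDerivAt (fun s _ => hf s) (hf'.intervalIntegrable _ _)]
        refine integral_congr fun s hs => ?_
        rw [Set.uIcc_of_le hnt] at hs
        exact Set.indicator_of_mem hs.1 _
      rw [z1, z2, zero_add]
    · intro n _
      exact (hintegrable _ 0 t).const_mul _
  rw [h1]
  simp only [logSum, sum_mul]
  rw [← sum_sub_distrib]
  exact sum_congr rfl fun n _ => by ring

/-- Integrals of exponentially decaying functions converge exponentially fast. -/
lemma exists_integral_limit {E : ℝ → ℝ} (hE : ∀ a b, 0 ≤ a → 0 ≤ b → IntervalIntegrable E volume a b)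
    {β D : ℝ} (hD : 0 < D) (hβ : 0 ≤ β) (h : ∀ s, 0 ≤ s → |E s| ≤ β * Real.exp (-s / D)) :
    ∃ I : ℝ, |I| ≤ β * D ∧
      ∀ t, 0 ≤ t → |(∫ s in (0 : ℝ)..t, E s) - I| ≤ β * D * Real.exp (-t / D) := by
  have key : ∀ a b, 0 ≤ a → a ≤ b → |(∫ s in (0 : ℝ)..b, E s) - ∫ s in (0 : ℝ)..a, E s| ≤
      β * D * Real.exp (-a / D) := by
    intro a b ha hab
    rw [integral_interval_sub_left (hE 0 b le_rfl (ha.trans hab)) (hE 0 a le_rfl ha)]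
    have hd : ∀ s, HasDerivAt (fun s => -(β * D) * Real.exp (-s / D)) (β * Real.exp (-s / D)) s := by
      intro s
      have h1 : HasDerivAt (fun s : ℝ => -s / D) (-1 / D) s := ((hasDerivAt_id s).neg).div_const D
      have h2 := (h1.exp).const_mul (-(β * D))
      exact h2.congr_deriv (by field_simp)
    have hc : Continuous fun s => β * Real.exp (-s / D) := by fun_prop
    have h1 := norm_integral_le_of_norm_le (μ := volume) (f := E) (g := fun s => β * Real.exp (-s / D)) hab
      (Filter.Eventually.of_forall fun s hs => h s (ha.trans hs.1.le)) (hc.intervalIntegrable a b)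
    rw [integral_eq_sub_of_hasDerivAt (fun s _ => hd s) (hc.intervalIntegrable a b)] at h1
    have h2 : 0 ≤ β * D * Real.exp (-b / D) := by positivity
    rw [Real.norm_eq_abs] at h1
    linarith
  have hlim : Filter.Tendsto (fun a : ℝ => β * D * Real.exp (-a / D)) Filter.atTop (nhds 0) := by
    have h1 : Filter.Tendsto (fun a : ℝ => -a / D) Filter.atTop Filter.atBot :=
      (Filter.tendsto_neg_atTop_atBot).atBot_div_const hD
    simpa using (Real.tendsto_exp_atBot.comp h1).const_mul (β * D)
  have hcau : CauchySeq fun t : ℝ => ∫ s in (0 : ℝ)..t, E s := by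
    rw [Metric.cauchySeq_iff']
    intro ε hε
    obtain ⟨N, hN⟩ := ((hlim.eventually (gt_mem_nhds hε)).and
      (Filter.eventually_ge_atTop (0 : ℝ))).exists
    refine ⟨N, fun n hn => ?_⟩
    rw [Real.dist_eq]
    exact (key N n hN.2 hn).trans_lt hN.1
  obtain ⟨I, hI⟩ := cauchySeq_tendsto_of_complete hcau
  have h2 : ∀ t, 0 ≤ t → |(∫ s in (0 : ℝ)..t, E s) - I| ≤ β * D * Real.exp (-t / D) := by
    intro t ht
    have h3 := (tendsto_const_nhds (x := ∫ s in (0 : ℝ)..t, E s)).sub hI |>.abs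
    refine le_of_tendsto h3 ?_
    filter_upwards [Filter.eventually_ge_atTop t] with b hb
    rw [abs_sub_comm]
    exact key t b ht hb
  refine ⟨I, ?_, h2⟩
  have := h2 0 le_rfl
  simpa using this

end Linnik

namespace Linnik

open Finset MeasureTheory intervalIntegral

lemma mul_exp_neg_div_le {D s : ℝ} (hD : 0 < D) :
    s * Real.exp (-s / D) ≤ 2 * D * Real.exp (-s / (2 * D)) := by
  have h1 : s / (2 * D) ≤ Real.exp (s / (2 * D)) := by linarith [Real.add_one_le_exp (s / (2 * D))]
  have h2 : s ≤ 2 * D * Real.exp (s / (2 * D)) := by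
    rw [div_le_iff₀ (by positivity)] at h1; linarith
  calc s * Real.exp (-s / D) ≤ 2 * D * Real.exp (s / (2 * D)) * Real.exp (-s / D) := by gcongr
    _ = 2 * D * Real.exp (-s / (2 * D)) := by
        rw [mul_assoc, ← Real.exp_add]; congr 2; field_simp; ring

lemma sq_mul_exp_neg_div_le {D s : ℝ} (hD : 0 < D) (hs : 0 ≤ s) :
    s ^ 2 * Real.exp (-s / D) ≤ 16 * D ^ 2 * Real.exp (-s / (2 * D)) := by
  have h1 := mul_exp_neg_div_le (s := s) (D := 2 * D) (by positivity)
  have h2 : Real.exp (-s / D) = Real.exp (-s / (2 * D)) ^ 2 := by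
    rw [← Real.exp_nat_mul]; congr 1; push_cast; field_simp
  have h3 : Real.exp (-s / (2 * (2 * D))) ^ 2 = Real.exp (-s / (2 * D)) := by
    rw [← Real.exp_nat_mul]; congr 1; push_cast; field_simp
  have h4 : 0 ≤ s * Real.exp (-s / (2 * D)) := by positivity
  calc s ^ 2 * Real.exp (-s / D) = (s * Real.exp (-s / (2 * D))) ^ 2 := by rw [h2]; ring
    _ ≤ (2 * (2 * D) * Real.exp (-s / (2 * (2 * D)))) ^ 2 := by gcongr
    _ = 16 * D ^ 2 * Real.exp (-s / (2 * (2 * D))) ^ 2 := by ring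
    _ = _ := by rw [h3]

lemma exp_neg_div_le_exp_neg_div_two {D t : ℝ} (hD : 0 < D) (ht : 0 ≤ t) :
    Real.exp (-t / D) ≤ Real.exp (-t / (2 * D)) := by
  rw [Real.exp_le_exp, div_le_div_iff₀ hD (by positivity)]
  nlinarith [mul_nonneg ht hD.le]

section LogWeights

variable {c : ℕ → ℝ} {v c₀ β D : ℝ}

lemma exists_logSum_mul_log (hD : 0 < D) (hβ : 0 ≤ β)
    (h : ∀ t, 0 ≤ t → |logSum c t - (v * t + c₀)| ≤ β * Real.exp (-t / D)) :
    ∃ d : ℝ, |d| ≤ β * D ∧ ∀ t, 0 ≤ t →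
      |logSum (fun n => c n * Real.log n) t - (v * t ^ 2 / 2 + d)| ≤
        3 * β * D * Real.exp (-t / (2 * D)) := by
  set E : ℝ → ℝ := fun s => logSum c s - (v * s + c₀) with hE
  have hEi : ∀ a b, IntervalIntegrable E volume a b := fun a b =>
    (intervalIntegrable_logSum c a b).sub (by apply Continuous.intervalIntegrable; fun_prop)
  obtain ⟨I, hI, hI'⟩ := exists_integral_limit (fun a b _ _ => hEi a b) hD hβ h
  refine ⟨-I, by rwa [abs_neg], fun t ht => ?_⟩
  have h1 := logSum_mul_eq (c := c) (f := id) (f' := fun _ => 1) (fun s => hasDerivAt_id s)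
    continuous_const ht
  simp only [id, mul_one] at h1
  have h2 : ∫ s in (0 : ℝ)..t, logSum c s = (∫ s in (0 : ℝ)..t, E s) + (v * t ^ 2 / 2 + c₀ * t) := by
    have e : ∀ s, logSum c s = E s + (v * s + c₀) := fun s => by simp [hE]
    simp_rw [e]
    rw [intervalIntegral.integral_add (hEi 0 t) (by apply Continuous.intervalIntegrable; fun_prop),
      intervalIntegral.integral_add (by apply Continuous.intervalIntegrable; fun_prop) (by simp),
      intervalIntegral.integral_const_mul, integral_id, intervalIntegral.integral_const]
    simp; ring
  have h3 : logSum (fun n => c n * Real.log n) t - (v * t ^ 2 / 2 + -I) =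
      t * E t - ((∫ s in (0 : ℝ)..t, E s) - I) := by
    rw [h1, h2]; simp only [hE]; ring
  rw [h3]
  calc _ ≤ |t * E t| + |(∫ s in (0 : ℝ)..t, E s) - I| := abs_sub _ _
    _ ≤ t * (β * Real.exp (-t / D)) + β * D * Real.exp (-t / D) := by
        rw [abs_mul, abs_of_nonneg ht]
        have := h t ht
        have := hI' t ht
        gcongr
    _ = β * (t * Real.exp (-t / D)) + β * D * Real.exp (-t / D) := by ring
    _ ≤ β * (2 * D * Real.exp (-t / (2 * D))) + β * D * Real.exp (-t / (2 * D)) := by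
        have := mul_exp_neg_div_le (s := t) hD
        have := exp_neg_div_le_exp_neg_div_two hD ht
        gcongr
    _ = _ := by ring

lemma exists_logSum_mul_log_sq (hD : 0 < D) (hβ : 0 ≤ β)
    (h : ∀ t, 0 ≤ t → |logSum c t - (v * t + c₀)| ≤ β * Real.exp (-t / D)) :
    ∃ k : ℝ, |k| ≤ 8 * β * D ^ 2 ∧ ∀ t, 0 ≤ t →
      |logSum (fun n => c n * Real.log n ^ 2) t - (v * t ^ 3 / 3 + k)| ≤
        24 * β * D ^ 2 * Real.exp (-t / (2 * D)) := by
  set E : ℝ → ℝ := fun s => logSum c s - (v * s + c₀) with hE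
  have hEi : ∀ a b, IntervalIntegrable E volume a b := fun a b =>
    (intervalIntegrable_logSum c a b).sub (by apply Continuous.intervalIntegrable; fun_prop)
  have hsE : ∀ a b, IntervalIntegrable (fun s => E s * (2 * s)) volume a b := fun a b =>
    (hEi a b).mul_continuousOn (by fun_prop)
  obtain ⟨I, hI, hI'⟩ := exists_integral_limit (E := fun s => E s * (2 * s)) (β := 4 * β * D)
    (D := 2 * D) (fun a b _ _ => hsE a b) (by positivity) (by positivity) (fun s hs => by
      rw [abs_mul, abs_of_nonneg (show 0 ≤ 2 * s by positivity)]
      calc |E s| * (2 * s) ≤ β * Real.exp (-s / D) * (2 * s) := by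
            have := h s hs; gcongr
        _ = 2 * β * (s * Real.exp (-s / D)) := by ring
        _ ≤ 2 * β * (2 * D * Real.exp (-s / (2 * D))) := by
            have := mul_exp_neg_div_le (s := s) hD; gcongr
        _ = _ := by ring)
  refine ⟨-I, by rw [abs_neg]; linarith, fun t ht => ?_⟩
  have h1 := logSum_mul_eq (c := c) (f := fun s => s ^ 2) (f' := fun s => 2 * s)
    (fun s => by simpa using hasDerivAt_pow 2 s) (by fun_prop) ht
  have h2 : ∫ s in (0 : ℝ)..t, logSum c s * (2 * s) =
      (∫ s in (0 : ℝ)..t, E s * (2 * s)) + (2 * v * t ^ 3 / 3 + c₀ * t ^ 2) := by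
    have e : ∀ s, logSum c s * (2 * s) = E s * (2 * s) + (2 * v * s ^ 2 + 2 * c₀ * s) :=
      fun s => by simp only [hE]; ring
    simp_rw [e]
    rw [intervalIntegral.integral_add (hsE 0 t) (by apply Continuous.intervalIntegrable; fun_prop),
      intervalIntegral.integral_add (by apply Continuous.intervalIntegrable; fun_prop)
        (by apply Continuous.intervalIntegrable; fun_prop),
      intervalIntegral.integral_const_mul, intervalIntegral.integral_const_mul, integral_id,
      integral_pow]
    norm_num; ring
  have h3 : logSum (fun n => c n * Real.log n ^ 2) t - (v * t ^ 3 / 3 + -I) =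
      t ^ 2 * E t - ((∫ s in (0 : ℝ)..t, E s * (2 * s)) - I) := by
    rw [h1, h2]; simp only [hE]; ring
  rw [h3]
  calc _ ≤ |t ^ 2 * E t| + |(∫ s in (0 : ℝ)..t, E s * (2 * s)) - I| := abs_sub _ _
    _ ≤ t ^ 2 * (β * Real.exp (-t / D)) + 4 * β * D * (2 * D) * Real.exp (-t / (2 * D)) := by
        rw [abs_mul, abs_of_nonneg (sq_nonneg t)]
        have := h t ht
        have := hI' t ht
        gcongr
    _ = β * (t ^ 2 * Real.exp (-t / D)) + 8 * β * D ^ 2 * Real.exp (-t / (2 * D)) := by ring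
    _ ≤ β * (16 * D ^ 2 * Real.exp (-t / (2 * D))) + 8 * β * D ^ 2 * Real.exp (-t / (2 * D)) := by
        have := sq_mul_exp_neg_div_le (s := t) hD ht
        gcongr
    _ = _ := by ring

end LogWeights

/-- Exponentially localised sums of a sequence of bounded density. -/
lemma logSum_mul_exp_le {a : ℕ → ℝ} {α β D t : ℝ} (hD : 0 < D) (hα : 0 ≤ α) (hβ : 0 ≤ β)
    (h0 : logSum a t ≤ α * t + β)
    (h : ∀ s, 0 ≤ s → s ≤ t → logSum a t - logSum a s ≤ α * (t - s) + β) (ht : 0 ≤ t) :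
    logSum (fun n => a n * Real.exp (-(t - Real.log n) / D)) t ≤ 2 * α * D + 2 * β := by
  have hd : ∀ s, HasDerivAt (fun s => Real.exp (-(t - s) / D)) (Real.exp (-(t - s) / D) / D) s := by
    intro s
    have h1 : HasDerivAt (fun s : ℝ => -(t - s) / D) (1 / D) s := by
      have := (((hasDerivAt_id s).const_sub t).neg).div_const D
      simpa using this
    exact h1.exp.congr_deriv (by ring)
  have hc : Continuous fun s => Real.exp (-(t - s) / D) / D := by fun_prop
  rw [logSum_mul_eq hd hc ht]
  have hintegrable : IntervalIntegrable (fun s => logSum a s * (Real.exp (-(t - s) / D) / D)) volume 0 t :=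
    (intervalIntegrable_logSum a 0 t).mul_continuousOn hc.continuousOn
  have e1 : ∫ s in (0 : ℝ)..t, Real.exp (-(t - s) / D) / D = 1 - Real.exp (-t / D) := by
    rw [integral_eq_sub_of_hasDerivAt (fun s _ => hd s) (hc.intervalIntegrable _ _)]
    simp
  have hd2 : ∀ s, HasDerivAt (fun s => (t - s + D) * Real.exp (-(t - s) / D))
      ((t - s) * (Real.exp (-(t - s) / D) / D)) s := by
    intro s
    have h1 : HasDerivAt (fun s : ℝ => t - s + D) (-1) s := by
      have := ((hasDerivAt_id s).const_sub t).add_const D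
      simpa using this
    exact (h1.mul (hd s)).congr_deriv (by field_simp; ring)
  have hc2 : Continuous fun s => (t - s) * (Real.exp (-(t - s) / D) / D) := by fun_prop
  have e2 : ∫ s in (0 : ℝ)..t, (t - s) * (Real.exp (-(t - s) / D) / D) =
      D - (t + D) * Real.exp (-t / D) := by
    rw [integral_eq_sub_of_hasDerivAt (fun s _ => hd2 s) (hc2.intervalIntegrable _ _)]
    simp
  have hmono : ∫ s in (0 : ℝ)..t, (logSum a t - (α * (t - s) + β)) * (Real.exp (-(t - s) / D) / D) ≤
      ∫ s in (0 : ℝ)..t, logSum a s * (Real.exp (-(t - s) / D) / D) := by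
    refine integral_mono_on ht (by apply Continuous.intervalIntegrable; fun_prop) hintegrable
      fun s hs => ?_
    have := h s hs.1 hs.2
    gcongr
    linarith
  have e3 : ∫ s in (0 : ℝ)..t, (logSum a t - (α * (t - s) + β)) * (Real.exp (-(t - s) / D) / D) =
      (logSum a t - β) * (1 - Real.exp (-t / D)) - α * (D - (t + D) * Real.exp (-t / D)) := by
    rw [← e1, ← e2, ← intervalIntegral.integral_const_mul, ← intervalIntegral.integral_const_mul,
      ← intervalIntegral.integral_sub (by apply Continuous.intervalIntegrable; fun_prop)
        (by apply Continuous.intervalIntegrable; fun_prop)]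
    exact integral_congr fun s _ => by ring
  rw [e3] at hmono
  simp only [sub_self, neg_zero, zero_div, Real.exp_zero, mul_one]
  have hexp0 : 0 < Real.exp (-t / D) := Real.exp_pos _
  have hexp1 : Real.exp (-t / D) ≤ 1 := Real.exp_le_one_iff.2 (by
    rw [neg_div]; linarith [div_nonneg ht hD.le])
  have h5 := mul_le_mul_of_nonneg_right h0 hexp0.le
  nlinarith [mul_nonneg hα hD.le, mul_nonneg (mul_nonneg hα hD.le) hexp0.le,
    mul_nonneg hβ hexp0.le, mul_nonneg (mul_nonneg hα ht) hexp0.le]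

/-- Dirichlet convolution. -/
def dconv {R : Type*} [NonUnitalNonAssocSemiring R] (f g : ℕ → R) (n : ℕ) : R :=
  ∑ x ∈ n.divisorsAntidiagonal, f x.1 * g x.2

lemma logSum_sum_divisorsAntidiagonal {R : Type*} [AddCommMonoid R] (F : ℕ → ℕ → R) {t T : ℝ}
    (h : t ≤ T) :
    logSum (fun n => ∑ x ∈ n.divisorsAntidiagonal, F x.1 x.2) t =
      ∑ m ∈ Ioc 0 ⌊Real.exp T⌋₊, logSum (F m) (t - Real.log m) := by
  simp only [logSum]
  rw [sum_sigma', sum_sigma']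
  symm
  refine sum_bij' (fun x _ => ⟨x.1 * x.2, (x.1, x.2)⟩) (fun x _ => ⟨x.2.1, x.2.2⟩) ?_ ?_ ?_ ?_ ?_
  · rintro ⟨m, k⟩ hx
    simp only [mem_sigma, mem_Ioc_floor_exp, Nat.mem_divisorsAntidiagonal] at hx ⊢
    obtain ⟨⟨hm, -⟩, hk, hl⟩ := hx
    refine ⟨⟨Nat.mul_pos hm hk, ?_⟩, by simp, (Nat.mul_pos hm hk).ne'⟩
    push_cast
    rw [Real.log_mul (by positivity) (by positivity)]
    linarith
  · rintro ⟨N, m, k⟩ hx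
    simp only [mem_sigma, mem_Ioc_floor_exp, Nat.mem_divisorsAntidiagonal] at hx ⊢
    obtain ⟨⟨hN, hl⟩, rfl, -⟩ := hx
    have hm := Nat.pos_of_mul_pos_right hN
    have hk := Nat.pos_of_mul_pos_left hN
    have h2 : 0 ≤ Real.log k := Real.log_natCast_nonneg k
    push_cast at hl
    rw [Real.log_mul (by positivity) (by positivity)] at hl
    exact ⟨⟨hm, by linarith⟩, hk, by linarith⟩
  · rintro ⟨m, k⟩ hx; rfl
  · rintro ⟨N, m, k⟩ hx
    simp only [mem_sigma, Nat.mem_divisorsAntidiagonal] at hx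
    obtain ⟨-, rfl, -⟩ := hx
    rfl
  · rintro ⟨m, k⟩ hx; rfl

lemma logSum_dconv {R : Type*} [NonUnitalNonAssocSemiring R] (f g : ℕ → R) {t T : ℝ} (h : t ≤ T) :
    logSum (dconv f g) t = ∑ m ∈ Ioc 0 ⌊Real.exp T⌋₊, f m * logSum g (t - Real.log m) := by
  simp only [logSum, mul_sum]
  exact logSum_sum_divisorsAntidiagonal (fun m k => f m * g k) h

/-- The integral of a convolution of summatory functions. -/
lemma integral_logSum_mul_logSum (f g : ℕ → ℂ) {T : ℝ} (hT : 0 ≤ T) :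
    ∫ s in (0 : ℝ)..T, logSum f s * logSum g (T - s) =
      ∫ s in (0 : ℝ)..T, logSum (dconv f g) s := by
  set N := ⌊Real.exp T⌋₊ with hN
  have hgi : ∀ a b : ℝ, IntervalIntegrable (logSum g) volume a b := intervalIntegrable_logSum g
  have hind : ∀ r a b : ℝ, IntervalIntegrable
      ((Set.Ici r).indicator fun s => logSum g (T - s)) volume a b := by
    intro r a b
    have h1 : IntervalIntegrable (fun s => logSum g (T - s)) volume a b := by
      simpa using (hgi (T - a) (T - b)).comp_sub_left T
    rw [intervalIntegrable_iff] at h1 ⊢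
    exact h1.indicator measurableSet_Ici
  have e1 : ∫ s in (0 : ℝ)..T, logSum f s * logSum g (T - s) =
      ∑ m ∈ Ioc 0 N, f m * ∫ s in (0 : ℝ)..(T - Real.log m), logSum g s := by
    have e2 : ∫ s in (0 : ℝ)..T, logSum f s * logSum g (T - s) =
        ∫ s in (0 : ℝ)..T, ∑ m ∈ Ioc 0 N,
          f m * (Set.Ici (Real.log m)).indicator (fun s => logSum g (T - s)) s := by
      refine integral_congr fun s hs => ?_
      rw [Set.uIcc_of_le hT] at hs
      rw [logSum_eq_sum_ite f hs.2, sum_mul]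
      refine sum_congr rfl fun n _ => ?_
      by_cases h : Real.log n ≤ s <;> simp [Set.indicator, h]
    rw [e2, intervalIntegral.integral_finsetSum fun m _ => (hind _ 0 T).const_mul _]
    refine sum_congr rfl fun m hm => ?_
    obtain ⟨hm0, hmT⟩ := mem_Ioc_floor_exp.1 hm
    have hl0 : 0 ≤ Real.log m := Real.log_natCast_nonneg m
    rw [intervalIntegral.integral_const_mul,
      ← integral_add_adjacent_intervals (hind _ 0 (Real.log m)) (hind _ (Real.log m) T)]
    have z1 : ∫ s in (0 : ℝ)..Real.log m,
        (Set.Ici (Real.log m)).indicator (fun s => logSum g (T - s)) s = 0 := by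
      rw [integral_of_le hl0, integral_Ioc_eq_integral_Ioo]
      refine setIntegral_eq_zero_of_forall_eq_zero fun s hs => ?_
      rw [Set.indicator_of_notMem]
      simpa using hs.2
    have z2 : ∫ s in (Real.log m)..T,
        (Set.Ici (Real.log m)).indicator (fun s => logSum g (T - s)) s =
        ∫ s in (Real.log m)..T, logSum g (T - s) := by
      refine integral_congr fun s hs => ?_
      rw [Set.uIcc_of_le hmT] at hs
      exact Set.indicator_of_mem (show s ∈ Set.Ici (Real.log m) from hs.1) _
    rw [z1, z2, zero_add, integral_comp_sub_left (fun s => logSum g s), sub_self]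
  have e3 : ∫ s in (0 : ℝ)..T, logSum (dconv f g) s =
      ∑ m ∈ Ioc 0 N, f m * ∫ s in (0 : ℝ)..(T - Real.log m), logSum g s := by
    have e4 : ∫ s in (0 : ℝ)..T, logSum (dconv f g) s =
        ∫ s in (0 : ℝ)..T, ∑ m ∈ Ioc 0 N, f m * logSum g (s - Real.log m) := by
      refine integral_congr fun s hs => ?_
      rw [Set.uIcc_of_le hT] at hs
      exact logSum_dconv f g hs.2
    rw [e4, intervalIntegral.integral_finsetSum fun m _ => by
      have := (hgi (0 - Real.log m) (T - Real.log m)).comp_sub_right (Real.log m)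
      simp only [sub_add_cancel] at this
      exact this.const_mul _]
    refine sum_congr rfl fun m hm => ?_
    rw [intervalIntegral.integral_const_mul, integral_comp_sub_right (fun s => logSum g s),
      ← integral_add_adjacent_intervals (hgi (0 - Real.log m) 0) (hgi 0 (T - Real.log m))]
    have hl0 : 0 ≤ Real.log m := Real.log_natCast_nonneg m
    have z1 : ∫ s in (0 - Real.log m)..0, logSum g s = 0 := by
      rw [integral_of_le (by linarith), integral_Ioc_eq_integral_Ioo]
      exact setIntegral_eq_zero_of_forall_eq_zero fun s hs => logSum_of_neg g hs.2
    rw [z1, zero_add]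
  rw [e1, e3]

end Linnik

namespace Linnik

open Finset MeasureTheory intervalIntegral
open scoped ArithmeticFunction.vonMangoldt ArithmeticFunction.Moebius ArithmeticFunction.zeta

/-- The reduced residue of `n` modulo `q`, with value `1` when `n` is not coprime to `q`. -/
noncomputable def residue (q n : ℕ) : (ZMod q)ˣ :=
  if h : n.Coprime q then ZMod.unitOfCoprime n h else 1

lemma coe_residue {q n : ℕ} (h : n.Coprime q) : ((residue q n : (ZMod q)ˣ) : ZMod q) = n := by
  rw [residue, dif_pos h, ZMod.coe_unitOfCoprime]

lemma residue_one (q : ℕ) : residue q 1 = 1 := by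
  ext; rw [coe_residue (Nat.coprime_one_left q)]; simp

lemma residue_mul {q m n : ℕ} (hm : m.Coprime q) (hn : n.Coprime q) :
    residue q (m * n) = residue q m * residue q n := by
  ext
  rw [Units.val_mul, coe_residue hm, coe_residue hn, coe_residue (hm.mul_left hn)]
  push_cast; rfl

/-- The weight `f n / n` restricted to rough numbers. -/
noncomputable def wt (Z : ℕ) (f : ℕ → ℝ) (n : ℕ) : ℝ := if Rough Z n then f n / n else 0

/-- The weight `f n / n` restricted to rough numbers in a reduced residue class. -/
noncomputable def cls (q Z : ℕ) (f : ℕ → ℝ) (b : (ZMod q)ˣ) (n : ℕ) : ℝ :=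
  if residue q n = b then wt Z f n else 0

/-- The sum of `f n / n` over rough `n ≤ exp t` in a reduced residue class. -/
noncomputable def classSum (q Z : ℕ) (f : ℕ → ℝ) (b : (ZMod q)ˣ) (t : ℝ) : ℝ :=
  logSum (cls q Z f b) t

/-- The sum of `f n / n` over rough `n ≤ exp t`. -/
noncomputable def totalSum (Z : ℕ) (f : ℕ → ℝ) (t : ℝ) : ℝ := logSum (wt Z f) t

lemma sum_cls (q Z : ℕ) [NeZero q] (f : ℕ → ℝ) (n : ℕ) : ∑ b, cls q Z f b n = wt Z f n := by
  simp [cls]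

lemma sum_classSum (q Z : ℕ) [NeZero q] (f : ℕ → ℝ) (t : ℝ) :
    ∑ b, classSum q Z f b t = totalSum Z f t := by
  simp only [classSum, totalSum, logSum]
  rw [sum_comm]
  exact sum_congr rfl fun n _ => sum_cls q Z f n

lemma abs_wt_le {Z : ℕ} {f g : ℕ → ℝ} (h : ∀ n, |f n| ≤ g n) (n : ℕ) : |wt Z f n| ≤ wt Z g n := by
  unfold wt
  split_ifs
  · rw [abs_div, Nat.abs_cast]; exact div_le_div_of_nonneg_right (h n) (Nat.cast_nonneg n)
  · simp

lemma wt_nonneg {Z : ℕ} {f : ℕ → ℝ} (h : ∀ n, 0 ≤ f n) (n : ℕ) : 0 ≤ wt Z f n := by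
  unfold wt
  split_ifs
  · exact div_nonneg (h n) (Nat.cast_nonneg n)
  · exact le_rfl

lemma cls_nonneg {q Z : ℕ} {f : ℕ → ℝ} (h : ∀ n, 0 ≤ f n) (b : (ZMod q)ˣ) (n : ℕ) :
    0 ≤ cls q Z f b n := by
  unfold cls
  split_ifs
  · exact wt_nonneg h n
  · exact le_rfl

lemma wt_congr {Z : ℕ} {f g : ℕ → ℝ} (h : ∀ n, n ≠ 0 → f n = g n) : wt Z f = wt Z g := by
  ext n
  by_cases hn : Rough Z n
  · simp [wt, hn, h n hn.1]
  · simp [wt, hn]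

lemma cls_congr {q Z : ℕ} {f g : ℕ → ℝ} (h : ∀ n, n ≠ 0 → f n = g n) (b : (ZMod q)ˣ) :
    cls q Z f b = cls q Z g b := by
  ext n; simp only [cls, wt_congr h]

lemma wt_mul_wt (Z : ℕ) (f g : ℕ → ℝ) {n : ℕ} {x : ℕ × ℕ} (hx : x ∈ n.divisorsAntidiagonal) :
    wt Z f x.1 * wt Z g x.2 = if Rough Z n then f x.1 * g x.2 / n else 0 := by
  obtain ⟨rfl, -⟩ := Nat.mem_divisorsAntidiagonal.1 hx
  simp only [wt, rough_mul]
  by_cases h1 : Rough Z x.1 <;> by_cases h2 : Rough Z x.2 <;> simp [h1, h2]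
  ring

lemma wt_dconv (Z : ℕ) (f g : ℕ → ℝ) : wt Z (dconv f g) = dconv (wt Z f) (wt Z g) := by
  ext n
  rw [dconv, sum_congr rfl fun x hx => wt_mul_wt Z f g hx]
  by_cases h : Rough Z n <;> simp [wt, h, dconv, sum_div]

lemma cls_dconv {q Z : ℕ} (hq0 : q ≠ 0) (hqZ : q ≤ Z) (f g : ℕ → ℝ) (b : (ZMod q)ˣ) (n : ℕ) :
    cls q Z (dconv f g) b n =
      ∑ x ∈ n.divisorsAntidiagonal, wt Z f x.1 * cls q Z g (b * (residue q x.1)⁻¹) x.2 := by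
  have e : ∀ x ∈ n.divisorsAntidiagonal, wt Z f x.1 * cls q Z g (b * (residue q x.1)⁻¹) x.2 =
      if residue q n = b then wt Z f x.1 * wt Z g x.2 else 0 := by
    intro x hx
    obtain ⟨rfl, -⟩ := Nat.mem_divisorsAntidiagonal.1 hx
    by_cases h1 : Rough Z x.1
    · by_cases h2 : Rough Z x.2
      · rw [residue_mul (h1.coprime hq0 hqZ) (h2.coprime hq0 hqZ), cls]
        simp only [eq_mul_inv_iff_mul_eq, mul_comm (residue q x.2), mul_ite, mul_zero]
      · simp [cls, wt, h2]
    · simp [wt, h1]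
  rw [sum_congr rfl e, cls, wt_dconv, dconv]
  split_ifs <;> simp

lemma classSum_dconv {q Z : ℕ} (hq0 : q ≠ 0) (hqZ : q ≤ Z) (f g : ℕ → ℝ) (b : (ZMod q)ˣ)
    {t T : ℝ} (h : t ≤ T) :
    classSum q Z (dconv f g) b t = ∑ m ∈ Ioc 0 ⌊Real.exp T⌋₊,
      wt Z f m * classSum q Z g (b * (residue q m)⁻¹) (t - Real.log m) := by
  have e : cls q Z (dconv f g) b = fun n => ∑ x ∈ n.divisorsAntidiagonal,
      wt Z f x.1 * cls q Z g (b * (residue q x.1)⁻¹) x.2 := funext (cls_dconv hq0 hqZ f g b)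
  rw [classSum, e, logSum_sum_divisorsAntidiagonal
    (fun m k => wt Z f m * cls q Z g (b * (residue q m)⁻¹) k) h]
  simp only [classSum, logSum, mul_sum]

lemma totalSum_dconv (Z : ℕ) (f g : ℕ → ℝ) {t T : ℝ} (h : t ≤ T) :
    totalSum Z (dconv f g) t =
      ∑ m ∈ Ioc 0 ⌊Real.exp T⌋₊, wt Z f m * totalSum Z g (t - Real.log m) := by
  rw [totalSum, wt_dconv, logSum_dconv _ _ h]; rfl

section Identities

lemma dconv_vonMangoldt_one (n : ℕ) :
    Real.log n = dconv (fun n => Λ n) (fun _ => 1) n := by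
  rw [dconv, ← ArithmeticFunction.vonMangoldt_sum, Nat.sum_divisorsAntidiagonal (fun a _ => Λ a * 1)]
  simp

lemma dconv_moebius_log (n : ℕ) :
    Λ n = dconv (fun n => (μ n : ℝ)) (fun n => Real.log n) n := by
  have h := congrArg (fun f : ArithmeticFunction ℝ => f n) ArithmeticFunction.moebius_mul_log_eq_vonMangoldt
  simp only [ArithmeticFunction.mul_apply] at h
  rw [← h]
  simp [dconv, ArithmeticFunction.log]

lemma dconv_moebius_one (n : ℕ) :
    (if n = 1 then (1 : ℝ) else 0) = dconv (fun n => (μ n : ℝ)) (fun _ => 1) n := by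
  have h := congrArg (fun f : ArithmeticFunction ℝ => f n)
    (ArithmeticFunction.coe_moebius_mul_coe_zeta (R := ℝ))
  simp only [ArithmeticFunction.mul_apply, ArithmeticFunction.one_apply] at h
  rw [← h, dconv]
  refine sum_congr rfl fun x hx => ?_
  have := (Nat.ne_zero_of_mem_divisorsAntidiagonal hx).2
  simp [ArithmeticFunction.zeta_apply, this]

lemma dconv_moebius_log_sq (n : ℕ) :
    Λ n * Real.log n + dconv (fun n => Λ n) (fun n => Λ n) n =
      dconv (fun n => (μ n : ℝ)) (fun n => Real.log n ^ 2) n := by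
  have h1 : ArithmeticFunction.pmul ArithmeticFunction.log ArithmeticFunction.log =
      ((ζ : ArithmeticFunction ℝ)) * (ArithmeticFunction.pmul (Λ : ArithmeticFunction ℝ) ArithmeticFunction.log + Λ * Λ) := by
    have h2 : ArithmeticFunction.pmul ArithmeticFunction.log ArithmeticFunction.log =
        ArithmeticFunction.pmul (Λ : ArithmeticFunction ℝ) ArithmeticFunction.log * (ζ : ArithmeticFunction ℝ) + Λ * ArithmeticFunction.log := by
      ext m
      rw [ArithmeticFunction.pmul_apply, ArithmeticFunction.log_apply]
      nth_rewrite 1 [← ArithmeticFunction.vonMangoldt_sum]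
      rw [← Nat.sum_divisorsAntidiagonal (fun a _ => Λ a), sum_mul, ArithmeticFunction.add_apply, ArithmeticFunction.mul_apply,
        ArithmeticFunction.mul_apply, ← sum_add_distrib]
      refine sum_congr rfl fun x hx => ?_
      obtain ⟨rfl, h0⟩ := Nat.mem_divisorsAntidiagonal.1 hx
      have h3 : x.1 ≠ 0 := left_ne_zero_of_mul h0
      have h4 : x.2 ≠ 0 := right_ne_zero_of_mul h0
      push_cast
      rw [Real.log_mul (by exact_mod_cast h3) (by exact_mod_cast h4)]
      simp [ArithmeticFunction.zeta_apply, h4, ArithmeticFunction.pmul_apply, ArithmeticFunction.log_apply]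
      ring
    rw [h2, mul_add, mul_comm, ← ArithmeticFunction.vonMangoldt_mul_zeta]
    ring_nf
  have h5 := congrArg (fun f : ArithmeticFunction ℝ => ((μ : ArithmeticFunction ℝ) * f) n) h1
  simp only [← mul_assoc, ArithmeticFunction.coe_moebius_mul_coe_zeta, one_mul] at h5
  simp only [ArithmeticFunction.add_apply, ArithmeticFunction.mul_apply,
    ArithmeticFunction.pmul_apply, ArithmeticFunction.log_apply] at h5
  simp only [dconv]
  rw [← h5]
  simp [pow_two]

end Identities

end Linnik

namespace Linnik

open Finset MeasureTheory intervalIntegral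
open scoped ArithmeticFunction.vonMangoldt ArithmeticFunction.Moebius

/-- The unit of length on the logarithmic scale. -/
noncomputable def scale (Z : ℕ) : ℝ := 48 * Real.log Z

/-- Asymptotic expansions, with constant `C`, of sums over rough numbers in residue classes. -/
structure Expansion (C : ℝ) (q Z : ℕ) (c d k : (ZMod q)ˣ → ℝ) : Prop where
  q_ne_zero : q ≠ 0
  q_le : q ≤ Z
  one_le : 1 ≤ C
  one_le_scale : 1 ≤ scale Z
  density_le : roughDensity Z * scale Z ≤ C
  le_density : 1 ≤ C * (roughDensity Z * scale Z)
  count : ∀ t, 0 ≤ t → |logSum (fun n => if Rough Z n ∧ n ≠ 1 then 1 else 0) t -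
    roughDensity Z * Real.exp t| ≤ C * roughDensity Z * Real.exp t * Real.exp (-t / scale Z)
  mertens : ∀ t, 0 ≤ t → |totalSum Z (fun n => Λ n) t - t| ≤ C * scale Z
  abs_c : ∀ b, |c b - if b = 1 then 1 else 0| ≤ C / q.totient
  abs_d : ∀ b, |d b| ≤ C * scale Z / q.totient
  abs_k : ∀ b, |k b| ≤ C * scale Z ^ 2 / q.totient
  one : ∀ b t, 0 ≤ t →
    |classSum q Z (fun _ => 1) b t - (roughDensity Z / q.totient * t + c b)| ≤
      C / q.totient * Real.exp (-t / scale Z)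
  log : ∀ b t, 0 ≤ t →
    |classSum q Z (fun n => Real.log n) b t - (roughDensity Z / q.totient * t ^ 2 / 2 + d b)| ≤
      C * scale Z / q.totient * Real.exp (-t / scale Z)
  log_sq : ∀ b t, 0 ≤ t →
    |classSum q Z (fun n => Real.log n ^ 2) b t -
        (roughDensity Z / q.totient * t ^ 3 / 3 + k b)| ≤
      C * scale Z ^ 2 / q.totient * Real.exp (-t / scale Z)

/-- The indicator of rough numbers other than `1` in a residue class. -/
noncomputable def roughInd (q Z : ℕ) (b : (ZMod q)ˣ) (n : ℕ) : ℝ :=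
  if residue q n = b ∧ Rough Z n ∧ n ≠ 1 then 1 else 0

lemma logSum_roughInd {q Z : ℕ} (hq0 : q ≠ 0) (hqZ : q ≤ Z) (b : (ZMod q)ˣ) (t : ℝ) :
    logSum (roughInd q Z b) t = roughCount' Z (b : ZMod q) (Real.exp t) := by
  simp only [logSum, roughInd, roughCount', sum_boole, Nat.cast_inj]
  congr 1
  ext n
  simp only [mem_filter, mem_Ioc]
  constructor
  · rintro ⟨⟨h1, h2⟩, h3, h4, h5⟩
    exact ⟨⟨by lia, h2⟩, h4, by rw [← h3, coe_residue (h4.coprime hq0 hqZ)]⟩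
  · rintro ⟨⟨h1, h2⟩, h4, h5⟩
    exact ⟨⟨by lia, h2⟩, Units.ext (by rw [← h5, coe_residue (h4.coprime hq0 hqZ)]), h4, by lia⟩

lemma exists_logSum_div {a : ℕ → ℝ} {v β D : ℝ} (hD : 0 < D) (hβ : 0 ≤ β)
    (h : ∀ t, 0 ≤ t → |logSum a t - v * Real.exp t| ≤ β * Real.exp t * Real.exp (-t / D)) :
    ∃ c : ℝ, |c - v| ≤ β * D ∧ ∀ t, 0 ≤ t →
      |logSum (fun n => a n * Real.exp (-Real.log n)) t - (v * t + c)| ≤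
        β * (1 + D) * Real.exp (-t / D) := by
  set E : ℝ → ℝ := fun s => logSum a s * Real.exp (-s) - v with hE
  have hEi : ∀ x y, IntervalIntegrable E volume x y := fun x y =>
    ((intervalIntegrable_logSum a x y).mul_continuousOn (by fun_prop)).sub (by simp)
  have hEb : ∀ t, 0 ≤ t → |E t| ≤ β * Real.exp (-t / D) := by
    intro t ht
    have e : E t = (logSum a t - v * Real.exp t) * Real.exp (-t) := by
      simp only [hE]; rw [sub_mul, mul_assoc, ← Real.exp_add]; simp
    rw [e, abs_mul, Real.abs_exp]
    calc _ ≤ β * Real.exp t * Real.exp (-t / D) * Real.exp (-t) := by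
          have := h t ht; gcongr
      _ = β * Real.exp (-t / D) * (Real.exp t * Real.exp (-t)) := by ring
      _ = _ := by rw [← Real.exp_add]; simp
  obtain ⟨I, hI, hI'⟩ := exists_integral_limit (fun a b _ _ => hEi a b) hD hβ hEb
  refine ⟨v + I, by simpa using hI, fun t ht => ?_⟩
  have hd : ∀ s : ℝ, HasDerivAt (fun s => Real.exp (-s)) (-Real.exp (-s)) s := fun s => by
    simpa using (hasDerivAt_neg s).exp
  have h1 := logSum_mul_eq (c := a) hd (by fun_prop) ht
  have h2 : ∫ s in (0 : ℝ)..t, logSum a s * -Real.exp (-s) = -((∫ s in (0 : ℝ)..t, E s) + v * t) := by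
    have e : ∀ s, logSum a s * -Real.exp (-s) = -(E s + v) := fun s => by simp only [hE]; ring
    simp_rw [e]
    rw [intervalIntegral.integral_neg, intervalIntegral.integral_add (hEi 0 t) (by simp),
      intervalIntegral.integral_const]
    simp; ring
  have h3 : logSum (fun n => a n * Real.exp (-Real.log n)) t - (v * t + (v + I)) =
      E t + ((∫ s in (0 : ℝ)..t, E s) - I) := by
    rw [h1, h2]; simp only [hE]; ring
  rw [h3]
  refine (abs_add_le _ _).trans ?_
  have := hEb t ht
  have := hI' t ht
  nlinarith

lemma sum_roughInd (q Z : ℕ) [NeZero q] (n : ℕ) :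
    ∑ b, roughInd q Z b n = if Rough Z n ∧ n ≠ 1 then 1 else 0 := by
  simp only [roughInd, ite_and]
  simp

lemma logSum_ite_eq_one {t x : ℝ} (ht : 0 ≤ t) :
    logSum (fun n => if n = 1 then x else 0) t = x := by
  rw [logSum, sum_ite_eq', if_pos]
  rw [mem_Ioc_floor_exp]
  simpa using ht

lemma exp_neg_log_eq {Z n : ℕ} (h : Rough Z n) : Real.exp (-Real.log n) = 1 / n := by
  have : (0 : ℝ) < n := by exact_mod_cast Nat.pos_of_ne_zero h.1
  rw [Real.exp_neg, Real.exp_log this, one_div]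

theorem exists_expansion : ∃ C : ℝ, ∀ q Z : ℕ, q ≠ 0 → 2 ^ 16 ≤ Z → q ^ 4 ≤ Z →
    ∃ c d k : (ZMod q)ˣ → ℝ, Expansion C q Z c d k := by
  have hU := upperConst_pos
  have hK : 0 < countConst := by
    have := flConst_pos
    unfold countConst; positivity
  set K := countConst with hKdef
  refine ⟨1200 * (K + 1) + 4 * upperConst, fun q Z hq0 hZ hqZ4 => ?_⟩
  set C := 1200 * (K + 1) + 4 * upperConst with hC
  have : NeZero q := ⟨hq0⟩
  have hqZ : q ≤ Z := (Nat.le_self_pow (by norm_num) q).trans hqZ4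
  set V := roughDensity Z with hV
  have hVpos : 0 < V := roughDensity_pos Z
  set φ : ℝ := (q.totient : ℝ) with hφ
  have hφ1 : 1 ≤ φ := by
    rw [hφ]; exact_mod_cast Nat.totient_pos.2 (Nat.pos_of_ne_zero hq0)
  have hφ0 : 0 < φ := by linarith
  have hlog : 1 ≤ Real.log Z := by
    rw [Real.le_log_iff_exp_le (by positivity)]
    have h1 : (65536 : ℝ) ≤ Z := by exact_mod_cast hZ
    have := Real.exp_one_lt_d9
    linarith
  set D₀ := 24 * Real.log Z with hD₀
  have hDD : scale Z = 2 * D₀ := by rw [scale, hD₀]; ring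
  have hD1 : 24 ≤ D₀ := by rw [hD₀]; linarith
  have hD0 : 0 < D₀ := by linarith
  have hVD : V * D₀ ≤ 24 := by
    have := roughDensity_mul_log_le Z
    rw [hD₀]; linarith
  have hV1 : V ≤ 24 := by nlinarith
  have hcount : ∀ b t, 0 ≤ t → |logSum (roughInd q Z b) t - V / φ * Real.exp t| ≤
      (K * (V / φ)) * Real.exp t * Real.exp (-t / D₀) := by
    intro b t ht
    have := abs_roughCount'_sub_le hZ hqZ4 b.isUnit (Real.one_le_exp ht)
    rw [logSum_roughInd hq0 hqZ, mul_comm (V / φ)]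
    rw [Real.log_exp] at this
    refine this.trans (le_of_eq ?_)
    rw [neg_div]; ring
  have hexp : ∀ t, 0 ≤ t → Real.exp (-t / D₀) ≤ Real.exp (-t / scale Z) := fun t ht => by
    rw [hDD]; exact exp_neg_div_le_exp_neg_div_two hD0 ht
  have hβ0 : 0 ≤ K * (V / φ) := by positivity
  choose c' hc' hc'' using fun b => exists_logSum_div hD0 hβ0 (hcount b)
  set β := K * (V / φ) * (1 + D₀) with hβ
  have hβpos : 0 ≤ β := by positivity
  have hβle : β ≤ 48 * K / φ := by
    rw [hβ, show K * (V / φ) * (1 + D₀) = K * (V + V * D₀) / φ by ring]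
    refine div_le_div_of_nonneg_right ?_ hφ0.le
    have : V + V * D₀ ≤ 48 := by linarith
    linarith [mul_le_mul_of_nonneg_left this hK.le]
  choose d hd hd' using fun b => exists_logSum_mul_log hD0 hβpos (hc'' b)
  choose k hk hk' using fun b => exists_logSum_mul_log_sq hD0 hβpos (hc'' b)
  have ecls : ∀ f : ℕ → ℝ, f 1 = 0 → ∀ b, cls q Z f b =
      fun n => roughInd q Z b n * Real.exp (-Real.log n) * f n := by
    intro f hf b
    ext n
    by_cases h1 : Rough Z n
    · by_cases h2 : n = 1
      · subst h2; simp [cls, wt, roughInd, hf]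
      · by_cases h3 : residue q n = b
        · simp [cls, wt, roughInd, h1, h2, h3, exp_neg_log_eq h1]; ring
        · simp [cls, roughInd, h3]
    · simp [cls, wt, roughInd, h1]
  have ecls1 : ∀ b, cls q Z (fun _ => 1) b = fun n =>
      roughInd q Z b n * Real.exp (-Real.log n) + if n = 1 then if b = 1 then 1 else 0 else 0 := by
    intro b
    ext n
    by_cases h1 : Rough Z n
    · by_cases h2 : n = 1
      · subst h2; simp [cls, wt, roughInd, rough_one, residue_one, eq_comm]
      · by_cases h3 : residue q n = b
        · simp [cls, wt, roughInd, h1, h2, h3, exp_neg_log_eq h1]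
        · simp [cls, roughInd, h3, h2]
    · have h2 : n ≠ 1 := by rintro rfl; exact h1 (rough_one Z)
      simp [cls, wt, roughInd, h1, h2]
  have hβ'' : 24 * β ≤ C / φ := by
    refine (mul_le_mul_of_nonneg_left hβle (by norm_num)).trans ?_
    rw [show 24 * (48 * K / φ) = (1152 * K) / φ by ring]
    refine div_le_div_of_nonneg_right ?_ hφ0.le
    rw [hC]; linarith
  have hβ' : β ≤ C / φ := by linarith
  refine ⟨fun b => c' b + if b = 1 then 1 else 0, d, k, hq0, hqZ, ?_, ?_, ?_, ?_, ?_, ?_, ?_, ?_,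
    ?_, ?_, ?_, ?_⟩
  · rw [hC]; linarith
  · rw [hDD]; linarith
  · rw [hDD, hC]; linarith
  · have h1 := one_le_roughDensity_mul_log hZ
    refine h1.trans ?_
    have h2 : 0 ≤ V * Real.log Z := by positivity
    have h3 : V * Real.log Z ≤ V * scale Z := by
      unfold scale; nlinarith
    have : 4 * upperConst ≤ C := by rw [hC]; linarith
    gcongr
  · intro t ht
    have e : logSum (fun n => if Rough Z n ∧ n ≠ 1 then (1 : ℝ) else 0) t =
        ∑ b, logSum (roughInd q Z b) t := by
      simp only [logSum]
      rw [sum_comm]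
      exact sum_congr rfl fun n _ => (sum_roughInd q Z n).symm
    have hcard : (#(univ : Finset (ZMod q)ˣ) : ℝ) = φ := by
      rw [card_univ, ZMod.card_units_eq_totient]
    have e2 : V * Real.exp t = ∑ _b : (ZMod q)ˣ, V / φ * Real.exp t := by
      rw [sum_const, nsmul_eq_mul, hcard]; field_simp
    rw [e, e2, ← sum_sub_distrib]
    calc _ ≤ ∑ b : (ZMod q)ˣ, |logSum (roughInd q Z b) t - V / φ * Real.exp t| :=
          abs_sum_le_sum_abs _ _
      _ ≤ ∑ _b : (ZMod q)ˣ, (K * (V / φ)) * Real.exp t * Real.exp (-t / D₀) :=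
          sum_le_sum fun b _ => hcount b t ht
      _ = K * V * Real.exp t * Real.exp (-t / D₀) := by
          rw [sum_const, nsmul_eq_mul, hcard]; field_simp
      _ ≤ _ := by
          have := hexp t ht
          gcongr
          rw [hC]; linarith
  · intro t ht
    have h1 := abs_sum_rough_vonMangoldt_div_sub_le hZ ht
    rw [sum_filter] at h1
    refine (show |totalSum Z (fun n => Λ n) t - t| ≤ 20 * Real.log Z from h1).trans ?_
    have : 1 ≤ C := by rw [hC]; linarith
    unfold scale; nlinarith
  · intro b
    simp only [add_sub_cancel_right]
    have h1 := hc' b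
    have h2 : |c' b| ≤ K * (V / φ) * D₀ + V / φ := by
      calc |c' b| = |(c' b - V / φ) + V / φ| := by rw [sub_add_cancel]
        _ ≤ |c' b - V / φ| + |V / φ| := abs_add_le _ _
        _ ≤ _ := by rw [abs_of_pos (div_pos hVpos hφ0)]; gcongr
    refine h2.trans ?_
    rw [show K * (V / φ) * D₀ + V / φ = (K * (V * D₀) + V) / φ by ring]
    gcongr
    rw [hC]; nlinarith
  · intro b
    refine (hd b).trans ?_
    rw [mul_div_right_comm, hDD]
    gcongr
    linarith
  · intro b
    refine (hk b).trans ?_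
    rw [mul_div_right_comm, hDD, mul_pow]
    have : 8 * β ≤ C / φ * 2 ^ 2 := by linarith
    nlinarith [sq_nonneg D₀]
  · intro b t ht
    have e : classSum q Z (fun _ => 1) b t =
        logSum (fun n => roughInd q Z b n * Real.exp (-Real.log n)) t + if b = 1 then 1 else 0 := by
      rw [classSum, ecls1]
      simp only [logSum, sum_add_distrib]
      congr 1
      exact logSum_ite_eq_one ht
    rw [e]
    have := hc'' b t ht
    calc _ = |logSum (fun n => roughInd q Z b n * Real.exp (-Real.log n)) t -
          (V / φ * t + c' b)| := by congr 1; ring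
      _ ≤ _ := this.trans (by have := hexp t ht; gcongr)
  · intro b t ht
    rw [classSum, ecls _ (by simp)]
    refine (hd' b t ht).trans ?_
    rw [hDD]
    gcongr
    rw [mul_div_right_comm]
    have : 3 * β ≤ C / φ * 2 := by linarith
    nlinarith
  · intro b t ht
    rw [classSum, ecls _ (by simp)]
    refine (hk' b t ht).trans ?_
    rw [hDD]
    gcongr
    rw [mul_div_right_comm, mul_pow]
    have : 24 * β ≤ C / φ * 2 ^ 2 := by linarith
    nlinarith [sq_nonneg D₀]

end Linnik

namespace Linnik

open Finset MeasureTheory intervalIntegral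
open scoped ArithmeticFunction.vonMangoldt ArithmeticFunction.Moebius

lemma sum_div_totient {q : ℕ} [NeZero q] (x : ℝ) :
    ∑ _b : (ZMod q)ˣ, x / q.totient = x := by
  have : (0 : ℝ) < q.totient := by exact_mod_cast Nat.totient_pos.2 (NeZero.pos q)
  rw [sum_const, nsmul_eq_mul, card_univ, ZMod.card_units_eq_totient]
  field_simp

namespace Expansion

variable {C : ℝ} {q Z : ℕ} {c d k : (ZMod q)ˣ → ℝ}

lemma totient_pos (h : Expansion C q Z c d k) : (0 : ℝ) < q.totient := by
  exact_mod_cast Nat.totient_pos.2 (Nat.pos_of_ne_zero h.q_ne_zero)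

lemma scale_pos (h : Expansion C q Z c d k) : 0 < scale Z := by linarith [h.one_le_scale]

lemma abs_sum_sub_le {F G : (ZMod q)ˣ → ℝ} {x : ℝ}
    [NeZero q] (hFG : ∀ b, |F b - G b| ≤ x / q.totient) : |∑ b, F b - ∑ b, G b| ≤ x := by
  rw [← sum_sub_distrib, ← sum_div_totient (q := q) x]
  exact (abs_sum_le_sum_abs _ _).trans (sum_le_sum fun b _ => hFG b)

lemma total_one (h : Expansion C q Z c d k) : ∃ c₀ : ℝ, |c₀| ≤ 2 * C ∧ ∀ t, 0 ≤ t →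
    |totalSum Z (fun _ => 1) t - (roughDensity Z * t + c₀)| ≤ C * Real.exp (-t / scale Z) := by
  have : NeZero q := ⟨h.q_ne_zero⟩
  refine ⟨∑ b, c b, ?_, fun t ht => ?_⟩
  · have h1 := abs_sum_sub_le h.abs_c
    simp only [sum_ite_eq', mem_univ, if_true] at h1
    have := h.one_le
    rw [abs_le] at h1 ⊢
    constructor <;> linarith
  · have h1 := abs_sum_sub_le (x := C * Real.exp (-t / scale Z)) fun b =>
      (h.one b t ht).trans (le_of_eq (by ring))
    rw [sum_classSum, sum_add_distrib, ← sum_mul, sum_div_totient] at h1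
    exact h1

lemma total_log (h : Expansion C q Z c d k) : ∃ d₀ : ℝ, |d₀| ≤ C * scale Z ∧ ∀ t, 0 ≤ t →
    |totalSum Z (fun n => Real.log n) t - (roughDensity Z * t ^ 2 / 2 + d₀)| ≤
      C * scale Z * Real.exp (-t / scale Z) := by
  have : NeZero q := ⟨h.q_ne_zero⟩
  refine ⟨∑ b, d b, ?_, fun t ht => ?_⟩
  · have h1 := abs_sum_sub_le (G := 0) (by simpa using h.abs_d)
    simpa using h1
  · have h1 := abs_sum_sub_le (x := C * scale Z * Real.exp (-t / scale Z)) fun b =>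
      (h.log b t ht).trans (le_of_eq (by ring))
    rw [sum_classSum, sum_add_distrib, ← sum_div, ← sum_mul, sum_div_totient] at h1
    exact h1

lemma totalSum_one_le (h : Expansion C q Z c d k) {t : ℝ} (ht : 0 ≤ t) :
    totalSum Z (fun _ => 1) t ≤ roughDensity Z * t + 3 * C := by
  obtain ⟨c₀, hc₀, hc⟩ := h.total_one
  have h1 := (abs_le.1 (hc t ht)).2
  have h2 : Real.exp (-t / scale Z) ≤ 1 := Real.exp_le_one_iff.2 (by
    rw [neg_div]; linarith [div_nonneg ht h.scale_pos.le])
  have h3 : C * Real.exp (-t / scale Z) ≤ C * 1 := by have := h.one_le; gcongr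
  linarith [(abs_le.1 hc₀).2]

lemma totalSum_one_sub_le (h : Expansion C q Z c d k) {s t : ℝ} (hs : 0 ≤ s) (hst : s ≤ t) :
    totalSum Z (fun _ => 1) t - totalSum Z (fun _ => 1) s ≤
      roughDensity Z * (t - s) + 2 * C := by
  obtain ⟨c₀, hc₀, hc⟩ := h.total_one
  have key : ∀ t, 0 ≤ t → C * Real.exp (-t / scale Z) ≤ C := fun t ht => by
    have h2 : Real.exp (-t / scale Z) ≤ 1 := Real.exp_le_one_iff.2 (by
      rw [neg_div]; linarith [div_nonneg ht h.scale_pos.le])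
    have h3 : C * Real.exp (-t / scale Z) ≤ C * 1 := by have := h.one_le; gcongr
    linarith
  have h1 := (abs_le.1 (hc t (hs.trans hst))).2
  have h2 := (abs_le.1 (hc s hs)).1
  linarith [key t (hs.trans hst), key s hs]

lemma logSum_wt_one_exp_le (h : Expansion C q Z c d k) {t : ℝ} (ht : 0 ≤ t) :
    logSum (fun n => wt Z (fun _ => 1) n * Real.exp (-(t - Real.log n) / scale Z)) t ≤ 8 * C := by
  have h0 := h.one_le
  have := logSum_mul_exp_le (a := wt Z (fun _ => 1)) (α := roughDensity Z) (β := 3 * C) h.scale_pos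
    (roughDensity_pos Z).le (by linarith) (h.totalSum_one_le ht)
    (fun s hs hst => by linarith [show logSum (wt Z fun _ => 1) t - logSum (wt Z fun _ => 1) s ≤ _
      from h.totalSum_one_sub_le hs hst]) ht
  linarith [h.density_le]

lemma logSum_wt_vonMangoldt_exp_le (h : Expansion C q Z c d k) {t : ℝ} (ht : 0 ≤ t) :
    logSum (fun n => wt Z (fun n => Λ n) n * Real.exp (-(t - Real.log n) / scale Z)) t ≤
      6 * C * scale Z := by
  have h0 := h.one_le
  have hs := h.scale_pos
  have hp : 0 ≤ C * scale Z := by positivity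
  have := logSum_mul_exp_le (a := wt Z (fun n => Λ n)) (α := 1) (β := 2 * C * scale Z) h.scale_pos
    (by norm_num) (by linarith) (by
      have := (abs_le.1 (h.mertens t ht)).2
      simp only [totalSum] at this
      linarith)
    (fun s hs hst => by
      have h1 := (abs_le.1 (h.mertens t ht)).2
      have h2 := (abs_le.1 (h.mertens s hs)).1
      simp only [totalSum] at h1 h2
      linarith) ht
  nlinarith

lemma abs_moebius_le (n : ℕ) : |(μ n : ℝ)| ≤ 1 := by
  have := ArithmeticFunction.abs_moebius_le_one (n := n)
  exact_mod_cast this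

/-- Errors decaying exponentially are harmless under convolution with a bounded sequence. -/
lemma abs_sum_wt_mul_le (h : Expansion C q Z c d k) {f : ℕ → ℝ} (hf : ∀ n, |f n| ≤ 1) {t B : ℝ}
    (ht : 0 ≤ t) (hB : 0 ≤ B) {E : ℕ → ℝ}
    (hE : ∀ m ∈ Ioc 0 ⌊Real.exp t⌋₊, |E m| ≤ B * Real.exp (-(t - Real.log m) / scale Z)) :
    |∑ m ∈ Ioc 0 ⌊Real.exp t⌋₊, wt Z f m * E m| ≤ B * (8 * C) := by
  calc _ ≤ ∑ m ∈ Ioc 0 ⌊Real.exp t⌋₊, |wt Z f m * E m| := abs_sum_le_sum_abs _ _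
    _ ≤ ∑ m ∈ Ioc 0 ⌊Real.exp t⌋₊,
        B * (wt Z (fun _ => 1) m * Real.exp (-(t - Real.log m) / scale Z)) := by
      refine sum_le_sum fun m hm => ?_
      rw [abs_mul, mul_left_comm]
      exact mul_le_mul (abs_wt_le hf m) (hE m hm) (abs_nonneg _) (wt_nonneg (by simp) m)
    _ = B * logSum (fun n => wt Z (fun _ => 1) n * Real.exp (-(t - Real.log n) / scale Z)) t := by
      rw [logSum, mul_sum]
    _ ≤ _ := by
      have := h.logSum_wt_one_exp_le ht
      gcongr

lemma abs_totalSum_le {f : ℕ → ℝ} (hf : ∀ n, |f n| ≤ 1) (t : ℝ) :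
    |totalSum Z f t| ≤ totalSum Z (fun _ => 1) t := by
  unfold totalSum logSum
  exact (abs_sum_le_sum_abs _ _).trans (sum_le_sum fun m _ => abs_wt_le hf m)

lemma abs_totalSum_moebius_le (h : Expansion C q Z c d k) {t : ℝ} (ht : 0 ≤ t) :
    |totalSum Z (fun n => (μ n : ℝ)) t| ≤ 12 * C ^ 2 := by
  have hC := h.one_le
  have hV := roughDensity_pos Z
  have hD := h.one_le_scale
  set V := roughDensity Z
  set D := scale Z
  rcases lt_or_ge t D with htD | htD
  · calc _ ≤ totalSum Z (fun _ => 1) t := abs_totalSum_le abs_moebius_le t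
      _ ≤ V * t + 3 * C := h.totalSum_one_le ht
      _ ≤ V * D + 3 * C := by gcongr
      _ ≤ 12 * C ^ 2 := by nlinarith [h.density_le]
  set N : ℝ → ℝ := logSum (fun n => if Rough Z n then (1 : ℝ) else 0) with hN
  have eN : ∀ s, 0 ≤ s → N s = 1 + logSum (fun n => if Rough Z n ∧ n ≠ 1 then (1 : ℝ) else 0) s := by
    intro s hs
    rw [hN]
    refine Eq.trans ?_ (congrArg (· + _) (logSum_ite_eq_one (x := (1 : ℝ)) hs))
    simp only [logSum]
    rw [← sum_add_distrib]
    refine sum_congr rfl fun n _ => ?_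
    by_cases h2 : n = 1
    · subst h2; simp [rough_one]
    · simp [h2]
  have hNb : ∀ s, 0 ≤ s → |N s - V * Real.exp s| ≤ 1 + C * V * Real.exp s * Real.exp (-s / D) := by
    intro s hs
    rw [eN s hs, add_sub_assoc]
    refine (abs_add_le _ _).trans ?_
    rw [abs_one]
    linarith [h.count s hs]
  have ewt : wt Z (fun n => (n : ℝ)) = fun n => if Rough Z n then (1 : ℝ) else 0 := by
    ext n
    by_cases h1 : Rough Z n
    · have : (n : ℝ) ≠ 0 := by exact_mod_cast h1.1
      simp [wt, h1, this]
    · simp [wt, h1]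
  have econv : dconv (fun n => (n : ℝ) * μ n) (fun n => (n : ℝ)) =
      fun n => if n = 1 then (1 : ℝ) else 0 := by
    ext n
    have h1 : dconv (fun n => (n : ℝ) * μ n) (fun n => (n : ℝ)) n =
        n * dconv (fun n => (μ n : ℝ)) (fun _ => 1) n := by
      rw [dconv, dconv, mul_sum]
      refine sum_congr rfl fun x hx => ?_
      rw [← (Nat.mem_divisorsAntidiagonal.1 hx).1]; push_cast; ring
    rw [h1, ← dconv_moebius_one]
    split_ifs with h2 <;> simp [h2]
  have hone : 1 = ∑ m ∈ Ioc 0 ⌊Real.exp t⌋₊,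
      wt Z (fun n => (n : ℝ) * μ n) m * N (t - Real.log m) := by
    have h1 := totalSum_dconv Z (fun n => (n : ℝ) * μ n) (fun n => (n : ℝ)) (le_refl t)
    rw [econv] at h1
    have h2 : totalSum Z (fun n => if n = 1 then (1 : ℝ) else 0) t = 1 := by
      refine Eq.trans ?_ (logSum_ite_eq_one (x := (1 : ℝ)) ht)
      rw [totalSum]
      congr 1
      ext n
      by_cases h3 : n = 1
      · subst h3; simp [wt, rough_one]
      · simp [wt, h3]
    rw [h2] at h1
    rw [h1]
    simp only [totalSum, ewt, hN]
  have hmain : V * Real.exp t * totalSum Z (fun n => (μ n : ℝ)) t = ∑ m ∈ Ioc 0 ⌊Real.exp t⌋₊,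
      wt Z (fun n => (n : ℝ) * μ n) m * (V * Real.exp (t - Real.log m)) := by
    rw [totalSum, logSum, mul_sum]
    refine sum_congr rfl fun m hm => ?_
    have hm0 : (0 : ℝ) < m := by exact_mod_cast (mem_Ioc.1 hm).1
    rw [Real.exp_sub, Real.exp_log hm0]
    unfold wt
    split_ifs
    · field_simp
    · simp
  have hdiff : |1 - V * Real.exp t * totalSum Z (fun n => (μ n : ℝ)) t| ≤
      N t + C * V * Real.exp t * (8 * C) := by
    rw [hone, hmain, ← sum_sub_distrib]
    calc _ ≤ ∑ m ∈ Ioc 0 ⌊Real.exp t⌋₊, |wt Z (fun n => (n : ℝ) * μ n) m * N (t - Real.log m) -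
            wt Z (fun n => (n : ℝ) * μ n) m * (V * Real.exp (t - Real.log m))| :=
          abs_sum_le_sum_abs _ _
      _ ≤ ∑ m ∈ Ioc 0 ⌊Real.exp t⌋₊, ((if Rough Z m then (1 : ℝ) else 0) + C * V * Real.exp t *
            (wt Z (fun _ => 1) m * Real.exp (-(t - Real.log m) / D))) := by
          refine sum_le_sum fun m hm => ?_
          have hm0 : (0 : ℝ) < m := by exact_mod_cast (mem_Ioc.1 hm).1
          have hs : 0 ≤ t - Real.log m := by linarith [(mem_Ioc_floor_exp.1 hm).2]
          rw [← mul_sub, abs_mul]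
          have h1 := hNb _ hs
          have h2 : |wt Z (fun n => (n : ℝ) * μ n) m| ≤ if Rough Z m then (1 : ℝ) else 0 := by
            refine (abs_wt_le (g := fun n => (n : ℝ)) (fun n => ?_) m).trans_eq (congrFun ewt m)
            rw [abs_mul, Nat.abs_cast]
            have := abs_moebius_le n
            nlinarith [Nat.cast_nonneg (α := ℝ) n]
          by_cases h3 : Rough Z m
          · simp only [h3, if_true] at h2 ⊢
            refine (mul_le_of_le_one_left (abs_nonneg _) h2).trans (h1.trans (le_of_eq ?_))
            rw [Real.exp_sub, Real.exp_log hm0]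
            simp only [wt, h3, if_true]
            ring
          · simp [wt, h3]
      _ = N t + C * V * Real.exp t * logSum (fun n => wt Z (fun _ => 1) n *
            Real.exp (-(t - Real.log n) / D)) t := by
          rw [sum_add_distrib, hN, logSum, logSum, mul_sum]
      _ ≤ _ := by
          have := h.logSum_wt_one_exp_le ht
          gcongr
  have hNt : N t ≤ 1 + V * Real.exp t * (1 + C) := by
    have h1 := (abs_le.1 (hNb t ht)).2
    have h2 : Real.exp (-t / D) ≤ 1 := Real.exp_le_one_iff.2 (by
      rw [neg_div]; linarith [div_nonneg ht h.scale_pos.le])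
    have h3 : C * V * Real.exp t * Real.exp (-t / D) ≤ C * V * Real.exp t * 1 := by gcongr
    linarith
  have hVe : 1 ≤ C * (V * Real.exp t) := by
    refine h.le_density.trans ?_
    have : D ≤ Real.exp t := by linarith [Real.add_one_le_exp t]
    gcongr
  set x := V * Real.exp t with hx
  have hx0 : 0 < x := by positivity
  have h5 : x * |totalSum Z (fun n => (μ n : ℝ)) t| ≤ x * (12 * C ^ 2) := by
    calc x * |totalSum Z (fun n => (μ n : ℝ)) t| = |x * totalSum Z (fun n => (μ n : ℝ)) t| := by
          rw [abs_mul, abs_of_pos hx0]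
      _ ≤ 1 + |1 - x * totalSum Z (fun n => (μ n : ℝ)) t| := by
          have := abs_sub_abs_le_abs_sub (x * totalSum Z (fun n => (μ n : ℝ)) t) 1
          rw [abs_one, abs_sub_comm] at this
          linarith
      _ ≤ 2 * (C * x) + x * (1 + C) + C * x * (8 * C) := by
          have : C * V * Real.exp t * (8 * C) = C * x * (8 * C) := by rw [hx]; ring
          linarith
      _ = x * (1 + 3 * C + 8 * C ^ 2) := by ring
      _ ≤ _ := by
          refine mul_le_mul_of_nonneg_left ?_ hx0.le
          nlinarith
  exact le_of_mul_le_mul_left h5 hx0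

end Expansion

end Linnik

namespace Linnik

open Finset MeasureTheory intervalIntegral
open scoped ArithmeticFunction.vonMangoldt ArithmeticFunction.Moebius

lemma hasDerivAt_max_zero_cube (x : ℝ) :
    HasDerivAt (fun s : ℝ => max s 0 ^ 3 / 3) (max x 0 ^ 2) x := by
  have key : ∀ y : ℝ, y ≠ 0 → HasDerivAt (fun s : ℝ => max s 0 ^ 3 / 3) (max y 0 ^ 2) y := by
    intro y hy
    rcases lt_or_gt_of_ne hy with h | h
    · rw [max_eq_right h.le]
      refine ((hasDerivAt_const y (0 : ℝ)).congr_of_eventuallyEq ?_).congr_deriv (by norm_num)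
      filter_upwards [Iio_mem_nhds h] with s hs
      rw [max_eq_right (le_of_lt hs)]; norm_num
    · rw [max_eq_left h.le]
      refine (((hasDerivAt_pow 3 y).div_const 3).congr_of_eventuallyEq ?_).congr_deriv (by
        norm_num)
      filter_upwards [Ioi_mem_nhds h] with s hs
      rw [max_eq_left (le_of_lt hs)]
  rcases eq_or_ne x 0 with rfl | hx
  · exact hasDerivAt_of_hasDerivAt_of_ne (g := fun y => max y 0 ^ 2) key (by fun_prop) (by fun_prop)
  · exact key x hx

lemma integral_max_sub_sq (a u v : ℝ) :
    ∫ s in u..v, max (s - a) 0 ^ 2 = max (v - a) 0 ^ 3 / 3 - max (u - a) 0 ^ 3 / 3 :=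
  integral_eq_sub_of_hasDerivAt
    (fun s _ => by simpa using (hasDerivAt_max_zero_cube (s - a)).comp_sub_const s a)
    (by apply Continuous.intervalIntegrable; fun_prop)

/-- Moments of the Möbius function over rough numbers. -/
noncomputable def moebiusMoment (Z j : ℕ) (t : ℝ) : ℝ :=
  ∑ m ∈ Ioc 0 ⌊Real.exp t⌋₊, wt Z (fun n => (μ n : ℝ)) m * (t - Real.log m) ^ j

lemma moebiusMoment_eq (Z : ℕ) {j : ℕ} (hj : j ≠ 0) {t T : ℝ} (h : t ≤ T) :
    moebiusMoment Z j t = ∑ m ∈ Ioc 0 ⌊Real.exp T⌋₊,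
      wt Z (fun n => (μ n : ℝ)) m * max (t - Real.log m) 0 ^ j := by
  rw [moebiusMoment]
  have h1 : Ioc 0 ⌊Real.exp t⌋₊ ⊆ Ioc 0 ⌊Real.exp T⌋₊ :=
    Ioc_subset_Ioc_right (Nat.floor_mono (Real.exp_le_exp.2 h))
  rw [← sum_subset h1]
  · refine sum_congr rfl fun m hm => ?_
    rw [max_eq_left (by linarith [(mem_Ioc_floor_exp.1 hm).2])]
  · intro m hm hm'
    rw [mem_Ioc_floor_exp] at hm hm'
    have : t < Real.log m := by
      by_contra! h2; exact hm' ⟨hm.1, h2⟩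
    rw [max_eq_right (by linarith), zero_pow hj, mul_zero]

lemma moebiusMoment_three_sub (Z : ℕ) {u v : ℝ} (h : u ≤ v) :
    moebiusMoment Z 3 v - moebiusMoment Z 3 u = 3 * ∫ s in u..v, moebiusMoment Z 2 s := by
  have e : ∫ s in u..v, moebiusMoment Z 2 s = ∫ s in u..v, ∑ m ∈ Ioc 0 ⌊Real.exp v⌋₊,
      wt Z (fun n => (μ n : ℝ)) m * max (s - Real.log m) 0 ^ 2 := by
    refine integral_congr fun s hs => ?_
    rw [Set.uIcc_of_le h] at hs
    exact moebiusMoment_eq Z two_ne_zero hs.2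
  rw [e, moebiusMoment_eq Z three_ne_zero le_rfl, moebiusMoment_eq Z three_ne_zero h,
    intervalIntegral.integral_finsetSum fun m _ => by
      apply Continuous.intervalIntegrable; fun_prop, mul_sum, ← sum_sub_distrib]
  refine sum_congr rfl fun m _ => ?_
  rw [intervalIntegral.integral_const_mul, integral_max_sub_sq]
  ring

lemma intervalIntegrable_moebiusMoment (Z : ℕ) {u v : ℝ} (h : u ≤ v) :
    IntervalIntegrable (moebiusMoment Z 2) volume u v := by
  have h1 : IntervalIntegrable (fun s => ∑ m ∈ Ioc 0 ⌊Real.exp v⌋₊,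
      wt Z (fun n => (μ n : ℝ)) m * max (s - Real.log m) 0 ^ 2) volume u v := by
    apply Continuous.intervalIntegrable; fun_prop
  refine h1.congr fun s hs => ?_
  rw [Set.uIoc_of_le h] at hs
  exact (moebiusMoment_eq Z two_ne_zero hs.2).symm

/-- Selberg's function `Λ log + Λ * Λ`. -/
noncomputable def selbergFn (n : ℕ) : ℝ :=
  Λ n * Real.log n + dconv (fun n => Λ n) (fun n => Λ n) n

namespace Expansion

variable {C : ℝ} {q Z : ℕ} {c d k : (ZMod q)ˣ → ℝ}

lemma abs_moebiusMoment_two_sub_le (h : Expansion C q Z c d k) {t : ℝ} (ht : 0 ≤ t) :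
    |roughDensity Z * moebiusMoment Z 2 t - 2 * t| ≤ 42 * C ^ 3 * scale Z := by
  obtain ⟨d₀, hd₀, hd⟩ := h.total_log
  have hC := h.one_le
  have hD := h.scale_pos
  have h1 : totalSum Z (fun n => Λ n) t = ∑ m ∈ Ioc 0 ⌊Real.exp t⌋₊, wt Z (fun n => (μ n : ℝ)) m *
      totalSum Z (fun n => Real.log n) (t - Real.log m) := by
    rw [← totalSum_dconv Z _ _ le_rfl]
    simp only [totalSum]
    rw [wt_congr fun n _ => dconv_moebius_log n]
  have h2 : totalSum Z (fun n => Λ n) t = roughDensity Z * moebiusMoment Z 2 t / 2 +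
      d₀ * totalSum Z (fun n => (μ n : ℝ)) t + ∑ m ∈ Ioc 0 ⌊Real.exp t⌋₊,
        wt Z (fun n => (μ n : ℝ)) m * (totalSum Z (fun n => Real.log n) (t - Real.log m) -
          (roughDensity Z * (t - Real.log m) ^ 2 / 2 + d₀)) := by
    rw [h1, moebiusMoment, totalSum, logSum, mul_sum, mul_sum, sum_div, ← sum_add_distrib,
      ← sum_add_distrib]
    exact sum_congr rfl fun m _ => by ring
  have h3 := h.abs_sum_wt_mul_le abs_moebius_le ht (B := C * scale Z) (by positivity)
    (E := fun m => totalSum Z (fun n => Real.log n) (t - Real.log m) -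
          (roughDensity Z * (t - Real.log m) ^ 2 / 2 + d₀)) fun m hm =>
      hd _ (by linarith [(mem_Ioc_floor_exp.1 hm).2])
  have h4 : |d₀ * totalSum Z (fun n => (μ n : ℝ)) t| ≤ C * scale Z * (12 * C ^ 2) := by
    rw [abs_mul]
    have := h.abs_totalSum_moebius_le ht
    gcongr
  have h5 := h.mertens t ht
  have h6 : C * scale Z * (12 * C ^ 2) + C * scale Z * (8 * C) + C * scale Z ≤
      21 * C ^ 3 * scale Z := by
    have h7 : C ≤ C ^ 2 := by nlinarith
    have h8 : C ^ 2 ≤ C ^ 3 := by nlinarith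
    nlinarith
  rw [abs_le] at h3 h4 h5 ⊢
  constructor <;> linarith

theorem selberg (h : Expansion C q Z c d k) (a : (ZMod q)ˣ) {t w : ℝ} (hw : scale Z ≤ w)
    (htw : w ≤ t) :
    |q.totient * (classSum q Z selbergFn a t - classSum q Z selbergFn a (t - w)) -
      (t ^ 2 - (t - w) ^ 2)| ≤ 61 * C ^ 3 * scale Z * w := by
  have hC := h.one_le
  have hD := h.scale_pos
  have hφ := h.totient_pos
  have hV := roughDensity_pos Z
  have hw0 : 0 < w := hD.trans_le hw
  set D := scale Z with hDdef
  set V := roughDensity Z with hVdef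
  set φ : ℝ := (q.totient : ℝ) with hφdef
  set K : ℝ → ℝ := fun s => ∑ m ∈ Ioc 0 ⌊Real.exp s⌋₊,
    wt Z (fun n => (μ n : ℝ)) m * k (a * (residue q m)⁻¹) with hK
  have hS : ∀ s, 0 ≤ s → |φ * classSum q Z selbergFn a s -
      (V * moebiusMoment Z 3 s / 3 + φ * K s)| ≤ C * D ^ 2 * (8 * C) := by
    intro s hs
    have h1 : classSum q Z selbergFn a s = ∑ m ∈ Ioc 0 ⌊Real.exp s⌋₊,
        wt Z (fun n => (μ n : ℝ)) m *
          classSum q Z (fun n => Real.log n ^ 2) (a * (residue q m)⁻¹) (s - Real.log m) := by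
      rw [← classSum_dconv h.q_ne_zero h.q_le _ _ _ le_rfl]
      simp only [classSum]
      rw [cls_congr fun n _ => (show selbergFn n = _ from dconv_moebius_log_sq n)]
    have h2 : φ * classSum q Z selbergFn a s - (V * moebiusMoment Z 3 s / 3 + φ * K s) =
        ∑ m ∈ Ioc 0 ⌊Real.exp s⌋₊, wt Z (fun n => (μ n : ℝ)) m * (φ *
          (classSum q Z (fun n => Real.log n ^ 2) (a * (residue q m)⁻¹) (s - Real.log m) -
            (V / φ * (s - Real.log m) ^ 3 / 3 + k (a * (residue q m)⁻¹)))) := by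
      rw [h1, moebiusMoment, hK, mul_sum, mul_sum, mul_sum, sum_div, ← sum_add_distrib,
        ← sum_sub_distrib]
      refine sum_congr rfl fun m _ => ?_
      field_simp
    rw [h2]
    refine h.abs_sum_wt_mul_le abs_moebius_le hs (by positivity) fun m hm => ?_
    rw [abs_mul, abs_of_pos hφ]
    have h3 := h.log_sq (a * (residue q m)⁻¹) (s - Real.log m)
      (by linarith [(mem_Ioc_floor_exp.1 hm).2])
    calc _ ≤ φ * (C * D ^ 2 / φ * Real.exp (-(s - Real.log m) / D)) := by gcongr
      _ = C * D ^ 2 * Real.exp (-(s - Real.log m) / D) := by field_simp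
  have hKd : |φ * K t - φ * K (t - w)| ≤ C * D ^ 2 * (V * w + 2 * C) := by
    have h1 : K t - K (t - w) = ∑ m ∈ Ioc 0 ⌊Real.exp t⌋₊ with t - w < Real.log (m : ℕ),
        wt Z (fun n => (μ n : ℝ)) m * k (a * (residue q m)⁻¹) :=
      logSum_sub_eq _ (by linarith)
    have h2 : totalSum Z (fun _ => 1) t - totalSum Z (fun _ => 1) (t - w) =
        ∑ m ∈ Ioc 0 ⌊Real.exp t⌋₊ with t - w < Real.log (m : ℕ), wt Z (fun _ => 1) m :=
      logSum_sub_eq _ (by linarith)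
    have h3 := h.totalSum_one_sub_le (s := t - w) (t := t) (by linarith) (by linarith)
    rw [h2, sub_sub_cancel] at h3
    rw [← mul_sub, abs_mul, abs_of_pos hφ, h1]
    calc _ ≤ φ * ∑ m ∈ Ioc 0 ⌊Real.exp t⌋₊ with t - w < Real.log (m : ℕ),
          wt Z (fun _ => 1) m * (C * D ^ 2 / φ) := by
          refine mul_le_mul_of_nonneg_left ?_ hφ.le
          refine (abs_sum_le_sum_abs _ _).trans (sum_le_sum fun m _ => ?_)
          rw [abs_mul]
          exact mul_le_mul (abs_wt_le abs_moebius_le m) (h.abs_k _) (abs_nonneg _)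
            (wt_nonneg (by simp) m)
      _ = C * D ^ 2 * ∑ m ∈ Ioc 0 ⌊Real.exp t⌋₊ with t - w < Real.log (m : ℕ),
          wt Z (fun _ => 1) m := by rw [← sum_mul]; field_simp
      _ ≤ _ := by gcongr
  have hJ : |V * (moebiusMoment Z 3 t - moebiusMoment Z 3 (t - w)) / 3 - (t ^ 2 - (t - w) ^ 2)| ≤
      42 * C ^ 3 * D * w := by
    have hle : t - w ≤ t := by linarith
    have hintegrable := intervalIntegrable_moebiusMoment Z hle
    have e : V * (moebiusMoment Z 3 t - moebiusMoment Z 3 (t - w)) / 3 - (t ^ 2 - (t - w) ^ 2) =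
        ∫ s in (t - w)..t, (V * moebiusMoment Z 2 s - 2 * s) := by
      rw [moebiusMoment_three_sub Z hle, intervalIntegral.integral_sub (hintegrable.const_mul V)
        (by apply Continuous.intervalIntegrable; fun_prop), intervalIntegral.integral_const_mul,
        intervalIntegral.integral_const_mul, integral_id]
      ring
    rw [e]
    have := norm_integral_le_of_norm_le_const (a := t - w) (b := t)
      (f := fun s => V * moebiusMoment Z 2 s - 2 * s) (C := 42 * C ^ 3 * D) (fun s hs => by
        rw [Set.uIoc_of_le hle] at hs
        exact h.abs_moebiusMoment_two_sub_le (by linarith [hs.1]))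
    rwa [Real.norm_eq_abs, sub_sub_cancel, abs_of_pos hw0] at this
  have h1 := hS t (by linarith)
  have h2 := hS (t - w) (by linarith)
  have h3 : C * D ^ 2 * (8 * C) ≤ 8 * C ^ 3 * D * w := by
    have : D ^ 2 ≤ D * w := by nlinarith
    have h4 : C ^ 2 ≤ C ^ 3 := by nlinarith [sq_nonneg C]
    calc C * D ^ 2 * (8 * C) = 8 * C ^ 2 * D ^ 2 := by ring
      _ ≤ 8 * C ^ 3 * (D * w) := by gcongr
      _ = _ := by ring
  have h4 : C * D ^ 2 * (V * w + 2 * C) ≤ 3 * C ^ 3 * D * w := by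
    have h5 : D ^ 2 ≤ D * w := by nlinarith
    have h6 : C ^ 2 ≤ C ^ 3 := by nlinarith [sq_nonneg C]
    calc C * D ^ 2 * (V * w + 2 * C) = C * D * w * (V * D) + 2 * C ^ 2 * D ^ 2 := by ring
      _ ≤ C * D * w * C + 2 * C ^ 3 * (D * w) := by
          have := h.density_le
          gcongr
      _ = C ^ 2 * (D * w) + 2 * C ^ 3 * (D * w) := by ring
      _ ≤ C ^ 3 * (D * w) + 2 * C ^ 3 * (D * w) := by gcongr
      _ = _ := by ring
  rw [abs_le] at h1 h2 hKd hJ ⊢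
  constructor <;> linarith

end Expansion

end Linnik

namespace Linnik

open Finset MeasureTheory intervalIntegral
open scoped ArithmeticFunction.vonMangoldt ArithmeticFunction.Moebius

section Characters

variable {q : ℕ} [NeZero q]

lemma sum_char_inv_mul_char (a b : (ZMod q)ˣ) :
    ∑ χ : DirichletCharacter ℂ q, χ (a⁻¹ : (ZMod q)ˣ) * χ b = if a = b then (q.totient : ℂ) else 0 := by
  have h := DirichletCharacter.sum_char_inv_mul_char_eq ℂ a.isUnit (b : ZMod q)
  simpa only [ZMod.inv_coe_unit, Units.val_inj] using h

lemma conj_char (χ : DirichletCharacter ℂ q) (a : (ZMod q)ˣ) :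
    (starRingEnd ℂ) (χ a) = χ (a⁻¹ : (ZMod q)ˣ) := by
  have h := MulChar.star_apply' χ (a : ZMod q)
  rw [MulChar.inv_apply, Ring.inverse_unit] at h
  exact h

/-- The character transform of a function on reduced residue classes. -/
noncomputable def transform (χ : DirichletCharacter ℂ q) (F : (ZMod q)ˣ → ℝ) : ℂ :=
  ∑ b : (ZMod q)ˣ, χ b * F b

lemma sum_norm_transform_sq (F : (ZMod q)ˣ → ℝ) :
    ∑ χ : DirichletCharacter ℂ q, ‖transform χ F‖ ^ 2 = q.totient * ∑ b, F b ^ 2 := by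
  have h : ∑ χ : DirichletCharacter ℂ q, (starRingEnd ℂ) (transform χ F) * transform χ F =
      q.totient * ∑ b, (F b : ℂ) ^ 2 := by
    simp only [transform, map_sum, map_mul, conj_char, Complex.conj_ofReal, sum_mul_sum]
    rw [sum_comm]
    simp_rw [sum_comm (s := (univ : Finset (DirichletCharacter ℂ q)))]
    rw [mul_sum]
    refine sum_congr rfl fun a _ => ?_
    have e : ∀ b : (ZMod q)ˣ, ∑ χ : DirichletCharacter ℂ q,
        χ (a⁻¹ : (ZMod q)ˣ) * (F a : ℂ) * (χ b * (F b : ℂ)) =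
          if a = b then (q.totient : ℂ) * ((F a : ℂ) * F b) else 0 := by
      intro b
      rw [← ite_zero_mul, ← sum_char_inv_mul_char, sum_mul]
      exact sum_congr rfl fun χ _ => by ring
    rw [sum_congr rfl fun b _ => e b]
    simp only [sum_ite_eq, mem_univ, if_true]
    ring
  simp only [Complex.conj_mul'] at h
  exact_mod_cast h

lemma sum_char_units_eq_zero {χ : DirichletCharacter ℂ q} (hχ : χ ≠ 1) :
    ∑ b : (ZMod q)ˣ, χ b = 0 := by
  obtain ⟨a, ha⟩ := (MulChar.ne_one_iff).1 hχ
  refine eq_zero_of_mul_eq_self_left ha ?_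
  rw [mul_sum]
  simp only [← map_mul, ← Units.val_mul]
  exact Fintype.sum_bijective _ (Group.mulLeft_bijective a) _ _ fun _ => rfl

lemma transform_add_const {χ : DirichletCharacter ℂ q} (hχ : χ ≠ 1) (F : (ZMod q)ˣ → ℝ) (y : ℝ) :
    transform χ (fun b => y + F b) = transform χ F := by
  simp only [transform]
  push_cast
  simp only [mul_add, sum_add_distrib, ← sum_mul, sum_char_units_eq_zero hχ, zero_mul, zero_add]

/-- Weights twisted by a character. -/
noncomputable def tw (χ : DirichletCharacter ℂ q) (Z : ℕ) (f : ℕ → ℝ) (n : ℕ) : ℂ :=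
  χ n * wt Z f n

lemma tw_dconv (χ : DirichletCharacter ℂ q) (Z : ℕ) (f g : ℕ → ℝ) :
    tw χ Z (dconv f g) = dconv (tw χ Z f) (tw χ Z g) := by
  ext n
  rw [tw, wt_dconv, dconv, dconv]
  push_cast
  rw [mul_sum]
  refine sum_congr rfl fun x hx => ?_
  rw [← (Nat.mem_divisorsAntidiagonal.1 hx).1, tw, tw]
  push_cast
  rw [map_mul]
  ring

/-- Sums of twisted weights. -/
noncomputable def charSum (χ : DirichletCharacter ℂ q) (Z : ℕ) (f : ℕ → ℝ) (t : ℝ) : ℂ :=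
  logSum (tw χ Z f) t

lemma char_natCast_of_rough {Z n : ℕ} (hqZ : q ≤ Z) (hn : Rough Z n)
    (χ : DirichletCharacter ℂ q) : χ (n : ZMod q) = χ (residue q n) := by
  rw [coe_residue (hn.coprime (NeZero.ne q) hqZ)]

lemma tw_eq {Z : ℕ} (hqZ : q ≤ Z) (χ : DirichletCharacter ℂ q) (f : ℕ → ℝ) (n : ℕ) :
    tw χ Z f n = χ (residue q n) * wt Z f n := by
  by_cases hn : Rough Z n
  · rw [tw, char_natCast_of_rough hqZ hn]
  · simp [tw, wt, hn]

lemma charSum_eq_transform {Z : ℕ} (hqZ : q ≤ Z) (χ : DirichletCharacter ℂ q) (f : ℕ → ℝ) (t : ℝ) :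
    charSum χ Z f t = transform χ fun b => classSum q Z f b t := by
  simp only [charSum, transform, classSum, logSum]
  push_cast
  simp only [mul_sum]
  rw [sum_comm]
  refine sum_congr rfl fun n _ => ?_
  rw [tw_eq hqZ, cls_sum_aux]
where
  cls_sum_aux {Z : ℕ} {χ : DirichletCharacter ℂ q} {f : ℕ → ℝ} {n : ℕ} :
      ∑ b : (ZMod q)ˣ, χ b * (cls q Z f b n : ℂ) = χ (residue q n) * wt Z f n := by
    simp [cls, apply_ite (fun x : ℝ => (x : ℂ))]

lemma totient_mul_eq_sum_transform (F : (ZMod q)ˣ → ℝ) (a : (ZMod q)ˣ) :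
    (q.totient : ℂ) * F a = ∑ χ : DirichletCharacter ℂ q, χ (a⁻¹ : (ZMod q)ˣ) * transform χ F := by
  simp only [transform, mul_sum]
  rw [sum_comm]
  have e : ∀ b : (ZMod q)ˣ, ∑ χ : DirichletCharacter ℂ q, χ (a⁻¹ : (ZMod q)ˣ) * (χ b * (F b : ℂ)) =
      if a = b then (q.totient : ℂ) * F b else 0 := by
    intro b
    rw [← ite_zero_mul, ← sum_char_inv_mul_char, sum_mul]
    exact sum_congr rfl fun χ _ => by ring
  rw [sum_congr rfl fun b _ => e b]
  simp

lemma charSum_one {Z : ℕ} (hqZ : q ≤ Z) (f : ℕ → ℝ) (t : ℝ) :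
    charSum (1 : DirichletCharacter ℂ q) Z f t = totalSum Z f t := by
  rw [charSum_eq_transform hqZ, transform, ← sum_classSum q]
  simp [MulChar.one_apply]

lemma charSum_of_neg (χ : DirichletCharacter ℂ q) (Z : ℕ) (f : ℕ → ℝ) {t : ℝ} (ht : t < 0) :
    charSum χ Z f t = 0 := logSum_of_neg _ ht

end Characters

namespace Expansion

variable {C : ℝ} {q Z : ℕ} {c d k : (ZMod q)ˣ → ℝ}

lemma exists_sum_c_eq (h : Expansion C q Z c d k) {t : ℝ} (ht : 0 ≤ t) :
    ∃ Y : ℝ, ∀ b, |(∑ m ∈ Ioc 0 ⌊Real.exp t⌋₊, wt Z (fun n => Λ n) m * c (b * (residue q m)⁻¹)) - Y| ≤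
      8 * C ^ 2 * scale Z / q.totient := by
  have hC := h.one_le
  have hD := h.scale_pos
  have hφ := h.totient_pos
  set V := roughDensity Z
  set φ : ℝ := (q.totient : ℝ) with hφdef
  set W : ℝ := ∑ m ∈ Ioc 0 ⌊Real.exp t⌋₊, wt Z (fun n => Λ n) m * (t - Real.log m)
  refine ⟨V / φ * t ^ 2 / 2 - V / φ * W, fun b => ?_⟩
  have h1 : classSum q Z (fun n => Real.log n) b t = ∑ m ∈ Ioc 0 ⌊Real.exp t⌋₊,
      wt Z (fun n => Λ n) m * classSum q Z (fun _ => 1) (b * (residue q m)⁻¹) (t - Real.log m) := by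
    rw [← classSum_dconv h.q_ne_zero h.q_le _ _ _ le_rfl]
    simp only [classSum]
    rw [cls_congr fun n _ => dconv_vonMangoldt_one n]
  set E : ℕ → ℝ := fun m => classSum q Z (fun _ => 1) (b * (residue q m)⁻¹) (t - Real.log m) -
    (V / φ * (t - Real.log m) + c (b * (residue q m)⁻¹)) with hE
  have h2 : classSum q Z (fun n => Real.log n) b t = V / φ * W +
      (∑ m ∈ Ioc 0 ⌊Real.exp t⌋₊, wt Z (fun n => Λ n) m * c (b * (residue q m)⁻¹)) +
      ∑ m ∈ Ioc 0 ⌊Real.exp t⌋₊, wt Z (fun n => Λ n) m * E m := by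
    rw [h1, mul_sum, ← sum_add_distrib, ← sum_add_distrib]
    exact sum_congr rfl fun m _ => by simp only [hE]; ring
  have h3 : |∑ m ∈ Ioc 0 ⌊Real.exp t⌋₊, wt Z (fun n => Λ n) m * E m| ≤
      C / φ * (6 * C * scale Z) := by
    refine le_trans ?_ (mul_le_mul_of_nonneg_left (h.logSum_wt_vonMangoldt_exp_le ht)
      (by positivity : 0 ≤ C / φ))
    rw [logSum, mul_sum]
    refine (abs_sum_le_sum_abs _ _).trans (sum_le_sum fun m hm => ?_)
    have hw : 0 ≤ wt Z (fun n => Λ n) m :=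
      wt_nonneg (fun n => ArithmeticFunction.vonMangoldt_nonneg) m
    rw [abs_mul, abs_of_nonneg hw]
    have := h.one (b * (residue q m)⁻¹) (t - Real.log m)
      (by linarith [(mem_Ioc_floor_exp.1 hm).2])
    nlinarith
  have h4 := h.log b t ht
  have h5 : Real.exp (-t / scale Z) ≤ 1 := Real.exp_le_one_iff.2 (by
    rw [neg_div]; linarith [div_nonneg ht hD.le])
  have h6 : C * scale Z / φ * Real.exp (-t / scale Z) ≤ C * scale Z / φ :=
    mul_le_of_le_one_right (by positivity) h5
  have h7 := h.abs_d b
  have h8 : C / φ * (6 * C * scale Z) + C * scale Z / φ + C * scale Z / φ ≤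
      8 * C ^ 2 * scale Z / φ := by
    rw [div_mul_eq_mul_div, ← add_div, ← add_div]
    refine div_le_div_of_nonneg_right ?_ hφ.le
    nlinarith [mul_pos hD (by linarith : 0 < C)]
  rw [abs_le] at h3 h4 h7 ⊢
  constructor <;> linarith

lemma sum_norm_transform_mul_charSum_sq_le (h : Expansion C q Z c d k) [NeZero q] (t : ℝ) :
    ∑ χ : DirichletCharacter ℂ q with χ ≠ 1, ‖transform χ c * charSum χ Z (fun n => Λ n) t‖ ^ 2 ≤
      64 * C ^ 4 * scale Z ^ 2 := by
  have hC := h.one_le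
  rcases lt_or_ge t 0 with ht | ht
  · simp only [charSum_of_neg _ Z _ ht, mul_zero, norm_zero]
    simp
    positivity
  obtain ⟨Y, hY⟩ := h.exists_sum_c_eq ht
  have hφ := h.totient_pos
  set B : (ZMod q)ˣ → ℝ := fun b =>
    (∑ m ∈ Ioc 0 ⌊Real.exp t⌋₊, wt Z (fun n => Λ n) m * c (b * (residue q m)⁻¹)) - Y with hB
  have e : ∀ χ : DirichletCharacter ℂ q, χ ≠ 1 →
      transform χ c * charSum χ Z (fun n => Λ n) t = transform χ B := by
    intro χ hχ
    rw [← transform_add_const hχ B Y]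
    simp only [hB, add_sub_cancel]
    simp only [transform, charSum, logSum]
    push_cast
    simp only [mul_sum]
    rw [sum_comm]
    refine sum_congr rfl fun m _ => ?_
    rw [tw_eq h.q_le, sum_mul]
    refine Fintype.sum_bijective (· * residue q m) (Group.mulRight_bijective _) _ _ fun b => ?_
    rw [mul_inv_cancel_right, Units.val_mul, map_mul]
    ring
  calc _ = ∑ χ : DirichletCharacter ℂ q with χ ≠ 1, ‖transform χ B‖ ^ 2 :=
        sum_congr rfl fun χ hχ => by rw [e χ (mem_filter.1 hχ).2]
    _ ≤ ∑ χ : DirichletCharacter ℂ q, ‖transform χ B‖ ^ 2 :=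
        sum_le_sum_of_subset_of_nonneg (filter_subset _ _) fun _ _ _ => by positivity
    _ = q.totient * ∑ b, B b ^ 2 := sum_norm_transform_sq B
    _ ≤ q.totient * ∑ b : (ZMod q)ˣ, (64 * C ^ 4 * scale Z ^ 2 / q.totient) / q.totient := by
        refine mul_le_mul_of_nonneg_left (sum_le_sum fun b _ => ?_) hφ.le
        rw [← sq_abs]
        calc _ ≤ (8 * C ^ 2 * scale Z / q.totient) ^ 2 := by
              exact pow_le_pow_left₀ (abs_nonneg _) (hY b) 2
          _ = _ := by field_simp; ring
    _ = _ := by rw [sum_div_totient]; field_simp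

end Expansion

end Linnik

namespace Linnik

open Finset MeasureTheory intervalIntegral
open scoped ArithmeticFunction.vonMangoldt ArithmeticFunction.Moebius

lemma intervalIntegrable_logSum_mul (f g : ℕ → ℂ) (x y a b : ℝ) :
    IntervalIntegrable (fun s => logSum f (s - x) * logSum g (y - s)) volume a b := by
  have h1 : StronglyMeasurable fun s => logSum f (s - x) :=
    (stronglyMeasurable_logSum f).comp_measurable (measurable_id.sub measurable_const)
  refine intervalIntegrable_of_bound (h1.mul (logSum_comp_sub_measurable g y))
    (M := logSum (fun n => ‖f n‖) (max a b - x) * logSum (fun n => ‖g n‖) (y - min a b))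
    fun s hs => ?_
  refine (norm_mul _ _).trans_le ?_
  have h2 : s ≤ max a b := hs.2
  have h3 : min a b ≤ s := hs.1.le
  exact mul_le_mul (norm_logSum_le f (by linarith)) (norm_logSum_le g (by linarith))
    (norm_nonneg _) (logSum_nonneg (fun n => norm_nonneg _) _)

lemma integral_shift_logSum_mul (f : ℕ → ℂ) {U x y : ℝ} (hx : 0 ≤ x) (hy : 0 ≤ y)
    (hU : x + y ≤ U) :
    ∫ s in (0 : ℝ)..U, logSum f (s - x) * logSum f (U - y - s) =
      ∫ s in (0 : ℝ)..(U - x - y), logSum (dconv f f) s := by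
  rw [← integral_logSum_mul_logSum f f (by linarith)]
  set W := U - x - y with hW
  have e : ∫ s in (0 : ℝ)..U, logSum f (s - x) * logSum f (U - y - s) =
      ∫ s in (-x)..(U - x), logSum f s * logSum f (W - s) := by
    have := intervalIntegral.integral_comp_sub_right (a := 0) (b := U)
      (fun s => logSum f s * logSum f (W - s)) x
    rw [zero_sub] at this
    rw [← this]
    refine integral_congr fun s _ => ?_
    simp only [hW]
    congr 2
    ring
  have hi : ∀ a b : ℝ, IntervalIntegrable (fun s => logSum f s * logSum f (W - s)) volume a b := by
    intro a b
    simpa using intervalIntegrable_logSum_mul f f 0 W a b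
  rw [e, ← integral_add_adjacent_intervals (hi (-x) 0) (hi 0 _),
    ← integral_add_adjacent_intervals (hi 0 W) (hi W _)]
  have z1 : ∫ s in (-x)..0, logSum f s * logSum f (W - s) = 0 := by
    refine intervalIntegral.integral_zero_ae ?_
    filter_upwards [compl_mem_ae_iff.2 (measure_singleton (0 : ℝ))] with s hs0 hs
    rw [Set.uIoc_of_le (by linarith)] at hs
    rw [logSum_of_neg f (lt_of_le_of_ne hs.2 (by simpa using hs0)), zero_mul]
  have z2 : ∫ s in W..(U - x), logSum f s * logSum f (W - s) = 0 := by
    refine intervalIntegral.integral_zero_ae (Filter.Eventually.of_forall fun s hs => ?_)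
    rw [Set.uIoc_of_le (by linarith)] at hs
    rw [logSum_of_neg f (t := W - s) (by linarith [hs.1]), mul_zero]
  rw [z1, z2]
  ring

lemma integral_incr_mul_incr (f : ℕ → ℂ) {h T : ℝ} (hh : 0 ≤ h) (hT : h ≤ T) :
    ∫ s in (0 : ℝ)..(T + h), (logSum f s - logSum f (s - h)) *
        (logSum f (T + h - s) - logSum f (T + h - s - h)) =
      ∫ s in T..(T + h), (logSum (dconv f f) s - logSum (dconv f f) (s - h)) := by
  set U := T + h with hU
  set P : ℝ → ℂ := fun W => ∫ s in (0 : ℝ)..W, logSum (dconv f f) s with hP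
  have hi := fun x y => intervalIntegrable_logSum_mul f f x (U - y) 0 U
  have e1 : ∫ s in (0 : ℝ)..U, (logSum f s - logSum f (s - h)) *
        (logSum f (U - s) - logSum f (U - s - h)) = P U - P (U - h) - P (U - h) + P (U - h - h) := by
    have e2 : ∀ s, (logSum f s - logSum f (s - h)) *
        (logSum f (U - s) - logSum f (U - s - h)) =
        logSum f (s - 0) * logSum f (U - 0 - s) - logSum f (s - h) * logSum f (U - 0 - s)
          - logSum f (s - 0) * logSum f (U - h - s) + logSum f (s - h) * logSum f (U - h - s) := by
      intro s
      rw [sub_zero, sub_zero, sub_right_comm U s h]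
      ring
    rw [integral_congr fun s _ => e2 s, intervalIntegral.integral_add
      (((hi 0 0).sub (hi h 0)).sub (hi 0 h)) (hi h h), intervalIntegral.integral_sub
      ((hi 0 0).sub (hi h 0)) (hi 0 h), intervalIntegral.integral_sub (hi 0 0) (hi h 0),
      integral_shift_logSum_mul f le_rfl le_rfl (by linarith),
      integral_shift_logSum_mul f hh le_rfl (by linarith),
      integral_shift_logSum_mul f le_rfl hh (by linarith),
      integral_shift_logSum_mul f hh hh (by linarith)]
    simp only [sub_zero, hP]
  have hJ := intervalIntegrable_logSum (dconv f f)
  have hJ' : IntervalIntegrable (fun s => logSum (dconv f f) (s - h)) volume T U := by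
    have := (hJ (T - h) (U - h)).comp_sub_right h
    simpa using this
  have h1 := integral_add_adjacent_intervals (hJ 0 T) (hJ T U)
  have h2 := integral_add_adjacent_intervals (hJ 0 (T - h)) (hJ (T - h) T)
  have h3 : U - h = T := by rw [hU]; ring
  rw [e1, intervalIntegral.integral_sub (hJ T U) hJ',
    intervalIntegral.integral_comp_sub_right (fun s => logSum (dconv f f) s) h, h3]
  simp only [hP]
  rw [← h1, ← h2]
  ring

section Kernel

variable {q : ℕ} [NeZero q]

/-- Increments of the twisted Chebyshev function on a logarithmic scale. -/
noncomputable def incr (χ : DirichletCharacter ℂ q) (Z : ℕ) (h s : ℝ) : ℂ :=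
  charSum χ Z (fun n => Λ n) s - charSum χ Z (fun n => Λ n) (s - h)

/-- Self-convolution of the increments. -/
noncomputable def kern (χ : DirichletCharacter ℂ q) (Z : ℕ) (h U : ℝ) : ℂ :=
  ∫ s in (0 : ℝ)..U, incr χ Z h s * incr χ Z h (U - s)

lemma stronglyMeasurable_incr (χ : DirichletCharacter ℂ q) (Z : ℕ) (h : ℝ) :
    StronglyMeasurable (incr χ Z h) :=
  (stronglyMeasurable_logSum _).sub
    ((stronglyMeasurable_logSum _).comp_measurable (measurable_id.sub measurable_const))

lemma norm_incr_le (χ : DirichletCharacter ℂ q) (Z : ℕ) {h s U : ℝ} (hh : 0 ≤ h) (hs : s ≤ U) :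
    ‖incr χ Z h s‖ ≤ 2 * logSum (fun n => ‖tw χ Z (fun n => Λ n) n‖) U := by
  refine (norm_sub_le _ _).trans ?_
  rw [two_mul]
  exact add_le_add (norm_logSum_le _ hs) (norm_logSum_le _ (by linarith))

lemma intervalIntegrable_incr_mul (χ : DirichletCharacter ℂ q) (Z : ℕ) {h U : ℝ} (hh : 0 ≤ h)
    (a b : ℝ) :
    IntervalIntegrable (fun s => incr χ Z h s * incr χ Z h (U - s)) volume a b := by
  refine intervalIntegrable_of_bound (M :=
    2 * logSum (fun n => ‖tw χ Z (fun n => Λ n) n‖) (max a b) *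
      (2 * logSum (fun n => ‖tw χ Z (fun n => Λ n) n‖) (U - min a b)))
    ((stronglyMeasurable_incr χ Z h).mul
    ((stronglyMeasurable_incr χ Z h).comp_measurable (measurable_const.sub measurable_id)))
    fun s hs => ?_
  refine (norm_mul _ _).trans_le ?_
  have h2 : s ≤ max a b := hs.2
  have h3 : min a b ≤ s := hs.1.le
  exact mul_le_mul (norm_incr_le χ Z hh h2)
    (norm_incr_le χ Z hh (by simp only [Pi.sub_apply, id]; linarith)) (norm_nonneg _)
    (mul_nonneg zero_le_two (logSum_nonneg (fun n => norm_nonneg _) _))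

lemma kern_eq (χ : DirichletCharacter ℂ q) (Z : ℕ) {h T : ℝ} (hh : 0 ≤ h) (hT : h ≤ T) :
    kern χ Z h (T + h) = ∫ s in T..(T + h),
      (charSum χ Z (dconv (fun n => Λ n) (fun n => Λ n)) s -
        charSum χ Z (dconv (fun n => Λ n) (fun n => Λ n)) (s - h)) := by
  simp only [charSum, tw_dconv]
  exact integral_incr_mul_incr _ hh hT

lemma sum_norm_kern_le (Z : ℕ) (S : Finset (DirichletCharacter ℂ q)) {h U B : ℝ} (hh : 0 ≤ h)
    (hU : 0 ≤ U) (hB : ∀ s, ∑ χ ∈ S, ‖incr χ Z h s‖ ^ 2 ≤ B) :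
    ∑ χ ∈ S, ‖kern χ Z h U‖ ≤ U * B := by
  have h1 : ∀ χ : DirichletCharacter ℂ q, ‖kern χ Z h U‖ ≤
      ∫ s in (0 : ℝ)..U, ‖incr χ Z h s * incr χ Z h (U - s)‖ := fun χ =>
    norm_integral_le_integral_norm hU
  have hi := fun χ : DirichletCharacter ℂ q => (intervalIntegrable_incr_mul χ Z (U := U) hh 0 U).norm
  calc _ ≤ ∑ χ ∈ S, ∫ s in (0 : ℝ)..U, ‖incr χ Z h s * incr χ Z h (U - s)‖ :=
        sum_le_sum fun χ _ => h1 χ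
    _ = ∫ s in (0 : ℝ)..U, ∑ χ ∈ S, ‖incr χ Z h s * incr χ Z h (U - s)‖ :=
        (intervalIntegral.integral_finsetSum fun χ _ => hi χ).symm
    _ ≤ ∫ _ in (0 : ℝ)..U, B := by
        refine integral_mono_on hU (by
          simpa only [Finset.sum_fn] using IntervalIntegrable.sum S fun χ _ => hi χ) (by simp) fun s _ => ?_
        have h2 := hB s
        have h3 := hB (U - s)
        have h4 : ∑ χ ∈ S, ‖incr χ Z h s * incr χ Z h (U - s)‖ ≤
            ∑ χ ∈ S, (‖incr χ Z h s‖ ^ 2 + ‖incr χ Z h (U - s)‖ ^ 2) / 2 :=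
          sum_le_sum fun χ _ => by
            rw [norm_mul]; nlinarith [sq_nonneg (‖incr χ Z h s‖ - ‖incr χ Z h (U - s)‖)]
        rw [← sum_div, sum_add_distrib] at h4
        linarith
    _ = U * B := by simp

end Kernel

end Linnik

namespace Linnik

open Finset MeasureTheory intervalIntegral
open scoped ArithmeticFunction.vonMangoldt ArithmeticFunction.Moebius

namespace Expansion

variable {C : ℝ} {q Z : ℕ} {c d k : (ZMod q)ˣ → ℝ}

lemma classSum_mul_log_sub_le (a : (ZMod q)ˣ) {s w T : ℝ} (hw : 0 ≤ w) (hT : w ≤ T)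
    (hs : s ∈ Set.Icc T (T + w)) :
    classSum q Z (fun n => Λ n * Real.log n) a s - classSum q Z (fun n => Λ n * Real.log n) a (s - w) ≤
      (T + w) * (classSum q Z (fun n => Λ n) a (T + w) - classSum q Z (fun n => Λ n) a (T - w)) := by
  have hΛ : ∀ n : ℕ, 0 ≤ Λ n := fun n => ArithmeticFunction.vonMangoldt_nonneg
  have hmono := logSum_mono (cls_nonneg (q := q) (Z := Z) hΛ a)
  have h1 : classSum q Z (fun n => Λ n) a s - classSum q Z (fun n => Λ n) a (s - w) ≤
      classSum q Z (fun n => Λ n) a (T + w) - classSum q Z (fun n => Λ n) a (T - w) := by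
    have e1 := hmono hs.2
    have e2 := hmono (show T - w ≤ s - w by linarith [hs.1])
    unfold classSum
    linarith
  refine le_trans ?_ (mul_le_mul_of_nonneg_left h1 (by linarith))
  unfold classSum
  rw [logSum_sub_eq _ (by linarith), logSum_sub_eq _ (by linarith), mul_sum]
  refine sum_le_sum fun n hn => ?_
  have hn' := (mem_Ioc_floor_exp.1 (mem_filter.1 hn).1)
  have : cls q Z (fun n => Λ n * Real.log n) a n = Real.log n * cls q Z (fun n => Λ n) a n := by
    unfold cls wt
    split_ifs <;> ring
  rw [this]
  exact mul_le_mul_of_nonneg_right (by linarith [hs.2]) (cls_nonneg hΛ a n)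

lemma integral_sq_sub_sq (T w : ℝ) :
    ∫ s in T..(T + w), (s ^ 2 - (s - w) ^ 2) = 2 * T * w ^ 2 := by
  have : ∀ s : ℝ, s ^ 2 - (s - w) ^ 2 = 2 * w * s - w ^ 2 := fun s => by ring
  simp only [this]
  rw [intervalIntegral.integral_sub (by apply Continuous.intervalIntegrable; fun_prop) (by simp),
    intervalIntegral.integral_const_mul, integral_id]
  simp
  ring

/-- A lower bound for the mass of primes in a residue class on a logarithmic interval. -/
theorem mass_ge (h : Expansion C q Z c d k) [NeZero q] (a : (ZMod q)ˣ) {w T : ℝ}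
    (hw : scale Z ≤ w) (hT : w ≤ T) :
    2 * T * w ^ 2 - 61 * C ^ 3 * scale Z * w ^ 2 -
        (∑ χ : DirichletCharacter ℂ q, χ (a⁻¹ : (ZMod q)ˣ) * kern χ Z w (T + w)).re ≤
      q.totient * (w * (T + w)) *
        (classSum q Z (fun n => Λ n) a (T + w) - classSum q Z (fun n => Λ n) a (T - w)) := by
  have hD := h.scale_pos
  have hw0 : 0 < w := hD.trans_le hw
  have hφ := h.totient_pos
  set M := classSum q Z (fun n => Λ n) a (T + w) - classSum q Z (fun n => Λ n) a (T - w)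
  set φ : ℝ := (q.totient : ℝ) with hφdef
  set LL : ℕ → ℝ := dconv (fun n => Λ n) (fun n => Λ n) with hLL
  set r : ℝ → ℝ := fun s => φ * (classSum q Z LL a s - classSum q Z LL a (s - w)) with hr
  have hshift : ∀ {E : Type} [NormedAddCommGroup E] (f : ℕ → E),
      IntervalIntegrable (fun s => logSum f (s - w)) volume T (T + w) := fun f => by
    simpa using (intervalIntegrable_logSum f (T - w) (T + w - w)).comp_sub_right w
  have hri : IntervalIntegrable r volume T (T + w) :=
    ((intervalIntegrable_logSum _ _ _).sub (hshift _)).const_mul _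
  have h1 : ∑ χ : DirichletCharacter ℂ q, χ (a⁻¹ : (ZMod q)ˣ) * kern χ Z w (T + w) =
      ((∫ s in T..(T + w), r s : ℝ) : ℂ) := by
    rw [← intervalIntegral.integral_ofReal]
    have e : ∀ s, ((r s : ℝ) : ℂ) = ∑ χ : DirichletCharacter ℂ q, χ (a⁻¹ : (ZMod q)ˣ) *
        (charSum χ Z LL s - charSum χ Z LL (s - w)) := by
      intro s
      simp only [hr, hφdef]
      push_cast
      rw [mul_sub, totient_mul_eq_sum_transform (fun b => classSum q Z LL b s),
        totient_mul_eq_sum_transform (fun b => classSum q Z LL b (s - w)), ← sum_sub_distrib]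
      refine sum_congr rfl fun χ _ => ?_
      rw [charSum_eq_transform h.q_le, charSum_eq_transform h.q_le, mul_sub]
    rw [integral_congr fun s _ => e s, intervalIntegral.integral_finsetSum fun χ _ =>
      ((intervalIntegrable_logSum _ _ _).sub (hshift _)).const_mul _]
    refine sum_congr rfl fun χ _ => ?_
    rw [intervalIntegral.integral_const_mul, kern_eq χ Z hw0.le hT]
  rw [h1, Complex.ofReal_re]
  have h2 : ∫ s in T..(T + w), (s ^ 2 - (s - w) ^ 2 - (61 * C ^ 3 * scale Z * w + φ * (T + w) * M)) ≤
      ∫ s in T..(T + w), r s := by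
    refine integral_mono_on (by linarith) (by apply Continuous.intervalIntegrable; fun_prop) hri
      fun s hs => ?_
    have e1 := (abs_le.1 (h.selberg a hw (hT.trans hs.1))).1
    have e2 : ∀ t, classSum q Z selbergFn a t =
        classSum q Z (fun n => Λ n * Real.log n) a t + classSum q Z LL a t := by
      intro t
      unfold classSum logSum
      rw [← sum_add_distrib]
      refine sum_congr rfl fun n _ => ?_
      unfold cls wt
      split_ifs
      · rw [← add_div]; rfl
      · simp
      · simp
    rw [e2, e2] at e1
    have e3 := classSum_mul_log_sub_le (q := q) (Z := Z) a hw0.le hT hs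
    have e4 := mul_le_mul_of_nonneg_left e3 hφ.le
    simp only [hr]
    simp only [M]
    linarith
  rw [intervalIntegral.integral_sub (by apply Continuous.intervalIntegrable; fun_prop) (by simp),
    integral_sq_sub_sq, intervalIntegral.integral_const, smul_eq_mul] at h2
  nlinarith

lemma norm_incr_one_le (h : Expansion C q Z c d k) [NeZero q] {w : ℝ} (hw : 0 ≤ w) (s : ℝ) :
    ‖incr (1 : DirichletCharacter ℂ q) Z w s‖ ≤ w + 2 * C * scale Z := by
  have hC := h.one_le
  have hD := h.scale_pos
  have hCD : 0 ≤ C * scale Z := by positivity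
  rw [incr, charSum_one h.q_le, charSum_one h.q_le, ← Complex.ofReal_sub, Complex.norm_real,
    Real.norm_eq_abs]
  rcases lt_or_ge s 0 with hs | hs
  · rw [totalSum, totalSum, logSum_of_neg _ hs, logSum_of_neg _ (by linarith)]
    simp; nlinarith
  have h1 := h.mertens s hs
  rcases lt_or_ge (s - w) 0 with hs' | hs'
  · rw [totalSum, totalSum, logSum_of_neg _ hs', sub_zero]
    rw [totalSum] at h1
    rw [abs_le] at h1 ⊢
    constructor <;> linarith
  · have h2 := h.mertens _ hs'
    rw [abs_le] at h1 h2 ⊢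
    constructor <;> linarith

lemma sum_norm_incr_sq_le (h : Expansion C q Z c d k) [NeZero q] {c₀ : ℝ} (hc₀ : 0 < c₀)
    {S : Finset (DirichletCharacter ℂ q)} (hS : ∀ χ ∈ S, χ ≠ 1 ∧ c₀ ≤ ‖transform χ c‖) (w s : ℝ) :
    ∑ χ ∈ S, ‖incr χ Z w s‖ ^ 2 ≤ 256 * C ^ 4 * scale Z ^ 2 / c₀ ^ 2 := by
  have key : ∀ s, ∑ χ ∈ S, ‖charSum χ Z (fun n => Λ n) s‖ ^ 2 ≤ 64 * C ^ 4 * scale Z ^ 2 / c₀ ^ 2 := by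
    intro s
    rw [le_div_iff₀ (by positivity), sum_mul]
    refine le_trans ?_ (h.sum_norm_transform_mul_charSum_sq_le s)
    refine le_trans (sum_le_sum fun χ hχ => ?_) (sum_le_sum_of_subset_of_nonneg
      (fun χ hχ => by simpa using (hS χ hχ).1) fun _ _ _ => by positivity)
    rw [norm_mul, mul_pow, mul_comm]
    have := (hS χ hχ).2
    gcongr
  have h1 : ∑ χ ∈ S, ‖incr χ Z w s‖ ^ 2 ≤ ∑ χ ∈ S, (2 * ‖charSum χ Z (fun n => Λ n) s‖ ^ 2 +
      2 * ‖charSum χ Z (fun n => Λ n) (s - w)‖ ^ 2) := by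
    refine sum_le_sum fun χ _ => ?_
    have := norm_sub_le (charSum χ Z (fun n => Λ n) s) (charSum χ Z (fun n => Λ n) (s - w))
    rw [incr]
    nlinarith [norm_nonneg (charSum χ Z (fun n => Λ n) s - charSum χ Z (fun n => Λ n) (s - w)),
      sq_nonneg (‖charSum χ Z (fun n => Λ n) s‖ - ‖charSum χ Z (fun n => Λ n) (s - w)‖)]
  rw [sum_add_distrib, ← mul_sum, ← mul_sum] at h1
  have h2 := key s
  have h3 := key (s - w)
  have e : 256 * C ^ 4 * scale Z ^ 2 / c₀ ^ 2 = 4 * (64 * C ^ 4 * scale Z ^ 2 / c₀ ^ 2) := by ring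
  rw [e]
  linarith

lemma norm_kern_one_le (h : Expansion C q Z c d k) [NeZero q] {w U : ℝ} (hw : 0 ≤ w) (hU : 0 ≤ U) :
    ‖kern (1 : DirichletCharacter ℂ q) Z w U‖ ≤ U * (w + 2 * C * scale Z) ^ 2 := by
  have := sum_norm_kern_le Z {(1 : DirichletCharacter ℂ q)} hw hU
    (B := (w + 2 * C * scale Z) ^ 2) fun s => by
      rw [sum_singleton]
      exact pow_le_pow_left₀ (norm_nonneg _) (h.norm_incr_one_le hw s) 2
  simpa using this

/-- The mass bound with the contribution of all unexceptional characters estimated. -/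
theorem mass_ge_sub_exceptional (h : Expansion C q Z c d k) [NeZero q] (a : (ZMod q)ˣ)
    {w T c₀ : ℝ} (hw : scale Z ≤ w) (hT : w ≤ T) (hc₀ : 0 < c₀)
    (E : Finset (DirichletCharacter ℂ q)) (hE : 1 ∉ E)
    (hS : ∀ χ ∉ E, χ ≠ 1 → c₀ ≤ ‖transform χ c‖) :
    2 * T * w ^ 2 - 61 * C ^ 3 * scale Z * w ^ 2 - (T + w) * (w + 2 * C * scale Z) ^ 2 -
        (T + w) * (256 * C ^ 4 * scale Z ^ 2 / c₀ ^ 2) -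
        (∑ χ ∈ E, χ (a⁻¹ : (ZMod q)ˣ) * kern χ Z w (T + w)).re ≤
      q.totient * (w * (T + w)) *
        (classSum q Z (fun n => Λ n) a (T + w) - classSum q Z (fun n => Λ n) a (T - w)) := by
  classical
  have hD := h.scale_pos
  have hw0 : 0 < w := hD.trans_le hw
  have h1 := h.mass_ge a hw hT
  set F : DirichletCharacter ℂ q → ℂ := fun χ => χ (a⁻¹ : (ZMod q)ˣ) * kern χ Z w (T + w) with hF
  have hFn : ∀ χ, ‖F χ‖ = ‖kern χ Z w (T + w)‖ := fun χ => by simp [hF]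
  set S : Finset (DirichletCharacter ℂ q) := univ.filter fun χ => χ ∉ E ∧ χ ≠ 1 with hSdef
  have e : ∑ χ, F χ = F 1 + ∑ χ ∈ E, F χ + ∑ χ ∈ S, F χ := by
    rw [← sum_filter_add_sum_filter_not univ (fun χ => χ ∈ E)]
    have e1 : (univ.filter fun χ : DirichletCharacter ℂ q => χ ∉ E) = insert 1 S := by
      ext χ
      by_cases hχ : χ = 1 <;> simp [hSdef, hχ, hE]
    rw [e1, sum_insert (by simp [hSdef]), filter_mem_eq_inter, univ_inter]
    ring
  have h2 : ‖∑ χ ∈ S, F χ‖ ≤ (T + w) * (256 * C ^ 4 * scale Z ^ 2 / c₀ ^ 2) := by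
    refine (norm_sum_le _ _).trans ?_
    simp only [hFn]
    exact sum_norm_kern_le Z S hw0.le (by linarith) fun s => h.sum_norm_incr_sq_le hc₀
      (fun χ hχ => ⟨(mem_filter.1 hχ).2.2, hS χ (mem_filter.1 hχ).2.1 (mem_filter.1 hχ).2.2⟩) w s
  have h3 : ‖F 1‖ ≤ (T + w) * (w + 2 * C * scale Z) ^ 2 := by
    rw [hFn]; exact h.norm_kern_one_le hw0.le (by linarith)
  have h4 := (abs_le.1 (Complex.abs_re_le_norm (F 1))).2
  have h5 := (abs_le.1 (Complex.abs_re_le_norm (∑ χ ∈ S, F χ))).2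
  rw [e, Complex.add_re, Complex.add_re] at h1
  linarith

end Expansion

end Linnik

namespace Linnik

open Finset Filter Topology

lemma coprime_primorial_iff_rough {Z n : ℕ} (hZ : 2 ≤ Z) : n.Coprime (primorial Z) ↔ Rough Z n := by
  have e : n.Coprime (primorial Z) ↔ ∀ p ∈ (Z + 1).primesBelow, ¬ p ∣ n := by
    rw [primorial, Nat.coprime_prod_right_iff]
    refine forall₂_congr fun p hp => ?_
    rw [Nat.coprime_comm, (Nat.prime_of_mem_primesBelow hp).coprime_iff_not_dvd]
  rw [e, Rough]
  refine ⟨fun h => ⟨?_, h⟩, fun h => h.2⟩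
  rintro rfl
  exact h 2 (mem_primesBelow_succ.2 ⟨hZ, Nat.prime_two⟩) (dvd_zero 2)

section Lift

variable {q : ℕ} [NeZero q]

instance (Z : ℕ) : NeZero (q * primorial Z) :=
  ⟨mul_ne_zero (NeZero.ne q) (primorial_pos Z).ne'⟩

/-- The character supported on rough numbers. -/
noncomputable def lift (Z : ℕ) (χ : DirichletCharacter ℂ q) : DirichletCharacter ℂ (q * primorial Z) :=
  DirichletCharacter.changeLevel (dvd_mul_right q (primorial Z)) χ

lemma lift_apply {Z : ℕ} (hZ : 2 ≤ Z) (hqZ : q ≤ Z) (χ : DirichletCharacter ℂ q) (n : ℕ) :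
    lift Z χ n = if Rough Z n then χ n else 0 := by
  have hiff : IsUnit ((n : ℕ) : ZMod (q * primorial Z)) ↔ Rough Z n := by
    rw [ZMod.isUnit_iff_coprime, Nat.coprime_mul_iff_right, coprime_primorial_iff_rough hZ]
    exact ⟨fun h => h.2, fun h => ⟨h.coprime (NeZero.ne q) hqZ, h⟩⟩
  split_ifs with h
  · obtain ⟨u, hu⟩ := hiff.2 h
    rw [lift, ← hu, DirichletCharacter.changeLevel_eq_cast_of_dvd]
    congr 1
    rw [hu, ZMod.cast_natCast (dvd_mul_right q (primorial Z))]
  · exact MulChar.map_nonunit _ fun hu => h (hiff.1 hu)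

/-- The Dirichlet series of a character over rough numbers, at `1 + σ`. -/
noncomputable def roughL (Z : ℕ) (χ : DirichletCharacter ℂ q) (σ : ℝ) : ℂ :=
  LSeries (fun n => lift Z χ n) (1 + σ)

lemma tendsto_logSum_tw {Z : ℕ} (hZ : 2 ≤ Z) (hqZ : q ≤ Z) (χ : DirichletCharacter ℂ q) {σ : ℝ}
    (hσ : 0 < σ) :
    Tendsto (logSum fun n => tw χ Z (fun _ => 1) n * (Real.exp (-σ * Real.log n) : ℂ)) atTop
      (𝓝 (roughL Z χ σ)) := by
  have hs : LSeriesSummable (fun n => lift Z χ n) (1 + σ) :=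
    ZMod.LSeriesSummable_of_one_lt_re _ (by simpa using hσ)
  have h1 := (hs.LSeriesHasSum.tendsto_sum_nat).comp
    ((tendsto_add_atTop_nat 1).comp (tendsto_nat_floor_atTop.comp Real.tendsto_exp_atTop))
  refine h1.congr fun t => ?_
  simp only [Function.comp_apply, logSum]
  rw [Finset.range_eq_Ico, Finset.sum_eq_sum_Ico_succ_bot (Nat.succ_pos _), LSeries.term_zero,
    zero_add]
  refine sum_congr (by ext; simp [Nat.succ_le_iff]) fun n hn => ?_
  have hn0 : n ≠ 0 := by have := (mem_Ioc.1 hn).1; omega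
  rw [LSeries.term_of_ne_zero hn0, lift_apply hZ hqZ, tw, wt]
  have hn' : (n : ℂ) ≠ 0 := by exact_mod_cast hn0
  by_cases hr : Rough Z n
  · rw [if_pos hr, if_pos hr, Complex.cpow_add _ _ hn', Complex.cpow_one,
      Complex.cpow_def_of_ne_zero hn', ← Complex.natCast_log, neg_mul, Real.exp_neg]
    push_cast
    rw [mul_comm (σ : ℂ), div_mul_eq_div_div, div_eq_mul_inv (_ / _)]
    ring
  · simp [hr]

lemma hasProd_roughL (Z : ℕ) (χ : DirichletCharacter ℂ q) {σ : ℝ} (hσ : 0 < σ) :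
    HasProd (fun p : Nat.Primes => (1 - lift Z χ p * ((Real.exp (-(1 + σ) * Real.log p) : ℝ) : ℂ))⁻¹)
      (roughL Z χ σ) := by
  have h := DirichletCharacter.LSeries_eulerProduct_hasProd (lift Z χ) (s := 1 + σ)
    (by simpa using hσ)
  unfold roughL
  convert h using 5 with p
  have hp : ((p : ℕ) : ℂ) ≠ 0 := by exact_mod_cast p.2.ne_zero
  rw [Complex.cpow_def_of_ne_zero hp, ← Complex.natCast_log]
  push_cast
  ring_nf

lemma norm_roughL_cube_mul_ge (Z : ℕ) (χ : DirichletCharacter ℂ q) {σ : ℝ} (hσ : 0 < σ) :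
    1 ≤ ‖roughL Z (1 : DirichletCharacter ℂ q) σ‖ ^ 3 * ‖roughL Z χ σ‖ ^ 4 * ‖roughL Z (χ ^ 2) σ‖ := by
  have h := DirichletCharacter.norm_LSeries_product_ge_one (lift Z χ) hσ 0
  rw [norm_mul, norm_mul, norm_pow, norm_pow] at h
  simpa [roughL, lift] using h

/-- Nonnegativity of an Euler product of real characters. -/
lemma one_le_prod_norm_roughL (Z : ℕ) (S : Finset (DirichletCharacter ℂ q)) {σ : ℝ} (hσ : 0 < σ)
    (hS : ∀ (p : Nat.Primes) (x : ℝ), 0 ≤ x → x ≤ 1 → ∏ χ ∈ S, ‖1 - lift Z χ p * (x : ℂ)‖ ≤ 1) :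
    1 ≤ ∏ χ ∈ S, ‖roughL Z χ σ‖ := by
  have hx : ∀ p : Nat.Primes, Real.exp (-(1 + σ) * Real.log p) < 1 := fun p => by
    rw [Real.exp_lt_one_iff]
    have := Real.log_pos (show (1 : ℝ) < p by exact_mod_cast p.2.one_lt)
    nlinarith
  have h1 : Tendsto (fun A : Finset Nat.Primes => ∏ χ ∈ S, ∏ p ∈ A,
      ‖(1 - lift Z χ p * ((Real.exp (-(1 + σ) * Real.log p) : ℝ) : ℂ))⁻¹‖) atTop
      (𝓝 (∏ χ ∈ S, ‖roughL Z χ σ‖)) :=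
    tendsto_finsetProd S fun χ _ => (hasProd_roughL Z χ hσ).norm
  refine ge_of_tendsto' h1 fun A => ?_
  rw [Finset.prod_comm]
  refine Finset.prod_induction _ (fun y : ℝ => 1 ≤ y) (fun a b ha hb => one_le_mul_of_one_le_of_one_le ha hb)
    le_rfl fun p _ => ?_
  simp only [norm_inv]
  rw [prod_inv_distrib]
  refine (one_le_inv₀ (prod_pos fun χ _ => ?_)).2 (hS p _ (Real.exp_pos _).le (hx p).le)
  rw [norm_pos_iff, sub_ne_zero]
  intro h
  have h2 := congrArg norm h
  rw [norm_one, norm_mul, Complex.norm_real, Real.norm_eq_abs, abs_of_pos (Real.exp_pos _)] at h2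
  have h3 := (lift Z χ).norm_le_one p
  nlinarith [hx p, Real.exp_pos (-(1 + σ) * Real.log p)]

lemma apply_eq_of_sq_eq_one {N : ℕ} {ψ : DirichletCharacter ℂ N} (h : ψ ^ 2 = 1) {x : ZMod N}
    (hx : IsUnit x) : ψ x = 1 ∨ ψ x = -1 := by
  rw [← sq_eq_one_iff, ← MulChar.pow_apply' ψ two_ne_zero, h, MulChar.one_apply hx]

lemma lift_sq_eq_one (Z : ℕ) {χ : DirichletCharacter ℂ q} (h : χ ^ 2 = 1) : lift Z χ ^ 2 = 1 := by
  rw [lift, ← map_pow, h, map_one]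

lemma norm_one_sub_ofReal {x : ℝ} (h : x ≤ 1) : ‖(1 : ℂ) - x‖ = 1 - x := by
  rw [← Complex.ofReal_one, ← Complex.ofReal_sub, Complex.norm_real, Real.norm_eq_abs,
    abs_of_nonneg (by linarith)]

lemma norm_one_add_ofReal {x : ℝ} (h : 0 ≤ x) : ‖(1 : ℂ) + x‖ = 1 + x := by
  rw [← Complex.ofReal_one, ← Complex.ofReal_add, Complex.norm_real, Real.norm_eq_abs,
    abs_of_nonneg (by linarith)]

lemma inv_one_sub_mul_eq_norm {N : ℕ} {ψ : DirichletCharacter ℂ N} (h : ψ ^ 2 = 1) (y : ZMod N) {x : ℝ}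
    (hx0 : 0 ≤ x) (hx : x ≤ 1) : (1 - ψ y * (x : ℂ))⁻¹ = (‖(1 - ψ y * (x : ℂ))⁻¹‖ : ℝ) := by
  by_cases hu : IsUnit y
  · rcases apply_eq_of_sq_eq_one h hu with e | e
    · rw [e, one_mul, norm_inv, norm_one_sub_ofReal hx]
      push_cast
      rfl
    · rw [e, neg_mul, one_mul, sub_neg_eq_add, norm_inv, norm_one_add_ofReal hx0]
      push_cast
      rfl
  · simp [MulChar.map_nonunit _ hu]

lemma roughL_eq_norm (Z : ℕ) {χ : DirichletCharacter ℂ q} (h : χ ^ 2 = 1) {σ : ℝ} (hσ : 0 < σ) :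
    roughL Z χ σ = ‖roughL Z χ σ‖ := by
  have h1 := hasProd_roughL Z χ hσ
  have h2 := h1.norm.map Complex.ofRealHom Complex.continuous_ofReal
  have e : (fun p : Nat.Primes =>
      (1 - lift Z χ p * ((Real.exp (-(1 + σ) * Real.log p) : ℝ) : ℂ))⁻¹) =
      Complex.ofRealHom ∘ fun p : Nat.Primes =>
        ‖(1 - lift Z χ p * ((Real.exp (-(1 + σ) * Real.log p) : ℝ) : ℂ))⁻¹‖ := by
    ext p
    refine inv_one_sub_mul_eq_norm (lift_sq_eq_one Z h) _ (Real.exp_pos _).le ?_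
    rw [Real.exp_le_one_iff]
    have := Real.log_pos (show (1 : ℝ) < p by exact_mod_cast p.2.one_lt)
    nlinarith
  rw [e] at h1
  exact h1.unique h2

lemma one_le_norm_roughL_mul (Z : ℕ) {χ : DirichletCharacter ℂ q} (h : χ ^ 2 = 1) (h1 : χ ≠ 1)
    {σ : ℝ} (hσ : 0 < σ) :
    1 ≤ ‖roughL Z (1 : DirichletCharacter ℂ q) σ‖ * ‖roughL Z χ σ‖ := by
  classical
  have key := one_le_prod_norm_roughL Z {1, χ} hσ fun p x hx0 hx1 => by
    rw [prod_pair h1.symm]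
    by_cases hu : IsUnit ((p : ℕ) : ZMod (q * primorial Z))
    · rw [show lift Z (1 : DirichletCharacter ℂ q) = 1 from map_one _, MulChar.one_apply hu, one_mul,
        norm_one_sub_ofReal hx1]
      rcases apply_eq_of_sq_eq_one (lift_sq_eq_one Z h) hu with e | e
      · rw [e, one_mul, norm_one_sub_ofReal hx1]; nlinarith
      · rw [e, neg_one_mul, sub_neg_eq_add, norm_one_add_ofReal hx0]; nlinarith
    · simp [MulChar.map_nonunit _ hu]
  rwa [prod_pair h1.symm] at key

lemma one_le_norm_roughL_mul_four (Z : ℕ) {χ ψ : DirichletCharacter ℂ q} (h : χ ^ 2 = 1)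
    (h' : ψ ^ 2 = 1) (h1 : χ ≠ 1) (h1' : ψ ≠ 1) (hne : χ ≠ ψ) {σ : ℝ} (hσ : 0 < σ) :
    1 ≤ ‖roughL Z (1 : DirichletCharacter ℂ q) σ‖ *
      (‖roughL Z χ σ‖ * (‖roughL Z ψ σ‖ * ‖roughL Z (χ * ψ) σ‖)) := by
  classical
  have e1 : (1 : DirichletCharacter ℂ q) ≠ χ * ψ := fun e => hne (by
    have := congrArg (χ * ·) e
    simpa [← mul_assoc, ← pow_two, h] using this)
  have e2 : χ ≠ χ * ψ := by simpa using h1'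
  have e3 : ψ ≠ χ * ψ := by simpa using h1
  have key := one_le_prod_norm_roughL Z {1, χ, ψ, χ * ψ} hσ fun p x hx0 hx1 => by
    rw [prod_insert (by simp [h1.symm, h1'.symm, e1]), prod_insert (by simp [hne, e2]),
      prod_pair e3]
    by_cases hu : IsUnit ((p : ℕ) : ZMod (q * primorial Z))
    · rw [show lift Z (1 : DirichletCharacter ℂ q) = 1 from map_one _, MulChar.one_apply hu, one_mul,
        norm_one_sub_ofReal hx1, show lift Z (χ * ψ) = lift Z χ * lift Z ψ from map_mul _ _ _,
        MulChar.mul_apply]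
      have a1 : (1 - x) * (1 - x) ≤ 1 := by nlinarith
      have a2 : (1 - x) * (1 + x) ≤ 1 := by nlinarith
      have a3 : 0 ≤ 1 - x := by linarith
      rcases apply_eq_of_sq_eq_one (lift_sq_eq_one Z h) hu with e | e <;>
      rcases apply_eq_of_sq_eq_one (lift_sq_eq_one Z h') hu with e' | e' <;>
      simp only [e, e', one_mul, mul_one, neg_mul, mul_neg, neg_neg, sub_neg_eq_add,
        norm_one_sub_ofReal hx1, norm_one_add_ofReal hx0]
      · nlinarith [mul_nonneg a3 a3]
      · nlinarith [mul_nonneg a3 (by linarith : 0 ≤ 1 + x)]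
      · nlinarith [mul_nonneg a3 (by linarith : 0 ≤ 1 + x)]
      · nlinarith [mul_nonneg a3 (by linarith : 0 ≤ 1 + x)]
    · simp [MulChar.map_nonunit _ hu]
  rwa [prod_insert (by simp [h1.symm, h1'.symm, e1]), prod_insert (by simp [hne, e2]),
    prod_pair e3] at key

end Lift

end Linnik

namespace Linnik

open Finset Filter Topology MeasureTheory intervalIntegral
open scoped ArithmeticFunction.vonMangoldt

section

variable {q : ℕ} [NeZero q]

lemma norm_transform_sub_le {χ : DirichletCharacter ℂ q} (hχ : χ ≠ 1) {F G : (ZMod q)ˣ → ℝ} {x y : ℝ}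
    (h : ∀ b, |F b - (y + G b)| ≤ x / q.totient) : ‖transform χ F - transform χ G‖ ≤ x := by
  rw [← transform_add_const hχ G y, transform, transform, ← sum_sub_distrib]
  refine (norm_sum_le _ _).trans ?_
  rw [← sum_div_totient (q := q) x]
  refine sum_le_sum fun b _ => ?_
  rw [← mul_sub, norm_mul, ← Complex.ofReal_sub, Complex.norm_real, Real.norm_eq_abs]
  have h1 := χ.norm_le_one b
  have h2 := h b
  nlinarith [abs_nonneg (F b - (y + G b))]

lemma norm_transform_le (χ : DirichletCharacter ℂ q) {F : (ZMod q)ˣ → ℝ} {x : ℝ}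
    (h : ∀ b, |F b| ≤ x / q.totient) : ‖transform χ F‖ ≤ x := by
  rw [transform]
  refine (norm_sum_le _ _).trans ?_
  rw [← sum_div_totient (q := q) x]
  refine sum_le_sum fun b _ => ?_
  rw [norm_mul, Complex.norm_real, Real.norm_eq_abs]
  have h1 := χ.norm_le_one b
  have h2 := h b
  nlinarith [abs_nonneg (F b)]

end

lemma classSum_eq_logSum_mul (q Z : ℕ) (f : ℕ → ℝ) (b : (ZMod q)ˣ) (t : ℝ) :
    classSum q Z f b t = logSum (fun n => cls q Z (fun _ => 1) b n * f n) t := by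
  rw [classSum]
  congr 1
  ext n
  simp only [cls, wt]
  split_ifs <;> ring

lemma totalSum_eq_logSum_mul (Z : ℕ) (f : ℕ → ℝ) (t : ℝ) :
    totalSum Z f t = logSum (fun n => wt Z (fun _ => 1) n * f n) t := by
  rw [totalSum]
  congr 1
  ext n
  simp only [wt]
  split_ifs <;> ring

lemma charSum_eq_logSum_mul {q : ℕ} (χ : DirichletCharacter ℂ q) (Z : ℕ) (f : ℕ → ℝ) (t : ℝ) :
    charSum χ Z f t = logSum (fun n => tw χ Z (fun _ => 1) n * (f n : ℂ)) t := by
  rw [charSum]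
  congr 1
  ext n
  simp only [tw, wt]
  split_ifs
  · push_cast; ring
  · simp

lemma integral_exp_neg_div_mul_le {D : ℝ} (hD : 0 < D) {t : ℝ} (ht : 0 ≤ t) :
    ∫ s in (0 : ℝ)..t, s * Real.exp (-s / D) ≤ D ^ 2 := by
  have h : ∀ s ∈ Set.uIcc 0 t, HasDerivAt (fun s => -(D * s + D ^ 2) * Real.exp (-s / D))
      (s * Real.exp (-s / D)) s := by
    intro s _
    have h1 : HasDerivAt (fun s : ℝ => -s / D) (-1 / D) s := (hasDerivAt_id s).neg.div_const D
    have h2 := (((hasDerivAt_id s).const_mul D).add_const (D ^ 2)).neg.mul h1.exp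
    refine h2.congr_deriv ?_
    simp only [id, Pi.neg_apply]
    field_simp
    ring
  rw [integral_eq_sub_of_hasDerivAt h (by apply Continuous.intervalIntegrable; fun_prop)]
  have : 0 ≤ (D * t + D ^ 2) * Real.exp (-t / D) := by positivity
  simp
  linarith

namespace Expansion

variable {C : ℝ} {q Z : ℕ} {c d k : (ZMod q)ˣ → ℝ}

lemma two_le (h : Expansion C q Z c d k) : 2 ≤ Z := by
  by_contra! hlt
  have h1 := h.one_le_scale
  rw [scale] at h1
  interval_cases Z <;> norm_num at h1

lemma abs_classSum_exp_sub_le (h : Expansion C q Z c d k) {σ t : ℝ} (hσ : 0 < σ) (ht : 0 ≤ t) :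
    ∃ X : ℝ, ∀ b : (ZMod q)ˣ,
      |classSum q Z (fun n => Real.exp (-σ * Real.log n) - 1 + σ * Real.log n) b t - X| ≤
        (C * (σ * (t * Real.exp (-t / scale Z)) + σ ^ 2 * scale Z ^ 2)) / q.totient := by
  have hD := h.scale_pos
  have hφ := h.totient_pos
  have hC := h.one_le
  set f : ℝ → ℝ := fun x => Real.exp (-σ * x) - 1 + σ * x with hf
  set f' : ℝ → ℝ := fun x => σ * (1 - Real.exp (-σ * x)) with hf'
  have hder : ∀ s, HasDerivAt f (f' s) s := fun s => by
    have h1 := (((hasDerivAt_id s).const_mul (-σ)).exp.sub_const 1).add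
      ((hasDerivAt_id s).const_mul σ)
    refine h1.congr_deriv ?_
    simp only [hf', id]; ring
  have hcont : Continuous f' := by fun_prop
  have hcf : Continuous f := by fun_prop
  have hf'0 : ∀ s, 0 ≤ s → 0 ≤ f' s ∧ f' s ≤ σ ^ 2 * s := fun s hs => by
    have h1 : Real.exp (-σ * s) ≤ 1 := Real.exp_le_one_iff.2 (by nlinarith)
    have h2 := Real.add_one_le_exp (-σ * s)
    constructor <;> simp only [hf'] <;> nlinarith
  have hft : |f t| ≤ σ * t := by
    have h1 : Real.exp (-σ * t) ≤ 1 := Real.exp_le_one_iff.2 (by nlinarith)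
    have h2 := Real.add_one_le_exp (-σ * t)
    rw [abs_le]
    constructor <;> simp only [hf] <;> nlinarith
  set v := roughDensity Z / q.totient with hv
  refine ⟨v * t * f t - ∫ s in (0 : ℝ)..t, v * s * f' s, fun b => ?_⟩
  rw [classSum_eq_logSum_mul]
  have e1 := logSum_mul_eq (c := cls q Z (fun _ => 1) b) hder hcont ht
  have e2 : ∫ s in (0 : ℝ)..t, f' s = f t := by
    rw [integral_eq_sub_of_hasDerivAt (fun s _ => hder s) (hcont.intervalIntegrable _ _)]
    simp [hf]
  have hi1 : IntervalIntegrable (fun s => logSum (cls q Z (fun _ => 1) b) s * f' s) volume 0 t :=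
    (intervalIntegrable_logSum _ 0 t).mul_continuousOn hcont.continuousOn
  have hi2 : IntervalIntegrable (fun s => v * s * f' s) volume 0 t :=
    Continuous.intervalIntegrable (by fun_prop) _ _
  have hi3 : IntervalIntegrable (fun s => c b * f' s) volume 0 t :=
    Continuous.intervalIntegrable (by fun_prop) _ _
  have e3 : logSum (fun n => cls q Z (fun _ => 1) b n * f (Real.log n)) t -
      (v * t * f t - ∫ s in (0 : ℝ)..t, v * s * f' s) =
      (classSum q Z (fun _ => 1) b t - (v * t + c b)) * f t -
        ∫ s in (0 : ℝ)..t, (classSum q Z (fun _ => 1) b s - (v * s + c b)) * f' s := by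
    have e4 : ∫ s in (0 : ℝ)..t, (classSum q Z (fun _ => 1) b s - (v * s + c b)) * f' s =
        (∫ s in (0 : ℝ)..t, logSum (cls q Z (fun _ => 1) b) s * f' s) -
          (∫ s in (0 : ℝ)..t, v * s * f' s) - ∫ s in (0 : ℝ)..t, c b * f' s := by
      rw [← intervalIntegral.integral_sub hi1 hi2, ← intervalIntegral.integral_sub (hi1.sub hi2) hi3]
      refine integral_congr fun s _ => ?_
      simp only [classSum]; ring
    rw [e4, e1, intervalIntegral.integral_const_mul, e2, classSum]
    ring
  refine le_trans (le_of_eq (congrArg abs e3)) ?_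
  have b1 : |(classSum q Z (fun _ => 1) b t - (v * t + c b)) * f t| ≤
      C / q.totient * Real.exp (-t / scale Z) * (σ * t) := by
    rw [abs_mul]
    exact mul_le_mul (h.one b t ht) hft (abs_nonneg _) (by positivity)
  have b2 : |∫ s in (0 : ℝ)..t, (classSum q Z (fun _ => 1) b s - (v * s + c b)) * f' s| ≤
      ∫ s in (0 : ℝ)..t, C / q.totient * σ ^ 2 * (s * Real.exp (-s / scale Z)) := by
    refine intervalIntegral.norm_integral_le_of_norm_le (f := fun s =>
      (classSum q Z (fun _ => 1) b s - (v * s + c b)) * f' s) ht ?_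
      (Continuous.intervalIntegrable (by fun_prop) _ _)
    refine Eventually.of_forall fun s hs => ?_
    rw [norm_mul, Real.norm_eq_abs, Real.norm_eq_abs, abs_of_nonneg (hf'0 s hs.1.le).1]
    calc _ ≤ C / q.totient * Real.exp (-s / scale Z) * (σ ^ 2 * s) :=
          mul_le_mul (h.one b s hs.1.le) (hf'0 s hs.1.le).2 (hf'0 s hs.1.le).1 (by positivity)
      _ = _ := by ring
  rw [intervalIntegral.integral_const_mul] at b2
  have b3 := mul_le_mul_of_nonneg_left (integral_exp_neg_div_mul_le hD ht)
    (show 0 ≤ C / q.totient * σ ^ 2 by positivity)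
  refine (abs_sub _ _).trans ((add_le_add b1 (b2.trans b3)).trans (le_of_eq ?_))
  ring

lemma norm_charSum_one_sub_le (h : Expansion C q Z c d k) [NeZero q] {χ : DirichletCharacter ℂ q}
    (hχ : χ ≠ 1) {t : ℝ} (ht : 0 ≤ t) :
    ‖charSum χ Z (fun _ => 1) t - transform χ c‖ ≤ C * Real.exp (-t / scale Z) := by
  rw [charSum_eq_transform h.q_le]
  refine norm_transform_sub_le hχ (y := roughDensity Z / q.totient * t) fun b => ?_
  exact (h.one b t ht).trans (le_of_eq (by ring))

lemma norm_charSum_log_sub_le (h : Expansion C q Z c d k) [NeZero q] {χ : DirichletCharacter ℂ q}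
    (hχ : χ ≠ 1) {t : ℝ} (ht : 0 ≤ t) :
    ‖charSum χ Z (fun n => Real.log n) t - transform χ d‖ ≤
      C * scale Z * Real.exp (-t / scale Z) := by
  rw [charSum_eq_transform h.q_le]
  refine norm_transform_sub_le hχ (y := roughDensity Z / q.totient * t ^ 2 / 2) fun b => ?_
  exact (h.log b t ht).trans (le_of_eq (by ring))

lemma tendsto_exp_neg_div {D : ℝ} (hD : 0 < D) :
    Tendsto (fun t : ℝ => Real.exp (-t / D)) atTop (𝓝 0) := by
  refine Real.tendsto_exp_atBot.comp ?_
  simp only [neg_div]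
  exact tendsto_neg_atTop_atBot.comp (tendsto_id.atTop_div_const hD)

lemma tendsto_charSum_one (h : Expansion C q Z c d k) [NeZero q] {χ : DirichletCharacter ℂ q}
    (hχ : χ ≠ 1) : Tendsto (charSum χ Z (fun _ => 1)) atTop (𝓝 (transform χ c)) := by
  rw [tendsto_iff_norm_sub_tendsto_zero]
  refine squeeze_zero' (Eventually.of_forall fun t => norm_nonneg _)
    ((eventually_ge_atTop 0).mono fun t ht => h.norm_charSum_one_sub_le hχ ht) ?_
  simpa using (tendsto_exp_neg_div h.scale_pos).const_mul C

lemma tendsto_charSum_log (h : Expansion C q Z c d k) [NeZero q] {χ : DirichletCharacter ℂ q}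
    (hχ : χ ≠ 1) : Tendsto (charSum χ Z (fun n => Real.log n)) atTop (𝓝 (transform χ d)) := by
  rw [tendsto_iff_norm_sub_tendsto_zero]
  refine squeeze_zero' (Eventually.of_forall fun t => norm_nonneg _)
    ((eventually_ge_atTop 0).mono fun t ht => h.norm_charSum_log_sub_le hχ ht) ?_
  simpa using (tendsto_exp_neg_div h.scale_pos).const_mul (C * scale Z)

/-- Expansion of the rough Dirichlet series near `1` to first order. -/
lemma norm_roughL_sub_le (h : Expansion C q Z c d k) [NeZero q] {χ : DirichletCharacter ℂ q}
    (hχ : χ ≠ 1) {σ : ℝ} (hσ : 0 < σ) :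
    ‖roughL Z χ σ - (transform χ c - σ * transform χ d)‖ ≤ C * (σ ^ 2 * scale Z ^ 2) := by
  have hD := h.scale_pos
  have h1 : Tendsto (fun t => charSum χ Z
      (fun n => Real.exp (-σ * Real.log n) - 1 + σ * Real.log n) t) atTop
      (𝓝 (roughL Z χ σ - transform χ c + σ * transform χ d)) := by
    have h2 := ((tendsto_logSum_tw h.two_le h.q_le χ hσ).sub (h.tendsto_charSum_one hχ)).add
      ((h.tendsto_charSum_log hχ).const_mul (σ : ℂ))
    refine h2.congr fun t => ?_
    rw [charSum_eq_logSum_mul _ _ (fun n => Real.log n),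
      charSum_eq_logSum_mul _ _ (fun n => Real.exp (-σ * Real.log n) - 1 + σ * Real.log n), charSum]
    simp only [logSum, mul_sum, ← sum_sub_distrib, ← sum_add_distrib]
    refine sum_congr rfl fun n _ => ?_
    push_cast
    ring
  have h3 : Tendsto (fun t : ℝ => C * (σ * (t * Real.exp (-t / scale Z)) + σ ^ 2 * scale Z ^ 2)) atTop
      (𝓝 (C * (σ * 0 + σ ^ 2 * scale Z ^ 2))) := by
    refine ((Tendsto.const_mul σ ?_).add_const _).const_mul C
    refine squeeze_zero' ((eventually_ge_atTop 0).mono fun t ht => by positivity)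
      (Eventually.of_forall fun t => mul_exp_neg_div_le hD) ?_
    simpa using (tendsto_exp_neg_div (D := 2 * scale Z) (by positivity)).const_mul (2 * scale Z)
  rw [mul_zero, zero_add] at h3
  have h4 := le_of_tendsto_of_tendsto h1.norm h3 ((eventually_ge_atTop 0).mono fun t ht => by
    obtain ⟨X, hX⟩ := h.abs_classSum_exp_sub_le hσ ht
    have := norm_transform_sub_le hχ (G := fun _ => 0) (y := X) (by simpa only [add_zero] using hX)
    beta_reduce
    rw [charSum_eq_transform h.q_le]
    rwa [show transform χ (fun _ => (0 : ℝ)) = 0 by simp [transform], sub_zero] at this)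
  rwa [← sub_add]

lemma norm_roughL_one_le (h : Expansion C q Z c d k) [NeZero q] {σ : ℝ} (hσ : 0 < σ) :
    ‖roughL Z (1 : DirichletCharacter ℂ q) σ‖ ≤ roughDensity Z / σ + 3 * C := by
  set V := roughDensity Z
  have hV : 0 < V := roughDensity_pos Z
  refine le_of_tendsto (tendsto_logSum_tw h.two_le h.q_le (1 : DirichletCharacter ℂ q) hσ).norm
    ((eventually_ge_atTop 0).mono fun t ht => ?_)
  rw [← charSum_eq_logSum_mul (1 : DirichletCharacter ℂ q) Z (fun n => Real.exp (-σ * Real.log n)),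
    charSum_one h.q_le, Complex.norm_real, Real.norm_eq_abs, totalSum_eq_logSum_mul]
  have hder : ∀ s, HasDerivAt (fun x => Real.exp (-σ * x)) (-σ * Real.exp (-σ * s)) s := fun s => by
    have h1 := ((hasDerivAt_id s).const_mul (-σ)).exp
    refine h1.congr_deriv ?_
    simp only [id]; ring
  have e1 := logSum_mul_eq (c := wt Z (fun _ => 1)) hder (by fun_prop) ht
  rw [abs_of_nonneg (logSum_nonneg (fun n => mul_nonneg (wt_nonneg (fun _ => zero_le_one) n)
    (Real.exp_pos _).le) _)]
  refine e1.trans_le ?_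
  have e2 : ∫ s in (0 : ℝ)..t, (V * s + 3 * C) * (σ * Real.exp (-σ * s)) =
      (V / σ + 3 * C) - (V * t + 3 * C + V / σ) * Real.exp (-σ * t) := by
    have hd : ∀ s ∈ Set.uIcc 0 t, HasDerivAt (fun s => -(V * s + (3 * C + V / σ)) * Real.exp (-σ * s))
        ((V * s + 3 * C) * (σ * Real.exp (-σ * s))) s := fun s _ => by
      have h2 := (((hasDerivAt_id s).const_mul V).add_const (3 * C + V / σ)).neg.mul (hder s)
      refine h2.congr_deriv ?_
      simp only [id, Pi.neg_apply]
      field_simp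
      ring
    rw [integral_eq_sub_of_hasDerivAt hd (by apply Continuous.intervalIntegrable; fun_prop)]
    simp
    ring
  have e3 : -∫ s in (0 : ℝ)..t, logSum (wt Z fun _ => 1) s * (-σ * Real.exp (-σ * s)) ≤
      ∫ s in (0 : ℝ)..t, (V * s + 3 * C) * (σ * Real.exp (-σ * s)) := by
    rw [← intervalIntegral.integral_neg]
    refine integral_mono_on ht ((intervalIntegrable_logSum _ 0 t).mul_continuousOn
      (by fun_prop)).neg (by apply Continuous.intervalIntegrable; fun_prop) fun s hs => ?_
    have h1 := h.totalSum_one_le hs.1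
    rw [totalSum] at h1
    have h2 : 0 < σ * Real.exp (-σ * s) := by positivity
    nlinarith
  have e4 := h.totalSum_one_le ht
  rw [totalSum] at e4
  have e5 := mul_le_mul_of_nonneg_right e4 (Real.exp_pos (-σ * t)).le
  have e6 : 0 ≤ V / σ * Real.exp (-σ * t) := by positivity
  linarith

lemma norm_transform_c_le (h : Expansion C q Z c d k) [NeZero q] (χ : DirichletCharacter ℂ q) :
    ‖transform χ c‖ ≤ 2 * C := by
  have h1 := norm_transform_le χ h.abs_c
  have h2 : transform χ (fun b => c b - if b = 1 then 1 else 0) = transform χ c - 1 := by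
    simp only [transform]
    push_cast
    simp only [mul_sub, sum_sub_distrib]
    congr 1
    rw [sum_eq_single (1 : (ZMod q)ˣ)] <;> simp +contextual
  rw [h2] at h1
  have h3 := norm_sub_norm_le (transform χ c) 1
  rw [norm_one] at h3
  linarith [h.one_le]

lemma norm_transform_d_le (h : Expansion C q Z c d k) [NeZero q] (χ : DirichletCharacter ℂ q) :
    ‖transform χ d‖ ≤ C * scale Z := norm_transform_le χ h.abs_d

lemma norm_roughL_one_div_le (h : Expansion C q Z c d k) [NeZero q] {η : ℝ} (hη : 0 < η) (hη1 : η ≤ 1) :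
    ‖roughL Z (1 : DirichletCharacter ℂ q) (η / scale Z)‖ ≤ 4 * C / η := by
  have hD := h.scale_pos
  have hC := h.one_le
  refine (h.norm_roughL_one_le (div_pos hη hD)).trans ?_
  rw [le_div_iff₀ hη, add_mul, div_div_eq_mul_div, div_mul_cancel₀ _ hη.ne']
  nlinarith [h.density_le]

lemma norm_roughL_div_le (h : Expansion C q Z c d k) [NeZero q] {χ : DirichletCharacter ℂ q}
    (hχ : χ ≠ 1) {η : ℝ} (hη : 0 < η) (hη1 : η ≤ 1) :
    ‖roughL Z χ (η / scale Z)‖ ≤ ‖transform χ c‖ + 2 * C * η := by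
  have hD := h.scale_pos
  have hC := h.one_le
  have h1 := h.norm_roughL_sub_le hχ (div_pos hη hD)
  have h2 : ‖transform χ c - ((η / scale Z : ℝ) : ℂ) * transform χ d‖ ≤ ‖transform χ c‖ + η * C := by
    refine (norm_sub_le _ _).trans (add_le_add le_rfl ?_)
    rw [norm_mul, Complex.norm_real, Real.norm_eq_abs, abs_of_pos (div_pos hη hD)]
    calc η / scale Z * ‖transform χ d‖ ≤ η / scale Z * (C * scale Z) := by
          have := h.norm_transform_d_le χ; gcongr
      _ = η * C := by field_simp
  have h3 : C * ((η / scale Z) ^ 2 * scale Z ^ 2) = C * η ^ 2 := by field_simp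
  have h4 : C * η ^ 2 ≤ C * η := by nlinarith [mul_pos hη (show 0 < C by linarith)]
  have h5 := norm_le_norm_add_norm_sub' (roughL Z χ (η / scale Z))
    (transform χ c - ((η / scale Z : ℝ) : ℂ) * transform χ d)
  linarith

end Expansion

/-- The lower bound for the nonexceptional values of the transform of the constant terms. -/
noncomputable def gapConst (C : ℝ) : ℝ := 1 / (20737 * C ^ 8)

lemma gapConst_pos {C : ℝ} (hC : 1 ≤ C) : 0 < gapConst C := by rw [gapConst]; positivity

lemma gapConst_le_one {C : ℝ} (hC : 1 ≤ C) : gapConst C ≤ 1 := by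
  rw [gapConst, div_le_one (by positivity)]
  nlinarith [one_le_pow₀ hC (n := 8)]

lemma mul_gapConst_lt_one {C : ℝ} (hC : 1 ≤ C) : 20736 * C ^ 8 * gapConst C < 1 := by
  rw [gapConst, mul_one_div, div_lt_one (by positivity)]
  nlinarith [one_le_pow₀ hC (n := 8)]

namespace Expansion

variable {C : ℝ} {q Z : ℕ} {c d k : (ZMod q)ˣ → ℝ}

lemma gapConst_le_of_sq_ne_one (h : Expansion C q Z c d k) [NeZero q] {χ : DirichletCharacter ℂ q}
    (hχ : χ ^ 2 ≠ 1) : gapConst C ≤ ‖transform χ c‖ := by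
  by_contra! hlt
  have hC := h.one_le
  set η := gapConst C with hη
  have h0 : 0 < η := gapConst_pos hC
  have h1 : η ≤ 1 := gapConst_le_one hC
  have hχ1 : χ ≠ 1 := by rintro rfl; simp at hχ
  have k1 := h.norm_roughL_one_div_le h0 h1
  have k2 := h.norm_roughL_div_le hχ1 h0 h1
  have k3 := h.norm_roughL_div_le hχ h0 h1
  have k4 := h.norm_transform_c_le (χ ^ 2)
  have k2' : ‖roughL Z χ (η / scale Z)‖ ≤ 3 * C * η := by nlinarith
  have k3' : ‖roughL Z (χ ^ 2) (η / scale Z)‖ ≤ 4 * C := by nlinarith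
  have key := norm_roughL_cube_mul_ge Z χ (div_pos h0 h.scale_pos)
  have : ‖roughL Z (1 : DirichletCharacter ℂ q) (η / scale Z)‖ ^ 3 * ‖roughL Z χ (η / scale Z)‖ ^ 4 *
      ‖roughL Z (χ ^ 2) (η / scale Z)‖ ≤ (4 * C / η) ^ 3 * (3 * C * η) ^ 4 * (4 * C) := by gcongr
  have e : (4 * C / η) ^ 3 * (3 * C * η) ^ 4 * (4 * C) = 20736 * C ^ 8 * η := by field_simp; ring
  linarith [mul_gapConst_lt_one hC]

lemma gapConst_le_of_ne (h : Expansion C q Z c d k) [NeZero q] {χ ψ : DirichletCharacter ℂ q}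
    (hχ : χ ≠ 1) (hψ : ψ ≠ 1) (hne : χ ≠ ψ) (hlt : ‖transform χ c‖ < gapConst C) :
    gapConst C ≤ ‖transform ψ c‖ := by
  by_contra! hlt'
  have hχ2 : χ ^ 2 = 1 := by
    by_contra h2
    exact absurd (h.gapConst_le_of_sq_ne_one h2) (not_le.2 hlt)
  have hψ2 : ψ ^ 2 = 1 := by
    by_contra h2
    exact absurd (h.gapConst_le_of_sq_ne_one h2) (not_le.2 hlt')
  have hprod : χ * ψ ≠ 1 := fun e => hne (by
    have := congrArg (χ * ·) e
    simpa [← mul_assoc, ← pow_two, hχ2] using this.symm)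
  have hC := h.one_le
  set η := gapConst C with hη
  have h0 : 0 < η := gapConst_pos hC
  have h1 : η ≤ 1 := gapConst_le_one hC
  have k1 := h.norm_roughL_one_div_le h0 h1
  have k2 := h.norm_roughL_div_le hχ h0 h1
  have k3 := h.norm_roughL_div_le hψ h0 h1
  have k4 := h.norm_roughL_div_le hprod h0 h1
  have k5 := h.norm_transform_c_le (χ * ψ)
  have k2' : ‖roughL Z χ (η / scale Z)‖ ≤ 3 * C * η := by nlinarith
  have k3' : ‖roughL Z ψ (η / scale Z)‖ ≤ 3 * C * η := by nlinarith
  have k4' : ‖roughL Z (χ * ψ) (η / scale Z)‖ ≤ 4 * C := by nlinarith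
  have key := one_le_norm_roughL_mul_four Z hχ2 hψ2 hχ hψ hne (div_pos h0 h.scale_pos)
  have : ‖roughL Z (1 : DirichletCharacter ℂ q) (η / scale Z)‖ * (‖roughL Z χ (η / scale Z)‖ *
      (‖roughL Z ψ (η / scale Z)‖ * ‖roughL Z (χ * ψ) (η / scale Z)‖)) ≤
      4 * C / η * (3 * C * η * (3 * C * η * (4 * C))) := by gcongr
  have e : 4 * C / η * (3 * C * η * (3 * C * η * (4 * C))) = 144 * C ^ 4 * η := by field_simp; ring
  have e2 : 144 * C ^ 4 * η ≤ 20736 * C ^ 8 * η := by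
    have : C ^ 4 ≤ C ^ 8 := pow_le_pow_right₀ hC (by norm_num)
    have : 144 * C ^ 4 ≤ 20736 * C ^ 8 := by linarith [pow_pos (show 0 < C by linarith) 8]
    gcongr
  linarith [mul_gapConst_lt_one hC]

lemma transform_im_eq_zero [NeZero q] {χ : DirichletCharacter ℂ q} (hχ : χ ^ 2 = 1)
    (F : (ZMod q)ˣ → ℝ) : (transform χ F).im = 0 := by
  rw [transform, Complex.im_sum]
  refine sum_eq_zero fun b _ => ?_
  rcases apply_eq_of_sq_eq_one hχ b.isUnit with e | e <;> simp [e]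

/-- For a real character, the transform of the first order terms is negative when the transform of
the constant terms is small. -/
lemma scale_div_le_neg_transform_d (h : Expansion C q Z c d k) [NeZero q] {χ : DirichletCharacter ℂ q}
    (hχ : χ ^ 2 = 1) (hχ1 : χ ≠ 1) (hδ : (transform χ c).re ≤ 1 / (128 * C ^ 3)) :
    scale Z / (16 * C) ≤ -(transform χ d).re := by
  have hC := h.one_le
  have hD := h.scale_pos
  set η := 1 / (8 * C ^ 2) with hη
  have hη0 : 0 < η := by positivity
  have hη1 : η ≤ 1 := by rw [hη, div_le_one (by positivity)]; nlinarith
  have k1 := h.norm_roughL_one_div_le hη0 hη1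
  have k2 := one_le_norm_roughL_mul Z hχ hχ1 (div_pos hη0 hD)
  have k3 : η / (4 * C) ≤ ‖roughL Z χ (η / scale Z)‖ := by
    rw [div_le_iff₀ (by positivity)]
    have k4 : 1 ≤ 4 * C / η * ‖roughL Z χ (η / scale Z)‖ :=
      k2.trans (mul_le_mul_of_nonneg_right k1 (norm_nonneg _))
    rw [div_mul_eq_mul_div, le_div_iff₀ hη0] at k4
    linarith
  have k5 := h.norm_roughL_sub_le hχ1 (div_pos hη0 hD)
  have k6 := (Complex.abs_re_le_norm _).trans k5
  rw [roughL_eq_norm Z hχ (div_pos hη0 hD)] at k6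
  simp only [Complex.sub_re, Complex.ofReal_re, Complex.re_ofReal_mul] at k6
  have k7 := (abs_le.1 k6).2
  have e1 : C * ((η / scale Z) ^ 2 * scale Z ^ 2) = 1 / (64 * C ^ 3) := by rw [hη]; field_simp; norm_num
  have e2 : η / (4 * C) = 1 / (32 * C ^ 3) := by rw [hη]; field_simp; norm_num
  have e3 : 1 / (32 * C ^ 3) = 2 * (1 / (64 * C ^ 3)) := by field_simp; norm_num
  have e4 : 1 / (64 * C ^ 3) = 2 * (1 / (128 * C ^ 3)) := by field_simp; norm_num
  have k8 : 1 / (128 * C ^ 3) ≤ η / scale Z * -(transform χ d).re := by linarith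
  have e5 : 1 / (128 * C ^ 3) = η / scale Z * (scale Z / (16 * C)) := by rw [hη]; field_simp; norm_num
  rw [e5] at k8
  exact le_of_mul_le_mul_left k8 (by positivity)

end Expansion

end Linnik

namespace Linnik

open Finset Filter Topology MeasureTheory intervalIntegral
open scoped ArithmeticFunction.vonMangoldt

lemma integral_logSum_real (c : ℕ → ℝ) {t : ℝ} (ht : 0 ≤ t) :
    ∫ s in (0 : ℝ)..t, logSum c s = ∑ n ∈ Ioc 0 ⌊Real.exp t⌋₊, c n * (t - Real.log n) := by
  have h := logSum_mul_eq (c := c) (f := id) (f' := fun _ => 1) hasDerivAt_id continuous_const ht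
  simp only [id, mul_one] at h
  simp only [mul_sub, sum_sub_distrib, ← sum_mul]
  simp only [logSum] at h ⊢
  linarith

lemma integral_logSum_complex (g : ℕ → ℂ) {t : ℝ} (ht : 0 ≤ t) :
    ∫ s in (0 : ℝ)..t, logSum g s = ∑ n ∈ Ioc 0 ⌊Real.exp t⌋₊, g n * ((t - Real.log n : ℝ) : ℂ) := by
  have e : ∀ s, logSum g s = ((logSum (fun n => (g n).re) s : ℝ) : ℂ) +
      ((logSum (fun n => (g n).im) s : ℝ) : ℂ) * Complex.I := fun s => by
    simp only [logSum]
    push_cast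
    rw [sum_mul, ← sum_add_distrib]
    exact sum_congr rfl fun n _ => (Complex.re_add_im _).symm
  simp only [e]
  rw [intervalIntegral.integral_add, intervalIntegral.integral_mul_const,
    intervalIntegral.integral_ofReal, intervalIntegral.integral_ofReal, integral_logSum_real _ ht,
    integral_logSum_real _ ht]
  · push_cast
    rw [sum_mul, ← sum_add_distrib]
    refine sum_congr rfl fun n _ => ?_
    conv_rhs => rw [← Complex.re_add_im (g n)]
    ring
  · have := intervalIntegrable_logSum (fun n => (((g n).re : ℝ) : ℂ)) 0 t
    exact this.congr fun s _ => by simp [logSum]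
  · have := (intervalIntegrable_logSum (fun n => (((g n).im : ℝ) : ℂ)) 0 t).mul_const Complex.I
    exact this.congr fun s _ => by simp [logSum]

lemma integral_logSum_dconv (f g : ℕ → ℂ) {T : ℝ} (hT : 0 ≤ T) :
    ∫ t in (0 : ℝ)..T, logSum (dconv f g) t =
      ∑ m ∈ Ioc 0 ⌊Real.exp T⌋₊, f m * ∫ s in (0 : ℝ)..(T - Real.log m), logSum g s := by
  have e : ∀ t ∈ Set.uIcc 0 T, logSum (dconv f g) t =
      ∑ m ∈ Ioc 0 ⌊Real.exp T⌋₊, f m * logSum g (t - Real.log m) := fun t ht => by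
    rw [Set.uIcc_of_le hT] at ht
    exact logSum_dconv f g ht.2
  have hi : ∀ x a b : ℝ, IntervalIntegrable (fun t => logSum g (t - x)) volume a b := fun x a b => by
    simpa using (intervalIntegrable_logSum g (a - x) (b - x)).comp_sub_right x
  rw [integral_congr e, intervalIntegral.integral_finsetSum fun m _ => (hi _ 0 T).const_mul (f m)]
  refine sum_congr rfl fun m hm => ?_
  have hm' : 0 ≤ Real.log m := Real.log_natCast_nonneg m
  rw [intervalIntegral.integral_const_mul, intervalIntegral.integral_comp_sub_right (logSum g), zero_sub,
    ← integral_add_adjacent_intervals (intervalIntegrable_logSum g (-Real.log m) 0)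
      (intervalIntegrable_logSum g 0 _)]
  have : ∫ x in (-Real.log m)..0, logSum g x = 0 := by
    rw [integral_of_le (by linarith), integral_Ioc_eq_integral_Ioo]
    exact setIntegral_eq_zero_of_forall_eq_zero fun s hs => logSum_of_neg _ hs.2
  rw [this, zero_add]

section

variable {q : ℕ} [NeZero q]

lemma norm_tw_le (χ : DirichletCharacter ℂ q) (Z : ℕ) {f : ℕ → ℝ} (hf : ∀ n, 0 ≤ f n) (n : ℕ) :
    ‖tw χ Z f n‖ ≤ wt Z f n := by
  rw [tw, norm_mul, Complex.norm_real, Real.norm_eq_abs, abs_of_nonneg (wt_nonneg hf n)]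
  exact mul_le_of_le_one_left (wt_nonneg hf n) (χ.norm_le_one _)

lemma norm_charSum_sub_le (χ : DirichletCharacter ℂ q) (Z : ℕ) {f : ℕ → ℝ} (hf : ∀ n, 0 ≤ f n)
    {s t : ℝ} (hst : s ≤ t) :
    ‖charSum χ Z f t - charSum χ Z f s‖ ≤ totalSum Z f t - totalSum Z f s := by
  rw [charSum, charSum, totalSum, totalSum, logSum_sub_eq _ hst, logSum_sub_eq _ hst]
  exact (norm_sum_le _ _).trans (sum_le_sum fun n _ => norm_tw_le χ Z hf n)

lemma charSum_log_eq (χ : DirichletCharacter ℂ q) (Z : ℕ) (t : ℝ) :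
    charSum χ Z (fun n => Real.log n) t =
      logSum (dconv (tw χ Z fun n => Λ n) (tw χ Z fun _ => 1)) t := by
  rw [charSum, ← tw_dconv, show (dconv (fun n => Λ n) fun _ => 1) = fun n : ℕ => Real.log n from
    funext fun n => (dconv_vonMangoldt_one n).symm]

lemma integral_charSum_one (χ : DirichletCharacter ℂ q) (Z : ℕ) {t : ℝ} (ht : 0 ≤ t) :
    ∫ s in (0 : ℝ)..t, charSum χ Z (fun _ => 1) s =
      t * charSum χ Z (fun _ => 1) t - charSum χ Z (fun n => Real.log n) t := by
  rw [charSum_eq_logSum_mul χ Z (fun n => Real.log n)]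
  simp only [charSum]
  rw [integral_logSum_complex _ ht]
  simp only [logSum, mul_sum, ← sum_sub_distrib]
  refine sum_congr rfl fun n _ => ?_
  push_cast
  ring

end

namespace Expansion

variable {C : ℝ} {q Z : ℕ} {c d k : (ZMod q)ˣ → ℝ}

lemma norm_charSum_vonMangoldt_sub_le (h : Expansion C q Z c d k) [NeZero q]
    (χ : DirichletCharacter ℂ q) {s t : ℝ} (hs : 0 ≤ s) (hst : s ≤ t) :
    ‖charSum χ Z (fun n => Λ n) t - charSum χ Z (fun n => Λ n) s‖ ≤ t - s + 2 * C * scale Z := by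
  refine (norm_charSum_sub_le χ Z (fun n => ArithmeticFunction.vonMangoldt_nonneg) hst).trans ?_
  have h1 := abs_le.1 (h.mertens t (hs.trans hst))
  have h2 := abs_le.1 (h.mertens s hs)
  linarith [h1.2, h2.1]

lemma norm_integral_charSum_one_sub_le (h : Expansion C q Z c d k) [NeZero q]
    {χ : DirichletCharacter ℂ q} (hχ : χ ≠ 1) {u : ℝ} (hu : 0 ≤ u) :
    ‖(∫ s in (0 : ℝ)..u, charSum χ Z (fun _ => 1) s) - (u * transform χ c - transform χ d)‖ ≤
      3 * C * scale Z * Real.exp (-u / (2 * scale Z)) := by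
  have hC := h.one_le
  have hD := h.scale_pos
  rw [integral_charSum_one χ Z hu]
  have h1 := h.norm_charSum_one_sub_le hχ hu
  have h2 := h.norm_charSum_log_sub_le hχ hu
  have e : u * charSum χ Z (fun _ => 1) u - charSum χ Z (fun n => Real.log n) u -
      (u * transform χ c - transform χ d) = u * (charSum χ Z (fun _ => 1) u - transform χ c) -
      (charSum χ Z (fun n => Real.log n) u - transform χ d) := by ring
  rw [e]
  refine (norm_sub_le _ _).trans ?_
  rw [norm_mul, Complex.norm_real, Real.norm_eq_abs, abs_of_nonneg hu]
  have h3 := mul_le_mul_of_nonneg_left h1 hu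
  have h4 := mul_le_mul_of_nonneg_left (mul_exp_neg_div_le (s := u) hD) (show 0 ≤ C by linarith)
  have h5 := mul_le_mul_of_nonneg_left (exp_neg_div_le_exp_neg_div_two hD hu)
    (show 0 ≤ C * scale Z by positivity)
  linarith

lemma norm_integral_charSum_log_sub_le (h : Expansion C q Z c d k) [NeZero q]
    {χ : DirichletCharacter ℂ q} (hχ : χ ≠ 1) {T : ℝ} (hT : 0 ≤ T) :
    ‖(∫ t in (0 : ℝ)..T, charSum χ Z (fun n => Real.log n) t) -
      (transform χ c * (∫ t in (0 : ℝ)..T, charSum χ Z (fun n => Λ n) t) -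
        transform χ d * charSum χ Z (fun n => Λ n) T)‖ ≤ 24 * C ^ 2 * scale Z ^ 2 := by
  have hC := h.one_le
  have hD := h.scale_pos
  have e1 : (∫ t in (0 : ℝ)..T, charSum χ Z (fun n => Λ n) t) = _ :=
    integral_logSum_complex (tw χ Z fun n => Λ n) hT
  simp only [charSum_log_eq]
  rw [integral_logSum_dconv _ _ hT, e1, charSum, logSum, mul_sum, mul_sum, ← sum_sub_distrib,
    ← sum_sub_distrib]
  refine (norm_sum_le _ _).trans ?_
  have h1 : ∀ m ∈ Ioc 0 ⌊Real.exp T⌋₊,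
      ‖(tw χ Z (fun n => Λ n) m * ∫ s in (0 : ℝ)..(T - Real.log m), logSum (tw χ Z fun _ => 1) s) -
        (transform χ c * (tw χ Z (fun n => Λ n) m * ((T - Real.log m : ℝ) : ℂ)) -
          transform χ d * tw χ Z (fun n => Λ n) m)‖ ≤
      3 * C * scale Z * (wt Z (fun n => Λ n) m * Real.exp (-(T - Real.log m) / (2 * scale Z))) := by
    intro m hm
    have hm' := (mem_Ioc_floor_exp.1 hm).2
    have h2 := h.norm_integral_charSum_one_sub_le hχ (u := T - Real.log m) (by linarith)
    have e : (tw χ Z (fun n => Λ n) m * ∫ s in (0 : ℝ)..(T - Real.log m), logSum (tw χ Z fun _ => 1) s) -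
        (transform χ c * (tw χ Z (fun n => Λ n) m * ((T - Real.log m : ℝ) : ℂ)) -
          transform χ d * tw χ Z (fun n => Λ n) m) = tw χ Z (fun n => Λ n) m *
        ((∫ s in (0 : ℝ)..(T - Real.log m), charSum χ Z (fun _ => 1) s) -
          (((T - Real.log m : ℝ) : ℂ) * transform χ c - transform χ d)) := by
      simp only [charSum]; ring
    rw [e, norm_mul]
    have h3 := norm_tw_le χ Z (f := fun n => Λ n) (fun n => ArithmeticFunction.vonMangoldt_nonneg) m
    calc _ ≤ wt Z (fun n => Λ n) m * (3 * C * scale Z * Real.exp (-(T - Real.log m) / (2 * scale Z))) :=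
          mul_le_mul h3 h2 (norm_nonneg _) ((norm_nonneg _).trans h3)
      _ = _ := by ring
  refine (sum_le_sum h1).trans ?_
  rw [← mul_sum]
  have h4 := logSum_mul_exp_le (a := wt Z (fun n => Λ n)) (α := 1) (β := 2 * C * scale Z)
    (D := 2 * scale Z) (by positivity) (by norm_num) (by positivity) (t := T) (by
      have := (abs_le.1 (h.mertens T hT)).2
      simp only [totalSum] at this
      nlinarith)
    (fun s hs hst => by
      have h1 := (abs_le.1 (h.mertens T hT)).2
      have h2 := (abs_le.1 (h.mertens s hs)).1
      simp only [totalSum] at h1 h2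
      linarith) hT
  have h5 : 2 * 1 * (2 * scale Z) + 2 * (2 * C * scale Z) ≤ 8 * C * scale Z := by nlinarith
  have h6 := mul_le_mul_of_nonneg_left (h4.trans h5) (show 0 ≤ 3 * C * scale Z by positivity)
  rw [logSum] at h6
  linarith

lemma integral_exp_neg_div_le {D : ℝ} (hD : 0 < D) {s t : ℝ} (hs : 0 ≤ s) :
    ∫ x in s..t, Real.exp (-x / D) ≤ D := by
  have hd : ∀ x ∈ Set.uIcc s t, HasDerivAt (fun x => -D * Real.exp (-x / D)) (Real.exp (-x / D)) x :=
    fun x _ => by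
      have h1 : HasDerivAt (fun x : ℝ => -x / D) (-1 / D) x := (hasDerivAt_id x).neg.div_const D
      refine (h1.exp.const_mul (-D)).congr_deriv ?_
      field_simp
  rw [integral_eq_sub_of_hasDerivAt hd (Continuous.intervalIntegrable (by fun_prop) _ _)]
  have h1 : Real.exp (-s / D) ≤ 1 := Real.exp_le_one_iff.2 (by
    rw [neg_div]; linarith [div_nonneg hs hD.le])
  have h2 := Real.exp_pos (-t / D)
  nlinarith

/-- The averaged explicit formula for a nontrivial character. -/
lemma norm_averaged_le (h : Expansion C q Z c d k) [NeZero q] {χ : DirichletCharacter ℂ q} (hχ : χ ≠ 1)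
    {T w : ℝ} (hw : 0 ≤ w) (hT : w ≤ T) :
    ‖transform χ d * w - transform χ c * w * charSum χ Z (fun n => Λ n) T +
      transform χ d * incr χ Z w T‖ ≤
      ‖transform χ c‖ * (w * (w + 2 * C * scale Z)) + 49 * C ^ 2 * scale Z ^ 2 := by
  have hC := h.one_le
  have hD := h.scale_pos
  have hTw : 0 ≤ T - w := by linarith
  have hi : ∀ (f : ℕ → ℝ) (a b : ℝ), IntervalIntegrable (fun t => charSum χ Z f t) volume a b :=
    fun f a b => intervalIntegrable_logSum _ a b
  have a1 := h.norm_integral_charSum_log_sub_le hχ (hw.trans hT)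
  have a2 := h.norm_integral_charSum_log_sub_le hχ hTw
  have a3 : ‖(∫ t in (T - w)..T, charSum χ Z (fun n => Real.log n) t) - w * transform χ d‖ ≤
      C * scale Z * scale Z := by
    have e : (∫ t in (T - w)..T, charSum χ Z (fun n => Real.log n) t) - w * transform χ d =
        ∫ t in (T - w)..T, (charSum χ Z (fun n => Real.log n) t - transform χ d) := by
      rw [intervalIntegral.integral_sub (hi _ _ _) intervalIntegrable_const,
        intervalIntegral.integral_const]
      simp
    rw [e]
    refine (intervalIntegral.norm_integral_le_of_norm_le (g := fun t => C * scale Z *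
      Real.exp (-t / scale Z)) (by linarith) (Eventually.of_forall fun t ht => ?_)
      (Continuous.intervalIntegrable (by fun_prop) _ _)).trans ?_
    · exact h.norm_charSum_log_sub_le hχ (by linarith [ht.1])
    · rw [intervalIntegral.integral_const_mul]
      exact mul_le_mul_of_nonneg_left (integral_exp_neg_div_le hD hTw) (by positivity)
  have a4 : ‖(∫ t in (T - w)..T, charSum χ Z (fun n => Λ n) t) - w * charSum χ Z (fun n => Λ n) T‖ ≤
      w * (w + 2 * C * scale Z) := by
    have e : (∫ t in (T - w)..T, charSum χ Z (fun n => Λ n) t) - w * charSum χ Z (fun n => Λ n) T =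
        ∫ t in (T - w)..T, (charSum χ Z (fun n => Λ n) t - charSum χ Z (fun n => Λ n) T) := by
      rw [intervalIntegral.integral_sub (hi _ _ _) intervalIntegrable_const,
        intervalIntegral.integral_const]
      simp
    rw [e]
    refine (intervalIntegral.norm_integral_le_of_norm_le_const (C := w + 2 * C * scale Z)
      fun t ht => ?_).trans (le_of_eq ?_)
    · rw [Set.uIoc_of_le (by linarith)] at ht
      rw [norm_sub_rev]
      exact (h.norm_charSum_vonMangoldt_sub_le χ (by linarith [ht.1]) ht.2).trans (by linarith [ht.1])
    · rw [sub_sub_cancel, abs_of_nonneg hw, mul_comm]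
  rw [← integral_add_adjacent_intervals (hi (fun n => Real.log n) 0 (T - w)) (hi _ (T - w) T),
    ← integral_add_adjacent_intervals (hi (fun n => Λ n) 0 (T - w)) (hi _ (T - w) T)] at a1
  set G₀ := ∫ t in (0 : ℝ)..(T - w), charSum χ Z (fun n => Real.log n) t
  set G₁ := ∫ t in (T - w)..T, charSum χ Z (fun n => Real.log n) t
  set H₀ := ∫ t in (0 : ℝ)..(T - w), charSum χ Z (fun n => Λ n) t
  set H₁ := ∫ t in (T - w)..T, charSum χ Z (fun n => Λ n) t
  have e : transform χ d * w - transform χ c * w * charSum χ Z (fun n => Λ n) T +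
      transform χ d * incr χ Z w T =
      ((G₀ + G₁ - (transform χ c * (H₀ + H₁) - transform χ d * charSum χ Z (fun n => Λ n) T)) -
        (G₀ - (transform χ c * H₀ - transform χ d * charSum χ Z (fun n => Λ n) (T - w)))) -
      (G₁ - w * transform χ d) + transform χ c * (H₁ - w * charSum χ Z (fun n => Λ n) T) := by
    rw [incr]; ring
  rw [e]
  refine (norm_add_le _ _).trans ?_
  have b1 := norm_sub_le (G₀ + G₁ - (transform χ c * (H₀ + H₁) - transform χ d *
    charSum χ Z (fun n => Λ n) T)) (G₀ - (transform χ c * H₀ - transform χ d *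
    charSum χ Z (fun n => Λ n) (T - w)))
  have b2 := norm_sub_le ((G₀ + G₁ - (transform χ c * (H₀ + H₁) - transform χ d *
    charSum χ Z (fun n => Λ n) T)) - (G₀ - (transform χ c * H₀ - transform χ d *
    charSum χ Z (fun n => Λ n) (T - w)))) (G₁ - w * transform χ d)
  have b3 : ‖transform χ c * (H₁ - w * charSum χ Z (fun n => Λ n) T)‖ ≤
      ‖transform χ c‖ * (w * (w + 2 * C * scale Z)) := by
    rw [norm_mul]; exact mul_le_mul_of_nonneg_left a4 (norm_nonneg _)
  have b4 : C * scale Z * scale Z ≤ C ^ 2 * scale Z ^ 2 := by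
    have : 0 ≤ (C - 1) * C * scale Z ^ 2 := by
      have : 0 ≤ C - 1 := by linarith
      positivity
    nlinarith
  linarith

end Expansion

end Linnik

namespace Linnik

open Finset Filter Topology MeasureTheory intervalIntegral
open scoped ArithmeticFunction.vonMangoldt

section Recursion

variable {y : ℝ → ℝ} {x w ε : ℝ}

lemma mem_Icc_of_recursion (hx : 0 ≤ x) (hw : 0 < w)
    (h0 : ∀ t, 0 ≤ t → t < w → |y t| ≤ ε)
    (h : ∀ t, w ≤ t → |y t * (1 + x) - y (t - w) - x| ≤ x * ε) {t : ℝ} (ht : 0 ≤ t) :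
    -ε ≤ y t ∧ y t ≤ 1 + ε := by
  have key : ∀ n : ℕ, ∀ t, 0 ≤ t → t < n * w → -ε ≤ y t ∧ y t ≤ 1 + ε := by
    intro n
    induction n with
    | zero => intro t h1 h2; simp at h2; linarith
    | succ n ih =>
      intro t h1 h2
      rcases lt_or_ge t w with h3 | h3
      · have := abs_le.1 (h0 t h1 h3)
        constructor <;> linarith
      · obtain ⟨i1, i2⟩ := ih (t - w) (by linarith) (by push_cast at h2; linarith)
        have := abs_le.1 (h t h3)
        have hx1 : 0 < 1 + x := by linarith
        constructor
        · by_contra! hc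
          have := mul_lt_mul_of_pos_right hc hx1
          nlinarith
        · by_contra! hc
          have := mul_lt_mul_of_pos_right hc hx1
          nlinarith
  obtain ⟨n, hn⟩ := exists_nat_gt (t / w)
  exact key n t ht ((div_lt_iff₀ hw).1 hn)

lemma one_sub_le_of_recursion (hx : 0 ≤ x) (hw : 0 < w)
    (h0 : ∀ t, 0 ≤ t → t < w → |y t| ≤ ε)
    (h : ∀ t, w ≤ t → |y t * (1 + x) - y (t - w) - x| ≤ x * ε) {t : ℝ} (ht : w ≤ t) :
    1 - ε - y t ≤ 1 / (1 + x * (t / (2 * w))) := by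
  have key : ∀ n : ℕ, ∀ t, n * w ≤ t → 0 ≤ t → (1 - ε - y t) * (1 + x) ^ n ≤ 1 := by
    intro n
    induction n with
    | zero =>
      intro t _ h2
      have := (mem_Icc_of_recursion hx hw h0 h h2).1
      simp; linarith
    | succ n ih =>
      intro t h1 h2
      push_cast at h1
      have hn : 0 ≤ (n : ℝ) * w := by positivity
      have i1 := ih (t - w) (by linarith) (by linarith)
      have i2 := (abs_le.1 (h t (by linarith))).1
      have hp : 0 < (1 + x) ^ n := by positivity
      calc (1 - ε - y t) * (1 + x) ^ (n + 1) = ((1 - ε - y t) * (1 + x)) * (1 + x) ^ n := by ring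
        _ ≤ (1 - ε - y (t - w)) * (1 + x) ^ n := mul_le_mul_of_nonneg_right (by nlinarith) hp.le
        _ ≤ 1 := i1
  have ht0 : 0 ≤ t := by linarith
  set n := ⌊t / w⌋₊
  have h1 : (n : ℝ) * w ≤ t := by
    rw [← le_div_iff₀ hw]; exact Nat.floor_le (by positivity)
  have h2 : t / (2 * w) ≤ n := by
    have h3 := Nat.lt_floor_add_one (t / w)
    have h4 : (1 : ℝ) ≤ n := by
      have : 1 ≤ n := Nat.le_floor (by rw [Nat.cast_one, le_div_iff₀ hw]; linarith)
      exact_mod_cast this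
    have e : t / (2 * w) = t / w / 2 := by field_simp
    rw [e]; linarith
  have h3 : 1 + x * (t / (2 * w)) ≤ (1 + x) ^ n := by
    have h4 := one_add_mul_le_pow (show (-2 : ℝ) ≤ x by linarith) n
    nlinarith
  have h5 := key n t h1 ht0
  have hp : 0 < 1 + x * (t / (2 * w)) := by positivity
  rw [le_div_iff₀ hp]
  rcases le_or_gt (1 - ε - y t) 0 with h6 | h6
  · nlinarith
  · exact (mul_le_mul_of_nonneg_left h3 h6.le).trans h5

end Recursion

section

variable {q : ℕ} [NeZero q]

lemma charSum_im_eq_zero {Z : ℕ} (hqZ : q ≤ Z) {χ : DirichletCharacter ℂ q} (hχ : χ ^ 2 = 1)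
    (f : ℕ → ℝ) (t : ℝ) : (charSum χ Z f t).im = 0 := by
  rw [charSum_eq_transform hqZ]
  exact Expansion.transform_im_eq_zero hχ _

lemma incr_im_eq_zero {Z : ℕ} (hqZ : q ≤ Z) {χ : DirichletCharacter ℂ q} (hχ : χ ^ 2 = 1)
    (w t : ℝ) : (incr χ Z w t).im = 0 := by
  rw [incr, Complex.sub_im, charSum_im_eq_zero hqZ hχ, charSum_im_eq_zero hqZ hχ, sub_zero]

end

namespace Expansion

variable {C : ℝ} {q Z : ℕ} {c d k : (ZMod q)ˣ → ℝ}

lemma norm_incr_le (h : Expansion C q Z c d k) [NeZero q] (χ : DirichletCharacter ℂ q) {w : ℝ}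
    (hw : 0 ≤ w) (s : ℝ) : ‖incr χ Z w s‖ ≤ w + 2 * C * scale Z := by
  refine le_trans ?_ (h.norm_incr_one_le hw s)
  refine (norm_charSum_sub_le χ Z (fun n => ArithmeticFunction.vonMangoldt_nonneg)
    (by linarith)).trans ?_
  rw [incr, charSum_one h.q_le, charSum_one h.q_le, ← Complex.ofReal_sub, Complex.norm_real]
  exact le_abs_self _

lemma re_transform_c_nonneg (h : Expansion C q Z c d k) [NeZero q] {χ : DirichletCharacter ℂ q}
    (hχ : χ ^ 2 = 1) (hχ1 : χ ≠ 1) : 0 ≤ (transform χ c).re := by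
  have h1 : ∀ σ : ℝ, 0 < σ →
      0 ≤ (transform χ c).re - σ * (transform χ d).re + C * (σ ^ 2 * scale Z ^ 2) := fun σ hσ => by
    have k5 := h.norm_roughL_sub_le hχ1 hσ
    have k6 := (Complex.abs_re_le_norm _).trans k5
    rw [roughL_eq_norm Z hχ hσ] at k6
    simp only [Complex.sub_re, Complex.ofReal_re, Complex.re_ofReal_mul] at k6
    have := (abs_le.1 k6).2
    have := norm_nonneg (roughL Z χ σ)
    linarith
  have h2 : Tendsto (fun σ : ℝ => (transform χ c).re - σ * (transform χ d).re +
      C * (σ ^ 2 * scale Z ^ 2)) (𝓝[>] 0) (𝓝 ((transform χ c).re - 0 * (transform χ d).re +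
      C * (0 ^ 2 * scale Z ^ 2))) :=
    (Continuous.tendsto (by fun_prop) 0).mono_left nhdsWithin_le_nhds
  have h3 := ge_of_tendsto h2 (by filter_upwards [self_mem_nhdsWithin] with σ hσ using h1 σ hσ)
  simpa using h3

/-- The parameters for which the increments of an exceptional character are controlled. -/
structure Exceptional (C : ℝ) {q : ℕ} (Z : ℕ) (c : (ZMod q)ˣ → ℝ) [NeZero q]
    (χ : DirichletCharacter ℂ q) (w ε : ℝ) : Prop where
  sq_eq_one : χ ^ 2 = 1
  ne_one : χ ≠ 1
  re_le : (transform χ c).re ≤ 1 / (128 * C ^ 3)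
  pos : 0 < ε
  le_half : ε ≤ 1 / 2
  width : 1568 * C ^ 3 * scale Z ≤ ε * w
  small : 64 * C * (transform χ c).re * w ≤ ε * scale Z

lemma exceptional_bounds (h : Expansion C q Z c d k) [NeZero q] {χ : DirichletCharacter ℂ q} {w ε : ℝ}
    (hχ : Exceptional C Z c χ w ε) {t : ℝ} (ht : w ≤ t) :
    -(2 * ε) ≤ -(incr χ Z w t).re / w ∧ -(incr χ Z w t).re / w ≤ 1 + 2 * ε ∧
      -(incr χ Z w t).re / w ≤
        1 / (1 + (transform χ c).re * t / (2 * C * scale Z)) + 2 * ε := by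
  obtain ⟨h2, h1, hδ, hε, hε1, hwid, hsm⟩ := hχ
  have hC := h.one_le
  have hD := h.scale_pos
  have hd := h.scale_div_le_neg_transform_d h2 h1 hδ
  have hd' : -(transform χ d).re ≤ C * scale Z :=
    (neg_le_abs _).trans ((Complex.abs_re_le_norm _).trans (h.norm_transform_d_le χ))
  have hδ0 := h.re_transform_c_nonneg h2 h1
  have hC3 : C ≤ C ^ 3 := le_self_pow₀ hC (by norm_num)
  have hw2 : 1568 * C * scale Z ≤ ε * w :=
    le_trans (by gcongr) hwid
  have hCD : 0 < C * scale Z := by positivity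
  have hw : 0 < w := by
    by_contra! hc
    nlinarith
  have hwCD : 2 * C * scale Z ≤ w := by nlinarith
  set δ := (transform χ c).re with hδdef
  set e := -(transform χ d).re with hedef
  have he : 0 < e := lt_of_lt_of_le (by positivity) hd
  set θ := δ / e with hθ
  have hθ0 : 0 ≤ θ := by positivity
  have hθw : 4 * (θ * w) ≤ ε := by
    rw [hθ, div_mul_eq_mul_div, mul_div_assoc', div_le_iff₀ he]
    have : ε * (scale Z / (16 * C)) ≤ ε * e := mul_le_mul_of_nonneg_left hd hε.le
    have e2 : 64 * C * δ * w / (16 * C) ≤ ε * scale Z / (16 * C) := by gcongr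
    have e3 : 64 * C * δ * w / (16 * C) = 4 * (δ * w) := by field_simp; ring
    have e4 : ε * scale Z / (16 * C) = ε * (scale Z / (16 * C)) := by ring
    linarith
  set H : ℝ → ℝ := fun s => (charSum χ Z (fun n => Λ n) s).re with hH
  have hb : ∀ s, w ≤ s → |-(incr χ Z w s).re / w - 1 - θ * H s| ≤ ε := fun s hs => by
    have k1 := h.norm_averaged_le h1 hw.le hs
    have k2 := (Complex.abs_re_le_norm _).trans k1
    have i1 := transform_im_eq_zero h2 c
    have i2 := transform_im_eq_zero h2 d
    have n1 : ‖transform χ c‖ = δ := by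
      rw [← Complex.re_add_im (transform χ c), i1]
      simp [abs_of_nonneg hδ0, ← hδdef]
    have e1 : (transform χ d * w - transform χ c * w * charSum χ Z (fun n => Λ n) s +
      transform χ d * incr χ Z w s).re = e * w * (-(incr χ Z w s).re / w - 1 - θ * H s) := by
      simp only [Complex.add_re, Complex.sub_re, Complex.mul_re, i1, i2, Complex.ofReal_re,
        Complex.ofReal_im, Complex.mul_im]
      rw [hθ, ← hδdef, show (transform χ d).re = -e by simp [hedef]]
      field_simp
      simp only [hH]
      ring
    rw [e1, n1] at k2
    rw [abs_mul, abs_of_pos (by positivity)] at k2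
    have k3 : δ * (w * (w + 2 * C * scale Z)) ≤ e * w * (ε / 2) := by
      have : δ = θ * e := by rw [hθ]; field_simp
      rw [this]
      have : θ * e * (w * (w + 2 * C * scale Z)) ≤ θ * e * (w * (w + w)) := by gcongr
      have : (4 * (θ * w)) * (e * w) ≤ ε * (e * w) := by gcongr
      linarith
    have k4 : 49 * C ^ 2 * scale Z ^ 2 ≤ e * w * (ε / 2) := by
      have : scale Z / (16 * C) * (1568 * C ^ 3 * scale Z) ≤ e * (ε * w) := by gcongr
      have e5 : scale Z / (16 * C) * (1568 * C ^ 3 * scale Z) = 98 * C ^ 2 * scale Z ^ 2 := by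
        field_simp; norm_num
      linarith
    have k5 : e * w * |-(incr χ Z w s).re / w - 1 - θ * H s| ≤ e * w * ε := by linarith
    exact le_of_mul_le_mul_left k5 (by positivity)
  set y : ℝ → ℝ := fun s => -θ * H s with hy
  have hinc : ∀ s, -(incr χ Z w s).re = H (s - w) - H s := fun s => by
    rw [incr, Complex.sub_re]; ring
  have hx : 0 ≤ θ * w := by positivity
  have y0 : ∀ s, 0 ≤ s → s < w → |y s| ≤ ε := fun s hs hsw => by
    have k1 := h.norm_charSum_vonMangoldt_sub_le χ le_rfl hs
    have z0 : charSum χ Z (fun n => Λ n) 0 = 0 := by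
      simp [charSum, logSum, tw, wt]
    rw [z0, sub_zero] at k1
    have k2 := (Complex.abs_re_le_norm _).trans k1
    simp only [hy]
    rw [abs_mul, abs_neg, abs_of_nonneg hθ0]
    calc θ * |H s| ≤ θ * (w + w) := by
          refine mul_le_mul_of_nonneg_left (k2.trans ?_) hθ0
          linarith
      _ ≤ ε := by linarith
  have y1 : ∀ s, w ≤ s → |y s * (1 + θ * w) - y (s - w) - θ * w| ≤ θ * w * ε := fun s hs => by
    have k1 := hb s hs
    have e1 : y s * (1 + θ * w) - y (s - w) - θ * w =
        θ * w * (-(incr χ Z w s).re / w - 1 - θ * H s) := by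
      rw [hinc]
      simp only [hy]
      field_simp
      ring
    rw [e1, abs_mul, abs_of_nonneg hx]
    exact mul_le_mul_of_nonneg_left k1 hx
  have r1 := mem_Icc_of_recursion hx hw y0 y1 (hw.le.trans ht)
  have r2 := one_sub_le_of_recursion hx hw y0 y1 ht
  have r3 := abs_le.1 (hb t ht)
  simp only [hy] at r1 r2
  have r4 : 1 / (1 + θ * w * (t / (2 * w))) ≤ 1 / (1 + δ * t / (2 * C * scale Z)) := by
    have ht0 : 0 ≤ t := hw.le.trans ht
    apply one_div_le_one_div_of_le (by positivity)
    have e1 : θ * w * (t / (2 * w)) = δ * t / (2 * e) := by rw [hθ]; field_simp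
    rw [e1]
    gcongr 1 + δ * t / ?_
    linarith
  refine ⟨?_, ?_, ?_⟩ <;> linarith [r1.1, r1.2, r3.1, r3.2]

end Expansion

end Linnik

namespace Linnik

open Finset Filter Topology MeasureTheory intervalIntegral
open scoped ArithmeticFunction.vonMangoldt

lemma integral_le_of_middle {f : ℝ → ℝ} {w U M : ℝ} (hi : ∀ a b, IntervalIntegrable f volume a b)
    (hw : 0 ≤ w) (hU : 2 * w ≤ U) (h4 : ∀ s, f s ≤ 4) (hM : ∀ s, w ≤ s → s ≤ U - w → f s ≤ M)
    (hM0 : 0 ≤ M) : ∫ s in (0 : ℝ)..U, f s ≤ M * U + 8 * w := by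
  rw [← integral_add_adjacent_intervals (hi 0 w) (hi w U),
    ← integral_add_adjacent_intervals (hi w (U - w)) (hi (U - w) U)]
  have h1 := integral_mono_on hw (hi 0 w) intervalIntegrable_const fun s _ => h4 s
  have h2 := integral_mono_on (by linarith) (hi (U - w) U) intervalIntegrable_const fun s _ => h4 s
  have h3 := integral_mono_on (by linarith) (hi w (U - w)) intervalIntegrable_const
    fun s hs => hM s hs.1 hs.2
  simp only [intervalIntegral.integral_const, smul_eq_mul] at h1 h2 h3
  nlinarith

namespace Expansion

variable {C : ℝ} {q Z : ℕ} {c d k : (ZMod q)ˣ → ℝ}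

lemma kern_re_eq (h : Expansion C q Z c d k) [NeZero q] {χ : DirichletCharacter ℂ q} (hχ : χ ^ 2 = 1)
    {w : ℝ} (hw : 0 < w) (U : ℝ) :
    (kern χ Z w U).re = w ^ 2 * ∫ s in (0 : ℝ)..U,
      (-(incr χ Z w s).re / w) * (-(incr χ Z w (U - s)).re / w) := by
  rw [kern, ← intervalIntegral.integral_const_mul]
  have h1 := Complex.reCLM.intervalIntegral_comp_comm
    (intervalIntegrable_incr_mul χ Z (U := U) hw.le 0 U)
  rw [← Complex.reCLM_apply, ← h1]
  refine integral_congr fun s _ => ?_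
  simp only [Complex.reCLM_apply, Complex.mul_re, incr_im_eq_zero h.q_le hχ]
  field_simp
  ring

lemma intervalIntegrable_kern_re [NeZero q] (χ : DirichletCharacter ℂ q) (hqZ : q ≤ Z)
    (hχ : χ ^ 2 = 1) {w : ℝ} (hw : 0 ≤ w) (U a b : ℝ) :
    IntervalIntegrable (fun s => (-(incr χ Z w s).re / w) * (-(incr χ Z w (U - s)).re / w))
      volume a b := by
  have h1 := (intervalIntegrable_incr_mul χ Z (U := U) hw a b)
  have h2 : IntervalIntegrable (fun s => (incr χ Z w s * incr χ Z w (U - s)).re) volume a b :=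
    ⟨h1.1.re, h1.2.re⟩
  refine (h2.div_const (w ^ 2)).congr fun s _ => ?_
  simp only [Complex.mul_re, incr_im_eq_zero hqZ hχ]
  ring

section

variable [NeZero q] {χ : DirichletCharacter ℂ q} {w ε U : ℝ}

lemma Exceptional.width_pos (h : Expansion C q Z c d k) (hχ : Exceptional C Z c χ w ε) :
    0 < w ∧ 2 * C * scale Z ≤ w := by
  have hC := h.one_le
  have hD := h.scale_pos
  have hε := hχ.pos
  have hε1 := hχ.le_half
  have hwid := hχ.width
  have hC3 : C ≤ C ^ 3 := le_self_pow₀ hC (by norm_num)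
  have hw2 : 1568 * C * scale Z ≤ ε * w := le_trans (by gcongr) hwid
  have hCD : 0 < C * scale Z := by positivity
  have hw : 0 < w := by
    by_contra! hc
    nlinarith
  exact ⟨hw, by nlinarith⟩

lemma abs_incr_div_le (h : Expansion C q Z c d k) (hχ : Exceptional C Z c χ w ε) (s : ℝ) :
    |-(incr χ Z w s).re / w| ≤ 2 := by
  obtain ⟨hw, hw2⟩ := Exceptional.width_pos h hχ
  have h1 := (Complex.abs_re_le_norm _).trans (h.norm_incr_le χ hw.le s)
  rw [abs_div, abs_neg, abs_of_pos hw, div_le_iff₀ hw]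
  linarith

lemma kern_re_le (h : Expansion C q Z c d k) (hχ : Exceptional C Z c χ w ε) (hU : 2 * w ≤ U) :
    (kern χ Z w U).re ≤ w ^ 2 * ((1 / (1 + (transform χ c).re * U / (4 * C * scale Z)) + 6 * ε) * U +
      8 * w) := by
  obtain ⟨hw, hw2⟩ := Exceptional.width_pos h hχ
  have hC := h.one_le
  have hD := h.scale_pos
  have hε := hχ.pos
  have hε1 := hχ.le_half
  have hδ := h.re_transform_c_nonneg hχ.sq_eq_one hχ.ne_one
  set δ := (transform χ c).re
  set ρ := 1 / (1 + δ * U / (4 * C * scale Z)) with hρ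
  have hU0 : 0 ≤ U := by linarith
  have hp : 0 ≤ δ * U / (4 * C * scale Z) := by positivity
  have hρ0 : 0 ≤ ρ := by positivity
  have hρ1 : ρ ≤ 1 := by rw [hρ, div_le_one (by positivity)]; linarith
  rw [h.kern_re_eq hχ.sq_eq_one hw]
  refine mul_le_mul_of_nonneg_left ?_ (by positivity)
  refine integral_le_of_middle (intervalIntegrable_kern_re χ h.q_le hχ.sq_eq_one hw.le U) hw.le hU
    (fun s => ?_) (fun s hs hs' => ?_) (by positivity)
  · have h1 := h.abs_incr_div_le hχ s
    have h2 := h.abs_incr_div_le hχ (U - s)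
    refine (le_abs_self _).trans ?_
    rw [abs_mul]
    nlinarith [abs_nonneg (-(incr χ Z w s).re / w), abs_nonneg (-(incr χ Z w (U - s)).re / w)]
  · have key : ∀ s, w ≤ s → w ≤ U - s → U / 2 ≤ s →
        (-(incr χ Z w s).re / w) * (-(incr χ Z w (U - s)).re / w) ≤ ρ + 6 * ε := by
      intro s h1 h2 h3
      obtain ⟨a1, a2, a3⟩ := h.exceptional_bounds hχ h1
      obtain ⟨b1, b2, b3⟩ := h.exceptional_bounds hχ h2
      have a4 : 1 / (1 + δ * s / (2 * C * scale Z)) ≤ ρ := by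
        refine one_div_le_one_div_of_le (by positivity) ?_
        have : δ * U / (4 * C * scale Z) = δ * (U / 2) / (2 * C * scale Z) := by field_simp; norm_num
        rw [this]
        gcongr
      have c1 : |-(incr χ Z w s).re / w| ≤ ρ + 2 * ε := abs_le.2 ⟨by linarith, by linarith⟩
      have c2 : |-(incr χ Z w (U - s)).re / w| ≤ 1 + 2 * ε := abs_le.2 ⟨by linarith, by linarith⟩
      refine (le_abs_self _).trans ?_
      rw [abs_mul]
      calc _ ≤ (ρ + 2 * ε) * (1 + 2 * ε) := mul_le_mul c1 c2 (abs_nonneg _) (by positivity)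
        _ ≤ ρ + 6 * ε := by nlinarith
    rcases le_total (U / 2) s with h3 | h3
    · exact key s hs (by linarith) h3
    · have := key (U - s) (by linarith) (by linarith) (by linarith)
      rw [sub_sub_cancel, mul_comm] at this
      exact this

lemma neg_kern_re_le (h : Expansion C q Z c d k) (hχ : Exceptional C Z c χ w ε) (hU : 2 * w ≤ U) :
    -(kern χ Z w U).re ≤ w ^ 2 * (4 * ε * U + 8 * w) := by
  obtain ⟨hw, hw2⟩ := Exceptional.width_pos h hχ
  have hε := hχ.pos
  have hε1 := hχ.le_half
  rw [h.kern_re_eq hχ.sq_eq_one hw, ← mul_neg, ← intervalIntegral.integral_neg]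
  refine mul_le_mul_of_nonneg_left ?_ (by positivity)
  refine integral_le_of_middle
    (fun a b => (intervalIntegrable_kern_re χ h.q_le hχ.sq_eq_one hw.le U a b).neg) hw.le hU
    (fun s => ?_) (fun s hs hs' => ?_) (by positivity)
  · have h1 := h.abs_incr_div_le hχ s
    have h2 := h.abs_incr_div_le hχ (U - s)
    refine (neg_le_abs _).trans ?_
    rw [abs_mul]
    nlinarith [abs_nonneg (-(incr χ Z w s).re / w), abs_nonneg (-(incr χ Z w (U - s)).re / w)]
  · obtain ⟨a1, a2, -⟩ := h.exceptional_bounds hχ hs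
    obtain ⟨b1, b2, -⟩ := h.exceptional_bounds hχ (t := U - s) (by linarith)
    set x := -(incr χ Z w s).re / w
    set y := -(incr χ Z w (U - s)).re / w
    rcases le_total 0 x with hx | hx <;> rcases le_total 0 y with hy | hy <;> nlinarith

/-- The mass of primes in a residue class, given a bound for the contribution of the exceptional
characters. -/
lemma mass_ge_of_kern_le (h : Expansion C q Z c d k) (a : (ZMod q)ˣ) {c₀ R κ : ℝ} (hε : 0 < ε)
    (hε1 : ε ≤ 1 / 2) (hc₀ : 0 < c₀) (hc₁ : c₀ ≤ 1) (hw : 1568 * C ^ 3 * scale Z ≤ c₀ * (ε * w))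
    (hU : 2 * w ≤ U) (E : Finset (DirichletCharacter ℂ q)) (hE : 1 ∉ E)
    (hS : ∀ χ ∉ E, χ ≠ 1 → c₀ ≤ ‖transform χ c‖)
    (hR : (∑ χ ∈ E, χ (a⁻¹ : (ZMod q)ˣ) * kern χ Z w U).re ≤ w ^ 2 * (R * U + 8 * w))
    (hκ : κ * U + 11 * w + (2 * ε + R) * U ≤ U) :
    κ * w ≤ q.totient * (classSum q Z (fun n => Λ n) a U - classSum q Z (fun n => Λ n) a (U - 2 * w)) := by
  have hC := h.one_le
  have hD := h.scale_pos
  have hCD : 0 < C ^ 3 * scale Z := by positivity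
  have hεw : c₀ * (ε * w) ≤ ε * w ∨ w ≤ 0 := by
    rcases le_or_gt w 0 with hc | hc
    · exact Or.inr hc
    · exact Or.inl (mul_le_of_le_one_left (by positivity) hc₁)
  have hw0 : 0 < w := by
    by_contra! hc
    nlinarith [mul_nonneg (mul_pos hc₀ hε).le (neg_nonneg.2 hc)]
  have hεw : c₀ * (ε * w) ≤ ε * w := mul_le_of_le_one_left (by positivity) hc₁
  have hwid : 1568 * C ^ 3 * scale Z ≤ ε * w := hw.trans hεw
  have hC3 : C ≤ C ^ 3 := le_self_pow₀ hC (by norm_num)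
  have hC23 : C ^ 2 ≤ C ^ 3 := pow_le_pow_right₀ hC (by norm_num)
  have h1C3 : 1 ≤ C ^ 3 := one_le_pow₀ hC
  have k1 : C * scale Z ≤ C ^ 3 * scale Z := by gcongr
  have k1' : C ^ 2 * scale Z ≤ C ^ 3 * scale Z := by gcongr
  have k1'' : 1 * scale Z ≤ C ^ 3 * scale Z := by gcongr
  have hεw2 : ε * w ≤ w / 2 := by nlinarith
  have key := h.mass_ge_sub_exceptional a (w := w) (T := U - w) (c₀ := c₀) (by linarith) (by linarith)
    hc₀ E hE hS
  rw [sub_add_cancel, show U - w - w = U - 2 * w by ring] at key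
  have k2 : (w + 2 * C * scale Z) ^ 2 ≤ w ^ 2 * (1 + ε) := by
    have : w + 2 * C * scale Z ≤ w * (1 + ε / 4) := by linarith
    calc (w + 2 * C * scale Z) ^ 2 ≤ (w * (1 + ε / 4)) ^ 2 := by gcongr
      _ = w ^ 2 * (1 + ε / 4) ^ 2 := by ring
      _ ≤ w ^ 2 * (1 + ε) := by gcongr; nlinarith
  have k3 : 256 * C ^ 4 * scale Z ^ 2 / c₀ ^ 2 ≤ w ^ 2 * ε := by
    rw [div_le_iff₀ (by positivity)]
    have : (16 * (C ^ 2 * scale Z)) ^ 2 ≤ (c₀ * (ε * w)) ^ 2 := by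
      apply pow_le_pow_left₀ (by positivity); linarith
    have h5 : (c₀ * (ε * w)) ^ 2 ≤ w ^ 2 * ε * c₀ ^ 2 := by
      have : ε ^ 2 ≤ ε := by nlinarith
      calc (c₀ * (ε * w)) ^ 2 = w ^ 2 * ε ^ 2 * c₀ ^ 2 := by ring
        _ ≤ _ := by gcongr
    calc 256 * C ^ 4 * scale Z ^ 2 = (16 * (C ^ 2 * scale Z)) ^ 2 := by ring
      _ ≤ _ := this.trans h5
  have k4 : 61 * C ^ 3 * scale Z ≤ w := by linarith
  have hU0 : 0 < U := by linarith
  have k5 := mul_le_mul_of_nonneg_left k2 hU0.le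
  have k6 := mul_le_mul_of_nonneg_left k3 hU0.le
  have k7 := mul_le_mul_of_nonneg_right k4 (sq_nonneg w)
  have k8 := mul_le_mul_of_nonneg_left hκ (sq_nonneg w)
  set Δ := classSum q Z (fun n => Λ n) a U - classSum q Z (fun n => Λ n) a (U - 2 * w)
  have k9 : κ * w * (w * U) ≤ q.totient * Δ * (w * U) := by nlinarith
  exact le_of_mul_le_mul_right k9 (by positivity)

end

end Expansion

end Linnik

namespace Linnik

open Finset Filter Topology

section RealCharacter

variable {q : ℕ} [NeZero q]

/-- The real part of a Dirichlet character at a natural number. -/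
noncomputable def rchar (χ : DirichletCharacter ℂ q) (n : ℕ) : ℝ := (χ (n : ZMod q)).re

/-- The convolution of the constant function with the real part of a character. -/
noncomputable def lam (χ : DirichletCharacter ℂ q) (n : ℕ) : ℝ := ∑ d ∈ n.divisors, rchar χ d

variable {χ : DirichletCharacter ℂ q}

lemma rchar_one : rchar χ 1 = 1 := by simp [rchar]

lemma rchar_cases (hχ : χ ^ 2 = 1) {n : ℕ} (hn : n.Coprime q) : rchar χ n = 1 ∨ rchar χ n = -1 := by
  rcases apply_eq_of_sq_eq_one hχ ((ZMod.isUnit_iff_coprime n q).2 hn) with h | h <;>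
    simp [rchar, h]

lemma rchar_eq_zero {n : ℕ} (hn : ¬ n.Coprime q) : rchar χ n = 0 := by
  rw [rchar, MulChar.map_nonunit χ (mt (ZMod.isUnit_iff_coprime n q).1 hn), Complex.zero_re]

lemma ofReal_rchar (hχ : χ ^ 2 = 1) (n : ℕ) : (rchar χ n : ℂ) = χ (n : ZMod q) := by
  by_cases hn : n.Coprime q
  · rcases apply_eq_of_sq_eq_one hχ ((ZMod.isUnit_iff_coprime n q).2 hn) with h | h <;>
      simp [rchar, h]
  · rw [rchar_eq_zero hn, MulChar.map_nonunit χ (mt (ZMod.isUnit_iff_coprime n q).1 hn),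
      Complex.ofReal_zero]

lemma rchar_mul (hχ : χ ^ 2 = 1) (m n : ℕ) : rchar χ (m * n) = rchar χ m * rchar χ n := by
  have h : ((rchar χ (m * n) : ℝ) : ℂ) = ((rchar χ m * rchar χ n : ℝ) : ℂ) := by
    push_cast
    rw [ofReal_rchar hχ, ofReal_rchar hχ, ofReal_rchar hχ, Nat.cast_mul, map_mul]
  exact_mod_cast h

lemma rchar_pow (hχ : χ ^ 2 = 1) (m k : ℕ) : rchar χ (m ^ k) = rchar χ m ^ k := by
  induction k with
  | zero => simp [rchar_one]
  | succ k ih => rw [pow_succ, rchar_mul hχ, ih, pow_succ]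

lemma abs_rchar_le (n : ℕ) : |rchar χ n| ≤ 1 :=
  (Complex.abs_re_le_norm _).trans (DirichletCharacter.norm_le_one χ _)

lemma rchar_trichotomy (hχ : χ ^ 2 = 1) (n : ℕ) : rchar χ n = 0 ∨ rchar χ n = 1 ∨ rchar χ n = -1 := by
  by_cases hn : n.Coprime q
  · exact Or.inr (rchar_cases hχ hn)
  · exact Or.inl (rchar_eq_zero hn)

lemma sum_rchar_period (hχ : χ ≠ 1) (M : ℕ) : ∑ i ∈ range q, rchar χ (M + i) = 0 := by
  have h0 := MulChar.sum_eq_zero_of_ne_one hχ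
  have h1 : ∑ i ∈ range q, χ ((M + i : ℕ) : ZMod q) = ∑ x : ZMod q, χ x := by
    refine sum_nbij' (fun i => ((M + i : ℕ) : ZMod q)) (fun x => (x - M).val) (by simp)
      (fun x _ => mem_range.2 (ZMod.val_lt _)) ?_ ?_ (by simp)
    · intro i hi
      rw [Nat.cast_add, add_sub_cancel_left, ZMod.val_cast_of_lt (mem_range.1 hi)]
    · intro x _
      rw [Nat.cast_add, ZMod.natCast_zmod_val, add_sub_cancel]
  have h2 : ∑ i ∈ range q, rchar χ (M + i) = (∑ i ∈ range q, χ ((M + i : ℕ) : ZMod q)).re := by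
    rw [Complex.re_sum]; rfl
  rw [h2, h1, h0, Complex.zero_re]

lemma abs_sum_rchar_le (hχ : χ ≠ 1) (N : ℕ) : |∑ n ∈ Ioc 0 N, rchar χ n| ≤ q := by
  have key : ∀ N : ℕ, |∑ i ∈ range N, rchar χ (1 + i)| ≤ q := by
    intro N
    induction N using Nat.strong_induction_on with
    | _ N ih =>
      rcases lt_or_ge N q with h | h
      · calc |∑ i ∈ range N, rchar χ (1 + i)| ≤ ∑ i ∈ range N, |rchar χ (1 + i)| :=
            abs_sum_le_sum_abs _ _
          _ ≤ ∑ i ∈ range N, (1 : ℝ) := sum_le_sum fun i _ => abs_rchar_le _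
          _ ≤ q := by simp; exact_mod_cast h.le
      · have h1 := ih (N - q) (Nat.sub_lt (by have := NeZero.pos q; omega) (NeZero.pos q))
        have h2 : N = N - q + q := by omega
        rw [h2, sum_range_add]
        have h3 := sum_rchar_period hχ (1 + (N - q))
        simp only [add_assoc] at h3
        rw [h3, add_zero]
        exact h1
  have h2 : Ioc 0 N = Ico 1 (N + 1) := by ext n; simp; omega
  rw [h2, sum_Ico_eq_sum_range, Nat.add_sub_cancel]
  exact key N

lemma abs_sum_mul_antitone_le {f g : ℕ → ℝ} {B : ℝ} (hf : ∀ N, |∑ n ∈ Ioc 0 N, f n| ≤ B) {M : ℕ}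
    (hg : ∀ n, M < n → g (n + 1) ≤ g n) (hg0 : ∀ n, M < n → 0 ≤ g n) (N : ℕ) :
    |∑ n ∈ Ioc M N, f n * g n| ≤ 2 * B * g (M + 1) := by
  have hB : 0 ≤ B := (abs_nonneg _).trans (hf 0)
  have h0 := hg0 (M + 1) (by omega)
  rcases le_or_gt N M with h | h
  · rw [Ioc_eq_empty_of_le h, sum_empty, abs_zero]; positivity
  have hF : ∀ N, M ≤ N → |∑ n ∈ Ioc M N, f n| ≤ 2 * B := by
    intro N hN
    have e := sum_Ioc_consecutive f (Nat.zero_le M) hN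
    have h1 := abs_le.1 (hf N)
    have h2 := abs_le.1 (hf M)
    rw [abs_le]; constructor <;> linarith
  have key : |∑ n ∈ Ioc M N, f n * g n - (∑ n ∈ Ioc M N, f n) * g N| ≤
      2 * B * (g (M + 1) - g N) := by
    induction N, (h : M + 1 ≤ N) using Nat.le_induction with
    | base => simp
    | succ N hN ih =>
      rw [sum_Ioc_succ_top (by omega), sum_Ioc_succ_top (by omega)]
      have h1 := abs_le.1 ih
      have h2 : |(∑ n ∈ Ioc M N, f n) * (g N - g (N + 1))| ≤ 2 * B * (g N - g (N + 1)) := by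
        have h4 := hg N (by omega)
        rw [abs_mul, abs_of_nonneg (by linarith : 0 ≤ g N - g (N + 1))]
        exact mul_le_mul_of_nonneg_right (hF N (by omega)) (by linarith)
      have h3 := abs_le.1 h2
      rw [abs_le]; constructor <;> nlinarith
  have h1 := abs_le.1 key
  have h2 : |(∑ n ∈ Ioc M N, f n) * g N| ≤ 2 * B * g N := by
    rw [abs_mul, abs_of_nonneg (hg0 N h)]
    exact mul_le_mul_of_nonneg_right (hF N h.le) (hg0 N h)
  have h3 := abs_le.1 h2
  rw [abs_le]; constructor <;> nlinarith

/-- `L` is the value at `1` of the `L`-function of a real character, with an explicit rate. -/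
def IsLOne (χ : DirichletCharacter ℂ q) (L : ℝ) : Prop :=
  ∀ M : ℕ, |∑ n ∈ Ioc 0 M, rchar χ n / n - L| ≤ 2 * q / (M + 1)

lemma exists_isLOne (hχ : χ ≠ 1) : ∃ L, IsLOne χ L := by
  have hd : ∀ M N : ℕ, M ≤ N →
      |∑ n ∈ Ioc 0 N, rchar χ n / n - ∑ n ∈ Ioc 0 M, rchar χ n / n| ≤ 2 * q / (M + 1) := by
    intro M N h
    rw [← sum_Ioc_consecutive (fun n : ℕ => rchar χ n / n) (Nat.zero_le M) h, add_sub_cancel_left]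
    have := abs_sum_mul_antitone_le (g := fun n : ℕ => 1 / (n : ℝ)) (abs_sum_rchar_le hχ) (M := M)
      (fun n hn => one_div_le_one_div_of_le (by exact_mod_cast (by omega : 0 < n))
        (by push_cast; linarith)) (fun n _ => by positivity) N
    simp only [mul_one_div] at this
    push_cast at this
    exact this
  have hlim : Tendsto (fun M : ℕ => 2 * (q : ℝ) / (M + 1)) atTop (𝓝 0) := by
    have := (tendsto_const_div_atTop_nhds_zero_nat (2 * (q : ℝ))).comp (tendsto_add_atTop_nat 1)
    refine this.congr fun n => ?_
    simp
  have hc : CauchySeq fun N : ℕ => ∑ n ∈ Ioc 0 N, rchar χ n / n := by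
    refine cauchySeq_of_le_tendsto_0 (fun M : ℕ => 2 * (2 * (q : ℝ) / (M + 1))) ?_
      (by simpa using hlim.const_mul 2)
    intro n m N hn hm
    have h1 := abs_le.1 (hd N n hn)
    have h2 := abs_le.1 (hd N m hm)
    rw [Real.dist_eq, abs_le]
    constructor <;> linarith
  obtain ⟨L, hL⟩ := cauchySeq_tendsto_of_complete hc
  refine ⟨L, fun M => ?_⟩
  have h1 : Tendsto (fun N : ℕ => |∑ n ∈ Ioc 0 N, rchar χ n / n - ∑ n ∈ Ioc 0 M, rchar χ n / n|)
      atTop (𝓝 |L - ∑ n ∈ Ioc 0 M, rchar χ n / n|) := (hL.sub_const _).abs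
  rw [abs_sub_comm]
  exact le_of_tendsto h1 (eventually_atTop.2 ⟨M, fun N hN => hd M N hN⟩)

lemma IsLOne.tendsto {L : ℝ} (h : IsLOne χ L) :
    Tendsto (fun N : ℕ => ∑ n ∈ Ioc 0 N, rchar χ n / n) atTop (𝓝 L) := by
  rw [tendsto_iff_norm_sub_tendsto_zero]
  have hlim : Tendsto (fun M : ℕ => 2 * (q : ℝ) / (M + 1)) atTop (𝓝 0) := by
    have := (tendsto_const_div_atTop_nhds_zero_nat (2 * (q : ℝ))).comp (tendsto_add_atTop_nat 1)
    refine this.congr fun n => ?_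
    simp
  exact squeeze_zero (fun _ => norm_nonneg _) (fun M => h M) hlim

lemma lam_mul (hχ : χ ^ 2 = 1) {m n : ℕ} (h : m.Coprime n) : lam χ (m * n) = lam χ m * lam χ n := by
  rw [lam, Nat.divisors_mul, Finset.mul_def, sum_image h.mul_injOn_divisors, sum_product, lam, lam,
    sum_mul_sum]
  exact sum_congr rfl fun i _ => sum_congr rfl fun j _ => rchar_mul hχ i j

lemma lam_prime_pow (hχ : χ ^ 2 = 1) {p : ℕ} (hp : p.Prime) (k : ℕ) :
    lam χ (p ^ k) = ∑ i ∈ range (k + 1), rchar χ p ^ i := by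
  rw [lam, Nat.sum_divisors_prime_pow hp]
  exact sum_congr rfl fun i _ => rchar_pow hχ p i

lemma lam_nonneg (hχ : χ ^ 2 = 1) (n : ℕ) : 0 ≤ lam χ n := by
  induction n using Nat.recOnPosPrimePosCoprime with
  | zero => simp [lam]
  | one => simp [lam, rchar_one]
  | prime_pow p k hp _ =>
    rw [lam_prime_pow hχ hp]
    rcases rchar_trichotomy hχ p with h | h | h <;> rw [h]
    · exact sum_nonneg fun i _ => by positivity
    · exact sum_nonneg fun i _ => by positivity
    · rw [neg_one_geom_sum]; split_ifs <;> norm_num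
  | coprime a b _ _ hab ha hb => rw [lam_mul hχ hab]; positivity

lemma one_le_lam_sq (hχ : χ ^ 2 = 1) {n : ℕ} (hn : n ≠ 0) : 1 ≤ lam χ (n ^ 2) := by
  induction n using Nat.recOnPosPrimePosCoprime with
  | zero => exact absurd rfl hn
  | one => simp [lam, rchar_one]
  | prime_pow p k hp _ =>
    rw [← pow_mul, lam_prime_pow hχ hp]
    rcases rchar_trichotomy hχ p with h | h | h <;> rw [h]
    · rw [sum_range_succ']; simp
    · simp
    · rw [neg_one_geom_sum, if_neg (by rw [Nat.not_even_iff_odd]; exact ⟨k, by ring⟩)]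
  | coprime a b ha hb hab iha ihb =>
    rw [mul_pow, lam_mul hχ (Nat.Coprime.pow 2 2 hab)]
    exact one_le_mul_of_one_le_of_one_le (iha (by omega)) (ihb (by omega))

lemma lam_prime_pow_mul (hχ : χ ^ 2 = 1) {p m : ℕ} (hp : p.Prime) (hm : ¬ p ∣ m) (k : ℕ) :
    lam χ (p ^ k * m) = (∑ i ∈ range (k + 1), rchar χ p ^ i) * lam χ m := by
  rw [lam_mul hχ (Nat.Coprime.pow_left k ((Nat.Prime.coprime_iff_not_dvd hp).2 hm)),
    lam_prime_pow hχ hp]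

/-- Hecke recursion. -/
lemma lam_prime_mul (hχ : χ ^ 2 = 1) {p n : ℕ} (hp : p.Prime) (hn : n ≠ 0) :
    lam χ (p * n) = (1 + rchar χ p) * lam χ n - rchar χ p * (if p ∣ n then lam χ (n / p) else 0) := by
  obtain ⟨k, m, hm, rfl⟩ := Nat.exists_eq_pow_mul_and_not_dvd hn p hp.ne_one
  rcases k with _ | k
  · rw [pow_zero, one_mul, if_neg hm, ← pow_one p, lam_prime_pow_mul hχ hp (by simpa using hm)]
    simp [sum_range_succ]
  · have e1 : p ^ (k + 1) * m / p = p ^ k * m := by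
      rw [pow_succ', mul_assoc, Nat.mul_div_cancel_left _ hp.pos]
    rw [if_pos (dvd_mul_of_dvd_left (dvd_pow_self p (by omega)) m), e1, ← mul_assoc, ← pow_succ',
      lam_prime_pow_mul hχ hp hm, lam_prime_pow_mul hχ hp hm, lam_prime_pow_mul hχ hp hm,
      sum_range_succ _ (k + 2), sum_range_succ _ (k + 1)]
    ring

lemma lam_prime_mul_le (hχ : χ ^ 2 = 1) {p n : ℕ} (hp : p.Prime) (h1 : rchar χ p = 1) (hn : n ≠ 0) :
    lam χ (p * n) ≤ 2 * lam χ n := by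
  rw [lam_prime_mul hχ hp hn, h1]
  have := lam_nonneg hχ (n / p)
  split_ifs <;> linarith

lemma lam_prime_mul_of_not_dvd (hχ : χ ^ 2 = 1) {p n : ℕ} (hp : p.Prime) (h1 : rchar χ p = -1)
    (hn : n ≠ 0) (hd : ¬ p ∣ n) : lam χ (p * n) = 0 := by
  rw [lam_prime_mul hχ hp hn, h1, if_neg hd]; ring

lemma lam_prime_mul_prime_mul (hχ : χ ^ 2 = 1) {p n : ℕ} (hp : p.Prime) (h1 : rchar χ p = -1)
    (hn : n ≠ 0) : lam χ (p * (p * n)) = lam χ n := by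
  rw [lam_prime_mul hχ hp (mul_ne_zero hp.ne_zero hn), h1, if_pos (dvd_mul_right p n),
    Nat.mul_div_cancel_left _ hp.pos]
  ring

lemma lam_prime {p : ℕ} (hp : p.Prime) : lam χ p = 1 + rchar χ p := by
  simp [lam, hp.sum_divisors, rchar_one, add_comm]

end RealCharacter

end Linnik

namespace Linnik

open Finset Filter Topology

lemma sum_divisors_eq_sum_sum (F : ℕ → ℕ → ℝ) (N : ℕ) :
    ∑ n ∈ Ioc 0 N, ∑ d ∈ n.divisors, F d (n / d) =
      ∑ d ∈ Ioc 0 N, ∑ m ∈ Ioc 0 N, if d * m ≤ N then F d m else 0 := by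
  have h1 : ∀ n ∈ Ioc 0 N, ∑ d ∈ n.divisors, F d (n / d) =
      ∑ d ∈ Ioc 0 N, ∑ m ∈ Ioc 0 N, if d * m = n then F d m else 0 := by
    intro n hn
    obtain ⟨h0, hN⟩ := mem_Ioc.1 hn
    rw [← Nat.sum_divisorsAntidiagonal F, ← sum_product', ← sum_filter]
    refine sum_congr ?_ fun _ _ => rfl
    ext ⟨d, m⟩
    simp only [Nat.mem_divisorsAntidiagonal, mem_filter, mem_product, mem_Ioc]
    constructor
    · rintro ⟨rfl, h⟩
      have hd : 0 < d := Nat.pos_of_ne_zero (by rintro rfl; simp at h)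
      have hm : 0 < m := Nat.pos_of_ne_zero (by rintro rfl; simp at h)
      exact ⟨⟨⟨hd, (Nat.le_mul_of_pos_right d hm).trans hN⟩, hm,
        (Nat.le_mul_of_pos_left m hd).trans hN⟩, rfl⟩
    · rintro ⟨-, rfl⟩
      exact ⟨rfl, h0.ne'⟩
  rw [sum_congr rfl h1, sum_comm]
  refine sum_congr rfl fun d hd => ?_
  rw [sum_comm]
  refine sum_congr rfl fun m hm => ?_
  have h0 : 0 < d * m := Nat.mul_pos (mem_Ioc.1 hd).1 (mem_Ioc.1 hm).1
  rw [sum_ite_eq]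
  exact if_congr (by rw [mem_Ioc]; exact ⟨fun h => h.2, fun h => ⟨h0, h⟩⟩) rfl rfl

/-- The Fejér-weighted count of multiples of `d` up to `N`. -/
noncomputable def fejerCount (N d : ℕ) : ℝ := ∑ m ∈ Ioc 0 N, max ((N : ℝ) - d * m) 0

lemma fejerCount_nonneg (N d : ℕ) : 0 ≤ fejerCount N d := sum_nonneg fun _ _ => le_max_right _ _

lemma fejerCount_succ_le (N d : ℕ) : fejerCount N (d + 1) ≤ fejerCount N d := by
  refine sum_le_sum fun m _ => max_le_max ?_ le_rfl
  push_cast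
  have : (0 : ℝ) ≤ m := by positivity
  linarith

lemma abs_fejerCount_sub_le {N d : ℕ} (hd : 0 < d) :
    |fejerCount N d - ((N : ℝ) ^ 2 / (2 * d) - N / 2)| ≤ (d : ℝ) := by
  have hd' : (0 : ℝ) < d := by exact_mod_cast hd
  have h1 : fejerCount N d = ∑ m ∈ Ioc 0 (N / d), ((N : ℝ) - d * m) := by
    have hsub : Ioc 0 (N / d) ⊆ Ioc 0 N := Ioc_subset_Ioc_right (Nat.div_le_self N d)
    rw [fejerCount, ← sum_subset hsub]
    · refine sum_congr rfl fun m hm => max_eq_left ?_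
      have := (Nat.le_div_iff_mul_le hd).1 (mem_Ioc.1 hm).2
      have h2 : (m : ℝ) * d ≤ N := by exact_mod_cast this
      linarith
    · intro m hm hm'
      refine max_eq_right ?_
      have h0 := (mem_Ioc.1 hm).1
      have : ¬ m * d ≤ N := fun h => hm' (mem_Ioc.2 ⟨h0, (Nat.le_div_iff_mul_le hd).2 h⟩)
      have h2 : (N : ℝ) ≤ m * d := by exact_mod_cast (not_le.1 this).le
      linarith
  have h2 : ∀ k : ℕ, ∑ m ∈ Ioc 0 k, ((N : ℝ) - d * m) = N * k - d * (k * (k + 1) / 2) := by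
    intro k
    induction k with
    | zero => simp
    | succ k ih => rw [sum_Ioc_succ_top (by omega), ih]; push_cast; ring
  have h3 : (N : ℝ) = d * (N / d : ℕ) + (N % d : ℕ) := by exact_mod_cast (Nat.div_add_mod N d).symm
  have h4 : ((N % d : ℕ) : ℝ) ≤ d := by exact_mod_cast (Nat.mod_lt N hd).le
  have h5 : (0 : ℝ) ≤ (N % d : ℕ) := by positivity
  rw [h1, h2]
  generalize ((N / d : ℕ) : ℝ) = k at *
  generalize ((N % d : ℕ) : ℝ) = r at *
  have e : (N : ℝ) * k - d * (k * (k + 1) / 2) - ((N : ℝ) ^ 2 / (2 * d) - N / 2) =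
      r * (d - r) / (2 * d) := by
    rw [h3]; field_simp; ring
  rw [e, abs_of_nonneg (div_nonneg (mul_nonneg h5 (by linarith)) (by positivity)),
    div_le_iff₀ (by positivity)]
  nlinarith

variable {q : ℕ} [NeZero q] {χ : DirichletCharacter ℂ q}

lemma sum_lam_mul_eq (χ : DirichletCharacter ℂ q) (N : ℕ) :
    ∑ n ∈ Ioc 0 N, lam χ n * ((N : ℝ) - n) = ∑ d ∈ Ioc 0 N, rchar χ d * fejerCount N d := by
  have h := sum_divisors_eq_sum_sum (fun d m => rchar χ d * ((N : ℝ) - d * m)) N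
  have e1 : ∑ n ∈ Ioc 0 N, lam χ n * ((N : ℝ) - n) =
      ∑ n ∈ Ioc 0 N, ∑ d ∈ n.divisors, rchar χ d * ((N : ℝ) - d * (n / d : ℕ)) := by
    refine sum_congr rfl fun n _ => ?_
    rw [lam, sum_mul]
    refine sum_congr rfl fun d hd => ?_
    rw [← Nat.cast_mul, Nat.mul_div_cancel' (Nat.dvd_of_mem_divisors hd)]
  rw [e1, h]
  refine sum_congr rfl fun d _ => ?_
  rw [fejerCount, mul_sum]
  refine sum_congr rfl fun m _ => ?_
  split_ifs with hdm
  · rw [max_eq_left]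
    have : (d : ℝ) * m ≤ N := by exact_mod_cast hdm
    linarith
  · rw [max_eq_right, mul_zero]
    have : (N : ℝ) ≤ d * m := by exact_mod_cast (not_le.1 hdm).le
    linarith

lemma sum_lam_mul_ge (hχ : χ ^ 2 = 1) (m : ℕ) :
    3 * (m : ℝ) ^ 3 ≤ ∑ n ∈ Ioc 0 (4 * m ^ 2), lam χ n * (((4 * m ^ 2 : ℕ) : ℝ) - n) := by
  have hinj : Set.InjOn (fun k : ℕ => k ^ 2) (Ioc 0 m : Finset ℕ) := fun a _ b _ h =>
    Nat.pow_left_injective (by norm_num : 2 ≠ 0) h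
  have hsub : (Ioc 0 m).image (fun k : ℕ => k ^ 2) ⊆ Ioc 0 (4 * m ^ 2) := by
    intro n hn
    obtain ⟨k, hk, rfl⟩ := mem_image.1 hn
    obtain ⟨h0, h1⟩ := mem_Ioc.1 hk
    exact mem_Ioc.2 ⟨by positivity, by nlinarith⟩
  have h1 := sum_le_sum_of_subset_of_nonneg (f := fun n : ℕ => lam χ n * (((4 * m ^ 2 : ℕ) : ℝ) - n))
    hsub fun n hn _ => mul_nonneg (lam_nonneg hχ n) (sub_nonneg.2 (by
      exact_mod_cast (mem_Ioc.1 hn).2))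
  rw [sum_image hinj] at h1
  refine le_trans ?_ h1
  have h2 : ∀ k ∈ Ioc 0 m, 3 * (m : ℝ) ^ 2 ≤
      lam χ (k ^ 2) * (((4 * m ^ 2 : ℕ) : ℝ) - ((k ^ 2 : ℕ) : ℝ)) := by
    intro k hk
    obtain ⟨h0, h1⟩ := mem_Ioc.1 hk
    have h3 := one_le_lam_sq hχ h0.ne'
    have h4 : (k : ℝ) ≤ m := by exact_mod_cast h1
    have h5 : (0 : ℝ) ≤ k := by positivity
    push_cast
    have h6 : 3 * (m : ℝ) ^ 2 ≤ 4 * m ^ 2 - k ^ 2 := by nlinarith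
    nlinarith [sq_nonneg (m : ℝ)]
  have h3 := sum_le_sum h2
  rw [sum_const, Nat.card_Ioc, Nat.sub_zero, nsmul_eq_mul] at h3
  linarith

lemma IsLOne.lower {L : ℝ} (h : IsLOne χ L) (hχ : χ ^ 2 = 1) (hχ1 : χ ≠ 1) :
    1 / (16000 * (q : ℝ) ^ 2) ≤ L := by
  set m : ℕ := 2000 * q ^ 2 with hm
  set N : ℕ := 4 * m ^ 2 with hN
  have hq : 1 ≤ q := NeZero.one_le
  obtain ⟨D, hD⟩ : ∃ D, D + 1 = 32 * q * m := ⟨32 * q * m - 1, by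
    have : 0 < 32 * q * m := by positivity
    omega⟩
  have hDN : D ≤ N := by
    have : 32 * q * m ≤ 4 * m ^ 2 := by rw [hm]; nlinarith [Nat.le_self_pow (two_ne_zero) q]
    omega
  have h1 := sum_lam_mul_ge hχ m
  rw [← hN, sum_lam_mul_eq, ← sum_Ioc_consecutive _ (Nat.zero_le D) hDN] at h1
  have h2 := abs_sum_mul_antitone_le (abs_sum_rchar_le hχ1) (M := D) (g := fejerCount N)
    (fun n _ => fejerCount_succ_le N n) (fun n _ => fejerCount_nonneg N n) N
  have h3 := abs_fejerCount_sub_le (N := N) (Nat.succ_pos D)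
  have h4 : |∑ d ∈ Ioc 0 D, rchar χ d * fejerCount N d - ((N : ℝ) ^ 2 / 2 *
      ∑ d ∈ Ioc 0 D, rchar χ d / d - N / 2 * ∑ d ∈ Ioc 0 D, rchar χ d)| ≤ (D : ℝ) ^ 2 := by
    rw [mul_sum, mul_sum, ← sum_sub_distrib, ← sum_sub_distrib]
    refine (abs_sum_le_sum_abs _ _).trans ((sum_le_sum (g := fun _ => (D : ℝ)) fun d hd => ?_).trans ?_)
    · obtain ⟨h0, h5⟩ := mem_Ioc.1 hd
      have h6 : (0 : ℝ) < d := by exact_mod_cast h0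
      have e : rchar χ d * fejerCount N d - ((N : ℝ) ^ 2 / 2 * (rchar χ d / d) - N / 2 * rchar χ d) =
          rchar χ d * (fejerCount N d - ((N : ℝ) ^ 2 / (2 * d) - N / 2)) := by field_simp
      rw [e, abs_mul]
      calc |rchar χ d| * |fejerCount N d - ((N : ℝ) ^ 2 / (2 * d) - N / 2)| ≤ 1 * d :=
            mul_le_mul (abs_rchar_le d) (abs_fejerCount_sub_le h0) (abs_nonneg _) zero_le_one
        _ ≤ D := by rw [one_mul]; exact_mod_cast h5
    · rw [sum_const, Nat.card_Ioc, nsmul_eq_mul, Nat.sub_zero, sq]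
  have h5 := abs_le.1 (h D)
  have h6 := abs_le.1 (abs_sum_rchar_le hχ1 D)
  have hq' : (1 : ℝ) ≤ q := by exact_mod_cast hq
  have hm' : (m : ℝ) = 2000 * (q : ℝ) ^ 2 := by rw [hm]; push_cast; ring
  have hN' : (N : ℝ) = 4 * (m : ℝ) ^ 2 := by rw [hN]; push_cast; ring
  have hD' : (D : ℝ) + 1 = 32 * q * m := by exact_mod_cast hD
  have hmpos : (0 : ℝ) < m := by rw [hm']; positivity
  have hDle : (D : ℝ) ^ 2 ≤ (32 * q * m) ^ 2 := by
    have : (0 : ℝ) ≤ D := by positivity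
    exact pow_le_pow_left₀ this (by linarith) 2
  have h7 : fejerCount N (D + 1) ≤ (m : ℝ) ^ 3 / (4 * q) + 32 * q * m := by
    have := (abs_le.1 h3).2
    have e : (N : ℝ) ^ 2 / (2 * ((D + 1 : ℕ) : ℝ)) = (m : ℝ) ^ 3 / (4 * q) := by
      rw [Nat.cast_add, Nat.cast_one, hD', hN']; field_simp; norm_num
    rw [e] at this
    push_cast at this
    have hNN : (0 : ℝ) ≤ N := by positivity
    linarith
  have e8 : 2 * (q : ℝ) / (D + 1) = 1 / (16 * m) := by rw [hD']; field_simp; norm_num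
  rw [e8] at h5
  have h9 : 2 * q * fejerCount N (D + 1) ≤ (m : ℝ) ^ 3 / 2 + 64 * q ^ 2 * m := by
    have := mul_le_mul_of_nonneg_left h7 (show (0 : ℝ) ≤ 2 * q by positivity)
    have e : 2 * (q : ℝ) * ((m : ℝ) ^ 3 / (4 * q) + 32 * q * m) = (m : ℝ) ^ 3 / 2 + 64 * q ^ 2 * m := by
      field_simp; ring
    linarith
  have h10 : (N : ℝ) ^ 2 / 2 * ∑ d ∈ Ioc 0 D, rchar χ d / d ≤ 8 * (m : ℝ) ^ 4 * L + (m : ℝ) ^ 3 / 2 := by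
    have := mul_le_mul_of_nonneg_left h5.2 (show (0 : ℝ) ≤ (N : ℝ) ^ 2 / 2 by positivity)
    have e : (N : ℝ) ^ 2 / 2 * (1 / (16 * m)) = (m : ℝ) ^ 3 / 2 := by rw [hN']; field_simp; norm_num
    have e2 : (N : ℝ) ^ 2 / 2 * L = 8 * (m : ℝ) ^ 4 * L := by rw [hN']; ring
    linarith
  have h11 : -((N : ℝ) / 2 * ∑ d ∈ Ioc 0 D, rchar χ d) ≤ 2 * q * (m : ℝ) ^ 2 := by
    have := mul_le_mul_of_nonneg_left h6.1 (show (0 : ℝ) ≤ (N : ℝ) / 2 by positivity)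
    have e : (N : ℝ) / 2 * -q = -(2 * q * (m : ℝ) ^ 2) := by rw [hN']; ring
    linarith
  have h12 := (abs_le.1 h4).2
  have h13 := (abs_le.1 h2).2
  have h14 : 2 * (m : ℝ) ^ 3 ≤ 8 * (m : ℝ) ^ 4 * L + 2 * q * (m : ℝ) ^ 2 + (32 * q * m) ^ 2 +
      64 * q ^ 2 * m := by linarith
  have h15 : 2 * (q : ℝ) * (m : ℝ) ^ 2 + (32 * q * m) ^ 2 + 64 * q ^ 2 * m ≤ (m : ℝ) ^ 3 := by
    have a1 : 2 * (q : ℝ) * (m : ℝ) ^ 2 ≤ 2 * q ^ 2 * (m : ℝ) ^ 2 :=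
      mul_le_mul_of_nonneg_right (by nlinarith) (by positivity)
    have a2 : 64 * (q : ℝ) ^ 2 * m ≤ 64 * q ^ 2 * (m : ℝ) ^ 2 :=
      mul_le_mul_of_nonneg_left (by nlinarith) (by positivity)
    have a3 : (m : ℝ) ^ 3 = 2000 * (q : ℝ) ^ 2 * (m : ℝ) ^ 2 := by
      rw [pow_succ', hm']
    nlinarith [show (0 : ℝ) ≤ (q : ℝ) ^ 2 * (m : ℝ) ^ 2 by positivity]
  have h16 : (m : ℝ) ^ 3 * 1 ≤ (m : ℝ) ^ 3 * (8 * m * L) := by linarith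
  have h17 := le_of_mul_le_mul_left h16 (by positivity)
  rw [div_le_iff₀ (by positivity)]
  rw [hm'] at h17
  linarith

end Linnik

namespace Linnik

open Finset Filter Topology

variable {q : ℕ} [NeZero q] {χ : DirichletCharacter ℂ q}

/-- Integers in a residue class up to `Y` divisible by all members of `D`. -/
noncomputable def clsSet (b : ZMod q) (Y : ℝ) (D : Finset ℕ) : Finset ℕ :=
  {n ∈ {n ∈ Ioc 0 ⌊Y⌋₊ | ((n : ℕ) : ZMod q) = b} | ∀ p ∈ D, p ∣ n}

lemma mem_clsSet {b : ZMod q} {Y : ℝ} {D : Finset ℕ} {n : ℕ} :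
    n ∈ clsSet b Y D ↔ ((0 < n ∧ n ≤ ⌊Y⌋₊) ∧ ((n : ℕ) : ZMod q) = b) ∧ ∀ p ∈ D, p ∣ n := by
  rw [clsSet, mem_filter, mem_filter, mem_Ioc]

lemma abs_card_mul_class_sub_le (b : ZMod q) {d : ℕ} (hd : d.Coprime q) {x : ℝ} (hx : 0 ≤ x) :
    |(#{m ∈ Ioc 0 ⌊x⌋₊ | ((d * m : ℕ) : ZMod q) = b} : ℝ) - x / q| ≤ 2 := by
  have h := abs_card_modEq_sub_le q (((residue q d)⁻¹ : (ZMod q)ˣ) * b).val (NeZero.pos q) hx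
  have e : {m ∈ Ioc 0 ⌊x⌋₊ | ((d * m : ℕ) : ZMod q) = b} =
      {m ∈ Ioc 0 ⌊x⌋₊ | m ≡ (((residue q d)⁻¹ : (ZMod q)ˣ) * b).val [MOD q]} := by
    refine filter_congr fun m _ => ?_
    rw [← ZMod.natCast_eq_natCast_iff, ZMod.natCast_zmod_val, Nat.cast_mul, ← coe_residue hd,
      Units.eq_inv_mul_iff_mul_eq]
  rw [e]
  exact h

lemma rchar_swap (hχ : χ ^ 2 = 1) {b : (ZMod q)ˣ} {d m : ℕ} (h : ((d * m : ℕ) : ZMod q) = b) :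
    rchar χ d = (χ b).re * rchar χ m := by
  have h1 : rchar χ (d * m) = (χ b).re := by rw [rchar, h]
  have hco : (d * m).Coprime q := (ZMod.isUnit_iff_coprime _ q).1 (h ▸ b.isUnit)
  have h2 : rchar χ m * rchar χ m = 1 := by
    rcases rchar_cases hχ (Nat.Coprime.coprime_mul_left hco) with h | h <;> rw [h] <;> norm_num
  rw [← h1, rchar_mul hχ, mul_assoc, h2, mul_one]

lemma sum_hyperbola (F : ℕ → ℕ → ℝ) {N s : ℕ} (h1 : s * s ≤ N) (h2 : N < (s + 1) * (s + 1)) :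
    ∑ d ∈ Ioc 0 N, ∑ m ∈ Ioc 0 N, (if d * m ≤ N then F d m else 0) =
      ∑ d ∈ Ioc 0 s, ∑ m ∈ Ioc 0 N, (if d * m ≤ N then F d m else 0) +
      ∑ m ∈ Ioc 0 s, ∑ d ∈ Ioc 0 N, (if m * d ≤ N then F d m else 0) -
      ∑ d ∈ Ioc 0 s, ∑ m ∈ Ioc 0 s, F d m := by
  have hsN : s ≤ N := by nlinarith
  have hsub : ∀ g : ℕ → ℝ, ∑ d ∈ Ioc 0 s, g d = ∑ d ∈ Ioc 0 N, if d ≤ s then g d else 0 := by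
    intro g
    rw [← sum_filter]
    refine sum_congr ?_ fun _ _ => rfl
    ext d; simp only [mem_Ioc, mem_filter]; omega
  rw [hsub, hsub, hsub]
  have e2 : ∑ m ∈ Ioc 0 N, (if m ≤ s then ∑ d ∈ Ioc 0 N, (if m * d ≤ N then F d m else 0) else 0) =
      ∑ d ∈ Ioc 0 N, ∑ m ∈ Ioc 0 N, (if m ≤ s then (if m * d ≤ N then F d m else 0) else 0) := by
    rw [sum_comm]
    refine sum_congr rfl fun m _ => ?_
    split_ifs <;> simp
  rw [e2, ← sum_add_distrib, ← sum_sub_distrib]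
  refine sum_congr rfl fun d hd => ?_
  have e3 : (if d ≤ s then ∑ m ∈ Ioc 0 N, (if d * m ≤ N then F d m else 0) else 0) =
      ∑ m ∈ Ioc 0 N, if d ≤ s then (if d * m ≤ N then F d m else 0) else 0 := by
    split_ifs <;> simp
  have e4 : (if d ≤ s then ∑ m ∈ Ioc 0 s, F d m else 0) =
      ∑ m ∈ Ioc 0 N, if d ≤ s then (if m ≤ s then F d m else 0) else 0 := by
    split_ifs
    · rw [hsub]
    · simp
  rw [e3, e4, ← sum_add_distrib, ← sum_sub_distrib]
  refine sum_congr rfl fun m hm => ?_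
  rw [mul_comm m d]
  by_cases hds : d ≤ s <;> by_cases hms : m ≤ s <;> by_cases hdm : d * m ≤ N <;>
    simp only [hds, hms, hdm, if_true, if_false] <;> try ring1
  · exact absurd ((Nat.mul_le_mul hds hms).trans h1) hdm
  · exact absurd (Nat.mul_le_mul (not_le.1 hds) (not_le.1 hms)) (by simp only [Nat.succ_eq_add_one]; omega)

lemma abs_sum_lam_class_sub_le {L : ℝ} (hL : IsLOne χ L) (hχ : χ ^ 2 = 1) (hχ1 : χ ≠ 1)
    (b : (ZMod q)ˣ) {Y : ℝ} (hY : 0 ≤ Y) :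
    |∑ n ∈ clsSet (b : ZMod q) Y ∅, lam χ n - Y / q * L * (1 + (χ b).re)| ≤ 11 * √Y := by
  set N := ⌊Y⌋₊ with hN
  set s := Nat.sqrt N with hs
  set F : ℕ → ℕ → ℝ := fun d m => if ((d * m : ℕ) : ZMod q) = b then rchar χ d else 0 with hF
  have hq : (0 : ℝ) < q := by exact_mod_cast NeZero.pos q
  have hsY : (s : ℝ) ≤ √Y := by
    refine Real.le_sqrt_of_sq_le ?_
    have h1 : ((s * s : ℕ) : ℝ) ≤ N := by exact_mod_cast Nat.sqrt_le N
    push_cast at h1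
    nlinarith [Nat.floor_le hY]
  have hsY' : √Y ≤ s + 1 := by
    refine Real.sqrt_le_iff.2 ⟨by positivity, ?_⟩
    have h1 : ((N + 1 : ℕ) : ℝ) ≤ (((s + 1) * (s + 1) : ℕ) : ℝ) := by
      exact_mod_cast Nat.lt_succ_sqrt N
    push_cast at h1
    nlinarith [Nat.lt_floor_add_one Y]
  have hT : ∑ n ∈ clsSet (b : ZMod q) Y ∅, lam χ n =
      ∑ n ∈ Ioc 0 N, ∑ d ∈ n.divisors, F d (n / d) := by
    have : clsSet (b : ZMod q) Y ∅ = {n ∈ Ioc 0 N | ((n : ℕ) : ZMod q) = b} := by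
      simp [clsSet, hN]
    rw [this, sum_filter]
    refine sum_congr rfl fun n _ => ?_
    have : ∀ d ∈ n.divisors, F d (n / d) = if (n : ZMod q) = b then rchar χ d else 0 := by
      intro d hd
      simp only [hF]
      rw [Nat.mul_div_cancel' (Nat.dvd_of_mem_divisors hd)]
    rw [sum_congr rfl this]
    split_ifs
    · rfl
    · simp
  set W := ∑ d ∈ Ioc 0 s, ∑ m ∈ Ioc 0 N, (if d * m ≤ N then F d m else 0) with hW
  set V := ∑ d ∈ Ioc 0 s, ∑ m ∈ Ioc 0 s, F d m with hV
  have hT2 : ∑ n ∈ clsSet (b : ZMod q) Y ∅, lam χ n = (1 + (χ b).re) * W - V := by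
    rw [hT, sum_divisors_eq_sum_sum, sum_hyperbola F (Nat.sqrt_le N) (Nat.lt_succ_sqrt N)]
    have : ∑ m ∈ Ioc 0 s, ∑ d ∈ Ioc 0 N, (if m * d ≤ N then F d m else 0) = (χ b).re * W := by
      rw [hW, mul_sum]
      refine sum_congr rfl fun d _ => ?_
      rw [mul_sum]
      refine sum_congr rfl fun m _ => ?_
      rw [mul_ite, mul_zero]
      refine if_congr Iff.rfl ?_ rfl
      simp only [hF]
      rw [mul_comm m d]
      split_ifs with h
      · rw [mul_comm] at h; exact rchar_swap hχ h
      · simp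
    rw [this]; ring
  have hWb : |W - Y / q * ∑ d ∈ Ioc 0 s, rchar χ d / d| ≤ 2 * s := by
    rw [hW, mul_sum, ← sum_sub_distrib]
    refine (abs_sum_le_sum_abs _ _).trans ((sum_le_sum (g := fun _ => (2 : ℝ)) fun d hd => ?_).trans ?_)
    · have hd0 := (mem_Ioc.1 hd).1
      have hd0' : (0 : ℝ) < d := by exact_mod_cast hd0
      have e : ∑ m ∈ Ioc 0 N, (if d * m ≤ N then F d m else 0) =
          rchar χ d * #{m ∈ Ioc 0 ⌊Y / d⌋₊ | ((d * m : ℕ) : ZMod q) = b} := by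
        simp only [hF]
        rw [← sum_filter, ← sum_filter, sum_const, nsmul_eq_mul, mul_comm, filter_filter]
        congr 3
        ext m
        simp only [mem_filter, mem_Ioc, Nat.floor_div_natCast, ← hN, Nat.le_div_iff_mul_le hd0]
        constructor
        · rintro ⟨⟨h0, -⟩, h1, h2⟩
          exact ⟨⟨h0, by rwa [mul_comm]⟩, h2⟩
        · rintro ⟨⟨h0, h1⟩, h2⟩
          exact ⟨⟨h0, (Nat.le_mul_of_pos_right m hd0).trans h1⟩, by rwa [mul_comm], h2⟩
      rw [e]
      by_cases hco : d.Coprime q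
      · have h1 := abs_card_mul_class_sub_le (b : ZMod q) hco (x := Y / d) (by positivity)
        have e2 : rchar χ d * #{m ∈ Ioc 0 ⌊Y / d⌋₊ | ((d * m : ℕ) : ZMod q) = b} -
            Y / q * (rchar χ d / d) = rchar χ d *
              (#{m ∈ Ioc 0 ⌊Y / d⌋₊ | ((d * m : ℕ) : ZMod q) = b} - Y / d / q) := by
          field_simp
        rw [e2, abs_mul]
        calc _ ≤ 1 * 2 := mul_le_mul (abs_rchar_le d) h1 (abs_nonneg _) zero_le_one
          _ = 2 := one_mul _
      · simp [rchar_eq_zero hco]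
    · rw [sum_const, Nat.card_Ioc, nsmul_eq_mul, Nat.sub_zero, mul_comm]
  have hVb : |V - s / q * ∑ d ∈ Ioc 0 s, rchar χ d| ≤ 2 * s := by
    rw [hV, mul_sum, ← sum_sub_distrib]
    refine (abs_sum_le_sum_abs _ _).trans ((sum_le_sum (g := fun _ => (2 : ℝ)) fun d hd => ?_).trans ?_)
    · have e : ∑ m ∈ Ioc 0 s, F d m =
          rchar χ d * #{m ∈ Ioc 0 ⌊(s : ℝ)⌋₊ | ((d * m : ℕ) : ZMod q) = b} := by
        simp only [hF]
        rw [← sum_filter, sum_const, nsmul_eq_mul, mul_comm, Nat.floor_natCast]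
      rw [e]
      by_cases hco : d.Coprime q
      · have h1 := abs_card_mul_class_sub_le (b : ZMod q) hco (x := s) (by positivity)
        have e2 : rchar χ d * #{m ∈ Ioc 0 ⌊(s : ℝ)⌋₊ | ((d * m : ℕ) : ZMod q) = b} -
            s / q * rchar χ d = rchar χ d *
              (#{m ∈ Ioc 0 ⌊(s : ℝ)⌋₊ | ((d * m : ℕ) : ZMod q) = b} - s / q) := by
          ring
        rw [e2, abs_mul]
        calc _ ≤ 1 * 2 := mul_le_mul (abs_rchar_le d) h1 (abs_nonneg _) zero_le_one
          _ = 2 := one_mul _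
      · simp [rchar_eq_zero hco]
    · rw [sum_const, Nat.card_Ioc, nsmul_eq_mul, Nat.sub_zero, mul_comm]
  have hS : |s / q * ∑ d ∈ Ioc 0 s, rchar χ d| ≤ s := by
    rw [abs_mul, abs_of_nonneg (by positivity : (0 : ℝ) ≤ s / q)]
    calc s / q * |∑ d ∈ Ioc 0 s, rchar χ d| ≤ s / q * (q : ℝ) :=
          mul_le_mul_of_nonneg_left (abs_sum_rchar_le hχ1 s) (by positivity)
      _ = s := by field_simp
  have hA : |Y / q * ∑ d ∈ Ioc 0 s, rchar χ d / d - Y / q * L| ≤ 2 * √Y := by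
    rw [← mul_sub, abs_mul, abs_of_nonneg (by positivity : 0 ≤ Y / q)]
    calc Y / q * |∑ d ∈ Ioc 0 s, rchar χ d / d - L| ≤ Y / q * (2 * q / (s + 1)) :=
          mul_le_mul_of_nonneg_left (hL s) (by positivity)
      _ = 2 * Y / (s + 1) := by field_simp
      _ ≤ 2 * √Y := by
        rw [div_le_iff₀ (by positivity)]
        nlinarith [Real.mul_self_sqrt hY, Real.sqrt_nonneg Y]
  have he : |1 + (χ b).re| ≤ 2 := by
    have := abs_le.1 ((Complex.abs_re_le_norm _).trans (DirichletCharacter.norm_le_one χ (b : ZMod q)))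
    rw [abs_le]; constructor <;> linarith
  have hWL : |W - Y / q * L| ≤ 4 * √Y := by
    have := abs_sub_le W (Y / q * ∑ d ∈ Ioc 0 s, rchar χ d / d) (Y / q * L)
    linarith
  have hVL : |V| ≤ 3 * √Y := by
    have h1 := abs_le.1 hVb
    have h2 := abs_le.1 hS
    rw [abs_le]; constructor <;> linarith
  have hm : |(1 + (χ b).re) * (W - Y / q * L)| ≤ 8 * √Y := by
    rw [abs_mul]
    calc _ ≤ 2 * (4 * √Y) := mul_le_mul he hWL (abs_nonneg _) (by norm_num)
      _ = 8 * √Y := by ring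
  rw [hT2]
  have h1 := abs_le.1 hVL
  have h2 := abs_le.1 hm
  rw [abs_le]; constructor <;> linarith

end Linnik

namespace Linnik

open Finset Filter Topology

variable {q : ℕ} [NeZero q] {χ : DirichletCharacter ℂ q}

lemma sum_clsSet_insert (G : ℕ → ℝ) (b : (ZMod q)ˣ) (Y : ℝ) {p : ℕ} {D : Finset ℕ} (hp : p.Prime)
    (hpq : p.Coprime q) (hD : ∀ r ∈ D, r.Prime) (hpD : p ∉ D) :
    ∑ n ∈ clsSet (b : ZMod q) Y (insert p D), G n =
      ∑ n ∈ clsSet (((residue q p)⁻¹ * b : (ZMod q)ˣ) : ZMod q) (Y / p) D, G (p * n) := by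
  have hcls : ∀ n : ℕ, ((p * n : ℕ) : ZMod q) = b ↔
      (n : ZMod q) = (((residue q p)⁻¹ * b : (ZMod q)ˣ) : ZMod q) := by
    intro n
    rw [Units.val_mul, Units.eq_inv_mul_iff_mul_eq, coe_residue hpq, Nat.cast_mul]
  have hdvd : ∀ n : ℕ, (∀ r ∈ D, r ∣ p * n) ↔ ∀ r ∈ D, r ∣ n := by
    refine fun n => forall₂_congr fun r hr => ⟨fun h => ?_, fun h => h.mul_left p⟩
    refine Nat.Coprime.dvd_of_dvd_mul_left ((Nat.coprime_primes (hD r hr) hp).2 ?_) h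
    rintro rfl; exact hpD hr
  symm
  refine sum_nbij (fun n => p * n) ?_ ?_ ?_ fun _ _ => rfl
  · intro n hn
    obtain ⟨⟨⟨h0, h1⟩, h2⟩, h3⟩ := mem_clsSet.1 hn
    rw [Nat.floor_div_natCast, Nat.le_div_iff_mul_le hp.pos, mul_comm] at h1
    refine mem_clsSet.2 ⟨⟨⟨Nat.mul_pos hp.pos h0, h1⟩, (hcls n).2 h2⟩, ?_⟩
    rw [forall_mem_insert]
    exact ⟨dvd_mul_right p n, (hdvd n).2 h3⟩
  · exact fun m _ n _ h => Nat.eq_of_mul_eq_mul_left hp.pos h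
  · intro n hn
    obtain ⟨⟨⟨h0, h1⟩, h2⟩, h3⟩ := mem_clsSet.1 hn
    rw [forall_mem_insert] at h3
    obtain ⟨⟨m, rfl⟩, h4⟩ := h3
    refine ⟨m, mem_clsSet.2 ⟨⟨⟨Nat.pos_of_mul_pos_left h0, ?_⟩, (hcls m).1 h2⟩, (hdvd m).1 h4⟩, rfl⟩
    rw [Nat.floor_div_natCast, Nat.le_div_iff_mul_le hp.pos, mul_comm]
    exact h1

/-- The sieve density of the convolution `lam χ`. -/
noncomputable def lamDensity (χ : DirichletCharacter ℂ q) (p : ℕ) : ℝ :=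
  1 - (1 - 1 / (p : ℝ)) * (1 - rchar χ p / p)

lemma re_char_residue_inv_mul (hχ : χ ^ 2 = 1) {p : ℕ} (hpq : p.Coprime q) (b : (ZMod q)ˣ) :
    (χ ((residue q p)⁻¹ * b : (ZMod q)ˣ)).re = rchar χ p * (χ b).re := by
  have h1 : (((residue q p) * ((residue q p)⁻¹ * b) : (ZMod q)ˣ) : ZMod q) = b := by
    rw [mul_inv_cancel_left]
  rw [Units.val_mul, coe_residue hpq] at h1
  have h2 := congrArg χ h1
  rw [map_mul, ← ofReal_rchar hχ] at h2
  have h3 := congrArg Complex.re h2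
  rw [Complex.re_ofReal_mul] at h3
  rw [← h3, ← mul_assoc]
  rcases rchar_cases hχ hpq with h | h <;> rw [h] <;> norm_num

lemma lam_level {L : ℝ} (hL : IsLOne χ L) (hχ : χ ^ 2 = 1) (hχ1 : χ ≠ 1) (D : Finset ℕ) :
    (∀ p ∈ D, p.Prime ∧ p.Coprime q) → ∀ (b : (ZMod q)ˣ) (Y : ℝ), 0 ≤ Y →
      |∑ n ∈ clsSet (b : ZMod q) Y D, lam χ n -
        Y / q * L * (1 + (χ b).re) * ∏ p ∈ D, lamDensity χ p| ≤
      11 * √Y * ((∏ p ∈ D, p : ℕ) : ℝ) ^ 2 := by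
  induction D using Finset.induction_on with
  | empty =>
    intro _ b Y hY
    simpa using abs_sum_lam_class_sub_le hL hχ hχ1 b hY
  | insert p D hpD ih =>
    intro hD b Y hY
    rw [forall_mem_insert] at hD
    obtain ⟨⟨hp, hpq⟩, hD⟩ := hD
    set u := residue q p
    have ih1 := ih hD (u⁻¹ * b) (Y / p) (by positivity)
    have ih2 := ih hD (u⁻¹ * (u⁻¹ * b)) (Y / p / p) (by positivity)
    rw [re_char_residue_inv_mul hχ hpq] at ih1
    rw [re_char_residue_inv_mul hχ hpq, re_char_residue_inv_mul hχ hpq] at ih2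
    set S1 := ∑ n ∈ clsSet ((u⁻¹ * b : (ZMod q)ˣ) : ZMod q) (Y / p) D, lam χ n
    set S2 := ∑ n ∈ clsSet ((u⁻¹ * (u⁻¹ * b) : (ZMod q)ˣ) : ZMod q) (Y / p / p) D, lam χ n with hS2
    have e : ∑ n ∈ clsSet (b : ZMod q) Y (insert p D), lam χ n =
        (1 + rchar χ p) * S1 - rchar χ p * S2 := by
      rw [sum_clsSet_insert _ b Y hp hpq (fun r hr => (hD r hr).1) hpD, mul_sum]
      have e2 : S2 = ∑ n ∈ clsSet ((u⁻¹ * b : (ZMod q)ˣ) : ZMod q) (Y / p) D,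
          if p ∣ n then lam χ (n / p) else 0 := by
        rw [← sum_filter]
        have e3 : {n ∈ clsSet ((u⁻¹ * b : (ZMod q)ˣ) : ZMod q) (Y / p) D | p ∣ n} =
            clsSet ((u⁻¹ * b : (ZMod q)ˣ) : ZMod q) (Y / p) (insert p D) := by
          ext n
          rw [mem_filter, mem_clsSet, mem_clsSet, forall_mem_insert]
          tauto
        rw [e3, sum_clsSet_insert _ _ _ hp hpq (fun r hr => (hD r hr).1) hpD, hS2]
        refine sum_congr rfl fun n _ => ?_
        rw [Nat.mul_div_cancel_left _ hp.pos]
      rw [e2, mul_sum, ← sum_sub_distrib]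
      refine sum_congr rfl fun n hn => ?_
      exact lam_prime_mul hχ hp (mem_clsSet.1 hn).1.1.1.ne'
    have hp2 : (2 : ℝ) ≤ p := by exact_mod_cast hp.two_le
    have hq : (0 : ℝ) < q := by exact_mod_cast NeZero.pos q
    rw [prod_insert hpD, prod_insert hpD, e]
    push_cast
    set G := ∏ r ∈ D, lamDensity χ r
    set Q := ∏ r ∈ D, (r : ℝ) with hQ
    push_cast at ih1 ih2
    rw [← hQ] at ih1 ih2
    have r1 : √(Y / p) ≤ √Y := Real.sqrt_le_sqrt (div_le_self hY (by linarith))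
    have r2 : √(Y / p / p) ≤ √Y :=
      (Real.sqrt_le_sqrt (div_le_self (by positivity) (by linarith))).trans r1
    have k1 : 11 * √(Y / p) * Q ^ 2 ≤ 11 * √Y * Q ^ 2 := by gcongr
    have k2 : 11 * √(Y / p / p) * Q ^ 2 ≤ 11 * √Y * Q ^ 2 := by gcongr
    have k3 : 3 * (11 * √Y * Q ^ 2) ≤ 11 * √Y * (p * Q) ^ 2 := by
      have h0 : 0 ≤ 11 * √Y * Q ^ 2 := by positivity
      have : 11 * √Y * (p * Q) ^ 2 = (p : ℝ) ^ 2 * (11 * √Y * Q ^ 2) := by ring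
      rw [this]
      exact mul_le_mul_of_nonneg_right (by nlinarith) h0
    have i1 := abs_le.1 (ih1.trans k1)
    have i2 := abs_le.1 (ih2.trans k2)
    have hp0 : (p : ℝ) ≠ 0 := by positivity
    rcases rchar_cases hχ hpq with h | h
    · rw [h] at i1 i2 ⊢
      have em : Y / q * L * (1 + (χ b).re) * (lamDensity χ p * G) =
          2 * (Y / p / q * L * (1 + 1 * (χ b).re) * G) -
            Y / p / p / q * L * (1 + 1 * (1 * (χ b).re)) * G := by
        rw [lamDensity, h]; field_simp; ring
      rw [em, abs_le]
      constructor <;> linarith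
    · rw [h] at i1 i2 ⊢
      have em : Y / q * L * (1 + (χ b).re) * (lamDensity χ p * G) =
            Y / p / p / q * L * (1 + -1 * (-1 * (χ b).re)) * G := by
        rw [lamDensity, h]; field_simp; ring
      rw [em, abs_le]
      constructor <;> linarith

lemma sieveDensity_lamDensity (hχ : χ ^ 2 = 1) (Z : ℕ) :
    SieveDensity Z (siftPrimes Z q) (lamDensity χ) := by
  intro p hp
  obtain ⟨h1, h2⟩ := mem_primesBelow_succ.1 (mem_filter.1 hp).1
  have h3 : (2 : ℝ) ≤ p := by exact_mod_cast h2.two_le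
  have h4 : (1 : ℝ) / p ≤ 1 / 2 := one_div_le_one_div_of_le (by norm_num) h3
  have h5 : (0 : ℝ) < 1 / p := by positivity
  have hpq : p.Coprime q := (Nat.Prime.coprime_iff_not_dvd h2).2 (mem_filter.1 hp).2
  have e : (2 : ℝ) / p = 2 * (1 / p) := by ring
  have e2 : rchar χ p / p = rchar χ p * (1 / p) := by ring
  rw [lamDensity, e, e2]
  generalize (1 : ℝ) / p = x at *
  refine ⟨h2, by exact_mod_cast h1, ?_⟩
  rcases rchar_cases hχ hpq with h | h <;> rw [h] <;>
    refine ⟨by nlinarith, by nlinarith, by nlinarith⟩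

end Linnik

namespace Linnik

open Finset Filter Topology

variable {q : ℕ} [NeZero q] {χ : DirichletCharacter ℂ q}

lemma sum_coprime_insert (hχ : χ ^ 2 = 1) {S : Finset ℕ} (hS : ∀ r ∈ S, r.Prime) {p : ℕ} (hp : p.Prime)
    (hpS : p ∉ S) (x : ℝ) :
    ∑ n ∈ Ioc 0 ⌊x⌋₊ with ∀ r ∈ insert p S, ¬ r ∣ n, rchar χ n / n =
      ∑ n ∈ Ioc 0 ⌊x⌋₊ with ∀ r ∈ S, ¬ r ∣ n, rchar χ n / n -
      rchar χ p / p * ∑ n ∈ Ioc 0 ⌊x / p⌋₊ with ∀ r ∈ S, ¬ r ∣ n, rchar χ n / n := by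
  have h1 := sum_filter_add_sum_filter_not (Ioc 0 ⌊x⌋₊ |>.filter fun n => ∀ r ∈ S, ¬ r ∣ n)
    (fun n => p ∣ n) (fun n : ℕ => rchar χ n / n)
  have e1 : ((Ioc 0 ⌊x⌋₊ |>.filter fun n => ∀ r ∈ S, ¬ r ∣ n).filter fun n => ¬ p ∣ n) =
      {n ∈ Ioc 0 ⌊x⌋₊ | ∀ r ∈ insert p S, ¬ r ∣ n} := by
    ext n
    simp only [mem_filter, forall_mem_insert]
    tauto
  have e2 : ∑ n ∈ (Ioc 0 ⌊x⌋₊ |>.filter fun n => ∀ r ∈ S, ¬ r ∣ n).filter fun n => p ∣ n,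
      rchar χ n / n =
      rchar χ p / p * ∑ n ∈ Ioc 0 ⌊x / p⌋₊ with ∀ r ∈ S, ¬ r ∣ n, rchar χ n / n := by
    rw [mul_sum]
    have hdvd : ∀ n : ℕ, (∀ r ∈ S, ¬ r ∣ p * n) ↔ ∀ r ∈ S, ¬ r ∣ n := by
      refine fun n => forall₂_congr fun r hr => not_congr ⟨fun h => ?_, fun h => h.mul_left p⟩
      refine Nat.Coprime.dvd_of_dvd_mul_left ((Nat.coprime_primes (hS r hr) hp).2 ?_) h
      rintro rfl; exact hpS hr
    symm
    refine sum_nbij (fun n => p * n) ?_ (fun m _ n _ h => Nat.eq_of_mul_eq_mul_left hp.pos h) ?_ ?_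
    · intro n hn
      rw [mem_filter, mem_Ioc, Nat.floor_div_natCast, Nat.le_div_iff_mul_le hp.pos, mul_comm] at hn
      rw [mem_filter, mem_filter, mem_Ioc]
      exact ⟨⟨⟨Nat.mul_pos hp.pos hn.1.1, hn.1.2⟩, (hdvd n).2 hn.2⟩, dvd_mul_right p n⟩
    · intro n hn
      rw [mem_coe, mem_filter, mem_filter, mem_Ioc] at hn
      obtain ⟨⟨⟨h0, h1⟩, h2⟩, m, rfl⟩ := hn
      refine ⟨m, ?_, rfl⟩
      rw [mem_coe, mem_filter, mem_Ioc, Nat.floor_div_natCast, Nat.le_div_iff_mul_le hp.pos, mul_comm]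
      exact ⟨⟨Nat.pos_of_mul_pos_left h0, h1⟩, (hdvd m).1 h2⟩
    · intro n _
      rw [rchar_mul hχ, Nat.cast_mul, div_mul_div_comm]
  rw [e1, e2] at h1
  linarith

lemma tendsto_sum_coprime {L : ℝ} (hL : IsLOne χ L) (hχ : χ ^ 2 = 1) (S : Finset ℕ) :
    (∀ r ∈ S, r.Prime) →
    Tendsto (fun x : ℝ => ∑ n ∈ Ioc 0 ⌊x⌋₊ with ∀ r ∈ S, ¬ r ∣ n, rchar χ n / n) atTop
      (𝓝 (L * ∏ p ∈ S, (1 - rchar χ p / p))) := by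
  induction S using Finset.induction_on with
  | empty =>
    intro _
    have h1 := hL.tendsto.comp (tendsto_nat_floor_atTop (α := ℝ))
    simp only [prod_empty, mul_one]
    refine h1.congr fun x => ?_
    simp
  | insert p S hpS ih =>
    intro hS
    rw [forall_mem_insert] at hS
    have h1 := ih hS.2
    have hp : (0 : ℝ) < p := by exact_mod_cast hS.1.pos
    have h2 := (h1.comp (tendsto_id.atTop_div_const hp)).const_mul (rchar χ p / p)
    have h3 := h1.sub h2
    rw [prod_insert hpS]
    have e : L * ((1 - rchar χ p / p) * ∏ r ∈ S, (1 - rchar χ r / r)) =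
        L * ∏ r ∈ S, (1 - rchar χ r / r) -
          rchar χ p / p * (L * ∏ r ∈ S, (1 - rchar χ r / r)) := by ring
    rw [e]
    refine h3.congr fun x => ?_
    exact (sum_coprime_insert hχ hS.2 hS.1 hpS x).symm

lemma prod_siftPrimes_rchar (χ : DirichletCharacter ℂ q) (Z : ℕ) :
    ∏ p ∈ (Z + 1).primesBelow, (1 - rchar χ p / p) = ∏ p ∈ siftPrimes Z q, (1 - rchar χ p / p) := by
  rw [siftPrimes, prod_filter]
  refine prod_congr rfl fun p hp => ?_
  split_ifs with h
  · rw [rchar_eq_zero]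
    · simp
    · rw [Nat.Prime.coprime_iff_not_dvd (mem_primesBelow_succ.1 hp).2]; exact not_not.2 h
  · rfl

lemma Expansion.re_transform_eq {C : ℝ} {Z : ℕ} {c d k : (ZMod q)ˣ → ℝ} (h : Expansion C q Z c d k)
    (hχ : χ ^ 2 = 1) (hχ1 : χ ≠ 1) {L : ℝ} (hL : IsLOne χ L) :
    (transform χ c).re = L * ∏ p ∈ siftPrimes Z q, (1 - rchar χ p / p) := by
  have h1 := (Complex.continuous_re.tendsto _).comp (h.tendsto_charSum_one hχ1)
  have h2 := (tendsto_sum_coprime hL hχ (Z + 1).primesBelow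
    fun r hr => (mem_primesBelow_succ.1 hr).2).comp Real.tendsto_exp_atTop
  rw [prod_siftPrimes_rchar] at h2
  refine tendsto_nhds_unique h1 (h2.congr fun t => ?_)
  simp only [Function.comp_apply, charSum, logSum, Complex.re_sum]
  rw [sum_filter]
  refine sum_congr rfl fun n hn => ?_
  have hn0 := (mem_Ioc.1 hn).1.ne'
  rw [tw, wt, rchar]
  by_cases hr : ∀ r ∈ (Z + 1).primesBelow, ¬ r ∣ n
  · rw [if_pos hr, if_pos ⟨hn0, hr⟩, mul_comm, Complex.re_ofReal_mul]; ring
  · rw [if_neg hr, if_neg fun h => hr h.2]; simp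

/-- The sum of `lam χ` over the rough integers up to `Y` in a residue class. -/
noncomputable def lamRough (χ : DirichletCharacter ℂ q) (Z : ℕ) (b : (ZMod q)ˣ) (Y : ℝ) : ℝ :=
  ∑ n ∈ Ioc 0 ⌊Y⌋₊ with Rough Z n ∧ ((n : ℕ) : ZMod q) = b, lam χ n

lemma lamRough_eq (χ : DirichletCharacter ℂ q) (Z : ℕ) (b : (ZMod q)ˣ) (Y : ℝ) :
    lamRough χ Z b Y = ∑ n ∈ {n ∈ Ioc 0 ⌊Y⌋₊ | ((n : ℕ) : ZMod q) = b} with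
      ∀ p ∈ siftPrimes Z q, ¬ p ∣ n, lam χ n := by
  rw [lamRough, filter_filter]
  refine sum_congr (filter_congr fun n hn => ?_) fun _ _ => rfl
  have hn0 := (mem_Ioc.1 hn).1
  constructor
  · rintro ⟨h1, h2⟩
    exact ⟨h2, fun p hp => h1.2 p (mem_filter.1 hp).1⟩
  · rintro ⟨h1, h2⟩
    refine ⟨⟨hn0.ne', fun p hp hd => ?_⟩, h1⟩
    by_cases hpq : p ∣ q
    · have hb := b.isUnit
      rw [← h1, ZMod.isUnit_iff_coprime] at hb
      have := Nat.dvd_gcd hd hpq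
      rw [hb] at this
      exact (mem_primesBelow_succ.1 hp).2.one_lt.ne' (Nat.dvd_one.1 this)
    · exact h2 p (mem_filter.2 ⟨hp, hpq⟩) hd

lemma one_add_re_nonneg (χ : DirichletCharacter ℂ q) (b : (ZMod q)ˣ) : 0 ≤ 1 + (χ b).re := by
  have := abs_le.1 ((Complex.abs_re_le_norm _).trans (DirichletCharacter.norm_le_one χ (b : ZMod q)))
  linarith

section

variable {C : ℝ} {Z : ℕ} {c d k : (ZMod q)ˣ → ℝ} {L : ℝ}

lemma Expansion.lam_main_eq (h : Expansion C q Z c d k) (hχ : χ ^ 2 = 1) (hχ1 : χ ≠ 1)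
    (hqZ : q ≤ Z) (hL : IsLOne χ L) (b : (ZMod q)ˣ) (Y : ℝ) :
    Y / q * L * (1 + (χ b).re) * ∏ p ∈ siftPrimes Z q, (1 - lamDensity χ p) =
      (1 + (χ b).re) * (Y * (roughDensity Z / q.totient * (transform χ c).re)) := by
  rw [h.re_transform_eq hχ hχ1 hL, ← roughDensity_div_totient (NeZero.ne q) hqZ]
  have : ∏ p ∈ siftPrimes Z q, (1 - lamDensity χ p) = (∏ p ∈ siftPrimes Z q, (1 - 1 / (p : ℝ))) *
      ∏ p ∈ siftPrimes Z q, (1 - rchar χ p / p) := by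
    rw [← prod_mul_distrib]
    exact prod_congr rfl fun p _ => by rw [lamDensity]; ring
  rw [this]; ring

lemma lam_level_sift (hχ : χ ^ 2 = 1) (hχ1 : χ ≠ 1) (hL : IsLOne χ L) (b : (ZMod q)ˣ) {Y : ℝ}
    (hY : 0 ≤ Y) : ∀ D ⊆ siftPrimes Z q,
      |∑ n ∈ {n ∈ Ioc 0 ⌊Y⌋₊ | ((n : ℕ) : ZMod q) = b} with ∀ p ∈ D, p ∣ n, lam χ n
        - Y / q * L * (1 + (χ b).re) * ∏ p ∈ D, lamDensity χ p| ≤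
        11 * √Y * ((∏ p ∈ D, p : ℕ) : ℝ) ^ 2 := by
  intro D hD
  refine lam_level hL hχ hχ1 D (fun p hp => ?_) b Y hY
  have hp' := mem_filter.1 (hD hp)
  have hpp := (mem_primesBelow_succ.1 hp'.1).2
  exact ⟨hpp, (Nat.Prime.coprime_iff_not_dvd hpp).2 hp'.2⟩

lemma Expansion.lamRough_le (h : Expansion C q Z c d k) (hχ : χ ^ 2 = 1) (hχ1 : χ ≠ 1)
    (hqZ : q ≤ Z) (b : (ZMod q)ˣ) {Y : ℝ} (hY : 0 ≤ Y) :
    lamRough χ Z b Y ≤ upperConst *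
      ((1 + (χ b).re) * (Y * (roughDensity Z / q.totient * (transform χ c).re))) +
      44 * √Y * (Z : ℝ) ^ (1 / 4 : ℝ) := by
  obtain ⟨L, hL⟩ := exists_isLOne hχ1
  have hL0 : 0 ≤ L := le_trans (by positivity) (hL.lower hχ hχ1)
  have hZ : (1 : ℝ) ≤ Z := by exact_mod_cast (NeZero.one_le (n := q)).trans hqZ
  have h1 := sieve_upper hZ (sieveDensity_lamDensity hχ Z)
    (Ω := {n ∈ Ioc 0 ⌊Y⌋₊ | ((n : ℕ) : ZMod q) = b}) (a := lam χ) (fun n _ => lam_nonneg hχ n)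
    (X := Y / q * L * (1 + (χ b).re)) (R := 11 * √Y)
    (mul_nonneg (by positivity) (one_add_re_nonneg χ b)) (by positivity)
    (lam_level_sift hχ hχ1 hL b hY)
  rw [h.lam_main_eq hχ hχ1 hqZ hL] at h1
  rw [lamRough_eq]
  refine h1.trans (le_of_eq (by ring))

lemma Expansion.lamRough_ge (h : Expansion C q Z c d k) (hχ : χ ^ 2 = 1) (hχ1 : χ ≠ 1)
    (hqZ : q ≤ Z) (b : (ZMod q)ˣ) {Y : ℝ} (hY : 0 ≤ Y) (K : ℕ) :
    (1 - flConst * Real.exp (-K)) *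
      ((1 + (χ b).re) * (Y * (roughDensity Z / q.totient * (transform χ c).re))) -
      44 * √Y * (Z : ℝ) ^ (12 * K + 19) ≤ lamRough χ Z b Y := by
  obtain ⟨L, hL⟩ := exists_isLOne hχ1
  have hL0 : 0 ≤ L := le_trans (by positivity) (hL.lower hχ hχ1)
  have hZ : (1 : ℝ) ≤ Z := by exact_mod_cast (NeZero.one_le (n := q)).trans hqZ
  have h1 := fundamental_lemma hZ (sieveDensity_lamDensity hχ Z)
    (Ω := {n ∈ Ioc 0 ⌊Y⌋₊ | ((n : ℕ) : ZMod q) = b}) (a := lam χ) (fun n _ => lam_nonneg hχ n)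
    (X := Y / q * L * (1 + (χ b).re)) (R := 11 * √Y)
    (mul_nonneg (by positivity) (one_add_re_nonneg χ b)) (by positivity)
    (lam_level_sift hχ hχ1 hL b hY) K
  rw [h.lam_main_eq hχ hχ1 hqZ hL, ← lamRough_eq] at h1
  have h2 := (abs_le.1 h1).1
  have e : 2 * blockConst * Real.exp (2 * blockConst) = flConst := rfl
  rw [e] at h2
  linarith

end

end Linnik

namespace Linnik

open Finset

lemma inv_sqrt_mul_succ_le {N : ℕ} (hN : 1 ≤ N) :
    1 / (√N * (N + 1 : ℝ)) ≤ 2 / √N - 2 / √(N + 1 : ℝ) := by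
  have h0 : (0 : ℝ) < N := by exact_mod_cast hN
  have hs : 0 < √(N : ℝ) := Real.sqrt_pos.2 h0
  have ht : 0 < √(N + 1 : ℝ) := Real.sqrt_pos.2 (by linarith)
  have hst : √(N : ℝ) ≤ √(N + 1 : ℝ) := Real.sqrt_le_sqrt (by linarith)
  have e1 := Real.sq_sqrt h0.le
  have e2 := Real.sq_sqrt (show (0 : ℝ) ≤ N + 1 by linarith)
  set s := √(N : ℝ)
  set t := √(N + 1 : ℝ)
  rw [← e2, div_sub_div _ _ hs.ne' ht.ne', div_le_div_iff₀ (by positivity) (by positivity)]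
  have e3 : (t - s) * (t + s) = 1 := by nlinarith
  have : 1 ≤ 2 * t * (t - s) := by nlinarith
  have := mul_le_mul_of_nonneg_right this (show 0 ≤ s * t by positivity)
  nlinarith

lemma sum_div_le_of_sum_le {a : ℕ → ℝ} {α β : ℝ} (hα : 0 ≤ α) (hβ : 0 ≤ β) {Z : ℕ} (hZ : 1 ≤ Z)
    (ha : ∀ n ≤ Z, a n = 0) (hA : ∀ N : ℕ, ∑ n ∈ Ioc 0 N, a n ≤ α * N + β * √N) {N : ℕ}
    (hN : Z ≤ N) : ∑ n ∈ Ioc 0 N, a n / n ≤ α * (1 + Real.log N) + 3 * β / √Z := by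
  have key : ∑ n ∈ Ioc 0 N, a n / n - (∑ n ∈ Ioc 0 N, a n) / N ≤
      α * (Real.log N - Real.log Z) + β * (2 / √Z - 2 / √N) := by
    induction N, hN using Nat.le_induction with
    | base =>
      rw [sum_eq_zero fun n hn => by rw [ha n (mem_Ioc.1 hn).2, zero_div],
        sum_eq_zero fun n hn => ha n (mem_Ioc.1 hn).2]
      simp
    | succ N hN ih =>
      rw [sum_Ioc_succ_top (by omega), sum_Ioc_succ_top (by omega)]
      have h1 : 1 ≤ N := hZ.trans hN
      have h0 : (0 : ℝ) < N := by exact_mod_cast h1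
      have hs : 0 < √(N : ℝ) := Real.sqrt_pos.2 h0
      have h2 := inv_sqrt_mul_succ_le h1
      have h3 : 1 / (N + 1 : ℝ) ≤ Real.log (N + 1) - Real.log N := by
        rw [← Real.log_div (by positivity) h0.ne']
        refine le_trans (le_of_eq ?_) (Real.one_sub_inv_le_log_of_pos (by positivity))
        field_simp; ring
      push_cast
      have h4 : (∑ n ∈ Ioc 0 N, a n) / N - (∑ n ∈ Ioc 0 N, a n) / (N + 1) ≤
          α * (1 / (N + 1)) + β * (1 / (√N * (N + 1))) := by
        have e1 : (∑ n ∈ Ioc 0 N, a n) / N - (∑ n ∈ Ioc 0 N, a n) / (N + 1) =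
          (∑ n ∈ Ioc 0 N, a n) * (1 / (N * (N + 1 : ℝ))) := by field_simp; ring
        have e2 : α * (1 / (N + 1)) + β * (1 / (√N * (N + 1))) =
            (α * N + β * √N) * (1 / (N * (N + 1 : ℝ))) := by
          have e3 : 1 / (√N * (N + 1 : ℝ)) = √N * (1 / (N * (N + 1 : ℝ))) := by
            rw [mul_one_div, div_eq_div_iff (by positivity) (by positivity)]
            linear_combination (-(N + 1 : ℝ)) * Real.mul_self_sqrt h0.le
          rw [e3]
          field_simp
        rw [e1, e2]
        exact mul_le_mul_of_nonneg_right (hA N) (by positivity)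
      have h5 := mul_le_mul_of_nonneg_left h3 hα
      have h6 := mul_le_mul_of_nonneg_left h2 hβ
      have h7 : (∑ n ∈ Ioc 0 N, a n + a (N + 1)) / (N + 1 : ℝ) =
        (∑ n ∈ Ioc 0 N, a n) / (N + 1 : ℝ) + a (N + 1) / (N + 1 : ℝ) := add_div _ _ _
      rw [h7]
      nlinarith
  have hZ' : (1 : ℝ) ≤ Z := by exact_mod_cast hZ
  have hN' : (Z : ℝ) ≤ N := by exact_mod_cast hN
  have hs : 0 < √(Z : ℝ) := Real.sqrt_pos.2 (by linarith)
  have hst : √(Z : ℝ) ≤ √N := Real.sqrt_le_sqrt hN'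
  have h1 : (∑ n ∈ Ioc 0 N, a n) / N ≤ α + β / √Z := by
    calc _ ≤ (α * N + β * √N) / N := by gcongr; exact hA N
      _ = α + β / √N := by
        have h0 : (0 : ℝ) < N := by linarith
        have := Real.mul_self_sqrt h0.le
        have hN0 : √(N : ℝ) ≠ 0 := by positivity
        rw [add_div, mul_div_cancel_right₀ _ h0.ne']
        congr 1
        nth_rewrite 2 [← this]
        field_simp
      _ ≤ _ := by gcongr
  have h2 : 0 ≤ α * Real.log Z := mul_nonneg hα (Real.log_nonneg hZ')
  have h3 : 0 ≤ β * (2 / √N) := by positivity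
  have e : 3 * β / √Z = β / √Z + β * (2 / √Z) := by ring
  rw [e]
  nlinarith

lemma sum_inv_mul_sqrt_le {Z : ℕ} (hZ : 1 ≤ Z) (N : ℕ) :
    ∑ n ∈ Ioc Z N, 1 / ((n : ℝ) * √n) ≤ 2 / √Z := by
  rcases le_total N Z with h | hN
  · rw [Ioc_eq_empty (by omega), sum_empty]; positivity
  suffices ∑ n ∈ Ioc Z N, 1 / ((n : ℝ) * √n) ≤ 2 / √Z - 2 / √N from
    this.trans (sub_le_self _ (by positivity))
  induction N, hN using Nat.le_induction with
  | base => simp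
  | succ N hN ih =>
    rw [sum_Ioc_succ_top hN]
    have h1 : 1 ≤ N := hZ.trans hN
    have h0 : (0 : ℝ) < N := by exact_mod_cast h1
    have hs : 0 < √(N : ℝ) := Real.sqrt_pos.2 h0
    have h2 := inv_sqrt_mul_succ_le h1
    have h3 : 1 / (((N + 1 : ℕ) : ℝ) * √((N + 1 : ℕ) : ℝ)) ≤ 1 / (√N * (N + 1 : ℝ)) := by
      push_cast
      rw [mul_comm]
      gcongr
      linarith
    push_cast at h3 ⊢
    linarith

variable {q : ℕ} [NeZero q] {χ : DirichletCharacter ℂ q}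

lemma sum_one_add_re_eq (hχ : χ ≠ 1) : ∑ b : (ZMod q)ˣ, (1 + (χ b).re) = q.totient := by
  have h1 : ∑ b : (ZMod q)ˣ, χ b = 0 := by
    rw [← MulChar.sum_eq_zero_of_ne_one hχ,
      ← sum_filter_of_ne (s := univ) (p := fun x : ZMod q => IsUnit x)
        fun x _ hx => by_contra fun h => hx (MulChar.map_nonunit χ h)]
    refine sum_nbij (fun b : (ZMod q)ˣ => (b : ZMod q)) (fun b _ => by simp)
      (fun _ _ _ _ h => Units.ext h) ?_ (fun _ _ => rfl)
    intro x hx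
    obtain ⟨u, rfl⟩ := (mem_filter.1 hx).2
    exact ⟨u, by simp, rfl⟩
  rw [sum_add_distrib, ← Complex.re_sum, h1]
  simp [ZMod.card_units_eq_totient]

lemma sum_lamRough (χ : DirichletCharacter ℂ q) {Z : ℕ} (hqZ : q ≤ Z) (Y : ℝ) :
    ∑ b : (ZMod q)ˣ, lamRough χ Z b Y = ∑ n ∈ Ioc 0 ⌊Y⌋₊ with Rough Z n, lam χ n := by
  simp only [lamRough, sum_filter]
  rw [sum_comm]
  refine sum_congr rfl fun n _ => ?_
  by_cases hn : Rough Z n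
  · simp only [hn, true_and, if_true]
    have hc := hn.coprime (NeZero.ne q) hqZ
    have : ∀ b : (ZMod q)ˣ, (n : ZMod q) = b ↔ residue q n = b := fun b => by
      rw [← coe_residue hc, Units.val_inj]
    simp [this]
  · simp [hn]

section

variable {C : ℝ} {Z : ℕ} {c d k : (ZMod q)ˣ → ℝ}

lemma Expansion.sum_rough_lam_le (h : Expansion C q Z c d k) (hχ : χ ^ 2 = 1) (hχ1 : χ ≠ 1)
    (hqZ : q ≤ Z) {Y : ℝ} (hY : 0 ≤ Y) :
    ∑ n ∈ Ioc 0 ⌊Y⌋₊ with Rough Z n, lam χ n ≤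
      upperConst * (roughDensity Z * (transform χ c).re) * Y +
        44 * q.totient * (Z : ℝ) ^ (1 / 4 : ℝ) * √Y := by
  rw [← sum_lamRough χ hqZ]
  refine (sum_le_sum fun b _ => h.lamRough_le hχ hχ1 hqZ b hY).trans (le_of_eq ?_)
  rw [sum_add_distrib, ← mul_sum, ← sum_mul, sum_one_add_re_eq hχ1, sum_const, card_univ,
    ZMod.card_units_eq_totient, nsmul_eq_mul]
  have : (q.totient : ℝ) ≠ 0 := by exact_mod_cast (Nat.totient_pos.2 (NeZero.pos q)).ne'
  field_simp

lemma Expansion.sum_inv_primes_split_le (h : Expansion C q Z c d k) (hχ : χ ^ 2 = 1) (hχ1 : χ ≠ 1)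
    (hqZ : q ≤ Z) {N : ℕ} (hN : Z ≤ N) :
    ∑ p ∈ Ioc Z N with p.Prime ∧ rchar χ p = 1, 1 / (p : ℝ) ≤
      upperConst * (roughDensity Z * (transform χ c).re) * (1 + Real.log N) +
        132 * q.totient * (Z : ℝ) ^ (1 / 4 : ℝ) / √Z := by
  have hZ : 1 ≤ Z := (NeZero.one_le (n := q)).trans hqZ
  have hδ : 0 ≤ (transform χ c).re := h.re_transform_c_nonneg hχ hχ1
  have hV := roughDensity_pos Z
  have hu := upperConst_pos
  have key := sum_div_le_of_sum_le (Z := Z)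
    (a := fun n => if Z < n ∧ n.Prime ∧ rchar χ n = 1 then 1 else 0)
    (α := upperConst * (roughDensity Z * (transform χ c).re))
    (β := 44 * q.totient * (Z : ℝ) ^ (1 / 4 : ℝ)) (by positivity) (by positivity) hZ
    (fun n hn => if_neg fun h => by omega) ?_ hN
  · refine le_trans (le_of_eq ?_) (key.trans (le_of_eq (by ring)))
    simp only [ite_div, zero_div]
    rw [← sum_filter]
    refine sum_congr ?_ fun _ _ => rfl
    ext p
    simp only [mem_filter, mem_Ioc]
    constructor
    · rintro ⟨h1, h2⟩; exact ⟨⟨by omega, h1.2⟩, h1.1, h2⟩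
    · rintro ⟨h1, h2, h3⟩; exact ⟨⟨h2, h1.2⟩, h3⟩
  · intro M
    have h1 := h.sum_rough_lam_le hχ hχ1 hqZ (Nat.cast_nonneg M)
    rw [Nat.floor_natCast] at h1
    refine le_trans ?_ h1
    rw [← sum_filter]
    refine le_trans (sum_le_sum (g := fun n => lam χ n) fun p hp => ?_)
      (sum_le_sum_of_subset_of_nonneg (fun p hp => ?_) fun n _ _ => lam_nonneg hχ n)
    · obtain ⟨-, -, hp, hp1⟩ := mem_filter.1 hp
      rw [lam_prime hp, hp1]; norm_num
    · obtain ⟨hm, hZp, hp, -⟩ := mem_filter.1 hp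
      exact mem_filter.2 ⟨hm, rough_of_prime hp hZp⟩

end

end Linnik

namespace Linnik

open Finset

variable {q : ℕ} [NeZero q] {χ : DirichletCharacter ℂ q} {Z : ℕ}

lemma sum_lam_dvd_le_lamRough (hqZ : q ≤ Z) {e : ℕ} (he : Rough Z e) (a : (ZMod q)ˣ)
    (X : ℝ) {f : ℕ → ℝ} {B : ℝ} (hf : ∀ m, m ≠ 0 → f (e * m) ≤ B * lam χ m) :
    ∑ n ∈ Ioc 0 ⌊X⌋₊ with (Rough Z n ∧ (n : ZMod q) = a) ∧ e ∣ n, f n ≤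
      B * lamRough χ Z ((residue q e)⁻¹ * a) (X / e) := by
  have he0 : 0 < e := Nat.pos_of_ne_zero he.1
  rw [lamRough, mul_sum]
  have key : ∑ n ∈ Ioc 0 ⌊X⌋₊ with (Rough Z n ∧ (n : ZMod q) = a) ∧ e ∣ n, f n =
      ∑ m ∈ Ioc 0 ⌊X / e⌋₊ with Rough Z m ∧ ((m : ℕ) : ZMod q) = ((residue q e)⁻¹ * a : (ZMod q)ˣ),
        f (e * m) := by
    have hu : ∀ m : ℕ, ((e * m : ℕ) : ZMod q) = a ↔
        (m : ZMod q) = ((residue q e)⁻¹ * a : (ZMod q)ˣ) := fun m => by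
      rw [Nat.cast_mul, ← coe_residue (he.coprime (NeZero.ne q) hqZ), Units.val_mul,
        Units.eq_inv_mul_iff_mul_eq]
    symm
    refine sum_nbij (fun m => e * m) ?_ (fun m _ n _ h => Nat.eq_of_mul_eq_mul_left he0 h) ?_
      fun _ _ => rfl
    · intro m hm
      rw [mem_filter, mem_Ioc, Nat.floor_div_natCast, Nat.le_div_iff_mul_le he0, mul_comm m] at hm
      rw [mem_filter, mem_Ioc, hu]
      exact ⟨⟨Nat.mul_pos he0 hm.1.1, hm.1.2⟩, ⟨rough_mul.2 ⟨he, hm.2.1⟩, hm.2.2⟩, dvd_mul_right e m⟩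
    · intro n hn
      rw [mem_coe, mem_filter, mem_Ioc] at hn
      obtain ⟨⟨h0, h1⟩, ⟨h2, h3⟩, m, rfl⟩ := hn
      refine ⟨m, ?_, rfl⟩
      rw [mem_coe, mem_filter, mem_Ioc, Nat.floor_div_natCast, Nat.le_div_iff_mul_le he0, mul_comm m]
      exact ⟨⟨Nat.pos_of_mul_pos_left h0, h1⟩, (rough_mul.1 h2).2, (hu m).1 h3⟩
  rw [key]
  exact sum_le_sum fun m hm => hf m (mem_Ioc.1 (mem_filter.1 hm).1).1.ne'

lemma sum_lam_prime_dvd_le (hχ : χ ^ 2 = 1) (hqZ : q ≤ Z) {p : ℕ} (hp : p.Prime) (hpZ : Z < p)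
    (a : (ZMod q)ˣ) {X B F : ℝ} (hX : 0 ≤ X)
    (hl : ∀ (b : (ZMod q)ˣ) (Y : ℝ), 0 ≤ Y → lamRough χ Z b Y ≤ B * Y + F * √Y) :
    ∑ n ∈ Ioc 0 ⌊X⌋₊ with (Rough Z n ∧ (n : ZMod q) = a) ∧ p ∣ n, lam χ n ≤
      if rchar χ p = 1 then 2 * (B * X / p + F * √X / √p) else B * X / p ^ 2 + F * √X / p := by
  have hr := rough_of_prime hp hpZ
  split_ifs with h1
  · refine (sum_lam_dvd_le_lamRough hqZ hr a X
      fun m hm => lam_prime_mul_le hχ hp h1 hm).trans ?_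
    have := hl ((residue q p)⁻¹ * a) (X / p) (by positivity)
    rw [Real.sqrt_div hX, ← mul_div_assoc, ← mul_div_assoc] at this
    gcongr
  · have h1' := (rchar_cases hχ (hr.coprime (NeZero.ne q) hqZ)).resolve_left h1
    have hr2 : Rough Z (p * p) := rough_mul.2 ⟨hr, hr⟩
    have h2 := sum_lam_dvd_le_lamRough hqZ hr2 a X (f := lam χ) (B := 1)
      fun m hm => by rw [one_mul, mul_assoc, lam_prime_mul_prime_mul hχ hp h1' hm]
    rw [one_mul] at h2
    have h3 := hl ((residue q (p * p))⁻¹ * a) (X / (p * p : ℕ)) (by positivity)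
    have h4 : B * (X / (p * p : ℕ)) + F * √(X / (p * p : ℕ)) = B * X / p ^ 2 + F * √X / p := by
      rw [Real.sqrt_div hX, Nat.cast_mul, Real.sqrt_mul_self (Nat.cast_nonneg p)]; ring
    refine le_trans (le_of_eq ?_) (h2.trans (h3.trans h4.le))
    symm
    refine sum_subset (fun n hn => ?_) fun n hn hn' => ?_
    · rw [mem_filter] at hn ⊢
      exact ⟨hn.1, hn.2.1, (dvd_mul_right p p).trans hn.2.2⟩
    · rw [mem_filter] at hn hn'
      obtain ⟨hn1, hn2, m, rfl⟩ := hn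
      have hm : m ≠ 0 := by rintro rfl; simp at hn1
      refine lam_prime_mul_of_not_dvd hχ hp h1' hm fun hd => hn' ⟨hn1, hn2, mul_dvd_mul_left p hd⟩

/-- The number of primes in the class `a` up to `X`. -/
noncomputable def primeCount (a : (ZMod q)ˣ) (X : ℝ) : ℕ :=
  #{p ∈ Ioc 0 ⌊X⌋₊ | p.Prime ∧ ((p : ℕ) : ZMod q) = a}

lemma lamRough_le_primeCount (hχ : χ ^ 2 = 1) (a : (ZMod q)ˣ) {X : ℝ} (hX : 0 ≤ X) :
    lamRough χ Z a X ≤ 1 + 2 * primeCount a X + ∑ p ∈ Ioc Z ⌊√X⌋₊ with p.Prime,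
      ∑ n ∈ Ioc 0 ⌊X⌋₊ with (Rough Z n ∧ (n : ZMod q) = a) ∧ p ∣ n, lam χ n := by
  have key : ∀ n ∈ Ioc 0 ⌊X⌋₊, (if Rough Z n ∧ (n : ZMod q) = a then lam χ n else 0) ≤
      (if n = 1 then 1 else 0) + (if n.Prime ∧ (n : ZMod q) = a then 2 else 0) +
      ∑ p ∈ Ioc Z ⌊√X⌋₊ with p.Prime,
        if (Rough Z n ∧ (n : ZMod q) = a) ∧ p ∣ n then lam χ n else 0 := by
    intro n hn
    have hs : 0 ≤ ∑ p ∈ Ioc Z ⌊√X⌋₊ with p.Prime,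
        if (Rough Z n ∧ (n : ZMod q) = a) ∧ p ∣ n then lam χ n else 0 :=
      sum_nonneg fun p _ => by split_ifs; exacts [lam_nonneg hχ n, le_rfl]
    by_cases h1 : n = 1
    · subst h1
      have : (if Rough Z 1 ∧ ((1 : ℕ) : ZMod q) = a then lam χ 1 else 0) ≤ 1 := by
        have e : lam χ 1 = 1 := by simp [lam, rchar_one]
        split_ifs <;> simp [e]
      have h2 : (0 : ℝ) ≤ if Nat.Prime 1 ∧ ((1 : ℕ) : ZMod q) = a then 2 else 0 := by
        split_ifs <;> norm_num
      rw [if_pos rfl]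
      linarith
    by_cases hr : Rough Z n ∧ (n : ZMod q) = a
    swap
    · rw [if_neg hr, if_neg h1]
      have : (0 : ℝ) ≤ if n.Prime ∧ (n : ZMod q) = a then 2 else 0 := by split_ifs <;> norm_num
      linarith
    rw [if_pos hr, if_neg h1, zero_add]
    by_cases hp : n.Prime
    · rw [lam_prime hp] at hs ⊢
      rw [if_pos ⟨hp, hr.2⟩]
      have := (abs_le.1 (abs_rchar_le (χ := χ) n)).2
      linarith
    · rw [if_neg fun h => hp h.1, zero_add]
      obtain ⟨h0, hX'⟩ := mem_Ioc.1 hn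
      have hm := Nat.minFac_prime h1
      have hmem : n.minFac ∈ {p ∈ Ioc Z ⌊√X⌋₊ | p.Prime} := by
        refine mem_filter.2 ⟨mem_Ioc.2 ⟨?_, ?_⟩, hm⟩
        · by_contra hlt
          exact hr.1.2 _ (mem_primesBelow_succ.2 ⟨not_lt.1 hlt, hm⟩) n.minFac_dvd
        · refine Nat.le_floor (Real.le_sqrt_of_sq_le ?_)
          have h2 : ((n.minFac ^ 2 : ℕ) : ℝ) ≤ n := by
            exact_mod_cast Nat.minFac_sq_le_self h0 hp
          push_cast at h2
          exact h2.trans ((Nat.cast_le.2 hX').trans (Nat.floor_le hX))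
      refine le_trans (le_of_eq ?_) (single_le_sum (f := fun p =>
        if (Rough Z n ∧ (n : ZMod q) = a) ∧ p ∣ n then lam χ n else 0)
        (fun p _ => by split_ifs; exacts [lam_nonneg hχ n, le_rfl]) hmem)
      rw [if_pos ⟨hr, n.minFac_dvd⟩]
  rw [lamRough, sum_filter]
  refine (sum_le_sum key).trans ?_
  rw [sum_add_distrib, sum_add_distrib, sum_comm]
  simp only [← sum_filter]
  refine add_le_add (add_le_add ?_ (le_of_eq ?_)) le_rfl
  · rw [sum_const, nsmul_eq_mul, mul_one]
    have : #{n ∈ Ioc 0 ⌊X⌋₊ | n = 1} ≤ 1 := by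
      refine (card_le_card (t := {1}) fun n hn => ?_).trans (by simp)
      simpa using (mem_filter.1 hn).2
    exact_mod_cast this
  · rw [sum_const, nsmul_eq_mul, primeCount, mul_comm]

lemma sum_sum_lam_prime_dvd_le (hχ : χ ^ 2 = 1) (hqZ : q ≤ Z) (a : (ZMod q)ˣ) {X B F : ℝ}
    (hX : 0 ≤ X) (hB : 0 ≤ B) (hF : 0 ≤ F)
    (hl : ∀ (b : (ZMod q)ˣ) (Y : ℝ), 0 ≤ Y → lamRough χ Z b Y ≤ B * Y + F * √Y) :
    ∑ p ∈ Ioc Z ⌊√X⌋₊ with p.Prime,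
      ∑ n ∈ Ioc 0 ⌊X⌋₊ with (Rough Z n ∧ (n : ZMod q) = a) ∧ p ∣ n, lam χ n ≤
      (2 * ∑ p ∈ Ioc Z ⌊√X⌋₊ with p.Prime ∧ rchar χ p = 1, 1 / (p : ℝ) + 2 / √Z) *
        (B * X + F * √X * √√X) := by
  have hZ : 1 ≤ Z := (NeZero.one_le (n := q)).trans hqZ
  have hM : 0 ≤ B * X + F * √X * √√X := by positivity
  have h1 : ∀ p ∈ {p ∈ Ioc Z ⌊√X⌋₊ | p.Prime},
      ∑ n ∈ Ioc 0 ⌊X⌋₊ with (Rough Z n ∧ (n : ZMod q) = a) ∧ p ∣ n, lam χ n ≤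
      (2 * (if rchar χ p = 1 then 1 / (p : ℝ) else 0) + 1 / ((p : ℝ) * √p)) *
        (B * X + F * √X * √√X) := by
    intro p hp
    obtain ⟨hm, hp⟩ := mem_filter.1 hp
    obtain ⟨hpZ, hpX⟩ := mem_Ioc.1 hm
    refine (sum_lam_prime_dvd_le hχ hqZ hp hpZ a hX hl).trans ?_
    have hp1 : (1 : ℝ) ≤ p := by exact_mod_cast hp.one_le
    have hs1 : 1 ≤ √(p : ℝ) := Real.one_le_sqrt.2 hp1
    have hs0 : 0 < √(p : ℝ) := by linarith
    have hss : √(p : ℝ) * √p = p := Real.mul_self_sqrt (by linarith)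
    have hsX : √(p : ℝ) ≤ √√X :=
      Real.sqrt_le_sqrt ((Nat.cast_le.2 hpX).trans (Nat.floor_le (Real.sqrt_nonneg X)))
    split_ifs with h1
    · have h2 : F * √X / √p ≤ F * √X * √√X / p := by
        rw [div_le_div_iff₀ hs0 (by linarith)]
        nth_rewrite 1 [← hss]
        rw [← mul_assoc]
        gcongr
      have h3 : 0 ≤ 1 / ((p : ℝ) * √p) * (B * X + F * √X * √√X) := by positivity
      have h4 : 2 * (1 / (p : ℝ)) * (B * X + F * √X * √√X) =
        2 * (B * X / p + F * √X * √√X / p) := by ring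
      rw [add_mul, h4]
      linarith
    · have h2 : F * √X / p ≤ F * √X * √√X / (p * √p) := by
        rw [div_le_div_iff₀ (by linarith) (by positivity)]
        calc F * √X * (p * √p) ≤ F * √X * (p * √√X) := by gcongr
          _ = _ := by ring
      have h3 : B * X / p ^ 2 ≤ B * X / (p * √p) := by
        rw [sq]
        gcongr
        nlinarith
      have h4 : (2 * 0 + 1 / ((p : ℝ) * √p)) * (B * X + F * √X * √√X) =
        B * X / (p * √p) + F * √X * √√X / (p * √p) := by ring
      rw [h4]
      linarith
  refine (sum_le_sum h1).trans ?_
  rw [← sum_mul]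
  refine mul_le_mul_of_nonneg_right ?_ hM
  rw [sum_add_distrib, ← mul_sum, ← sum_filter, filter_filter]
  gcongr
  refine le_trans (sum_le_sum_of_subset_of_nonneg (filter_subset _ _) fun p _ _ => ?_)
    (sum_inv_mul_sqrt_le hZ _)
  positivity

section

variable {C : ℝ} {c d k : (ZMod q)ˣ → ℝ}

lemma Expansion.primeCount_ge (h : Expansion C q Z c d k) (hχ : χ ^ 2 = 1) (hχ1 : χ ≠ 1)
    (hqZ : q ≤ Z) {a : (ZMod q)ˣ} (ha : χ a = 1) {X η : ℝ} (hX : 1 ≤ X) {K : ℕ}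
    (hK : flConst * Real.exp (-K) ≤ 1 / 2)
    (hη : ∑ p ∈ Ioc Z ⌊√X⌋₊ with p.Prime ∧ rchar χ p = 1, 1 / (p : ℝ) + 1 / √Z ≤ η)
    (hη1 : η ≤ 1) (hη2 : 8 * upperConst * η ≤ 1) :
    X * (roughDensity Z / q.totient * (transform χ c).re) / 2 -
      133 * √X * √√X * (Z : ℝ) ^ (12 * K + 19) ≤ 2 * primeCount a X := by
  set W := roughDensity Z / q.totient * (transform χ c).re with hW
  have hZ : (1 : ℝ) ≤ Z := by exact_mod_cast (NeZero.one_le (n := q)).trans hqZ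
  have hδ : 0 ≤ (transform χ c).re := h.re_transform_c_nonneg hχ hχ1
  have hV := roughDensity_pos Z
  have hu := upperConst_pos
  have hW0 : 0 ≤ W := by positivity
  have hl : ∀ (b : (ZMod q)ˣ) (Y : ℝ), 0 ≤ Y →
      lamRough χ Z b Y ≤ 2 * upperConst * W * Y + 44 * (Z : ℝ) ^ (1 / 4 : ℝ) * √Y := by
    intro b Y hY
    refine (h.lamRough_le hχ hχ1 hqZ b hY).trans ?_
    have h1 := (abs_le.1 ((Complex.abs_re_le_norm _).trans
      (DirichletCharacter.norm_le_one χ (b : ZMod q)))).2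
    have h2 : (1 + (χ b).re) * (Y * W) ≤ 2 * (Y * W) :=
      mul_le_mul_of_nonneg_right (by linarith) (by positivity)
    have h3 := mul_le_mul_of_nonneg_left h2 hu.le
    rw [← hW]
    linarith
  have h1 := lamRough_le_primeCount (Z := Z) hχ a (X := X) (by linarith)
  have h2 := sum_sum_lam_prime_dvd_le hχ hqZ a (X := X) (by linarith) (by positivity)
    (by positivity) hl
  have h3 := h.lamRough_ge hχ hχ1 hqZ a (Y := X) (by linarith) K
  rw [ha, ← hW, Complex.one_re] at h3
  set S := ∑ p ∈ Ioc Z ⌊√X⌋₊ with p.Prime ∧ rchar χ p = 1, 1 / (p : ℝ)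
  have hXW : 0 ≤ X * W := by positivity
  have hx : 1 ≤ √X := Real.one_le_sqrt.2 hX
  have hxx : 1 ≤ √√X := Real.one_le_sqrt.2 hx
  have hzK : (1 : ℝ) ≤ (Z : ℝ) ^ (12 * K + 19) := one_le_pow₀ hZ
  have hz4 : (Z : ℝ) ^ (1 / 4 : ℝ) ≤ (Z : ℝ) ^ (12 * K + 19) := by
    rw [← Real.rpow_natCast]
    refine Real.rpow_le_rpow_of_exponent_le hZ ?_
    push_cast
    have : (0 : ℝ) ≤ K := Nat.cast_nonneg K
    linarith
  have h4 : (2 * S + 2 / √Z) * (2 * upperConst * W * X + 44 * (Z : ℝ) ^ (1 / 4 : ℝ) * √X * √√X) ≤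
      X * W / 2 + 88 * √X * √√X * (Z : ℝ) ^ (12 * K + 19) := by
    have e1 : 2 * S + 2 / √Z ≤ 2 * η := by
      have : 2 / √(Z : ℝ) = 2 * (1 / √Z) := by ring
      linarith
    have hη0 : 0 ≤ η := le_trans (by positivity) hη
    have e2 : 2 * η * (2 * upperConst * W * X) ≤ X * W / 2 := by nlinarith
    have e3 : 2 * η * (44 * (Z : ℝ) ^ (1 / 4 : ℝ) * √X * √√X) ≤
        2 * 1 * (44 * (Z : ℝ) ^ (12 * K + 19) * √X * √√X) := by gcongr
    calc _ ≤ 2 * η * (2 * upperConst * W * X + 44 * (Z : ℝ) ^ (1 / 4 : ℝ) * √X * √√X) := by gcongr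
      _ ≤ _ := by linarith
  have h5 : 1 ≤ √X * √√X * (Z : ℝ) ^ (12 * K + 19) :=
    one_le_mul_of_one_le_of_one_le (one_le_mul_of_one_le_of_one_le hx hxx) hzK
  have h6 : 44 * √X * (Z : ℝ) ^ (12 * K + 19) ≤ 44 * (√X * √√X * (Z : ℝ) ^ (12 * K + 19)) := by
    have : √X * 1 * (Z : ℝ) ^ (12 * K + 19) ≤ √X * √√X * (Z : ℝ) ^ (12 * K + 19) := by gcongr
    linarith
  have h7 : 1 / 2 * ((1 + 1) * (X * W)) ≤ (1 - flConst * Real.exp (-K)) * ((1 + 1) * (X * W)) :=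
    mul_le_mul_of_nonneg_right (by linarith) (by positivity)
  linarith

end

end Linnik

namespace Linnik

open Finset

variable {q : ℕ} [NeZero q] {χ : DirichletCharacter ℂ q} {Z : ℕ} {C : ℝ} {c d k : (ZMod q)ˣ → ℝ}

lemma Expansion.density_mul_re_ge (h : Expansion C q Z c d k) (hχ : χ ^ 2 = 1) (hχ1 : χ ≠ 1)
    (hqZ : q ≤ Z) :
    1 / (36864000 * C ^ 2 * (Z : ℝ) ^ 5) ≤ roughDensity Z / q.totient * (transform χ c).re := by
  obtain ⟨L, hL⟩ := exists_isLOne hχ1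
  have hL1 := hL.lower hχ hχ1
  have hq : (0 : ℝ) < q := by exact_mod_cast NeZero.pos q
  have hφ : (0 : ℝ) < q.totient := by exact_mod_cast Nat.totient_pos.2 (NeZero.pos q)
  have hφq : (q.totient : ℝ) ≤ q := by exact_mod_cast Nat.totient_le q
  have hqZ' : (q : ℝ) ≤ Z := by exact_mod_cast hqZ
  have hZ : (0 : ℝ) < Z := by linarith
  have hV := roughDensity_pos Z
  have hC : 0 < C := by linarith [h.one_le]
  have hV1 : 1 / (48 * C * Z) ≤ roughDensity Z := by
    rw [div_le_iff₀ (by positivity)]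
    refine h.le_density.trans ?_
    have : Real.log Z ≤ Z := (Real.log_le_sub_one_of_pos hZ).trans (by linarith)
    calc C * (roughDensity Z * scale Z) = roughDensity Z * (48 * C * Real.log Z) := by
          rw [scale]; ring
      _ ≤ _ := by gcongr
  have hprod : roughDensity Z ≤ ∏ p ∈ siftPrimes Z q, (1 - rchar χ p / p) := by
    have h1 := roughDensity_div_totient (NeZero.ne q) hqZ
    have h2 : roughDensity Z ≤ ∏ p ∈ siftPrimes Z q, (1 - 1 / (p : ℝ)) := by
      have e : ∏ p ∈ siftPrimes Z q, (1 - 1 / (p : ℝ)) = roughDensity Z * (q / q.totient) := by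
        field_simp
        field_simp at h1
        linarith
      rw [e]
      exact le_mul_of_one_le_right hV.le ((one_le_div hφ).2 hφq)
    refine h2.trans (prod_le_prod (fun p hp => ?_) fun p hp => ?_)
    · exact (one_sub_inv_prime_pos (mem_primesBelow_succ.1 (mem_filter.1 hp).1).2).le
    · have := (abs_le.1 (abs_rchar_le (χ := χ) p)).2
      gcongr
  rw [h.re_transform_eq hχ hχ1 hL]
  calc 1 / (36864000 * C ^ 2 * (Z : ℝ) ^ 5) =
        1 / (48 * C * Z) / Z * (1 / (16000 * (Z : ℝ) ^ 2) * (1 / (48 * C * Z))) := by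
        field_simp; norm_num
    _ ≤ roughDensity Z / q.totient * (1 / (16000 * (q : ℝ) ^ 2) * roughDensity Z) := by
        gcongr; exact (Nat.totient_le q).trans hqZ
    _ ≤ _ := by
        have : 0 ≤ L := le_trans (by positivity) hL1
        gcongr

lemma exists_primeCount_ge (C : ℝ) (hC : 1 ≤ C) : ∃ ℓ κ Z₀ : ℝ, 1 ≤ ℓ ∧ 0 < κ ∧
    ∀ (q Z : ℕ) [NeZero q] (c d k : (ZMod q)ˣ → ℝ) (χ : DirichletCharacter ℂ q) (a : (ZMod q)ˣ)
      (U : ℝ), Expansion C q Z c d k → χ ^ 2 = 1 → χ ≠ 1 → χ a = 1 → q ^ 8 ≤ Z → Z₀ ≤ Z →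
      ℓ * scale Z ≤ U → (transform χ c).re * U ≤ κ * scale Z →
      Real.exp U / (Z : ℝ) ^ 6 ≤ primeCount a (Real.exp U) := by
  have hu := upperConst_pos
  obtain ⟨K, hK⟩ : ∃ K : ℕ, flConst * Real.exp (-K) ≤ 1 / 2 := by
    have hf := flConst_pos
    obtain ⟨K, hK⟩ := exists_nat_ge (Real.log (2 * flConst))
    refine ⟨K, ?_⟩
    have h1 : 2 * flConst ≤ Real.exp K := by
      rw [← Real.log_le_iff_le_exp (by positivity)]; exact hK
    rw [Real.exp_neg, ← div_eq_mul_inv, div_le_iff₀ (Real.exp_pos _)]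
    linarith
  set u := upperConst + 1 with hu'
  refine ⟨K + 3, 1 / (16 * u ^ 2 * C), max (2 ^ 16) (max (16 * (36864000 * C ^ 2)) ((2128 * u) ^ 8)),
    by linarith [(Nat.cast_nonneg K : (0 : ℝ) ≤ K)], by positivity, ?_⟩
  intro q Z _ c d k χ a U h hχ hχ1 ha hqZ hZ0 hU hδU
  rw [max_le_iff, max_le_iff] at hZ0
  obtain ⟨hZ1, hZ2, hZ3⟩ := hZ0
  have hq1 : 1 ≤ q := NeZero.one_le
  have hqZ1 : q ≤ Z := (Nat.le_self_pow (by norm_num) q).trans hqZ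
  have hZpos : (0 : ℝ) < Z := by linarith
  have hD := h.one_le_scale
  have hK0 : (0 : ℝ) ≤ K := Nat.cast_nonneg K
  have hδ : 0 ≤ (transform χ c).re := h.re_transform_c_nonneg hχ hχ1
  have hV := roughDensity_pos Z
  have hU3 : 3 ≤ U := by nlinarith
  have hexp : (Z : ℝ) ^ (12 * K + 36) ≤ Real.exp (U / 4) := by
    rw [← Real.exp_log hZpos, ← Real.exp_nat_mul, Real.exp_le_exp]
    push_cast
    rw [scale] at hU
    linarith
  have hZ1' : (1 : ℝ) ≤ Z := by linarith
  have hsX : √(Real.exp U) = Real.exp (U / 2) := by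
    rw [Real.sqrt_eq_iff_mul_self_eq (Real.exp_pos _).le (Real.exp_pos _).le, ← Real.exp_add]
    congr 1; ring
  have hssX : √√(Real.exp U) = Real.exp (U / 4) := by
    rw [hsX, Real.sqrt_eq_iff_mul_self_eq (Real.exp_pos _).le (Real.exp_pos _).le, ← Real.exp_add]
    congr 1; ring
  set r := (Z : ℝ) ^ (1 / 8 : ℝ) with hr
  have hr8 : r ^ 8 = Z := by
    rw [hr, ← Real.rpow_natCast, ← Real.rpow_mul hZpos.le]; norm_num
  have hr0 : 0 < r := Real.rpow_pos_of_pos hZpos _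
  have hr1 : 1 ≤ r := Real.one_le_rpow hZ1' (by norm_num)
  have hru : 2128 * u ≤ r := by
    rw [← hr8] at hZ3
    exact le_of_pow_le_pow_left₀ (by norm_num) hr0.le hZ3
  have hqr : (q : ℝ) ≤ r := by
    refine le_of_pow_le_pow_left₀ (n := 8) (by norm_num) hr0.le ?_
    rw [hr8]; exact_mod_cast hqZ
  have hr4 : (Z : ℝ) ^ (1 / 4 : ℝ) = r ^ 2 := by
    rw [hr, ← Real.rpow_natCast, ← Real.rpow_mul hZpos.le]; norm_num
  have hr2 : √(Z : ℝ) = r ^ 4 := by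
    rw [Real.sqrt_eq_iff_mul_self_eq hZpos.le (by positivity), ← hr8]; ring
  have hZU : (Z : ℝ) ≤ √(Real.exp U) := by
    rw [hsX]
    calc (Z : ℝ) ≤ (Z : ℝ) ^ (12 * K + 36) := le_self_pow₀ hZ1' (by omega)
      _ ≤ Real.exp (U / 4) := hexp
      _ ≤ _ := by gcongr; norm_num
  have hφq : (q.totient : ℝ) ≤ q := by exact_mod_cast Nat.totient_le q
  have hsum := h.sum_inv_primes_split_le hχ hχ1 hqZ1 (Nat.le_floor hZU)
  have hlog : 1 + Real.log ⌊√(Real.exp U)⌋₊ ≤ U := by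
    have h1 : Real.log ⌊√(Real.exp U)⌋₊ ≤ Real.log (√(Real.exp U)) := by
      refine Real.log_le_log ?_ (Nat.floor_le (Real.sqrt_nonneg _))
      exact_mod_cast lt_of_lt_of_le (lt_of_lt_of_le hq1 hqZ1) (Nat.le_floor hZU)
    rw [hsX, Real.log_exp] at h1
    rw [hsX]
    linarith
  have hη : ∑ p ∈ Ioc Z ⌊√(Real.exp U)⌋₊ with p.Prime ∧ rchar χ p = 1, 1 / (p : ℝ) + 1 / √Z ≤
      1 / (8 * u) := by
    have h1 : upperConst * (roughDensity Z * (transform χ c).re) *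
        (1 + Real.log ⌊√(Real.exp U)⌋₊) ≤ 1 / (16 * u) := by
      calc _ ≤ upperConst * (roughDensity Z * (transform χ c).re) * U := by gcongr
        _ = upperConst * roughDensity Z * ((transform χ c).re * U) := by ring
        _ ≤ upperConst * roughDensity Z * (1 / (16 * u ^ 2 * C) * scale Z) := by gcongr
        _ = upperConst / (16 * u ^ 2 * C) * (roughDensity Z * scale Z) := by ring
        _ ≤ upperConst / (16 * u ^ 2 * C) * C := by gcongr; exact h.density_le
        _ = upperConst / (16 * u ^ 2) := by field_simp
        _ ≤ u / (16 * u ^ 2) := by gcongr; linarith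
        _ = _ := by field_simp
    have h2 : 132 * q.totient * (Z : ℝ) ^ (1 / 4 : ℝ) / √Z ≤ 132 / r := by
      rw [hr4, hr2]
      calc _ ≤ 132 * r * r ^ 2 / r ^ 4 := by gcongr; linarith
        _ = _ := by field_simp
    have h3 : 1 / √(Z : ℝ) ≤ 1 / r := by
      rw [hr2]
      gcongr
      exact le_self_pow₀ hr1 (by norm_num)
    have h4 : 133 / r ≤ 1 / (16 * u) := by
      rw [div_le_div_iff₀ hr0 (by positivity)]; linarith
    have e1 : 133 / r = 132 / r + 1 / r := by ring
    have e2 : 1 / (8 * u) = 1 / (16 * u) + 1 / (16 * u) := by field_simp; norm_num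
    linarith
  have key := h.primeCount_ge hχ hχ1 hqZ1 ha (X := Real.exp U) (Real.one_le_exp (by linarith)) hK hη
    (by rw [div_le_one (by positivity)]; linarith)
    (by rw [mul_one_div, div_le_one (by positivity)]; linarith)
  have hW := h.density_mul_re_ge hχ hχ1 hqZ1
  set W := roughDensity Z / q.totient * (transform χ c).re
  have hW2 : 16 / (Z : ℝ) ^ 6 ≤ W := by
    refine le_trans ?_ hW
    rw [div_le_div_iff₀ (by positivity) (by positivity)]
    calc 16 * (36864000 * C ^ 2 * (Z : ℝ) ^ 5) = 16 * (36864000 * C ^ 2) * (Z : ℝ) ^ 5 := by ring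
      _ ≤ Z * (Z : ℝ) ^ 5 := by gcongr
      _ = _ := by ring
  rw [hssX, hsX] at key
  have hX : Real.exp U = Real.exp (U / 2) * Real.exp (U / 4) * Real.exp (U / 4) := by
    rw [← Real.exp_add, ← Real.exp_add]; congr 1; ring
  have h8 : 532 * (Z : ℝ) ^ (12 * K + 19) ≤ Real.exp (U / 4) * W := by
    calc 532 * (Z : ℝ) ^ (12 * K + 19) ≤ Z * (Z : ℝ) ^ (12 * K + 19) := by gcongr; linarith
      _ = (Z : ℝ) ^ (12 * K + 20) := by ring
      _ ≤ (Z : ℝ) ^ (12 * K + 30) := pow_le_pow_right₀ hZ1' (by omega)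
      _ = (Z : ℝ) ^ (12 * K + 36) * (1 / (Z : ℝ) ^ 6) := by
        rw [mul_one_div, eq_div_iff (by positivity), ← pow_add]
      _ ≤ Real.exp (U / 4) * W := by
        have : 1 / (Z : ℝ) ^ 6 ≤ W := le_trans (by gcongr; norm_num) hW2
        gcongr
  have h9 := mul_le_mul_of_nonneg_left h8 (show 0 ≤ Real.exp (U / 2) * Real.exp (U / 4) by positivity)
  have h10 := mul_le_mul_of_nonneg_left hW2 (Real.exp_pos U).le
  have e : Real.exp U * W = Real.exp (U / 2) * Real.exp (U / 4) * (Real.exp (U / 4) * W) := by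
    rw [hX]; ring
  have e2 : Real.exp U * (16 / (Z : ℝ) ^ 6) = 16 * (Real.exp U / (Z : ℝ) ^ 6) := by ring
  have e3 : 0 ≤ Real.exp U / (Z : ℝ) ^ 6 := by positivity
  rw [e2] at h10
  linarith

end Linnik

namespace Linnik

open Finset
open scoped ArithmeticFunction.vonMangoldt

variable {q : ℕ} [NeZero q] {Z : ℕ}

lemma classSum_sub_le_primeCount (hqZ : q ≤ Z) (a : (ZMod q)ˣ) {w U : ℝ} (hw : 0 ≤ w)
    (hU : 0 ≤ U) :
    classSum q Z (fun n => Λ n) a U - classSum q Z (fun n => Λ n) a (U - 2 * w) ≤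
      (U * primeCount a (Real.exp U) + 2 * Real.exp (U / 2) * U) * Real.exp (2 * w - U) := by
  have key : ∀ n ∈ Ioc 0 ⌊Real.exp U⌋₊,
      (if U - 2 * w < Real.log n then cls q Z (fun n => Λ n) a n else 0) ≤
      ((if n.Prime ∧ (n : ZMod q) = a then U else 0) + if ¬ n.Prime then Λ n else 0) *
        Real.exp (2 * w - U) := by
    intro n hn
    obtain ⟨hn0, hnU⟩ := mem_Ioc_floor_exp.1 hn
    have hn' : (0 : ℝ) < n := by exact_mod_cast hn0
    have hΛ := ArithmeticFunction.vonMangoldt_nonneg (n := n)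
    have hR : 0 ≤ ((if n.Prime ∧ (n : ZMod q) = a then U else 0) + if ¬ n.Prime then Λ n else 0) *
        Real.exp (2 * w - U) := by
      refine mul_nonneg (add_nonneg ?_ ?_) (Real.exp_pos _).le <;> split_ifs <;> first | assumption | rfl
    by_cases hc : U - 2 * w < Real.log n ∧ residue q n = a ∧ Rough Z n
    · obtain ⟨h1, h2, h3⟩ := hc
      rw [cls, wt, if_pos h1, if_pos h2, if_pos h3]
      have h4 : (n : ZMod q) = a := by rw [← h2, coe_residue (h3.coprime (NeZero.ne q) hqZ)]
      have h5 : (1 : ℝ) / n ≤ Real.exp (2 * w - U) := by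
        rw [show 2 * w - U = -(U - 2 * w) by ring, Real.exp_neg, ← one_div]
        refine one_div_le_one_div_of_le (Real.exp_pos _) ?_
        rw [← Real.le_log_iff_exp_le hn']; exact h1.le
      have h6 : Λ n ≤ (if n.Prime ∧ (n : ZMod q) = a then U else 0) + if ¬ n.Prime then Λ n else 0 := by
        by_cases hp : n.Prime
        · rw [if_pos ⟨hp, h4⟩, if_neg (not_not.2 hp), add_zero]
          exact ArithmeticFunction.vonMangoldt_le_log.trans hnU
        · rw [if_neg fun h => hp h.1, if_pos hp, zero_add]
      calc Λ n / n = Λ n * (1 / n) := by ring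
        _ ≤ Λ n * Real.exp (2 * w - U) := by gcongr
        _ ≤ _ := by gcongr
    · refine le_trans (le_of_eq ?_) hR
      rw [cls, wt]
      split_ifs with h1 h2 h3
      exacts [absurd ⟨h1, h2, h3⟩ hc, rfl, rfl, rfl]
  rw [classSum, classSum, logSum_sub_eq _ (by linarith), sum_filter]
  refine (sum_le_sum key).trans ?_
  rw [← sum_mul, sum_add_distrib, ← sum_filter, ← sum_filter,
    ← Chebyshev.psi_sub_theta_eq_sum_not_prime]
  refine mul_le_mul_of_nonneg_right (add_le_add (le_of_eq ?_) ?_) (Real.exp_pos _).le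
  · rw [sum_const, nsmul_eq_mul, primeCount, mul_comm]
  · refine (Chebyshev.psi_sub_theta_le (Real.one_le_exp hU)).trans (le_of_eq ?_)
    rw [Real.log_exp, Real.sqrt_eq_rpow, ← Real.exp_mul]
    ring_nf

lemma primeCount_ge_of_mass {D : ℝ} (hqZ : q ≤ Z) (hD : 1 ≤ D) (hZD : (Z : ℝ) ≤ Real.exp D)
    (a : (ZMod q)ˣ) {κ w U : ℝ} (hw : 0 ≤ w) (hκ : 1 ≤ κ * w) (hU : 16 * D + 6 * w ≤ U)
    (h : κ * w ≤ q.totient *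
      (classSum q Z (fun n => Λ n) a U - classSum q Z (fun n => Λ n) a (U - 2 * w))) :
    Real.exp (U - (2 * w + 2 * D)) / U ≤ primeCount a (Real.exp U) := by
  have hU0 : 0 < U := by linarith
  have hφ : (q.totient : ℝ) ≤ Real.exp D :=
    le_trans (by exact_mod_cast (Nat.totient_le q).trans hqZ) hZD
  have h1 := classSum_sub_le_primeCount hqZ a hw hU0.le
  set P : ℝ := (primeCount a (Real.exp U) : ℝ)
  have hP : 0 ≤ P := Nat.cast_nonneg _
  have h2 : 1 ≤ Real.exp D * ((U * P + 2 * Real.exp (U / 2) * U) * Real.exp (2 * w - U)) := by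
    refine hκ.trans (h.trans ?_)
    calc _ ≤ (q.totient : ℝ) * ((U * P + 2 * Real.exp (U / 2) * U) * Real.exp (2 * w - U)) := by gcongr
      _ ≤ _ := by gcongr
  have h3 : Real.exp (U - 2 * w - D) ≤ U * P + 2 * Real.exp (U / 2) * U := by
    have := mul_le_mul_of_nonneg_right h2 (Real.exp_pos (U - 2 * w - D)).le
    rw [one_mul] at this
    refine this.trans (le_of_eq ?_)
    have e : Real.exp D * Real.exp (2 * w - U) * Real.exp (U - 2 * w - D) = 1 := by
      rw [← Real.exp_add, ← Real.exp_add, Real.exp_eq_one_iff]; ring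
    linear_combination (U * P + 2 * Real.exp (U / 2) * U) * e
  have hD2 : 2 ≤ Real.exp D := by
    have := Real.add_one_le_exp D; linarith
  have h4 : 2 * Real.exp (U / 2) * U ≤ Real.exp (U - 2 * w - D) / 2 := by
    have e1 : U ≤ 8 * Real.exp (U / 8) := by
      have := Real.add_one_le_exp (U / 8); linarith
    have e2 : (32 : ℝ) ≤ Real.exp (4 * D) * Real.exp D := by
      rw [← Real.exp_add, show 4 * D + D = (5 : ℕ) * D by push_cast; ring, Real.exp_nat_mul]
      calc (32 : ℝ) = 2 ^ 5 := by norm_num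
        _ ≤ _ := by gcongr
    have e3 : 32 * Real.exp (U / 2) * Real.exp (U / 8) ≤ Real.exp (U - 2 * w - D) := by
      calc _ ≤ Real.exp (4 * D) * Real.exp D * Real.exp (U / 2) * Real.exp (U / 8) := by gcongr
        _ = Real.exp (4 * D + D + U / 2 + U / 8) := by simp only [Real.exp_add]
        _ ≤ _ := by gcongr; linarith
    calc 2 * Real.exp (U / 2) * U ≤ 2 * Real.exp (U / 2) * (8 * Real.exp (U / 8)) := by gcongr
      _ ≤ _ := by linarith
  have h5 : Real.exp (U - (2 * w + 2 * D)) ≤ Real.exp (U - 2 * w - D) / 2 := by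
    rw [le_div_iff₀ (by norm_num), show U - 2 * w - D = U - (2 * w + 2 * D) + D by ring, Real.exp_add]
    gcongr
  rw [div_le_iff₀ hU0]
  linarith

set_option maxHeartbeats 1000000 in
theorem Expansion.exists_primeCount_ge {C : ℝ} (hC : 1 ≤ C) : ∃ ℓ B Z₀ : ℝ, 1 ≤ ℓ ∧ 1 ≤ B ∧
    ∀ (q Z : ℕ) [NeZero q] (c d k : (ZMod q)ˣ → ℝ) (a : (ZMod q)ˣ) (U : ℝ),
      Expansion C q Z c d k → q ^ 8 ≤ Z → Z₀ ≤ Z → ℓ * scale Z ≤ U →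
      Real.exp (U - B * scale Z) / U ≤ primeCount a (Real.exp U) := by
  obtain ⟨ℓF, κF, Z₀, hℓF, hκF, hF⟩ := Linnik.exists_primeCount_ge C hC
  have hC0 : 0 < C := by linarith
  have hg := gapConst_pos hC
  have hg1 := gapConst_le_one hC
  set g := gapConst C
  obtain ⟨θ, hθ0, hθ1, hθ⟩ : ∃ θ : ℝ, 0 < θ ∧ θ ≤ 1 ∧ ∀ x, κF / (4 * C) ≤ x → 1 / (1 + x) ≤ 1 - θ := by
    have hx0 : 0 < κF / (4 * C) := by positivity
    refine ⟨1 - 1 / (1 + κF / (4 * C)), ?_, ?_, fun x hx => ?_⟩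
    · rw [sub_pos, div_lt_one (by positivity)]; linarith
    · have : 0 ≤ 1 / (1 + κF / (4 * C)) := by positivity
      linarith
    · rw [sub_sub_cancel]; gcongr
  obtain ⟨ε, hε⟩ : ∃ ε, ε = θ / 32 := ⟨_, rfl⟩
  have hε0 : 0 < ε := by rw [hε]; positivity
  obtain ⟨ℓ₂, hℓ₂⟩ : ∃ ℓ₂, ℓ₂ = 1568 * C ^ 3 / (g * ε) := ⟨_, rfl⟩
  have hℓ₂0 : 0 < ℓ₂ := by rw [hℓ₂]; positivity
  obtain ⟨c₂, hc₂0, hc₂g, hc₂C, hc₂ε⟩ : ∃ c₂ : ℝ, 0 < c₂ ∧ c₂ ≤ g ∧ c₂ ≤ 1 / (128 * C ^ 3) ∧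
      64 * C * c₂ * ℓ₂ ≤ ε := by
    refine ⟨min g (min (1 / (128 * C ^ 3)) (ε / (64 * C * ℓ₂))), by positivity, min_le_left _ _,
      (min_le_right _ _).trans (min_le_left _ _), ?_⟩
    have : min g (min (1 / (128 * C ^ 3)) (ε / (64 * C * ℓ₂))) ≤ ε / (64 * C * ℓ₂) :=
      (min_le_right _ _).trans (min_le_right _ _)
    rw [le_div_iff₀ (by positivity)] at this
    linarith
  obtain ⟨ℓ₁, hℓ₁⟩ : ∃ ℓ₁, ℓ₁ = 1568 * C ^ 3 / (c₂ * ε) := ⟨_, rfl⟩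
  have hℓ₁₂ : ℓ₂ ≤ ℓ₁ := by rw [hℓ₁, hℓ₂]; gcongr
  have hℓ₁0 : 0 < ℓ₁ := hℓ₂0.trans_le hℓ₁₂
  refine ⟨ℓF + 16 + 44 * ℓ₁ / θ, 2 * ℓ₁ + 2, Z₀, ?_, ?_, ?_⟩
  · have : 0 ≤ 44 * ℓ₁ / θ := by positivity
    linarith
  · linarith
  intro q Z _ c d k a U h hqZ8 hZ₀ hU
  have hD := h.one_le_scale
  have hD0 : 0 < scale Z := by linarith
  have hqZ := h.q_le
  set D := scale Z with hDdef
  have hZ1 : (1 : ℝ) ≤ Z := by exact_mod_cast (NeZero.one_le (n := q)).trans hqZ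
  have hZD : (Z : ℝ) = Real.exp (D / 48) := by
    rw [hDdef, scale, mul_div_cancel_left₀ _ (by norm_num), Real.exp_log (by linarith)]
  have hUs : ℓF * D ≤ U ∧ 16 * D + 44 * ℓ₁ * D / θ ≤ U := by
    have e : (ℓF + 16 + 44 * ℓ₁ / θ) * D = ℓF * D + 16 * D + 44 * ℓ₁ * D / θ := by ring
    have e1 : 0 ≤ 44 * ℓ₁ * D / θ := by positivity
    have e2 : 0 ≤ ℓF * D := by positivity
    constructor <;> linarith
  have hU0 : 0 < U := by nlinarith [hUs.1]
  have hmass : ∀ (c₀ ℓ : ℝ), 0 < c₀ → c₀ ≤ 1 → ℓ = 1568 * C ^ 3 / (c₀ * ε) → ℓ ≤ ℓ₁ →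
      ∀ E : Finset (DirichletCharacter ℂ q), 1 ∉ E →
      (∀ χ ∉ E, χ ≠ 1 → c₀ ≤ ‖transform χ c‖) →
      (∑ χ ∈ E, χ (a⁻¹ : (ZMod q)ˣ) * kern χ Z (ℓ * D) U).re ≤
        (ℓ * D) ^ 2 * ((1 - θ + 6 * ε) * U + 8 * (ℓ * D)) →
      Real.exp (U - (2 * ℓ₁ + 2) * D) / U ≤ primeCount a (Real.exp U) := by
    intro c₀ ℓ hc₀ hc₁ hℓ hℓ1 E hE hS hR
    have hℓ0 : 0 < ℓ := by rw [hℓ]; positivity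
    have e1 : 1568 * C ^ 3 = ℓ * (c₀ * ε) := by rw [hℓ]; field_simp
    have e2 : 44 * (ℓ * D) ≤ θ * U := by
      have : 44 * ℓ₁ * D / θ ≤ U := by linarith [hUs.2]
      rw [div_le_iff₀ hθ0] at this
      have : ℓ * D ≤ ℓ₁ * D := by gcongr
      linarith
    have e3 : 16 * D + 6 * (ℓ * D) ≤ U := by
      have e4 : 44 * (ℓ₁ * D) ≤ 44 * ℓ₁ * D / θ := by
        rw [le_div_iff₀ hθ0]
        have : 0 ≤ ℓ₁ * D := by positivity
        nlinarith
      have : ℓ * D ≤ ℓ₁ * D := by gcongr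
      have : 0 ≤ ℓ₁ * D := by positivity
      linarith [hUs.2]
    have hw0 : 0 ≤ ℓ * D := by positivity
    have hm := h.mass_ge_of_kern_le a (κ := θ / 2) hε0 (by rw [hε]; linarith) hc₀ hc₁
      (w := ℓ * D) (by rw [e1, ← hDdef]; exact le_of_eq (by ring)) (U := U) (by linarith) E hE hS hR
      (by rw [hε]; nlinarith)
    have hκ : 1 ≤ θ / 2 * (ℓ * D) := by
      have e5 : 1568 ≤ ℓ * ε := by
        have : 1568 * 1 ≤ 1568 * C ^ 3 := by gcongr; exact one_le_pow₀ hC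
        calc (1568 : ℝ) ≤ ℓ * (c₀ * ε) := by linarith
          _ ≤ ℓ * (1 * ε) := by gcongr
          _ = _ := by ring
      rw [hε] at e5
      nlinarith
    refine le_trans ?_ (primeCount_ge_of_mass hqZ hD ?_ a hw0 hκ e3 hm)
    · have : ℓ * D ≤ ℓ₁ * D := by gcongr
      gcongr
      linarith
    · rw [hZD]; gcongr; linarith
  by_cases hex : ∃ χ : DirichletCharacter ℂ q, χ ≠ 1 ∧ ‖transform χ c‖ < c₂
  swap
  · push Not at hex
    refine hmass c₂ ℓ₁ hc₂0 (hc₂g.trans hg1) hℓ₁ le_rfl ∅ (by simp) (fun χ _ h1 => hex χ h1) ?_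
    rw [sum_empty, Complex.zero_re]
    have : 0 ≤ 1 - θ := by linarith
    positivity
  obtain ⟨χ, hχ1, hχc⟩ := hex
  have hχ : χ ^ 2 = 1 := by
    by_contra h2
    linarith [h.gapConst_le_of_sq_ne_one h2]
  have hre : (transform χ c).re ≤ c₂ := ((Complex.re_le_norm _).trans hχc.le)
  have hE : Exceptional C Z c χ (ℓ₂ * D) ε := by
    refine ⟨hχ, hχ1, hre.trans hc₂C, hε0, by rw [hε]; linarith, ?_, ?_⟩
    · have e1 : 1568 * C ^ 3 = ℓ₂ * (g * ε) := by rw [hℓ₂]; field_simp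
      rw [e1, ← hDdef]
      calc ℓ₂ * (g * ε) * D ≤ ℓ₂ * (1 * ε) * D := by gcongr
        _ = _ := by ring
    · rw [← hDdef]
      calc 64 * C * (transform χ c).re * (ℓ₂ * D) ≤ 64 * C * c₂ * (ℓ₂ * D) := by gcongr
        _ = 64 * C * c₂ * ℓ₂ * D := by ring
        _ ≤ _ := by gcongr
  have hU2 : 2 * (ℓ₂ * D) ≤ U := by
    have e1 : ℓ₂ * D ≤ ℓ₁ * D := by gcongr
    have e4 : 44 * (ℓ₁ * D) ≤ 44 * ℓ₁ * D / θ := by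
      rw [le_div_iff₀ hθ0]
      have : 0 ≤ ℓ₁ * D := by positivity
      nlinarith
    have : 0 ≤ ℓ₁ * D := by positivity
    linarith [hUs.2]
  have hmass' : (χ (a⁻¹ : (ZMod q)ˣ) * kern χ Z (ℓ₂ * D) U).re ≤
        (ℓ₂ * D) ^ 2 * ((1 - θ + 6 * ε) * U + 8 * (ℓ₂ * D)) →
      Real.exp (U - (2 * ℓ₁ + 2) * D) / U ≤ primeCount a (Real.exp U) := by
    intro hR
    refine hmass g ℓ₂ hg hg1 hℓ₂ hℓ₁₂ {χ} (by simpa using hχ1.symm) (fun ψ hψ hψ1 => ?_) (by simpa using hR)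
    exact h.gapConst_le_of_ne hχ1 hψ1 (fun e => hψ (by simp [e])) (by linarith)
  rcases apply_eq_of_sq_eq_one hχ (a⁻¹).isUnit with ha | ha
  · by_cases hδ : κF * D ≤ (transform χ c).re * U
    · refine hmass' ?_
      rw [ha, one_mul]
      refine (h.kern_re_le hE hU2).trans ?_
      gcongr
      refine hθ _ ?_
      rw [← hDdef, div_le_div_iff₀ (by positivity) (by positivity)]
      nlinarith
    · have ha' : χ (a : ZMod q) = 1 := by
        have : χ (a : ZMod q) * χ (a⁻¹ : (ZMod q)ˣ) = 1 := by
          rw [← map_mul, ← Units.val_mul, mul_inv_cancel, Units.val_one, map_one]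
        rwa [ha, mul_one] at this
      refine le_trans ?_ (hF q Z c d k χ a U h hχ hχ1 ha' hqZ8 hZ₀ hUs.1 (not_le.1 hδ).le)
      have hU1 : 1 ≤ U := by nlinarith [hUs.1]
      calc Real.exp (U - (2 * ℓ₁ + 2) * D) / U ≤ Real.exp (U - (2 * ℓ₁ + 2) * D) / 1 := by gcongr
        _ ≤ Real.exp (U - D / 8) := by
          rw [div_one]
          gcongr
          nlinarith
        _ = _ := by
          rw [Real.exp_sub, hZD, ← Real.exp_nat_mul]
          congr 2
          push_cast
          ring
  · refine hmass' ?_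
    rw [ha, neg_one_mul, Complex.neg_re]
    refine (h.neg_kern_re_le hE hU2).trans ?_
    gcongr
    rw [hε]; linarith

end Linnik

namespace Linnik

open Finset

theorem exists_primeCount_lower : ∃ ℓ B : ℝ, 1 ≤ ℓ ∧ 1 ≤ B ∧
    ∀ (q : ℕ) [NeZero q] (a : (ZMod q)ˣ) (U : ℝ), 2 ≤ q → ℓ * Real.log q ≤ U →
      Real.exp (U - B * Real.log q) / U ≤ primeCount a (Real.exp U) := by
  obtain ⟨C, hC⟩ := exists_expansion
  have hC1 : 1 ≤ C := by
    obtain ⟨c, d, k, h⟩ := hC 1 (2 ^ 16) one_ne_zero le_rfl (by norm_num)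
    exact h.one_le
  obtain ⟨ℓ, B, Z₀, hℓ, hB, hmain⟩ := Expansion.exists_primeCount_ge hC1
  obtain ⟨N, hN⟩ := pow_unbounded_of_one_lt Z₀ one_lt_two
  have hA : (1 : ℝ) ≤ 48 * (N + 16 : ℕ) := by
    have : (0 : ℝ) ≤ N := Nat.cast_nonneg N
    push_cast; linarith
  refine ⟨ℓ * (48 * (N + 16 : ℕ)), B * (48 * (N + 16 : ℕ)), by nlinarith, by nlinarith, ?_⟩
  intro q _ a U hq hU
  have hq8 : ∀ m ≤ N + 16, q ^ m ≤ q ^ (N + 16) := fun m hm => Nat.pow_le_pow_right (by omega) hm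
  obtain ⟨c, d, k, h⟩ := hC q (q ^ (N + 16)) (NeZero.ne q)
    ((Nat.pow_le_pow_left hq 16).trans (hq8 16 (by omega))) (hq8 4 (by omega))
  have hs : scale (q ^ (N + 16)) = 48 * (N + 16 : ℕ) * Real.log q := by
    rw [scale, Nat.cast_pow, Real.log_pow]; ring
  have hZ : Z₀ ≤ ((q ^ (N + 16) : ℕ) : ℝ) := by
    refine hN.le.trans ?_
    exact_mod_cast (Nat.pow_le_pow_left hq N).trans (hq8 N (by omega))
  have := hmain q (q ^ (N + 16)) c d k a U h (hq8 8 (by omega)) hZ (by rw [hs, ← mul_assoc]; exact hU)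
  rwa [hs, ← mul_assoc] at this

theorem exists_le_primeCount : ∃ L : ℝ, 0 < L ∧ ∀ (q : ℕ) [NeZero q] (a : (ZMod q)ˣ) (n : ℕ), 2 ≤ q →
    1 ≤ n → n ≤ primeCount a ((q : ℝ) ^ L * n * Real.log (2 * n)) := by
  obtain ⟨ℓ, B, hℓ, hB, hmain⟩ := exists_primeCount_lower
  obtain ⟨N, hN⟩ := exists_nat_ge (ℓ + B)
  refine ⟨B + (2 * N + 10 : ℕ), by positivity, fun q _ a n hq hn => ?_⟩
  set L : ℝ := B + (2 * N + 10 : ℕ) with hL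
  have hL' : L = B + 2 * N + 10 := by rw [hL]; push_cast; ring
  have hq' : (2 : ℝ) ≤ q := by exact_mod_cast hq
  have hn' : (1 : ℝ) ≤ n := by exact_mod_cast hn
  have hl2 : Real.log 2 ≤ Real.log q := Real.log_le_log (by norm_num) hq'
  have hl : 1 / 2 ≤ Real.log (2 * n) := by
    have h1 := Real.log_two_gt_d9
    have h2 : Real.log 2 ≤ Real.log (2 * n) := Real.log_le_log (by norm_num) (by linarith)
    linarith
  have hq0 : (0 : ℝ) < q := by linarith
  set X := (q : ℝ) ^ L * n * Real.log (2 * n) with hX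
  have hX0 : 0 < X := by positivity
  have hlogX : Real.log X = L * Real.log q + Real.log n + Real.log (Real.log (2 * n)) := by
    rw [hX, Real.log_mul (by positivity) (by positivity), Real.log_mul (by positivity) (by positivity),
      Real.log_rpow hq0]
  have hQ : 0 < Real.log q := Real.log_pos (by linarith)
  have hlow : ℓ * Real.log q ≤ Real.log X := by
    have h1 : -Real.log q ≤ Real.log (Real.log (2 * n)) := by
      have := Real.log_le_log (by norm_num) hl
      rw [one_div, Real.log_inv] at this
      linarith
    have h2 : 0 ≤ Real.log n := Real.log_nonneg hn'
    rw [hlogX, hL']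
    nlinarith
  have hU0 : 0 < Real.log X := lt_of_lt_of_le (by positivity) hlow
  have key := hmain q a (Real.log X) hq hlow
  rw [Real.exp_log hX0] at key
  have hup : Real.log X ≤ (q : ℝ) ^ (2 * N + 10) * Real.log (2 * n) := by
    have h1 : Real.log (Real.log (2 * n)) ≤ Real.log (2 * n) :=
      (Real.log_le_sub_one_of_pos (by linarith)).trans (by linarith)
    have h2 : Real.log n ≤ Real.log (2 * n) := Real.log_le_log (by linarith) (by linarith)
    have h3 : Real.log q ≤ q := (Real.log_le_sub_one_of_pos hq0).trans (by linarith)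
    have h4 : 1024 * (1 + N * 3 : ℝ) ≤ (2 : ℝ) ^ (2 * N + 10) := by
      have := one_add_mul_le_pow (show (-2 : ℝ) ≤ 3 by norm_num) N
      rw [pow_add, pow_mul]
      norm_num at this ⊢
      linarith
    have h5 : (2 : ℝ) ^ (2 * N + 9) * q ≤ (q : ℝ) ^ (2 * N + 10) := by
      rw [pow_succ (q : ℝ)]; gcongr
    have h6 : 2 * (L * q) + 2 ≤ (2 : ℝ) ^ (2 * N + 9) * q := by
      rw [pow_succ] at h4
      rw [hL']
      nlinarith
    have h7 : L * Real.log q ≤ L * q * (2 * Real.log (2 * n)) := by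
      have hL0 : 0 < L := by positivity
      calc L * Real.log q ≤ L * q := by gcongr
        _ ≤ _ := le_mul_of_one_le_right (by positivity) (by linarith)
    have h8 := mul_le_mul_of_nonneg_right (h6.trans h5) (show 0 ≤ Real.log (2 * n) by linarith)
    rw [hlogX]
    linarith
  have hfin : (n : ℝ) ≤ Real.exp (Real.log X - B * Real.log q) / Real.log X := by
    rw [le_div_iff₀ hU0, Real.exp_sub, Real.exp_log hX0, mul_comm B, ← Real.rpow_def_of_pos hq0,
      le_div_iff₀ (by positivity)]
    calc (n : ℝ) * Real.log X * (q : ℝ) ^ B ≤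
        n * ((q : ℝ) ^ (2 * N + 10) * Real.log (2 * n)) * (q : ℝ) ^ B := by gcongr
      _ = X := by rw [hX, hL, Real.rpow_add hq0, Real.rpow_natCast]; ring
  exact_mod_cast hfin.trans key

end Linnik

/-- **Linnik-type bound (Lemma 5.1 / paper's Lemma).**
There is an absolute constant `L > 0` such that for every pair of coprime positive
integers `a`, `q` with `q ≥ 2` and every `n ≥ 1`, there are at least `n` primes
congruent to `a` modulo `q`, and the `n`-th such prime `p` (in increasing order)
satisfies `p ≤ q ^ L * n * log (2 * n)`. -/
theorem linnik_nth_prime_bound :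
    ∃ L : ℝ, 0 < L ∧
      ∀ a q : ℕ, 0 < a → 2 ≤ q → Nat.Coprime a q →
        ∀ n : ℕ, 1 ≤ n →
          (∃ T : Finset ℕ, T.card = n ∧ ∀ p ∈ T, p.Prime ∧ p % q = a % q) ∧
          ((Nat.nth (fun p => p.Prime ∧ p % q = a % q) (n - 1) : ℝ) ≤
            (q : ℝ) ^ L * (n : ℝ) * Real.log (2 * (n : ℝ))) := by
  obtain ⟨L, hL, hmain⟩ := Linnik.exists_le_primeCount
  refine ⟨L, hL, fun a q _ hq hc n hn => ?_⟩
  have : NeZero q := ⟨by omega⟩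
  have h := hmain q (ZMod.unitOfCoprime a hc) n hq hn
  have hX : 0 ≤ (q : ℝ) ^ L * n * Real.log (2 * n) := by
    have h1 : (1 : ℝ) ≤ n := by exact_mod_cast hn
    have h2 : 0 ≤ Real.log (2 * n) := Real.log_nonneg (by linarith)
    positivity
  set X := (q : ℝ) ^ L * n * Real.log (2 * n)
  simp only [Linnik.primeCount, ZMod.coe_unitOfCoprime, ZMod.natCast_eq_natCast_iff'] at h
  constructor
  · obtain ⟨T, hT, hcard⟩ := Finset.exists_subset_card_eq h
    exact ⟨T, hcard, fun p hp => (Finset.mem_filter.1 (hT hp)).2⟩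
  · have hcount : n - 1 < Nat.count (fun p => p.Prime ∧ p % q = a % q) (⌊X⌋₊ + 1) := by
      rw [Nat.count_eq_card_filter_range]
      refine lt_of_lt_of_le (by omega) (h.trans (Finset.card_le_card ?_))
      refine Finset.filter_subset_filter _ fun p hp => ?_
      have := (Finset.mem_Ioc.1 hp).2
      exact Finset.mem_range.2 (by omega)
    have hlt := Nat.nth_lt_of_lt_count hcount
    exact (Nat.cast_le.2 (Nat.lt_succ_iff.1 hlt)).trans (Nat.floor_le hX)
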